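/- Let p ∈ (2,3]. Let (d_n)_{n∈ℤ} be an ℝ^d-valued stationary sequence of martingale differences with respect to (ℱ_n)_{n∈ℤ} with E|d_0|_d^p < ∞, satisfying conditions (C1) and (C2). Then for any ε > 0, enlarging the probability space if necessary, there exists a sequence (N_i)_{i≥1} of i.i.d. ℝ^d-valued centered Gaussian random variables with covariance Var(N_1) = E(d_0 d_0^t) such that M_n − Σ_{i=1}^n N_i = o(n^{1/p} (log n)^{(p+1)/(2p) + ε}) almost surely if p ∈ (2,3), and M_n − Σ_{i=1}^n N_i = o(n^{1/3} (log n)^{1+ε}) almost surely if p = 3. -/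

import Mathlib

open MeasureTheory ProbabilityTheory Filter Asymptotics
open scoped ENNReal NNReal Topology

noncomputable section

/-- Standard normal cumulative distribution function Φ. -/
def stdNormalCDF (x : ℝ) : ℝ := ((gaussianReal 0 1) (Set.Iic x)).toReal

/-- Generalized inverse Φ⁻¹. -/
def stdNormalCDFInv (y : ℝ) : ℝ := sInf {x : ℝ | y ≤ stdNormalCDF x}

/-- Quantile function of `|X|`: the cadlag inverse of the tail function `x ↦ ℙ(|X| > x)`. -/
def absQuantile {Ω : Type*} [MeasurableSpace Ω] (P : Measure Ω) (X : Ω → ℝ) (u : ℝ) : ℝ :=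
  sInf {x : ℝ | (P {ω | x < |X ω|}).toReal ≤ u}

/-- The envelope norm `‖X‖_{1,Φ,p} = ∫₀¹ (1 ∨ Φ⁻¹(1-u/2))^{p-2} Q_X(u) du`. -/
def envNorm {Ω : Type*} [MeasurableSpace Ω] (P : Measure Ω) (p : ℝ) (X : Ω → ℝ) : ℝ≥0∞ :=
  ∫⁻ u in Set.Ioo (0:ℝ) 1,
    ENNReal.ofReal ((max 1 (stdNormalCDFInv (1 - u/2))) ^ (p - 2) * absQuantile P X u)

/-- `γ` is the centered Gaussian law on `ℝ^D` with covariance matrix `S`. -/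
def IsCenteredGaussianCov (D : ℕ) (S : Matrix (Fin D) (Fin D) ℝ)
    (γ : Measure (EuclideanSpace ℝ (Fin D))) : Prop :=
  IsProbabilityMeasure γ ∧
    ∀ t : Fin D → ℝ,
      Measure.map (fun x => ∑ i, t i * x i) γ =
        gaussianReal 0 (Real.toNNReal (∑ i, ∑ j, t i * S i j * t j))

/-- Partial sums `M_n = ∑_{k=1}^n d_k`. -/
def partialSum {Ω : Type*} {D : ℕ} (d : ℤ → Ω → EuclideanSpace ℝ (Fin D)) (n : ℕ) (ω : Ω) :
    EuclideanSpace ℝ (Fin D) :=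
  ∑ k ∈ Finset.Icc (1 : ℤ) (n : ℤ), d k ω

open Finset (abs_sum_le_sum_abs card_range card_univ measurable_fun_sum mem_univ mul_sum
  prod_congr range sum_add_distrib sum_congr sum_const sum_div sum_eq_zero sum_insert sum_le_sum
  sum_mul sum_mul_sum sum_nonneg sum_range_add sum_range_succ sum_sub_distrib)
open Real (div_rpow add_one_le_exp exp exp_add exp_pos mul_rpow norm_eq_abs one_le_rpow rpow_add
  rpow_add_one rpow_le_rpow rpow_le_rpow_of_exponent_le rpow_le_rpow_of_nonpos rpow_mul
  rpow_natCast rpow_neg rpow_nonneg rpow_one rpow_one_add' rpow_pos_of_pos rpow_two sq_sqrt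
  sqrt_eq_rpow sqrt_le_left sqrt_le_sqrt sqrt_nonneg zero_rpow)
open ENNReal (ofReal ofReal_add ofReal_le_ofReal ofReal_mul ofReal_ne_top ofReal_sum_of_nonneg
  toReal_mul toReal_ofReal)
open Set (Iic Iio Ioi Ioo mem_Iic)
open Matrix (diagonal mulVec mul_apply one_apply transpose_apply)
open Function (uncurry)

set_option linter.unusedSectionVars false

local notation "ℰ" => EuclideanSpace ℝ
local notation "𝒳" ι:max => ℤ → ℰ ι
local notation "𝒵" ι:max => (ℤ → ℰ ι) × (ℕ → unitInterval)

/-! ### The standard Gaussian measure on a euclidean space -/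

/-- The standard Gaussian measure on `ℝ^ι`. -/
abbrev stdG (ι : Type) [Fintype ι] : Measure (ℰ ι) :=
  stdGaussian (ℰ ι)

section Gaussian

variable {ι : Type} [Fintype ι]

lemma integral_cexp_stdG (t u : ℰ ι) :
    ∫ z, Complex.exp (inner ℝ z t * Complex.I + inner ℝ z u) ∂(stdG ι)
      = Complex.exp (∑ i, (t i * Complex.I + u i) ^ 2 / 2) := by
  rw [stdG, ← map_pi_eq_stdGaussian, integral_map (by fun_prop) (by fun_prop)]
  have h : ∀ z : ι → ℝ, Complex.exp (inner ℝ (WithLp.toLp 2 z) t * Complex.I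
      + inner ℝ (WithLp.toLp 2 z) u)
      = ∏ i, Complex.exp ((t i * Complex.I + u i) * z i) := by
    intro z
    rw [← Complex.exp_sum]
    congr 1
    simp only [PiLp.inner_apply, RCLike.inner_apply, conj_trivial]
    push_cast
    rw [sum_mul, ← sum_add_distrib]
    exact sum_congr rfl fun i _ => by ring
  simp_rw [h]
  rw [integral_fintype_prod_eq_prod (fun i (x : ℝ) => Complex.exp ((t i * Complex.I + u i) * x)),
    Complex.exp_sum]
  refine prod_congr rfl fun i _ => ?_
  have := complexMGF_id_gaussianReal (μ := 0) (v := 1) (t i * Complex.I + u i)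
  simp only [complexMGF, id] at this
  rw [this]
  simp

lemma integrable_exp_mul_norm_stdG (c : ℝ) :
    Integrable (fun z => exp (c * ‖z‖)) (stdG ι) := by
  obtain ⟨C, hC, hint⟩ := IsGaussian.exists_integrable_exp_sq (stdG ι)
  refine (hint.const_mul (exp (c ^ 2 / (4 * C)))).mono' (by fun_prop) (ae_of_all _ fun z => ?_)
  rw [norm_eq_abs, abs_of_pos (exp_pos _), ← exp_add]
  apply Real.exp_le_exp.2
  have : 0 ≤ (2 * C * ‖z‖ - c) ^ 2 / (4 * C) := by positivity
  have e : (2 * C * ‖z‖ - c) ^ 2 / (4 * C) = C * ‖z‖ ^ 2 - c * ‖z‖ + c ^ 2 / (4 * C) := by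
    field_simp; ring
  linarith

/-- The Cameron–Martin formula for translations of the standard Gaussian measure. -/
lemma map_add_stdG (u : ℰ ι) :
    (stdG ι).map (fun z => z + u)
      = (stdG ι).withDensity (fun z => ofReal (exp (inner ℝ z u - ‖u‖ ^ 2 / 2))) := by
  have hint : Integrable (fun z => exp (inner ℝ z u - ‖u‖ ^ 2 / 2)) (stdG ι) := by
    refine (integrable_exp_mul_norm_stdG ‖u‖).mono' (by fun_prop) (ae_of_all _ fun z => ?_)
    rw [norm_eq_abs, abs_of_pos (exp_pos _)]
    apply Real.exp_le_exp.2
    have := real_inner_le_norm z u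
    nlinarith [sq_nonneg ‖u‖]
  have : IsFiniteMeasure ((stdG ι).withDensity
      (fun z => ofReal (exp (inner ℝ z u - ‖u‖ ^ 2 / 2)))) :=
    isFiniteMeasure_withDensity_ofReal hint.2
  have : IsProbabilityMeasure ((stdG ι).map (fun z => z + u)) :=
    Measure.isProbabilityMeasure_map (by fun_prop)
  apply Measure.ext_of_charFun
  ext t
  rw [charFun_apply, charFun_apply, integral_map (by fun_prop) (by fun_prop),
    integral_withDensity_eq_integral_toReal_smul (by fun_prop) (by simp)]
  have h1 : ∀ z : ℰ ι, Complex.exp (inner ℝ (z + u) t * Complex.I)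
      = Complex.exp (inner ℝ z t * Complex.I + inner ℝ z (0 : ℰ ι))
        * Complex.exp (inner ℝ u t * Complex.I) := by
    intro z
    rw [← Complex.exp_add, inner_add_left, inner_zero_right]
    congr 1; push_cast; ring
  have h2 : ∀ z : ℰ ι,
      (ofReal (exp (inner ℝ z u - ‖u‖ ^ 2 / 2))).toReal
        • Complex.exp (inner ℝ z t * Complex.I)
      = Complex.exp (inner ℝ z t * Complex.I + inner ℝ z u) * Complex.exp (-(‖u‖ ^ 2 / 2 : ℝ)) := by
    intro z
    rw [toReal_ofReal (exp_pos _).le, Complex.real_smul, Complex.ofReal_exp,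
      ← Complex.exp_add, ← Complex.exp_add]
    congr 1; push_cast; ring
  simp_rw [h1, h2]
  rw [integral_mul_const, integral_mul_const, integral_cexp_stdG, integral_cexp_stdG,
    ← Complex.exp_add, ← Complex.exp_add]
  congr 1
  rw [EuclideanSpace.norm_sq_eq, PiLp.inner_apply]
  simp only [RCLike.inner_apply, conj_trivial, norm_eq_abs, sq_abs]
  push_cast
  rw [sum_mul, sum_div, ← Finset.sum_neg_distrib, ← sum_add_distrib,
    ← sum_add_distrib]
  refine sum_congr rfl fun i _ => ?_
  simp only [PiLp.zero_apply]
  push_cast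
  ring

lemma integral_add_stdG (u : ℰ ι) (F : ℰ ι → ℝ)
    (hF : Measurable F) :
    ∫ z, F (z + u) ∂(stdG ι) = ∫ z, exp (inner ℝ z u - ‖u‖ ^ 2 / 2) * F z ∂(stdG ι) := by
  rw [← integral_map (φ := fun z => z + u) (by fun_prop) hF.aestronglyMeasurable, map_add_stdG,
    integral_withDensity_eq_integral_toReal_smul (by fun_prop) (by simp)]
  refine integral_congr_ae (ae_of_all _ fun z => ?_)
  simp only [smul_eq_mul]
  rw [toReal_ofReal (exp_pos _).le]

/-- The centered Gaussian measure with covariance `t` times the identity. -/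
def scaledG (ι : Type) [Fintype ι] (t : ℝ) : Measure (ℰ ι) :=
  (stdG ι).map (fun z => √t • z)

instance (t : ℝ) : IsProbabilityMeasure (scaledG ι t) :=
  Measure.isProbabilityMeasure_map (by fun_prop)

lemma charFun_scaledG {t : ℝ} (ht : 0 ≤ t) (x : ℰ ι) :
    charFun (scaledG ι t) x = Complex.exp (-t * ‖x‖ ^ 2 / 2) := by
  rw [scaledG, charFun_map_smul, charFun_stdGaussian, norm_smul]
  congr 1
  rw [norm_eq_abs, abs_of_nonneg (sqrt_nonneg t)]
  push_cast
  rw [mul_pow, ← Complex.ofReal_pow, sq_sqrt ht]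
  ring

lemma scaledG_conv {s t : ℝ} (hs : 0 ≤ s) (ht : 0 ≤ t) :
    (scaledG ι s) ∗ (scaledG ι t) = scaledG ι (s + t) := by
  apply Measure.ext_of_charFun
  ext x
  rw [charFun_conv, charFun_scaledG hs, charFun_scaledG ht, charFun_scaledG (add_nonneg hs ht),
    ← Complex.exp_add]
  congr 1; push_cast; ring

lemma integral_scaledG {t : ℝ} (F : ℰ ι → ℝ) (hF : Measurable F) :
    ∫ z, F z ∂(scaledG ι t) = ∫ z, F (√t • z) ∂(stdG ι) := by
  rw [scaledG, integral_map (by fun_prop) hF.aestronglyMeasurable]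

lemma map_eval_stdG (a : ι) : (stdG ι).map (fun z => z a) = gaussianReal 0 1 := by
  classical
  have := measurePreserving_eval_multivariateGaussian (ι := ι) (μ := 0) (S := 1)
    Matrix.PosSemidef.one (i := a)
  rw [multivariateGaussian_zero_one] at this
  simpa using this.map_eq

end Gaussian

section Kernels

variable {ι : Type} [Fintype ι]

/-- A continuous function of at most exponential growth. -/
def ExpGrowth (q : ℰ ι → ℝ) : Prop :=
  Continuous q ∧ ∃ A c : ℝ, 0 ≤ A ∧ 0 ≤ c ∧ ∀ z, |q z| ≤ A * exp (c * ‖z‖)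

namespace ExpGrowth

variable {q r : ℰ ι → ℝ}

lemma integrable (hq : ExpGrowth q) : Integrable q (stdG ι) := by
  obtain ⟨hc, A, c, _, _, h⟩ := hq
  exact ((integrable_exp_mul_norm_stdG c).const_mul A).mono' hc.aestronglyMeasurable
    (ae_of_all _ h)

lemma mul (hq : ExpGrowth q) (hr : ExpGrowth r) : ExpGrowth (fun z => q z * r z) := by
  obtain ⟨hc, A, c, hA, hc0, h⟩ := hq
  obtain ⟨hc', A', c', hA', hc0', h'⟩ := hr
  refine ⟨hc.mul hc', A * A', c + c', by positivity, by positivity, fun z => ?_⟩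
  rw [abs_mul, add_mul, exp_add]
  calc |q z| * |r z| ≤ (A * exp (c * ‖z‖)) * (A' * exp (c' * ‖z‖)) :=
        mul_le_mul (h z) (h' z) (abs_nonneg _) (by positivity)
    _ = _ := by ring

lemma add (hq : ExpGrowth q) (hr : ExpGrowth r) : ExpGrowth (fun z => q z + r z) := by
  obtain ⟨hc, A, c, hA, hc0, h⟩ := hq
  obtain ⟨hc', A', c', hA', hc0', h'⟩ := hr
  refine ⟨hc.add hc', A + A', c + c', by positivity, by positivity, fun z => ?_⟩
  have h1 : exp (c * ‖z‖) ≤ exp ((c + c') * ‖z‖) :=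
    Real.exp_le_exp.2 (by nlinarith [norm_nonneg z, mul_nonneg hc0' (norm_nonneg z)])
  have h2 : exp (c' * ‖z‖) ≤ exp ((c + c') * ‖z‖) :=
    Real.exp_le_exp.2 (by nlinarith [norm_nonneg z, mul_nonneg hc0 (norm_nonneg z)])
  calc |q z + r z| ≤ |q z| + |r z| := abs_add_le _ _
    _ ≤ A * exp (c * ‖z‖) + A' * exp (c' * ‖z‖) := add_le_add (h z) (h' z)
    _ ≤ A * exp ((c + c') * ‖z‖) + A' * exp ((c + c') * ‖z‖) := by gcongr
    _ = _ := by ring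

lemma const (a : ℝ) : ExpGrowth (fun _ : ℰ ι => a) :=
  ⟨continuous_const, |a|, 0, abs_nonneg _, le_rfl, fun z => by simp⟩

lemma neg (hq : ExpGrowth q) : ExpGrowth (fun z => - q z) := by
  simpa using (const (-1)).mul hq

lemma sub (hq : ExpGrowth q) (hr : ExpGrowth r) : ExpGrowth (fun z => q z - r z) := by
  simpa [sub_eq_add_neg] using hq.add hr.neg

lemma of_le (hq : ExpGrowth q) (hr : Continuous r) (h : ∀ z, |r z| ≤ |q z|) : ExpGrowth r := by
  obtain ⟨hc, A, c, hA, hc0, h'⟩ := hq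
  exact ⟨hr, A, c, hA, hc0, fun z => (h z).trans (h' z)⟩

lemma exp {c : ℝ} (hc : 0 ≤ c) : ExpGrowth (fun z : ℰ ι => exp (c * ‖z‖)) :=
  ⟨by fun_prop, 1, c, zero_le_one, hc, fun z => by rw [abs_of_pos (exp_pos _), one_mul]⟩

lemma norm : ExpGrowth (fun z : ℰ ι => ‖z‖) :=
  (exp zero_le_one).of_le (by fun_prop) fun z => by
    rw [abs_of_nonneg (norm_nonneg z), abs_of_pos (exp_pos _)]
    have := add_one_le_exp (1 * ‖z‖); linarith

lemma one_add_norm_rpow {s : ℝ} (hs : 0 ≤ s) :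
    ExpGrowth (fun z : ℰ ι => (1 + ‖z‖) ^ s) := by
  refine (exp hs).of_le ?_ fun z => ?_
  · exact (by fun_prop : Continuous fun z : ℰ ι => 1 + ‖z‖).rpow_const
      fun z => Or.inl (by positivity)
  · rw [abs_of_nonneg (by positivity), abs_of_pos (exp_pos _), mul_comm s, Real.exp_mul]
    apply rpow_le_rpow (by positivity) _ hs
    have := add_one_le_exp ‖z‖; linarith

lemma inner (u : ℰ ι) :
    ExpGrowth (fun z : ℰ ι => (inner ℝ z u : ℝ)) :=
  (norm.mul (const ‖u‖)).of_le (by fun_prop) fun z => by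
    rw [abs_mul, abs_norm, abs_norm]; exact abs_real_inner_le_norm z u

lemma eval (a : ι) : ExpGrowth (fun z : ℰ ι => z a) :=
  norm.of_le (by fun_prop) fun z => by
    rw [abs_norm]; exact PiLp.norm_apply_le z a

lemma exp_inner (u : ℰ ι) :
    ExpGrowth (fun z : ℰ ι => Real.exp (Inner.inner ℝ z u - ‖u‖ ^ 2 / 2)) :=
  (exp (norm_nonneg u)).of_le (by fun_prop) fun z => by
    rw [abs_of_pos (exp_pos _), abs_of_pos (exp_pos _)]
    apply Real.exp_le_exp.2
    have := real_inner_le_norm z u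
    nlinarith [sq_nonneg ‖u‖]

lemma abs (hq : ExpGrowth q) : ExpGrowth (fun z => |q z|) :=
  hq.of_le hq.1.abs fun z => by rw [abs_abs]

end ExpGrowth

lemma integral_eval_stdG (a : ι) : ∫ z, z a ∂(stdG ι) = 0 := by
  have := integral_strongDual_stdGaussian (E := ℰ ι) (EuclideanSpace.proj a)
  simpa using this

lemma integral_eval_mul_eval_stdG [DecidableEq ι] (a b : ι) :
    ∫ z, z a * z b ∂(stdG ι) = (1 : Matrix ι ι ℝ) a b := by
  have h := covariance_eval_multivariateGaussian (ι := ι) (μ := 0) (S := 1)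
    Matrix.PosSemidef.one a b
  rw [multivariateGaussian_zero_one, covariance] at h
  simpa only [integral_eval_stdG, sub_zero] using h

/-- The function `f` averaged against the kernel `q` of a standard Gaussian vector. -/
def smear (q f : ℰ ι → ℝ) (σ : ℝ) (x : ℰ ι) : ℝ :=
  ∫ z, f (x + σ • z) * q z ∂(stdG ι)

section smear

variable {q f : ℰ ι → ℝ} {σ : ℝ}

lemma abs_sub_le_of_lipschitz (hf : LipschitzWith 1 f) (x y : ℰ ι) :
    |f x - f y| ≤ ‖x - y‖ := by
  simpa [Real.dist_eq, dist_eq_norm] using hf.dist_le_mul x y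

lemma ExpGrowth.of_lipschitz (hf : LipschitzWith 1 f) (x : ℰ ι) (σ : ℝ) :
    ExpGrowth (fun z => f (x + σ • z)) := by
  refine (((const |f x|).add ((const |σ|).mul norm))).of_le
    (hf.continuous.comp (by fun_prop)) fun z => ?_
  rw [abs_of_nonneg (a := _ + _) (by positivity)]
  have := abs_sub_le_of_lipschitz hf (x + σ • z) x
  rw [add_sub_cancel_left, norm_smul, norm_eq_abs] at this
  have h2 := abs_sub_abs_le_abs_sub (f (x + σ • z)) (f x)
  linarith

lemma integrable_smear (hf : LipschitzWith 1 f) (hq : ExpGrowth q) (x : ℰ ι) :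
    Integrable (fun z => f (x + σ • z) * q z) (stdG ι) :=
  ((ExpGrowth.of_lipschitz hf x σ).mul hq).integrable

lemma abs_smear_le (hf : LipschitzWith 1 f) (hq : ExpGrowth q) (h0 : ∫ z, q z ∂(stdG ι) = 0)
    (hσ : 0 ≤ σ) (x : ℰ ι) :
    |smear q f σ x| ≤ σ * ∫ z, ‖z‖ * |q z| ∂(stdG ι) := by
  have e : smear q f σ x = ∫ z, (f (x + σ • z) - f x) * q z ∂(stdG ι) := by
    simp_rw [sub_mul]
    rw [integral_sub (integrable_smear hf hq x) (hq.integrable.const_mul _), integral_const_mul,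
      h0, mul_zero, sub_zero, smear]
  rw [e, ← integral_const_mul]
  refine (abs_integral_le_integral_abs).trans (integral_mono_of_nonneg
    (ae_of_all _ fun z => abs_nonneg _) ((ExpGrowth.norm.mul hq.abs).integrable.const_mul _)
    (ae_of_all _ fun z => ?_))
  have := abs_sub_le_of_lipschitz hf (x + σ • z) x
  rw [add_sub_cancel_left, norm_smul, norm_eq_abs, abs_of_nonneg hσ] at this
  simp only [abs_mul]
  rw [← mul_assoc]
  gcongr

lemma abs_smear_sub_le (hf : LipschitzWith 1 f) (hq : ExpGrowth q) (σ : ℝ)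
    (x y : ℰ ι) :
    |smear q f σ x - smear q f σ y| ≤ ‖x - y‖ * ∫ z, |q z| ∂(stdG ι) := by
  rw [smear, smear, ← integral_sub (integrable_smear hf hq x) (integrable_smear hf hq y),
    ← integral_const_mul]
  refine (abs_integral_le_integral_abs).trans (integral_mono_of_nonneg
    (ae_of_all _ fun z => abs_nonneg _) (hq.abs.integrable.const_mul _)
    (ae_of_all _ fun z => ?_))
  have := abs_sub_le_of_lipschitz hf (x + σ • z) (y + σ • z)
  rw [add_sub_add_right_eq_sub] at this
  simp only
  rw [← sub_mul, abs_mul]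
  gcongr

lemma abs_smear_sub_scale_le (hf : LipschitzWith 1 f) (hq : ExpGrowth q) (σ σ' : ℝ)
    (x : ℰ ι) :
    |smear q f σ' x - smear q f σ x| ≤ |σ' - σ| * ∫ z, ‖z‖ * |q z| ∂(stdG ι) := by
  rw [smear, smear, ← integral_sub (integrable_smear hf hq x) (integrable_smear hf hq x),
    ← integral_const_mul]
  refine (abs_integral_le_integral_abs).trans (integral_mono_of_nonneg
    (ae_of_all _ fun z => abs_nonneg _) ((ExpGrowth.norm.mul hq.abs).integrable.const_mul _)
    (ae_of_all _ fun z => ?_))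
  have := abs_sub_le_of_lipschitz hf (x + σ' • z) (x + σ • z)
  rw [add_sub_add_left_eq_sub, ← sub_smul, norm_smul, norm_eq_abs] at this
  simp only
  rw [← sub_mul, abs_mul, ← mul_assoc]
  gcongr

end smear

end Kernels

section Taylor

variable {ι : Type} [Fintype ι]

lemma Real.abs_exp_sub_quadratic_le (v : ℝ) :
    |exp v - 1 - v - v ^ 2 / 2| ≤ |v| ^ 3 * exp |v| := by
  have h := Complex.norm_exp_sub_sum_le_norm_mul_exp (v : ℂ) 3
  simp only [sum_range_succ, Finset.sum_range_zero, pow_zero, pow_one, Nat.factorial,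
    Complex.norm_real, norm_eq_abs] at h
  have e : Complex.exp (v : ℂ) - (0 + 1 / ((1 : ℕ) : ℂ) + (v : ℂ) / ((0 + 1) * 1 : ℕ)
      + (v : ℂ) ^ 2 / ((1 + 1) * ((0 + 1) * 1) : ℕ))
      = ((exp v - 1 - v - v ^ 2 / 2 : ℝ) : ℂ) := by
    push_cast; ring
  rw [e, Complex.norm_real] at h
  exact h

/-- The kernel of the second order Taylor remainder in the Cameron–Martin formula. -/
def remKernel (u z : ℰ ι) : ℝ :=
  exp (inner ℝ z u - ‖u‖ ^ 2 / 2) - 1 - inner ℝ z u - (inner ℝ z u ^ 2 - ‖u‖ ^ 2) / 2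

/-- The kernel of second order derivatives of Gaussian averages. -/
def hessKernel [DecidableEq ι] (a b : ι) (z : ℰ ι) : ℝ :=
  z a * z b - (1 : Matrix ι ι ℝ) a b

lemma expGrowth_quad (u : ℰ ι) :
    ExpGrowth (fun z : ℰ ι => ((inner ℝ z u : ℝ) ^ 2 - ‖u‖ ^ 2) / 2) := by
  have := (((ExpGrowth.inner u).mul (ExpGrowth.inner u)).sub (.const (‖u‖ ^ 2))).mul
    (.const (1 / 2))
  convert this using 2
  ring

lemma expGrowth_remKernel (u : ℰ ι) : ExpGrowth (remKernel u) :=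
  (((ExpGrowth.exp_inner u).sub (.const 1)).sub (.inner u)).sub (expGrowth_quad u)

/-- Gaussian average of `f` at scale `σ`. -/
def smooth (f : ℰ ι → ℝ) (σ : ℝ) (x : ℰ ι) : ℝ :=
  ∫ z, f (x + σ • z) ∂(stdG ι)

lemma smooth_eq_smear {f : ℰ ι → ℝ} {σ : ℝ} :
    smooth f σ = smear (fun _ => 1) f σ := by
  ext x; simp [smooth, smear]

lemma inner_eq_sum (z u : ℰ ι) : (inner ℝ z u : ℝ) = ∑ a, z a * u a := by
  rw [PiLp.inner_apply]
  exact sum_congr rfl fun i _ => by simp [mul_comm]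

lemma abs_remKernel_le {u : ℰ ι} (hu : ‖u‖ ≤ 1) (z : ℰ ι) :
    |remKernel u z| ≤ ‖u‖ ^ 3 * ((1 + ‖z‖) ^ 3 * exp (1 + ‖z‖) + (1 + ‖z‖)) := by
  set w : ℝ := inner ℝ z u with hw
  set t := ‖u‖
  set N := ‖z‖
  have ht : 0 ≤ t := norm_nonneg _
  have hN : 0 ≤ N := norm_nonneg _
  have hwb : |w| ≤ N * t := abs_real_inner_le_norm z u
  have e : remKernel u z = (exp (w - t ^ 2 / 2) - 1 - (w - t ^ 2 / 2)
      - (w - t ^ 2 / 2) ^ 2 / 2) + (t ^ 4 / 8 - w * t ^ 2 / 2) := by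
    rw [remKernel]; ring
  have hv : |w - t ^ 2 / 2| ≤ t * (1 + N) := by
    refine (abs_sub _ _).trans ?_
    rw [abs_of_nonneg (a := t ^ 2 / 2) (by positivity)]
    nlinarith
  have h1 := Real.abs_exp_sub_quadratic_le (w - t ^ 2 / 2)
  have h2 : |w - t ^ 2 / 2| ^ 3 * exp |w - t ^ 2 / 2|
      ≤ (t * (1 + N)) ^ 3 * exp (1 + N) := by
    have : |w - t ^ 2 / 2| ≤ 1 + N := hv.trans (by nlinarith)
    gcongr
  have h3 : |t ^ 4 / 8 - w * t ^ 2 / 2| ≤ t ^ 3 * (1 + N) := by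
    refine (abs_sub _ _).trans ?_
    rw [abs_of_nonneg (a := t ^ 4 / 8) (by positivity), abs_div, abs_mul,
      abs_of_nonneg (a := t ^ 2) (by positivity), abs_two]
    have a1 : |w| * t ^ 2 ≤ N * t * t ^ 2 := by gcongr
    have a2 : t ^ 4 ≤ t ^ 3 := pow_le_pow_of_le_one ht hu (by norm_num)
    have a3 : 0 ≤ N * t ^ 3 := by positivity
    have a4 : 0 ≤ t ^ 3 := by positivity
    nlinarith
  rw [e]
  refine (abs_add_le _ _).trans ((add_le_add (h1.trans h2) h3).trans (le_of_eq ?_))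
  ring

variable [DecidableEq ι]

lemma expGrowth_hessKernel (a b : ι) : ExpGrowth (hessKernel a b) :=
  ((ExpGrowth.eval a).mul (.eval b)).sub (.const _)

lemma integral_hessKernel (a b : ι) : ∫ z, hessKernel a b z ∂(stdG ι) = 0 := by
  simp only [hessKernel]
  rw [integral_sub ((ExpGrowth.eval a).mul (.eval b)).integrable (integrable_const _),
    integral_eval_mul_eval_stdG]
  simp

lemma quad_eq_sum (z u : ℰ ι) :
    (inner ℝ z u : ℝ) ^ 2 - ‖u‖ ^ 2 = ∑ a, ∑ b, hessKernel a b z * (u a * u b) := by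
  simp only [hessKernel, sub_mul, sum_sub_distrib, one_apply, ite_mul, one_mul,
    zero_mul, Finset.sum_ite_eq, mem_univ, if_true]
  rw [inner_eq_sum, EuclideanSpace.norm_sq_eq, sq, sum_mul_sum]
  congr 1
  · exact sum_congr rfl fun a _ => sum_congr rfl fun b _ => by ring
  · exact sum_congr rfl fun a _ => by rw [norm_eq_abs, sq_abs, sq]

lemma integral_inner_stdG (u : ℰ ι) : ∫ z, (inner ℝ z u : ℝ) ∂(stdG ι) = 0 := by
  simp_rw [inner_eq_sum]
  rw [integral_finsetSum _ fun a _ => (ExpGrowth.eval a).integrable.mul_const _]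
  simp [integral_mul_const, integral_eval_stdG]

lemma integral_quad_stdG (u : ℰ ι) :
    ∫ z, ((inner ℝ z u : ℝ) ^ 2 - ‖u‖ ^ 2) / 2 ∂(stdG ι) = 0 := by
  rw [integral_div]
  simp_rw [quad_eq_sum]
  rw [integral_finsetSum _ fun a _ => integrable_finsetSum _ fun b _ =>
    (expGrowth_hessKernel a b).integrable.mul_const _]
  simp_rw [integral_finsetSum _ fun b _ => (expGrowth_hessKernel _ b).integrable.mul_const _,
    integral_mul_const, integral_hessKernel]
  simp

lemma integral_remKernel (u : ℰ ι) : ∫ z, remKernel u z ∂(stdG ι) = 0 := by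
  have h1 : ∫ z, exp (inner ℝ z u - ‖u‖ ^ 2 / 2) ∂(stdG ι) = 1 := by
    have := integral_add_stdG u (fun _ => 1) measurable_const
    simpa using this.symm
  simp only [remKernel]
  rw [integral_sub, integral_sub, integral_sub, h1, integral_inner_stdG, integral_quad_stdG]
  · simp
  · exact (ExpGrowth.exp_inner u).integrable
  · exact integrable_const _
  · exact ((ExpGrowth.exp_inner u).sub (.const 1)).integrable
  · exact (ExpGrowth.inner u).integrable
  · exact (((ExpGrowth.exp_inner u).sub (.const 1)).sub (.inner u)).integrable
  · exact (expGrowth_quad u).integrable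

/-- First derivative of the Gaussian average of `f` at scale `σ`. -/
def smoothGrad (f : ℰ ι → ℝ) (σ : ℝ) (a : ι) (x : ℰ ι) : ℝ :=
  σ⁻¹ * smear (fun z => z a) f σ x

/-- Second derivative of the Gaussian average of `f` at scale `σ`. -/
def smoothHess (f : ℰ ι → ℝ) (σ : ℝ) (a b : ι) (x : ℰ ι) : ℝ :=
  (σ ^ 2)⁻¹ * smear (hessKernel a b) f σ x

section

variable {f : ℰ ι → ℝ} {σ : ℝ}

lemma smoothGrad_sum (hf : LipschitzWith 1 f) (hσ : 0 < σ) (x u : ℰ ι) :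
    ∑ a, smoothGrad f σ a x * (σ • u) a = smear (fun z => inner ℝ z u) f σ x := by
  simp only [smear, inner_eq_sum, mul_sum]
  rw [integral_finsetSum _ fun a _ => by
    simpa [mul_assoc] using (integrable_smear hf (ExpGrowth.eval a) x).mul_const (u a)]
  refine sum_congr rfl fun a _ => ?_
  simp only [← mul_assoc]
  rw [integral_mul_const, smoothGrad, smear, PiLp.smul_apply, smul_eq_mul]
  field_simp

lemma smoothHess_sum (hf : LipschitzWith 1 f) (hσ : 0 < σ) (x u : ℰ ι) :
    (1 / 2) * ∑ a, ∑ b, smoothHess f σ a b x * ((σ • u) a * (σ • u) b)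
      = smear (fun z => ((inner ℝ z u : ℝ) ^ 2 - ‖u‖ ^ 2) / 2) f σ x := by
  simp only [smear, quad_eq_sum]
  simp_rw [mul_div_assoc', integral_div, mul_sum]
  rw [integral_finsetSum _ fun a _ => integrable_finsetSum _ fun b _ => by
    simpa [mul_assoc] using
      (integrable_smear hf (expGrowth_hessKernel a b) x).mul_const (u a * u b)]
  rw [sum_div]
  refine sum_congr rfl fun a _ => ?_
  rw [integral_finsetSum _ fun b _ => by
    simpa [mul_assoc] using
      (integrable_smear hf (expGrowth_hessKernel a b) x).mul_const (u a * u b)]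
  rw [sum_div]
  refine sum_congr rfl fun b _ => ?_
  simp_rw [← mul_assoc (f _) (hessKernel a b _)]
  rw [integral_mul_const, smoothHess, smear, PiLp.smul_apply, PiLp.smul_apply, smul_eq_mul,
    smul_eq_mul]
  field_simp

lemma smooth_taylor_eq (hf : LipschitzWith 1 f) (hσ : 0 < σ) (x u : ℰ ι) :
    smooth f σ (x + σ • u) - smooth f σ x - ∑ a, smoothGrad f σ a x * (σ • u) a
      - (1 / 2) * ∑ a, ∑ b, smoothHess f σ a b x * ((σ • u) a * (σ • u) b)
      = smear (remKernel u) f σ x := by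
  rw [smoothGrad_sum hf hσ, smoothHess_sum hf hσ]
  have h1 : smooth f σ (x + σ • u)
      = smear (fun z => exp (inner ℝ z u - ‖u‖ ^ 2 / 2)) f σ x := by
    have := integral_add_stdG u (fun z => f (x + σ • z))
      (hf.continuous.comp (by fun_prop)).measurable
    rw [smooth, smear]
    simp_rw [mul_comm (f _)]
    rw [← this]
    congr 1; ext z; congr 1
    rw [smul_add]; abel
  rw [h1, smooth_eq_smear]
  simp only [smear, remKernel]
  rw [← integral_sub, ← integral_sub, ← integral_sub]
  · congr 1; ext z; ring
  · exact (integrable_smear hf (.exp_inner u) x).sub (integrable_smear hf (.const 1) x) |>.sub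
      (integrable_smear hf (.inner u) x)
  · exact integrable_smear hf (expGrowth_quad u) x
  · exact (integrable_smear hf (.exp_inner u) x).sub (integrable_smear hf (.const 1) x)
  · exact integrable_smear hf (.inner u) x
  · exact integrable_smear hf (.exp_inner u) x
  · exact integrable_smear hf (.const 1) x

end

set_option maxHeartbeats 1000000 in
/-- Taylor estimate for Gaussian averages of Lipschitz functions. -/
lemma exists_smooth_taylor {p : ℝ} (hp : 2 ≤ p) (hp3 : p ≤ 3) :
    ∃ C, 0 ≤ C ∧ ∀ f : ℰ ι → ℝ, LipschitzWith 1 f → ∀ σ, 0 < σ → ∀ x y,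
      |smooth f σ (x + y) - smooth f σ x - ∑ a, smoothGrad f σ a x * y a
        - (1 / 2) * ∑ a, ∑ b, smoothHess f σ a b x * (y a * y b)| ≤ C * σ ^ (1 - p) * ‖y‖ ^ p := by
  set R : ℰ ι → ℝ :=
    fun z => (1 + ‖z‖) ^ 3 * exp (1 + ‖z‖) + (1 + ‖z‖) with hR
  have h1N : ExpGrowth (fun z : ℰ ι => 1 + ‖z‖) := (ExpGrowth.const 1).add .norm
  have hRg : ExpGrowth R := by
    have e1 : ExpGrowth (fun z : ℰ ι => exp (1 + ‖z‖)) := by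
      have := (ExpGrowth.const (ι := ι) (exp 1)).mul (ExpGrowth.exp zero_le_one)
      simpa [exp_add] using this
    have := (((h1N.mul h1N).mul h1N).mul e1).add h1N
    convert this using 2
    rw [hR]; ring
  set C1 := ∫ z, ‖z‖ * R z ∂(stdG ι)
  set C2 := ∫ z, ‖z‖ * ‖z‖ ∂(stdG ι)
  set C3 := ∫ z, ‖z‖ * (‖z‖ * ‖z‖ + 1) ∂(stdG ι)
  have hR0 : ∀ z, 0 ≤ R z := fun z => by positivity
  have hC1 : 0 ≤ C1 := integral_nonneg fun z => mul_nonneg (norm_nonneg _) (hR0 z)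
  have hC2 : 0 ≤ C2 := integral_nonneg fun z => by positivity
  have hC3 : 0 ≤ C3 := integral_nonneg fun z => by positivity
  refine ⟨C1 + (1 + C2 + C3), by positivity, fun f hf σ hσ x y => ?_⟩
  obtain ⟨u, rfl⟩ : ∃ u, y = σ • u := ⟨σ⁻¹ • y, by rw [smul_smul, mul_inv_cancel₀ hσ.ne', one_smul]⟩
  have hpow : σ ^ (1 - p) * ‖σ • u‖ ^ p = σ * ‖u‖ ^ p := by
    rw [norm_smul, norm_eq_abs, abs_of_pos hσ, mul_rpow hσ.le (norm_nonneg _),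
      ← mul_assoc, ← rpow_add hσ]
    simp
  rw [mul_assoc, hpow]
  rcases le_total ‖u‖ 1 with hu | hu
  · rw [smooth_taylor_eq hf hσ]
    refine (abs_smear_le hf (expGrowth_remKernel u) (integral_remKernel u) hσ.le x).trans ?_
    have h1 : ∫ z, ‖z‖ * |remKernel u z| ∂(stdG ι) ≤ ‖u‖ ^ p * C1 := by
      rw [← integral_const_mul]
      refine integral_mono_of_nonneg (ae_of_all _ fun z => by positivity)
        ((ExpGrowth.norm.mul hRg).integrable.const_mul _) (ae_of_all _ fun z => ?_)
      have h2 : ‖u‖ ^ 3 ≤ ‖u‖ ^ p := by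
        rcases eq_or_lt_of_le (norm_nonneg u) with h0 | h0
        · rw [← h0, zero_rpow (by linarith)]; norm_num
        · rw [← rpow_natCast]
          exact Real.rpow_le_rpow_of_exponent_ge h0 hu (by simpa using hp3)
      have := (abs_remKernel_le hu z).trans
        (mul_le_mul_of_nonneg_right h2 (hR0 z))
      simp only
      nlinarith [norm_nonneg z]
    calc σ * ∫ z, ‖z‖ * |remKernel u z| ∂(stdG ι) ≤ σ * (‖u‖ ^ p * C1) := by gcongr
      _ = C1 * (σ * ‖u‖ ^ p) := by ring
      _ ≤ _ := mul_le_mul_of_nonneg_right (by linarith) (by positivity)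
  · have hup : ‖u‖ ≤ ‖u‖ ^ p := by
      simpa using rpow_le_rpow_of_exponent_le hu (by linarith : (1 : ℝ) ≤ p)
    have hup2 : ‖u‖ ^ 2 ≤ ‖u‖ ^ p := by
      rw [← rpow_natCast]
      exact rpow_le_rpow_of_exponent_le hu (by simpa using hp)
    rw [smoothGrad_sum hf hσ, smoothHess_sum hf hσ, smooth_eq_smear]
    have a1 := abs_smear_sub_le hf (ExpGrowth.const 1) σ (x + σ • u) x
    have a2 := abs_smear_le hf (ExpGrowth.inner u) (integral_inner_stdG u) hσ.le x
    have a3 := abs_smear_le hf (expGrowth_quad u) (integral_quad_stdG u) hσ.le x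
    have b1 : ‖x + σ • u - x‖ * ∫ _z, |(1 : ℝ)| ∂(stdG ι) = σ * ‖u‖ := by
      simp [norm_smul, abs_of_pos hσ]
    have b2 : ∫ z, ‖z‖ * |(inner ℝ z u : ℝ)| ∂(stdG ι) ≤ ‖u‖ * C2 := by
      rw [← integral_const_mul]
      refine integral_mono_of_nonneg (ae_of_all _ fun z => by positivity)
        ((ExpGrowth.norm.mul .norm).integrable.const_mul _) (ae_of_all _ fun z => ?_)
      have := abs_real_inner_le_norm z u
      simp only
      nlinarith [norm_nonneg z]
    have b3 : ∫ z, ‖z‖ * |((inner ℝ z u : ℝ) ^ 2 - ‖u‖ ^ 2) / 2| ∂(stdG ι) ≤ ‖u‖ ^ 2 * C3 := by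
      rw [← integral_const_mul]
      refine integral_mono_of_nonneg (ae_of_all _ fun z => by positivity)
        ((ExpGrowth.norm.mul ((ExpGrowth.norm.mul .norm).add (.const 1))).integrable.const_mul _)
        (ae_of_all _ fun z => ?_)
      have h1 := abs_real_inner_le_norm z u
      have h2 : (inner ℝ z u : ℝ) ^ 2 ≤ (‖z‖ * ‖u‖) ^ 2 :=
        sq_le_sq' (by linarith [neg_abs_le (inner ℝ z u : ℝ)]) ((le_abs_self _).trans h1)
      have h3 : |((inner ℝ z u : ℝ) ^ 2 - ‖u‖ ^ 2) / 2| ≤ ‖u‖ ^ 2 * (‖z‖ * ‖z‖ + 1) := by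
        rw [abs_le]
        constructor <;>
          nlinarith [sq_nonneg (inner ℝ z u : ℝ), sq_nonneg ‖u‖, sq_nonneg (‖z‖ * ‖u‖)]
      simp only
      nlinarith [norm_nonneg z]
    rw [b1] at a1
    clear_value C1 C2 C3
    have c2 := a2.trans (mul_le_mul_of_nonneg_left b2 hσ.le)
    have c3 := a3.trans (mul_le_mul_of_nonneg_left b3 hσ.le)
    refine (abs_sub _ _).trans ?_
    refine (add_le_add (abs_sub _ _) le_rfl).trans ?_
    have d1 : σ * ‖u‖ ≤ σ * ‖u‖ ^ p := by gcongr
    have d2 : σ * (‖u‖ * C2) ≤ C2 * (σ * ‖u‖ ^ p) := by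
      have := mul_le_mul_of_nonneg_left d1 hC2; linarith
    have d3 : σ * (‖u‖ ^ 2 * C3) ≤ C3 * (σ * ‖u‖ ^ p) := by
      have : σ * ‖u‖ ^ 2 ≤ σ * ‖u‖ ^ p := by gcongr
      have := mul_le_mul_of_nonneg_left this hC3; linarith
    have d4 : 0 ≤ C1 * (σ * ‖u‖ ^ p) := by positivity
    linarith

set_option maxHeartbeats 1000000 in
lemma exists_smoothHess_holder {p : ℝ} (hp : 2 ≤ p) (hp3 : p ≤ 3) :
    ∃ C, 0 ≤ C ∧ ∀ f : ℰ ι → ℝ, LipschitzWith 1 f → ∀ σ σ', 0 < σ → σ ≤ σ' →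
      ∀ a b x y, |smoothHess f σ a b x - smoothHess f σ' a b y|
        ≤ C * σ ^ (1 - p) * (‖x - y‖ ^ (p - 2) + (σ' - σ) ^ (p - 2)) := by
  set q : ℰ ι → ℝ := fun z => ‖z‖ * ‖z‖ + 1
  have hqg : ExpGrowth q := (ExpGrowth.norm.mul .norm).add (.const 1)
  have hq0 : ∀ z, 0 ≤ q z := fun z => by positivity
  have hle : ∀ a b z, |hessKernel (ι := ι) a b z| ≤ q z := by
    intro a b z
    have h1 : |z a| ≤ ‖z‖ := PiLp.norm_apply_le z a
    have h2 : |z b| ≤ ‖z‖ := PiLp.norm_apply_le z b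
    refine (abs_sub _ _).trans (add_le_add ?_ ?_)
    · rw [abs_mul]; gcongr
    · rw [one_apply]; split_ifs <;> simp
  set A := ∫ z, q z ∂(stdG ι)
  set B := ∫ z, ‖z‖ * q z ∂(stdG ι)
  have hA : 0 ≤ A := integral_nonneg hq0
  have hB : 0 ≤ B := integral_nonneg fun z => mul_nonneg (norm_nonneg _) (hq0 z)
  have hAle : ∀ a b, ∫ z, |hessKernel (ι := ι) a b z| ∂(stdG ι) ≤ A := fun a b =>
    integral_mono (expGrowth_hessKernel a b).abs.integrable hqg.integrable (hle a b)
  have hBle : ∀ a b, ∫ z, ‖z‖ * |hessKernel (ι := ι) a b z| ∂(stdG ι) ≤ B := fun a b =>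
    integral_mono (ExpGrowth.norm.mul (expGrowth_hessKernel a b).abs).integrable
      (ExpGrowth.norm.mul hqg).integrable fun z =>
        mul_le_mul_of_nonneg_left (hle a b z) (norm_nonneg _)
  have interp : ∀ {σ D t M : ℝ}, 0 < σ → 0 ≤ t → 0 ≤ M → D ≤ M * σ⁻¹ → D ≤ M * (σ ^ 2)⁻¹ * t →
      D ≤ M * σ ^ (1 - p) * t ^ (p - 2) := by
    intro σ D t M hσ ht hM h1 h2
    have e : σ ^ (1 - p) * t ^ (p - 2) = σ⁻¹ * (t / σ) ^ (p - 2) := by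
      rw [div_rpow ht hσ.le, div_eq_mul_inv, ← rpow_neg hσ.le, ← Real.rpow_neg_one σ,
        mul_comm (t ^ _), ← mul_assoc, ← rpow_add hσ]
      congr 2; ring
    rw [mul_assoc, e]
    rcases le_total (t / σ) 1 with h | h
    · refine h2.trans ?_
      have : t / σ ≤ (t / σ) ^ (p - 2) := by
        rcases eq_or_lt_of_le (div_nonneg ht hσ.le) with h0 | h0
        · rw [← h0]; positivity
        · simpa using Real.rpow_le_rpow_of_exponent_ge h0 h (by linarith : p - 2 ≤ 1)
      calc M * (σ ^ 2)⁻¹ * t = M * (σ⁻¹ * (t / σ)) := by field_simp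
        _ ≤ _ := by gcongr
    · refine h1.trans ?_
      have : 1 ≤ (t / σ) ^ (p - 2) := one_le_rpow h (by linarith)
      calc M * σ⁻¹ = M * (σ⁻¹ * 1) := by ring
        _ ≤ _ := by gcongr
  refine ⟨(2 * B + A) + 3 * B, by positivity, fun f hf σ σ' hσ hσ' a b x y => ?_⟩
  have hσ0' : 0 < σ' := hσ.trans_le hσ'
  have hbd : ∀ s, 0 < s → ∀ x, |smoothHess f s a b x| ≤ B * s⁻¹ := by
    intro s hs x
    rw [smoothHess, abs_mul, abs_of_pos (by positivity)]
    have := abs_smear_le hf (expGrowth_hessKernel a b) (integral_hessKernel a b) hs.le x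
    calc (s ^ 2)⁻¹ * |smear (hessKernel a b) f s x| ≤ (s ^ 2)⁻¹ * (s * B) := by
          gcongr; exact this.trans (by gcongr; exact hBle a b)
      _ = _ := by field_simp
  have hσi : σ'⁻¹ ≤ σ⁻¹ := inv_anti₀ hσ hσ'
  have h1 : |smoothHess f σ a b x - smoothHess f σ a b y|
      ≤ (2 * B + A) * σ ^ (1 - p) * ‖x - y‖ ^ (p - 2) := by
    refine interp hσ (norm_nonneg _) (by positivity) ?_ ?_
    · refine (abs_sub _ _).trans ((add_le_add (hbd σ hσ x) (hbd σ hσ y)).trans ?_)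
      have : 0 ≤ A * σ⁻¹ := by positivity
      linarith
    · rw [smoothHess, smoothHess, ← mul_sub, abs_mul, abs_of_pos (by positivity)]
      have := (abs_smear_sub_le hf (expGrowth_hessKernel a b) σ x y).trans
        (mul_le_mul_of_nonneg_left (hAle a b) (norm_nonneg _))
      calc _ ≤ (σ ^ 2)⁻¹ * (‖x - y‖ * A) := by gcongr
        _ = A * (σ ^ 2)⁻¹ * ‖x - y‖ := by ring
        _ ≤ _ := by gcongr; linarith
  have h2 : |smoothHess f σ a b y - smoothHess f σ' a b y|
      ≤ (3 * B) * σ ^ (1 - p) * (σ' - σ) ^ (p - 2) := by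
    refine interp hσ (sub_nonneg.2 hσ') (by positivity) ?_ ?_
    · refine (abs_sub _ _).trans ((add_le_add (hbd σ hσ y) (hbd σ' hσ0' y)).trans ?_)
      have : B * σ'⁻¹ ≤ B * σ⁻¹ := by gcongr
      have : 0 ≤ B * σ⁻¹ := by positivity
      linarith
    · have e : smoothHess f σ a b y - smoothHess f σ' a b y
          = (σ ^ 2)⁻¹ * (smear (hessKernel a b) f σ y - smear (hessKernel a b) f σ' y)
            + ((σ ^ 2)⁻¹ - (σ' ^ 2)⁻¹) * smear (hessKernel a b) f σ' y := by
        rw [smoothHess, smoothHess]; ring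
      have hn : 0 ≤ (σ ^ 2)⁻¹ - (σ' ^ 2)⁻¹ := by
        rw [sub_nonneg]; gcongr
      rw [e]
      refine (abs_add_le _ _).trans ?_
      rw [abs_mul, abs_mul, abs_of_pos (a := (σ ^ 2)⁻¹) (by positivity), abs_of_nonneg hn]
      have g1 := (abs_smear_sub_scale_le hf (expGrowth_hessKernel a b) σ' σ y).trans
        (mul_le_mul_of_nonneg_left (hBle a b) (abs_nonneg _))
      rw [abs_sub_comm σ σ', abs_of_nonneg (sub_nonneg.2 hσ')] at g1
      have g2 := (abs_smear_le hf (expGrowth_hessKernel a b) (integral_hessKernel a b) hσ0'.le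
        y).trans
        (mul_le_mul_of_nonneg_left (hBle a b) hσ0'.le)
      have g3 : ((σ ^ 2)⁻¹ - (σ' ^ 2)⁻¹) * (σ' * B) ≤ 2 * B * (σ ^ 2)⁻¹ * (σ' - σ) := by
        have e2 : ((σ ^ 2)⁻¹ - (σ' ^ 2)⁻¹) * (σ' * B)
            = B * (σ ^ 2)⁻¹ * (σ' - σ) * ((σ' + σ) / σ') := by
          field_simp; ring
        rw [e2]
        have : (σ' + σ) / σ' ≤ 2 := by rw [div_le_iff₀ hσ0']; linarith
        have h0 : 0 ≤ B * (σ ^ 2)⁻¹ * (σ' - σ) :=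
          mul_nonneg (by positivity) (sub_nonneg.2 hσ')
        nlinarith
      have g4 : (σ ^ 2)⁻¹ * |smear (hessKernel a b) f σ y - smear (hessKernel a b) f σ' y|
          ≤ (σ ^ 2)⁻¹ * ((σ' - σ) * B) := by gcongr
      have g5 := mul_le_mul_of_nonneg_left g2 hn
      linarith
  have hs : 0 ≤ σ ^ (1 - p) := rpow_nonneg hσ.le _
  have k1 : 0 ≤ σ ^ (1 - p) * ‖x - y‖ ^ (p - 2) := by positivity
  have k2 : 0 ≤ σ ^ (1 - p) * (σ' - σ) ^ (p - 2) :=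
    mul_nonneg hs (rpow_nonneg (sub_nonneg.2 hσ') _)
  have := abs_sub_le (smoothHess f σ a b x) (smoothHess f σ a b y) (smoothHess f σ' a b y)
  nlinarith [mul_nonneg hA k1, mul_nonneg hB k1, mul_nonneg hA k2, mul_nonneg hB k2]

lemma exists_smoothHess_bound :
    ∃ C, 0 ≤ C ∧ ∀ f : ℰ ι → ℝ, LipschitzWith 1 f → ∀ σ, 0 < σ →
      ∀ a b x, |smoothHess f σ a b x| ≤ C * σ⁻¹ := by
  refine ⟨∑ a, ∑ b, ∫ z, ‖z‖ * |hessKernel (ι := ι) a b z| ∂(stdG ι), by positivity,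
    fun f hf s hs a b x => ?_⟩
  have hle : ∫ z, ‖z‖ * |hessKernel (ι := ι) a b z| ∂(stdG ι)
      ≤ ∑ a, ∑ b, ∫ z, ‖z‖ * |hessKernel (ι := ι) a b z| ∂(stdG ι) :=
    (Finset.single_le_sum (f := fun b => ∫ z, ‖z‖ * |hessKernel (ι := ι) a b z| ∂(stdG ι))
      (fun _ _ => by positivity) (mem_univ b)).trans
    (Finset.single_le_sum (f := fun a => ∑ b, ∫ z, ‖z‖ * |hessKernel (ι := ι) a b z| ∂(stdG ι))
      (fun _ _ => by positivity) (mem_univ a))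
  generalize (∑ a, ∑ b, ∫ z, ‖z‖ * |hessKernel (ι := ι) a b z| ∂(stdG ι)) = S at hle
  rw [smoothHess, abs_mul, abs_of_pos (by positivity)]
  have := abs_smear_le hf (expGrowth_hessKernel a b) (integral_hessKernel a b) hs.le x
  calc (s ^ 2)⁻¹ * |smear (hessKernel a b) f s x| ≤ (s ^ 2)⁻¹ * (s * S) := by
        gcongr; exact this.trans (by gcongr)
    _ = _ := by field_simp

end Taylor

section PosPart

/-- The power `t₊ ^ q` of the positive part. -/
def posPow (q t : ℝ) : ℝ := max t 0 ^ q

lemma posPow_nonneg (q t : ℝ) : 0 ≤ posPow q t := rpow_nonneg (le_max_right _ _) _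

lemma continuous_posPow {q : ℝ} (hq : 0 ≤ q) : Continuous (posPow q) :=
  (by fun_prop : Continuous fun t : ℝ => max t 0).rpow_const fun _ => Or.inr hq

lemma posPow_le {q : ℝ} (hq : 0 ≤ q) (t : ℝ) : posPow q t ≤ |t| ^ q :=
  rpow_le_rpow (le_max_right _ _) (max_le (le_abs_self t) (abs_nonneg t)) hq

lemma hasDerivAt_posPow {q : ℝ} (hq : 1 < q) (t : ℝ) :
    HasDerivAt (posPow q) (q * posPow (q - 1) t) t := by
  rcases lt_trichotomy t 0 with ht | ht | ht
  · have h0 : q * posPow (q - 1) t = 0 := by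
      rw [posPow, max_eq_right ht.le, zero_rpow (by linarith), mul_zero]
    rw [h0]
    refine (hasDerivAt_const t (0 : ℝ)).congr_of_eventuallyEq ?_
    filter_upwards [eventually_lt_nhds ht] with s hs
    rw [posPow, max_eq_right hs.le, zero_rpow (by linarith)]
  · subst ht
    have h0 : q * posPow (q - 1) 0 = 0 := by
      rw [posPow, max_self, zero_rpow (by linarith), mul_zero]
    rw [h0]
    have h1 := hasDerivAt_abs_rpow 0 hq
    simp only [mul_zero] at h1
    rw [hasDerivAt_iff_isLittleO] at h1 ⊢
    refine IsBigO.trans_isLittleO (IsBigO.of_bound 1 (Eventually.of_forall fun s => ?_)) h1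
    have e : posPow q 0 = 0 := by rw [posPow, max_self, zero_rpow (by linarith)]
    simp only [e, sub_zero, smul_zero, abs_zero, zero_rpow (by linarith : q ≠ 0), one_mul,
      norm_eq_abs]
    rw [abs_of_nonneg (posPow_nonneg _ _), abs_of_nonneg (by positivity)]
    exact posPow_le (by linarith) s
  · have h1 := Real.hasDerivAt_rpow_const (x := t) (p := q) (Or.inl ht.ne')
    have e : q * posPow (q - 1) t = q * t ^ (q - 1) := by rw [posPow, max_eq_left ht.le]
    rw [e]
    refine h1.congr_of_eventuallyEq ?_
    filter_upwards [eventually_gt_nhds ht] with s hs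
    rw [posPow, max_eq_left hs.le]

lemma abs_posPow_sub_le {q : ℝ} (hq : 0 ≤ q) (hq1 : q ≤ 1) (s t : ℝ) :
    |posPow q s - posPow q t| ≤ |s - t| ^ q := by
  have key : ∀ s t : ℝ, posPow q s - posPow q t ≤ |s - t| ^ q := by
    intro s t
    have h1 : max s 0 ≤ max t 0 + |s - t| := by
      have := le_abs_self (s - t)
      have := abs_nonneg (s - t)
      rcases max_cases s 0 with h | h <;> rcases max_cases t 0 with h' | h' <;> linarith
    have h2 : posPow q s ≤ (max t 0 + |s - t|) ^ q :=
      rpow_le_rpow (le_max_right _ _) h1 hq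
    have h3 := Real.rpow_add_le_add_rpow (le_max_right t 0) (abs_nonneg (s - t)) hq hq1
    rw [posPow, posPow] at *
    linarith
  rw [abs_le]
  constructor
  · have := key t s
    rw [abs_sub_comm] at this
    linarith
  · exact key s t

lemma abs_sub_le_of_deriv {g g' : ℝ → ℝ} (hg : ∀ t, HasDerivAt g (g' t) t) {C q : ℝ}
    (hC : 0 ≤ C) (hq : 0 ≤ q) (h : ∀ t, |g' t| ≤ C * |t| ^ q) (y : ℝ) :
    |g y - g 0| ≤ C * |y| ^ (q + 1) := by
  have := Convex.norm_image_sub_le_of_norm_hasDerivWithin_le (f := g) (f' := g')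
    (s := Set.uIcc 0 y) (C := C * |y| ^ q) (x := 0) (y := y)
    (fun t _ => (hg t).hasDerivWithinAt) (fun t ht => (h t).trans ?_) (convex_uIcc 0 y)
    Set.left_mem_uIcc Set.right_mem_uIcc
  · rcases eq_or_ne y 0 with rfl | hy
    · simp; positivity
    · rw [rpow_add_one (abs_pos.2 hy).ne', ← mul_assoc]
      simpa using this
  · have : |t| ≤ |y| := by
      have := Set.abs_sub_left_of_mem_uIcc ht
      simpa using this
    gcongr

lemma posPow_taylor {p : ℝ} (hp : 2 < p) (hp3 : p ≤ 3) (x y : ℝ) :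
    |posPow p (x + y) - posPow p x - p * posPow (p - 1) x * y
      - (1 / 2) * (p * (p - 1) * posPow (p - 2) x * (y * y))| ≤ p * (p - 1) * |y| ^ p := by
  have hc : 0 ≤ p * (p - 1) := by nlinarith
  have d2 : ∀ t, HasDerivAt (fun t => p * posPow (p - 1) (x + t)
      - p * (p - 1) * posPow (p - 2) x * t)
      (p * (p - 1) * posPow (p - 2) (x + t) - p * (p - 1) * posPow (p - 2) x) t := by
    intro t
    have h1 := ((hasDerivAt_posPow (q := p - 1) (by linarith) (x + t)).comp_const_add x
      t).const_mul p
    have h2 := (hasDerivAt_id t).const_mul (p * (p - 1) * posPow (p - 2) x)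
    refine (h1.sub h2).congr_deriv ?_
    rw [show p - 1 - 1 = p - 2 by ring]; ring
  have b2 : ∀ y, |p * posPow (p - 1) (x + y) - p * (p - 1) * posPow (p - 2) x * y
      - p * posPow (p - 1) x| ≤ p * (p - 1) * |y| ^ (p - 2 + 1) := by
    intro y
    have := abs_sub_le_of_deriv d2 hc (by linarith : 0 ≤ p - 2) (fun t => ?_) y
    · simpa using this
    · rw [← mul_sub, abs_mul, abs_of_nonneg hc]
      gcongr
      have := abs_posPow_sub_le (by linarith : 0 ≤ p - 2) (by linarith) (x + t) x
      simpa using this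
  have d1 : ∀ t, HasDerivAt (fun t => posPow p (x + t) - p * posPow (p - 1) x * t
      - (1 / 2) * (p * (p - 1) * posPow (p - 2) x * (t * t)))
      (p * posPow (p - 1) (x + t) - p * (p - 1) * posPow (p - 2) x * t
        - p * posPow (p - 1) x) t := by
    intro t
    have h1 := (hasDerivAt_posPow (q := p) (by linarith) (x + t)).comp_const_add x t
    have h2 := (hasDerivAt_id t).const_mul (p * posPow (p - 1) x)
    have h3 := (((hasDerivAt_id t).mul (hasDerivAt_id t)).const_mul
      (p * (p - 1) * posPow (p - 2) x)).const_mul (1 / 2)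
    refine ((h1.sub h2).sub h3).congr_deriv ?_
    simp only [id]; ring
  have := abs_sub_le_of_deriv d1 hc (by linarith : 0 ≤ p - 2 + 1) b2 y
  have e : p - 2 + 1 + 1 = p := by ring
  rw [e] at this
  convert this using 2
  simp only [add_zero, mul_zero, sub_zero]
  ring

end PosPart

section JetSeq

variable {ι : Type} [Fintype ι] {J : Type} [MeasurableSpace J]

/-- Backward heat flow `h`, with second order jets `(h (k+1), G k, H k)`, as it is used in
Lindeberg's replacement argument. The functions may depend on a random label `j`. -/
structure JetSeq (p c K : ℝ) (m : ℕ) (L : ℕ → ℝ) (h : ℕ → J → ℰ ι → ℝ)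
    (G : ℕ → ι → J → ℰ ι → ℝ)
    (H : ℕ → ι → ι → J → ℰ ι → ℝ) : Prop where
  meas_h : ∀ k ≤ m, Measurable (uncurry (h k))
  meas_G : ∀ k < m, ∀ a, Measurable (uncurry (G k a))
  meas_H : ∀ k < m, ∀ a b, Measurable (uncurry (H k a b))
  growth_h : ∀ k ≤ m, ∀ j x, |h k j x| ≤ K * (1 + ‖x‖) ^ p
  growth_G : ∀ k < m, ∀ a j x, |G k a j x| ≤ K * (1 + ‖x‖) ^ (p - 1)
  growth_H : ∀ k < m, ∀ a b j x, |H k a b j x| ≤ K * (1 + ‖x‖) ^ (p - 2)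
  heat : ∀ k < m, ∀ j x, h k j x = ∫ z, h (k + 1) j (x + z) ∂(stdG ι)
  taylor : ∀ k < m, ∀ j x y, |h (k + 1) j (x + y) - h (k + 1) j x - ∑ a, G k a j x * y a
    - (1 / 2) * ∑ a, ∑ b, H k a b j x * (y a * y b)| ≤ L k * ‖y‖ ^ p
  holder : ∀ k k', k < k' → k' < m → ∀ a b j x y, |H k' a b j x - H k a b j y|
    ≤ L k' * (‖x - y‖ ^ (p - 2) + c * ((k' - k : ℕ) : ℝ) ^ ((p - 2) / 2))
  mono : ∀ k k', k ≤ k' → k' < m → L k ≤ L k'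
  nonneg : ∀ k < m, 0 ≤ L k
  K_nonneg : 0 ≤ K

lemma smooth_smooth {f : ℰ ι → ℝ} (hf : Continuous f) {K p : ℝ} (hp : 0 ≤ p)
    (hK : ∀ x, |f x| ≤ K * (1 + ‖x‖) ^ p) {s : ℝ} (hs : 0 ≤ s) (x : ℰ ι) :
    ∫ z, smooth f (√s) (x + z) ∂(stdG ι) = smooth f (√(s + 1)) x := by
  have h1 : ∀ (t : ℝ) x, smooth f (√t) x = ∫ z, f (x + z) ∂(scaledG ι t) := fun t x =>
    (integral_scaledG (fun z => f (x + z)) (hf.comp (by fun_prop)).measurable).symm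
  have h2 : stdG ι = scaledG ι 1 := by
    rw [scaledG]; simp
  have h0 : scaledG ι 1 ∗ scaledG ι s = scaledG ι (s + 1) := by
    rw [scaledG_conv zero_le_one hs, add_comm]
  have hint : Integrable (fun z => f (x + z)) (scaledG ι (s + 1)) := by
    have hc : Continuous fun z => f (x + z) := hf.comp (by fun_prop)
    rw [scaledG]
    refine (integrable_map_measure hc.aestronglyMeasurable (by fun_prop)).2 ?_
    have g : ExpGrowth (fun z : ℰ ι =>
        K * (((1 + ‖x‖) * (1 + √(s + 1))) ^ p * (1 + ‖z‖) ^ p)) :=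
      (ExpGrowth.const K).mul ((ExpGrowth.const _).mul (.one_add_norm_rpow hp))
    refine (g.of_le (hf.comp (by fun_prop)) fun z => ?_).integrable
    refine (hK _).trans (le_trans ?_ (le_abs_self _))
    have hK0 : 0 ≤ K := by
      have := (abs_nonneg _).trans (hK 0)
      simpa using this
    rw [← mul_rpow (by positivity) (by positivity)]
    gcongr
    have := norm_add_le x (√(s + 1) • z)
    rw [norm_smul, norm_eq_abs, abs_of_nonneg (sqrt_nonneg _)] at this
    nlinarith [norm_nonneg x, norm_nonneg z, sqrt_nonneg (s + 1),
      mul_nonneg (norm_nonneg x) (norm_nonneg z), mul_nonneg (sqrt_nonneg (s + 1)) (norm_nonneg z),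
      mul_nonneg (norm_nonneg x) (sqrt_nonneg (s + 1)),
      mul_nonneg (norm_nonneg x) (mul_nonneg (norm_nonneg z) (sqrt_nonneg (s + 1)))]
  simp_rw [h1]
  rw [h2, ← h0, integral_conv (by rwa [h0])]
  refine integral_congr_ae (ae_of_all _ fun z => ?_)
  simp only [add_assoc]

end JetSeq

section JetExist

variable {ι : Type} [Fintype ι]

/-- Moments of `1 + ‖z‖` under the standard Gaussian measure. -/
def gMom (ι : Type) [Fintype ι] (q : ℝ) : ℝ :=
  ∫ z, (1 + ‖z‖) ^ q ∂(stdG ι)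

lemma gMom_nonneg (q : ℝ) : 0 ≤ gMom ι q := integral_nonneg fun z => by positivity

lemma gMom_mono {q r : ℝ} (hq : 0 ≤ q) (h : q ≤ r) : gMom ι q ≤ gMom ι r :=
  integral_mono (ExpGrowth.one_add_norm_rpow hq).integrable
    (ExpGrowth.one_add_norm_rpow (hq.trans h)).integrable fun z =>
      rpow_le_rpow_of_exponent_le (by linarith [norm_nonneg z]) h

section growth

variable {F : ℰ ι → ℝ} {K q : ℝ}

lemma growth_shift (hq : 0 ≤ q) (hK : ∀ x, |F x| ≤ K * (1 + ‖x‖) ^ q) {σ : ℝ} (hσ : 0 ≤ σ)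
    (x z : ℰ ι) :
    |F (x + σ • z)| ≤ K * ((1 + σ) ^ q * (1 + ‖x‖) ^ q) * (1 + ‖z‖) ^ q := by
  have hK0 : 0 ≤ K := by
    have := (abs_nonneg _).trans (hK 0)
    simpa using this
  refine (hK _).trans ?_
  rw [mul_assoc, ← mul_rpow (by positivity) (by positivity),
    ← mul_rpow (by positivity) (by positivity)]
  have h := norm_add_le x (σ • z)
  rw [norm_smul, norm_eq_abs, abs_of_nonneg hσ] at h
  gcongr
  have h1 := mul_nonneg hσ (norm_nonneg x)
  have h2 := mul_nonneg (norm_nonneg x) (norm_nonneg z)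
  have h3 := mul_nonneg h1 (norm_nonneg z)
  nlinarith [norm_nonneg x, norm_nonneg z]

lemma expGrowth_shift (hF : Continuous F) (hq : 0 ≤ q) (hK : ∀ x, |F x| ≤ K * (1 + ‖x‖) ^ q)
    {σ : ℝ} (hσ : 0 ≤ σ) (x : ℰ ι) : ExpGrowth (fun z => F (x + σ • z)) :=
  ((ExpGrowth.const (K * ((1 + σ) ^ q * (1 + ‖x‖) ^ q))).mul (.one_add_norm_rpow hq)).of_le
    (hF.comp (by fun_prop)) fun z => (growth_shift hq hK hσ x z).trans (le_abs_self _)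

lemma abs_smooth_le (hq : 0 ≤ q) (hK : ∀ x, |F x| ≤ K * (1 + ‖x‖) ^ q)
    {σ : ℝ} (hσ : 0 ≤ σ) (x : ℰ ι) :
    |smooth F σ x| ≤ K * (1 + σ) ^ q * gMom ι q * (1 + ‖x‖) ^ q := by
  refine abs_integral_le_integral_abs.trans ?_
  refine (integral_mono_of_nonneg (ae_of_all _ fun z => abs_nonneg _)
    ((ExpGrowth.one_add_norm_rpow hq).integrable.const_mul _)
    (ae_of_all _ fun z => growth_shift hq hK hσ x z)).trans (le_of_eq ?_)
  rw [integral_const_mul, gMom]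
  ring

end growth

lemma measurable_smear {J : Type} [MeasurableSpace J] {q : ℰ ι → ℝ}
    (hq : Measurable q) {f : J → ℰ ι → ℝ} (hf : Measurable (uncurry f))
    (σ : ℝ) : Measurable (uncurry fun j => smear q (f j) σ) := by
  have h : Measurable (fun w : (J × ℰ ι) × ℰ ι =>
      f w.1.1 (w.1.2 + σ • w.2) * q w.2) := by
    refine Measurable.mul ?_ (hq.comp measurable_snd)
    exact hf.comp (f := fun w : (J × ℰ ι) × ℰ ι =>
      (w.1.1, w.1.2 + σ • w.2)) (by fun_prop)
  exact (h.stronglyMeasurable.integral_prod_right' (ν := stdG ι)).measurable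

lemma measurable_smooth {J : Type} [MeasurableSpace J]
    {f : J → ℰ ι → ℝ} (hf : Measurable (uncurry f))
    (σ : ℝ) : Measurable (uncurry fun j => smooth (f j) σ) := by
  simp_rw [smooth_eq_smear]
  exact measurable_smear measurable_const hf σ

lemma sqrt_sub_sqrt_rpow_le {q s t : ℝ} (hq : 0 ≤ q) (hs : 0 ≤ s) (hst : s ≤ t) :
    (√t - √s) ^ q ≤ (t - s) ^ (q / 2) := by
  have h1 : √t - √s ≤ √(t - s) := by
    rw [sub_le_iff_le_add']
    refine Real.sqrt_le_iff.2 ⟨by positivity, ?_⟩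
    rw [add_sq, sq_sqrt hs, sq_sqrt (sub_nonneg.2 hst)]
    have := mul_nonneg (sqrt_nonneg s) (sqrt_nonneg (t - s))
    linarith
  have h0 : 0 ≤ √t - √s := sub_nonneg.2 (sqrt_le_sqrt hst)
  refine (rpow_le_rpow h0 h1 hq).trans (le_of_eq ?_)
  rw [sqrt_eq_rpow, ← rpow_mul (by linarith)]
  congr 1; ring

variable [DecidableEq ι]

/-- Jets for Lipschitz functions smoothed by a standard Gaussian vector. -/
lemma exists_jetSeq_lipschitz {p : ℝ} (hp : 2 < p) (hp3 : p ≤ 3) :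
    ∃ C, 0 ≤ C ∧ ∀ (J : Type) [MeasurableSpace J] (f : J → ℰ ι → ℝ),
      Measurable (uncurry f) → (∀ j, LipschitzWith 1 (f j)) → (∀ j, f j 0 = 0) →
      ∀ m : ℕ, ∃ (K : ℝ) (h : ℕ → J → ℰ ι → ℝ)
        (G : ℕ → ι → J → ℰ ι → ℝ) (H : ℕ → ι → ι → J → ℰ ι → ℝ),
        JetSeq p 1 K m (fun k => C * √((m : ℝ) - k) ^ (1 - p)) h G H ∧
        (∀ j x, h m j x = smooth (f j) 1 x) ∧ (∀ j, h 0 j 0 = smooth (f j) (√(m + 1)) 0) ∧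
        (0 < m → ∀ a b j x, |H 0 a b j x| ≤ C * (√m)⁻¹) := by
  obtain ⟨C1, hC1, hT⟩ := exists_smooth_taylor (ι := ι) hp.le hp3
  obtain ⟨C2, hC2, hH⟩ := exists_smoothHess_holder (ι := ι) hp.le hp3
  obtain ⟨C3, hC3, hB⟩ := exists_smoothHess_bound (ι := ι)
  refine ⟨C1 + C2 + C3, by positivity, fun J _ f hf hl h0 m => ?_⟩
  set B := ∫ z : ℰ ι, ‖z‖ * ‖z‖ ∂(stdG ι)
  have hB0 : 0 ≤ B := integral_nonneg fun z => by positivity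
  have hfg : ∀ j x, |f j x| ≤ 1 * (1 + ‖x‖) ^ p := by
    intro j x
    have h1 := abs_sub_le_of_lipschitz (hl j) x 0
    rw [h0, sub_zero, sub_zero] at h1
    have h2 : (1 + ‖x‖) ≤ (1 + ‖x‖) ^ p := by
      simpa using rpow_le_rpow_of_exponent_le (x := 1 + ‖x‖) (by linarith [norm_nonneg x])
        (by linarith : (1 : ℝ) ≤ p)
    linarith
  have hpos : ∀ k : ℕ, k < m → (1 : ℝ) ≤ (m : ℝ) - k := by
    intro k hk
    have : (k : ℝ) + 1 ≤ m := by exact_mod_cast hk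
    linarith
  have hσ : ∀ k : ℕ, k < m → 1 ≤ √((m : ℝ) - k) := fun k hk => Real.one_le_sqrt.2 (hpos k hk)
  refine ⟨1 * (1 + √(m + 1)) ^ p * gMom ι p + B + C3,
    fun k j => smooth (f j) (√((m : ℝ) + 1 - k)),
    fun k a j => smoothGrad (f j) (√((m : ℝ) - k)) a,
    fun k a b j => smoothHess (f j) (√((m : ℝ) - k)) a b, ?_, ?_, ?_, ?_⟩
  · have hgm := gMom_nonneg (ι := ι) p
    refine ⟨fun k _ => measurable_smooth hf _, fun k _ a => ?_, fun k _ a b => ?_,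
      fun k hk j x => ?_, fun k hk a j x => ?_, fun k hk a b j x => ?_, fun k hk j x => ?_,
      fun k hk j x y => ?_, fun k k' hkk hk' a b j x y => ?_, fun k k' hkk hk' => ?_,
      fun k hk => ?_, by positivity⟩
    · exact (measurable_smear (by fun_prop) hf _).const_mul _
    · exact (measurable_smear (expGrowth_hessKernel a b).1.measurable hf _).const_mul _
    · refine (abs_smooth_le (by linarith) (hfg j) (sqrt_nonneg _) x).trans ?_
      have h1 : √((m : ℝ) + 1 - k) ≤ √(m + 1) := sqrt_le_sqrt (by simp)
      gcongr
      have h2 : (1 + √((m : ℝ) + 1 - k)) ^ p ≤ (1 + √(m + 1)) ^ p := by gcongr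
      have := mul_le_mul_of_nonneg_right h2 hgm
      linarith
    · have hs := hσ k hk
      have h1 := abs_smear_le (hl j) (ExpGrowth.eval a) (integral_eval_stdG a)
        (by linarith : 0 ≤ √((m : ℝ) - k)) x
      have h2 : ∫ z : ℰ ι, ‖z‖ * |z a| ∂(stdG ι) ≤ B :=
        integral_mono (ExpGrowth.norm.mul (ExpGrowth.eval a).abs).integrable
          (ExpGrowth.norm.mul .norm).integrable fun z =>
            mul_le_mul_of_nonneg_left (PiLp.norm_apply_le z a) (norm_nonneg _)
      have h3 : |smoothGrad (f j) (√((m : ℝ) - k)) a x| ≤ B := by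
        rw [smoothGrad, abs_mul, abs_of_nonneg (by positivity)]
        calc _ ≤ (√((m : ℝ) - k))⁻¹ * (√((m : ℝ) - k) * B) := by
              gcongr; exact h1.trans (by gcongr)
          _ = B := by field_simp
      have h4 : 1 ≤ (1 + ‖x‖) ^ (p - 1) :=
        one_le_rpow (by linarith [norm_nonneg x]) (by linarith)
      have h5 : 0 ≤ 1 * (1 + √(m + 1)) ^ p * gMom ι p := by positivity
      refine h3.trans ((le_mul_of_one_le_right hB0 h4).trans ?_)
      gcongr; linarith
    · have hs := hσ k hk
      have h3 : |smoothHess (f j) (√((m : ℝ) - k)) a b x| ≤ C3 := by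
        refine (hB _ (hl j) _ (by linarith) a b x).trans ?_
        exact mul_le_of_le_one_right hC3 (inv_le_one_of_one_le₀ hs)
      have h4 : 1 ≤ (1 + ‖x‖) ^ (p - 2) :=
        one_le_rpow (by linarith [norm_nonneg x]) (by linarith)
      have h5 : 0 ≤ 1 * (1 + √(m + 1)) ^ p * gMom ι p := by positivity
      refine h3.trans ((le_mul_of_one_le_right hC3 h4).trans ?_)
      gcongr; linarith
    · have := smooth_smooth (hl j).continuous (by linarith) (hfg j)
        (by push_cast; linarith [hpos k hk] : (0 : ℝ) ≤ (m : ℝ) + 1 - (k + 1 : ℕ)) x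
      rw [this]; congr 2; push_cast; ring
    · have e : (m : ℝ) + 1 - (k + 1 : ℕ) = m - k := by push_cast; ring
      rw [e]
      have hs := hσ k hk
      refine (hT _ (hl j) _ (by linarith) x y).trans ?_
      gcongr
      linarith
    · have hs := hσ k' hk'
      have hkr : (k : ℝ) ≤ k' := by exact_mod_cast hkk.le
      refine (hH _ (hl j) (√((m : ℝ) - k')) (√((m : ℝ) - k)) (by linarith)
        (sqrt_le_sqrt (by linarith)) a b x y).trans ?_
      have h1 := sqrt_sub_sqrt_rpow_le (q := p - 2) (by linarith)
        (by linarith [hpos k' hk'] : (0 : ℝ) ≤ m - k') (by linarith : (m : ℝ) - k' ≤ m - k)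
      rw [show (m : ℝ) - k - (m - k') = ((k' - k : ℕ) : ℝ) by
        rw [Nat.cast_sub hkk.le]; ring] at h1
      have h2 : 0 ≤ √((m : ℝ) - k) - √((m : ℝ) - k') :=
        sub_nonneg.2 (sqrt_le_sqrt (by linarith))
      rw [one_mul]
      refine mul_le_mul (by gcongr; linarith) (by gcongr)
        (add_nonneg (by positivity) (rpow_nonneg h2 _)) (by positivity)
    · have hkr : (k : ℝ) ≤ k' := by exact_mod_cast hkk
      have hs := hσ k' hk'
      have : √((m : ℝ) - k) ^ (1 - p) ≤ √((m : ℝ) - k') ^ (1 - p) :=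
        rpow_le_rpow_of_nonpos (by linarith) (sqrt_le_sqrt (by linarith)) (by linarith)
      gcongr
    · positivity
  · intro j x; simp
  · intro j; simp
  · intro hm a b j x
    have := hB _ (hl j) (√((m : ℝ) - (0 : ℕ))) (by
      rw [Nat.cast_zero, sub_zero]; exact Real.sqrt_pos.2 (by exact_mod_cast hm)) a b x
    refine this.trans ?_
    rw [Nat.cast_zero, sub_zero]
    gcongr
    linarith

/-- The function `x ↦ (s * x i - l)₊ ^ q`. -/
def coordPow (i : ι) (s l q : ℝ) (x : ℰ ι) : ℝ := posPow q (s * x i - l)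

section coordPow

variable {i : ι} {s l q : ℝ}

lemma continuous_coordPow (hq : 0 ≤ q) : Continuous (coordPow i s l q) :=
  (continuous_posPow hq).comp (by fun_prop)

lemma abs_coordPow_le (hs : |s| = 1) (hl : 0 ≤ l) (hq : 0 ≤ q) (x : ℰ ι) :
    |coordPow i s l q x| ≤ 1 * (1 + ‖x‖) ^ q := by
  rw [one_mul, coordPow, abs_of_nonneg (posPow_nonneg _ _)]
  refine rpow_le_rpow (le_max_right _ _) (max_le ?_ (by positivity)) hq
  have h1 := PiLp.norm_apply_le x i
  rw [norm_eq_abs] at h1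
  have h2 : s * x i ≤ |x i| := (le_abs_self _).trans (by rw [abs_mul, hs, one_mul])
  linarith

lemma integrable_coordPow (hs : |s| = 1) (hl : 0 ≤ l) (hq : 0 ≤ q) {σ : ℝ} (hσ : 0 ≤ σ)
    (x : ℰ ι) : Integrable (fun z => coordPow i s l q (x + σ • z)) (stdG ι) :=
  (expGrowth_shift (continuous_coordPow hq) hq (abs_coordPow_le hs hl hq) hσ x).integrable

lemma coordPow_taylor {p : ℝ} (hp : 2 < p) (hp3 : p ≤ 3) (hs : |s| = 1) (hl : 0 ≤ l) {σ : ℝ}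
    (hσ : 0 ≤ σ) (x y : ℰ ι) :
    |smooth (coordPow i s l p) σ (x + y) - smooth (coordPow i s l p) σ x
      - s * (p * smooth (coordPow i s l (p - 1)) σ x) * y i
      - (1 / 2) * (p * (p - 1) * smooth (coordPow i s l (p - 2)) σ x * (y i * y i))|
      ≤ p * (p - 1) * ‖y‖ ^ p := by
  have hpp : 0 ≤ p * (p - 1) := by nlinarith
  have i0 := integrable_coordPow (i := i) (q := p) hs hl (by linarith) hσ
  have i1 := integrable_coordPow (i := i) (q := p - 1) hs hl (by linarith) hσ
  have i2 := integrable_coordPow (i := i) (q := p - 2) hs hl (by linarith) hσ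
  have e : smooth (coordPow i s l p) σ (x + y) - smooth (coordPow i s l p) σ x
      - s * (p * smooth (coordPow i s l (p - 1)) σ x) * y i
      - (1 / 2) * (p * (p - 1) * smooth (coordPow i s l (p - 2)) σ x * (y i * y i))
      = ∫ z, (coordPow i s l p (x + y + σ • z) - coordPow i s l p (x + σ • z)
        - coordPow i s l (p - 1) (x + σ • z) * (s * p * y i)
        - coordPow i s l (p - 2) (x + σ • z) * ((1 / 2) * (p * (p - 1)) * (y i * y i)))
        ∂(stdG ι) := by
    have j0 : Integrable (fun z => coordPow i s l p (x + y + σ • z) - coordPow i s l p (x + σ • z))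
        (stdG ι) := (i0 _).sub (i0 _)
    have j1 : Integrable (fun z => coordPow i s l p (x + y + σ • z) - coordPow i s l p (x + σ • z)
        - coordPow i s l (p - 1) (x + σ • z) * (s * p * y i)) (stdG ι) :=
      j0.sub ((i1 _).mul_const _)
    rw [integral_sub j1 ((i2 _).mul_const _), integral_sub j0 ((i1 _).mul_const _),
      integral_sub (i0 _) (i0 _), integral_mul_const, integral_mul_const]
    simp only [smooth]
    ring
  rw [e]
  refine abs_integral_le_integral_abs.trans ?_
  have hbd : ∀ z, |coordPow i s l p (x + y + σ • z) - coordPow i s l p (x + σ • z)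
        - coordPow i s l (p - 1) (x + σ • z) * (s * p * y i)
        - coordPow i s l (p - 2) (x + σ • z) * ((1 / 2) * (p * (p - 1)) * (y i * y i))|
        ≤ p * (p - 1) * ‖y‖ ^ p := by
    intro z
    have h1 := posPow_taylor hp hp3 (s * (x + σ • z) i - l) (s * y i)
    have e1 : s * (x + σ • z) i - l + s * y i = s * (x + y + σ • z) i - l := by
      simp only [PiLp.add_apply]; ring
    have hs2 : s * s = 1 := by rw [← abs_mul_abs_self, hs, one_mul]
    have e2 : s * y i * (s * y i) = y i * y i := by
      linear_combination (y i * y i) * hs2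
    rw [e1, e2] at h1
    have h2 : |s * y i| ^ p ≤ ‖y‖ ^ p := by
      rw [abs_mul, hs, one_mul]
      exact rpow_le_rpow (abs_nonneg _) (PiLp.norm_apply_le y i) (by linarith)
    refine le_trans (le_of_eq ?_) (h1.trans (mul_le_mul_of_nonneg_left h2 hpp))
    congr 1
    simp only [coordPow]
    ring
  refine (integral_mono_of_nonneg (ae_of_all _ fun z => abs_nonneg _)
    (integrable_const (p * (p - 1) * ‖y‖ ^ p)) (ae_of_all _ hbd)).trans (le_of_eq ?_)
  simp

lemma smooth_coordPow_holder (hs : |s| = 1) (hl : 0 ≤ l) (hq : 0 ≤ q) (hq1 : q ≤ 1) {σ σ' : ℝ}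
    (hσ : 0 ≤ σ) (hσ' : σ ≤ σ') (x y : ℰ ι) :
    |smooth (coordPow i s l q) σ x - smooth (coordPow i s l q) σ' y|
      ≤ ‖x - y‖ ^ q + gMom ι q * (σ' - σ) ^ q := by
  have hσ0 : 0 ≤ σ' - σ := sub_nonneg.2 hσ'
  have hbd : ∀ z, |coordPow i s l q (x + σ • z) - coordPow i s l q (y + σ' • z)|
      ≤ ‖x - y‖ ^ q + (1 + ‖z‖) ^ q * (σ' - σ) ^ q := by
    intro z
    refine (abs_posPow_sub_le hq hq1 _ _).trans ?_
    have h1 : |s * (x + σ • z) i - l - (s * (y + σ' • z) i - l)|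
        ≤ ‖x - y‖ + (1 + ‖z‖) * (σ' - σ) := by
      have e1 : s * (x + σ • z) i - l - (s * (y + σ' • z) i - l)
          = s * ((x - y) i - (σ' - σ) * z i) := by
        simp only [PiLp.add_apply, PiLp.sub_apply, PiLp.smul_apply, smul_eq_mul]; ring
      rw [e1, abs_mul, hs, one_mul]
      refine (abs_sub _ _).trans (add_le_add (PiLp.norm_apply_le (x - y) i) ?_)
      rw [abs_mul, abs_of_nonneg hσ0, mul_comm]
      have := PiLp.norm_apply_le z i
      rw [norm_eq_abs] at this
      exact mul_le_mul_of_nonneg_right (by linarith) hσ0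
    refine (rpow_le_rpow (abs_nonneg _) h1 hq).trans ?_
    have h3 : 0 ≤ (1 + ‖z‖) * (σ' - σ) := mul_nonneg (by positivity) hσ0
    refine (Real.rpow_add_le_add_rpow (norm_nonneg _) h3 hq hq1).trans ?_
    rw [mul_rpow (by positivity) hσ0]
  rw [smooth, smooth, ← integral_sub (integrable_coordPow hs hl hq hσ x)
    (integrable_coordPow hs hl hq (hσ.trans hσ') y)]
  refine abs_integral_le_integral_abs.trans ?_
  have ig := (ExpGrowth.one_add_norm_rpow (ι := ι) hq).integrable
  refine (integral_mono_of_nonneg (ae_of_all _ fun z => abs_nonneg _)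
    ((integrable_const _).add (ig.mul_const _)) (ae_of_all _ hbd)).trans ?_
  rw [integral_add' (integrable_const _) (ig.mul_const _), integral_mul_const]
  simp [gMom]

lemma abs_smooth_coordPow_le (hs : |s| = 1) (hl : 0 ≤ l) {p : ℝ} (hq : 0 ≤ q) (hqp : q ≤ p)
    {σ τ : ℝ} (hσ : 0 ≤ σ) (hστ : σ ≤ τ) (x : ℰ ι) :
    |smooth (coordPow i s l q) σ x| ≤ (1 + τ) ^ p * gMom ι p * (1 + ‖x‖) ^ q := by
  refine (abs_smooth_le hq (abs_coordPow_le hs hl hq) hσ x).trans ?_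
  have h2 : (1 + σ) ^ q ≤ (1 + τ) ^ p :=
    (rpow_le_rpow (by positivity) (by linarith) hq).trans
      (rpow_le_rpow_of_exponent_le (by linarith) hqp)
  have h3 := gMom_nonneg (ι := ι) q
  have h4 := gMom_mono (ι := ι) hq hqp
  rw [one_mul]
  have : (1 + σ) ^ q * gMom ι q ≤ (1 + τ) ^ p * gMom ι p := mul_le_mul h2 h4 h3
    (rpow_nonneg (by linarith) _)
  gcongr

lemma measurable_smooth_coordPow (hq : 0 ≤ q) (σ : ℝ) :
    Measurable (uncurry fun _ : Unit => smooth (coordPow i s l q) σ) :=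
  measurable_smooth (f := fun _ : Unit => coordPow i s l q)
    ((continuous_coordPow hq).measurable.comp measurable_snd) σ

end coordPow

/-- Jets for powers of positive parts of a coordinate. -/
lemma exists_jetSeq_posPow {p : ℝ} (hp : 2 < p) (hp3 : p ≤ 3) (i : ι) {s l : ℝ} (hs : |s| = 1)
    (hl : 0 ≤ l) (m : ℕ) :
    ∃ (K : ℝ) (h : ℕ → Unit → ℰ ι → ℝ)
        (G : ℕ → ι → Unit → ℰ ι → ℝ)
        (H : ℕ → ι → ι → Unit → ℰ ι → ℝ),
        JetSeq p (gMom ι (p - 2)) K m (fun _ => p * (p - 1)) h G H ∧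
        (∀ j x, h m j x = posPow p (s * x i - l)) ∧
        (∀ j, h 0 j 0 = ∫ z, posPow p (s * (√m * z i) - l) ∂(stdG ι)) := by
  have hpp : 0 ≤ p * (p - 1) := by nlinarith
  have hsm : ∀ k : ℕ, √((m : ℝ) - k) ≤ √m := fun k => sqrt_le_sqrt (by simp)
  have hgm := gMom_nonneg (ι := ι) p
  obtain ⟨B, hB⟩ : ∃ B, B = (1 + √m) ^ p * gMom ι p := ⟨_, rfl⟩
  have hB0 : 0 ≤ B := by rw [hB]; positivity
  have hKb : ∀ c, 0 ≤ c → c ≤ p * (p - 1) → ∀ q, 0 ≤ q → q ≤ p → ∀ k : ℕ, ∀ x,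
      |c * smooth (coordPow i s l q) (√((m : ℝ) - k)) x| ≤ p * (p - 1) * B * (1 + ‖x‖) ^ q := by
    intro c hc hc' q hq hqp k x
    rw [abs_mul, abs_of_nonneg hc, mul_assoc]
    refine mul_le_mul hc' ?_ (abs_nonneg _) hpp
    rw [hB]
    exact abs_smooth_coordPow_le hs hl hq hqp (sqrt_nonneg _) (hsm k) x
  refine ⟨p * (p - 1) * B, fun k _ => smooth (coordPow i s l p) (√((m : ℝ) - k)),
    fun k a _ x => if a = i then
      s * (p * smooth (coordPow i s l (p - 1)) (√((m : ℝ) - (k + 1 : ℕ))) x) else 0,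
    fun k a b _ x => if a = i then (if b = i then p * (p - 1)
      * smooth (coordPow i s l (p - 2)) (√((m : ℝ) - (k + 1 : ℕ))) x else 0) else 0, ?_, ?_, ?_⟩
  · refine ⟨fun k _ => measurable_smooth_coordPow (by linarith) _, fun k _ a => ?_,
      fun k _ a b => ?_, fun k hk j x => ?_, fun k hk a j x => ?_, fun k hk a b j x => ?_,
      fun k hk j x => ?_, fun k hk j x y => ?_, fun k k' hkk hk' a b j x y => ?_,
      fun k k' hkk hk' => le_rfl, fun k hk => hpp, by positivity⟩
    · by_cases h : a = i
      · simp only [h, if_true]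
        exact ((measurable_smooth_coordPow (by linarith) _).const_mul p).const_mul s
      · simp only [h, if_false]
        exact measurable_const
    · by_cases h : a = i
      · by_cases h' : b = i
        · simp only [h, h', if_true]
          exact (measurable_smooth_coordPow (by linarith) _).const_mul _
        · simp only [h', if_false, ite_self]
          exact measurable_const
      · simp only [h, if_false]
        exact measurable_const
    · have := hKb 1 zero_le_one (by nlinarith) p (by linarith) le_rfl k x
      rwa [one_mul] at this
    · split_ifs
      · rw [abs_mul, hs, one_mul]
        exact hKb p (by linarith) (by nlinarith) (p - 1) (by linarith) (by linarith) (k + 1) x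
      · rw [abs_zero]; positivity
    · split_ifs
      · exact hKb (p * (p - 1)) hpp le_rfl (p - 2) (by linarith) (by linarith) (k + 1) x
      · rw [abs_zero]; positivity
      · rw [abs_zero]; positivity
    · have hk' : (k : ℝ) + 1 ≤ m := by exact_mod_cast hk
      rw [smooth_smooth (continuous_coordPow (by linarith)) (by linarith)
        (abs_coordPow_le hs hl (by linarith)) (by push_cast; linarith) x]
      congr 2; push_cast; ring
    · simp only [ite_mul, zero_mul, Finset.sum_ite_eq', mem_univ, if_true]
      have hsum : ∀ W : ℝ, (∑ a, ∑ b, if a = i then (if b = i then W * (y a * y b) else 0) else 0)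
          = W * (y i * y i) := by
        intro W
        rw [Finset.sum_eq_single i]
        · simp
        · intro a _ ha; simp [ha]
        · simp
      rw [hsum]
      exact coordPow_taylor hp hp3 hs hl (sqrt_nonneg _) x y
    · have hkr : (k : ℝ) ≤ k' := by exact_mod_cast hkk.le
      have hk1 : (k' : ℝ) + 1 ≤ m := by exact_mod_cast hk'
      have hc := gMom_nonneg (ι := ι) (p - 2)
      have hpos : 0 ≤ p * (p - 1) * (‖x - y‖ ^ (p - 2)
          + gMom ι (p - 2) * ((k' - k : ℕ) : ℝ) ^ ((p - 2) / 2)) := by positivity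
      split_ifs
      swap; · simpa using hpos
      swap; · simpa using hpos
      rw [← mul_sub, abs_mul, abs_of_nonneg hpp]
      refine mul_le_mul_of_nonneg_left ?_ hpp
      refine (smooth_coordPow_holder hs hl (by linarith) (by linarith) (sqrt_nonneg _)
        (sqrt_le_sqrt (by push_cast; linarith)) x y).trans ?_
      have := sqrt_sub_sqrt_rpow_le (q := p - 2) (s := (m : ℝ) - (k' + 1 : ℕ))
          (t := (m : ℝ) - (k + 1 : ℕ)) (by linarith) (by push_cast; linarith)
          (by push_cast; linarith)
      rw [show (m : ℝ) - (k + 1 : ℕ) - (m - (k' + 1 : ℕ)) = ((k' - k : ℕ) : ℝ) by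
        rw [Nat.cast_sub hkk.le]; push_cast; ring] at this
      exact add_le_add le_rfl (mul_le_mul_of_nonneg_left this hc)
  · intro j x
    simp [smooth, coordPow]
  · intro j
    simp only [smooth, coordPow, Nat.cast_zero, sub_zero, zero_add, PiLp.smul_apply, smul_eq_mul]

end JetExist

section PathSpace

variable {ι : Type*} [Fintype ι] [DecidableEq ι]

/-- The shift by `k` on bi-infinite sequences. -/
def shiftBy {E : Type*} (k : ℤ) (x : ℤ → E) : ℤ → E := fun n => x (n + k)

/-- The sum of the `n` terms following time `s`. -/
def blockSum {E : Type*} [AddCommMonoid E] (s : ℤ) (n : ℕ) (x : ℤ → E) : E :=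
  ∑ l ∈ range n, x (s + l + 1)

/-- The sum of the centred products of coordinates over the `n` times following `s`. -/
def blockXi (s : ℤ) (n : ℕ) (a b : ι) (x : 𝒳 ι) : ℝ :=
  ∑ l ∈ range n,
    (x (s + l + 1) a * x (s + l + 1) b - (1 : Matrix ι ι ℝ) a b)

lemma measurable_shiftBy {E : Type*} [MeasurableSpace E] (k : ℤ) :
    Measurable (shiftBy k : (ℤ → E) → ℤ → E) :=
  measurable_pi_lambda _ fun _ => measurable_pi_apply _

section blockSum

variable {E : Type*} [AddCommMonoid E]

lemma blockSum_shiftBy (s k : ℤ) (n : ℕ) (x : ℤ → E) :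
    blockSum s n (shiftBy k x) = blockSum (s + k) n x := by
  simp only [blockSum, shiftBy]
  exact sum_congr rfl fun l _ => by congr 1; ring

lemma blockSum_add (s : ℤ) (n m : ℕ) (x : ℤ → E) :
    blockSum s (n + m) x = blockSum s n x + blockSum (s + n) m x := by
  simp only [blockSum, sum_range_add]
  congr 1
  exact sum_congr rfl fun l _ => by push_cast; congr 1; ring

@[simp] lemma blockSum_zero (s : ℤ) (x : ℤ → E) : blockSum s 0 x = 0 := by simp [blockSum]

lemma blockSum_succ (s : ℤ) (n : ℕ) (x : ℤ → E) :
    blockSum s (n + 1) x = blockSum s n x + x (s + n + 1) := by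
  simp [blockSum, sum_range_succ]

lemma dependsOn_blockSum (s : ℤ) (n : ℕ) :
    DependsOn (blockSum s n : (ℤ → E) → E) (Iic (s + n)) := by
  intro x y h
  refine sum_congr rfl fun l hl => h _ ?_
  have := Finset.mem_range.1 hl
  simp only [mem_Iic]; omega

lemma measurable_blockSum [MeasurableSpace E] [MeasurableAdd₂ E] (s : ℤ) (n : ℕ) :
    Measurable (blockSum s n : (ℤ → E) → E) :=
  Finset.measurable_sum _ fun _ _ => measurable_pi_apply _

end blockSum

lemma blockXi_shiftBy (s k : ℤ) (n : ℕ) (a b : ι) (x : 𝒳 ι) :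
    blockXi s n a b (shiftBy k x) = blockXi (s + k) n a b x := by
  simp only [blockXi, shiftBy]
  refine sum_congr rfl fun l _ => ?_
  rw [show s + l + 1 + k = s + k + l + 1 by ring]

lemma blockXi_add (s : ℤ) (n m : ℕ) (a b : ι) (x : 𝒳 ι) :
    blockXi s (n + m) a b x = blockXi s n a b x + blockXi (s + n) m a b x := by
  simp only [blockXi, sum_range_add]
  congr 1
  refine sum_congr rfl fun l _ => ?_
  rw [show s + ((n + l : ℕ) : ℤ) + 1 = s + n + l + 1 by push_cast; ring]

lemma measurable_coord (k : ℤ) (a : ι) : Measurable fun x : 𝒳 ι => x k a := by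
  fun_prop

lemma measurable_blockXi (s : ℤ) (n : ℕ) (a b : ι) : Measurable (blockXi s n a b) :=
  Finset.measurable_sum _ fun _ _ =>
    ((measurable_coord _ _).mul (measurable_coord _ _)).sub_const _

lemma DependsOn.comp_shiftBy {E F : Type*} {w : (ℤ → E) → F} {n : ℤ}
    (hw : DependsOn w (Iic n)) (k : ℤ) :
    DependsOn (fun x => w (shiftBy k x)) (Iic (n + k)) := by
  intro x y h
  refine hw fun i hi => h _ ?_
  simp only [mem_Iic] at hi ⊢; omega

/-- The laws of stationary martingale difference sequences with moments of order `p` and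
identity covariance. -/
structure MartLaw (p : ℝ) (μ : Measure (𝒳 ι)) : Prop where
  prob : IsProbabilityMeasure μ
  shift : ∀ k, μ.map (shiftBy k) = μ
  mart : ∀ (a : ι) (w : 𝒳 ι → ℝ), Measurable w → DependsOn w (Iic 0) →
    Integrable (fun x => w x * x 1 a) μ → ∫ x, w x * x 1 a ∂μ = 0
  mom : MemLp (fun x => x 0) (ofReal p) μ
  cov : ∀ a b, ∫ x, x 0 a * x 0 b ∂μ = (1 : Matrix ι ι ℝ) a b

namespace MartLaw

variable {p : ℝ} {μ : Measure (𝒳 ι)}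

lemma measurePreserving (hμ : MartLaw p μ) (k : ℤ) : MeasurePreserving (shiftBy k) μ μ :=
  ⟨measurable_shiftBy k, hμ.shift k⟩

lemma integral_shift (hμ : MartLaw p μ) (k : ℤ) {f : 𝒳 ι → ℝ}
    (hf : Measurable f) : ∫ x, f (shiftBy k x) ∂μ = ∫ x, f x ∂μ := by
  conv_rhs => rw [← hμ.shift k]
  rw [integral_map (measurable_shiftBy k).aemeasurable hf.aestronglyMeasurable]

lemma memLp_coord (hμ : MartLaw p μ) (k : ℤ) :
    MemLp (fun x : 𝒳 ι => x k) (ofReal p) μ := by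
  have := hμ.mom.comp_measurePreserving (hμ.measurePreserving k)
  refine this.ae_eq (ae_of_all _ fun x => ?_)
  simp [shiftBy]

lemma memLp_blockSum (hμ : MartLaw p μ) (s : ℤ) (n : ℕ) :
    MemLp (blockSum s n : 𝒳 ι → _) (ofReal p) μ :=
  memLp_finsetSum _ fun _ _ => hμ.memLp_coord _

lemma integrable_one_add (hμ : MartLaw p μ) (hp : 0 ≤ p)
    {A B : 𝒳 ι → ℰ ι}
    (hA : MemLp A (ofReal p) μ) (hB : MemLp B (ofReal p) μ) :
    Integrable (fun x => (1 + ‖A x‖ + ‖B x‖) ^ p) μ := by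
  have := hμ.prob
  have h : MemLp (fun x => 1 + ‖A x‖ + ‖B x‖) (ofReal p) μ :=
    ((memLp_const (1 : ℝ)).add hA.norm).add hB.norm
  refine (h.integrable_norm_rpow').congr (ae_of_all _ fun x => ?_)
  simp only [toReal_ofReal hp, norm_eq_abs]
  rw [abs_of_nonneg (by positivity)]

lemma integrable_of_le (hμ : MartLaw p μ) (hp : 0 ≤ p)
    {A B : 𝒳 ι → ℰ ι}
    (hA : MemLp A (ofReal p) μ) (hB : MemLp B (ofReal p) μ)
    {f : 𝒳 ι → ℝ} (hf : Measurable f) {C : ℝ}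
    (h : ∀ x, |f x| ≤ C * (1 + ‖A x‖ + ‖B x‖) ^ p) : Integrable f μ :=
  ((hμ.integrable_one_add hp hA hB).const_mul C).mono' hf.aestronglyMeasurable
    (ae_of_all _ fun x => by rw [norm_eq_abs]; exact h x)

lemma integral_norm_coord (hμ : MartLaw p μ) (hp : 0 ≤ p) (k : ℤ) :
    Integrable (fun x : 𝒳 ι => ‖x k‖ ^ p) μ ∧
    ∫ x, ‖x k‖ ^ p ∂μ = ∫ x, ‖x 0‖ ^ p ∂μ := by
  have := hμ.prob
  refine ⟨by simpa [toReal_ofReal hp] using (hμ.memLp_coord k).integrable_norm_rpow', ?_⟩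
  have hm : Measurable fun x : 𝒳 ι => ‖x 0‖ ^ p := by fun_prop
  have := hμ.integral_shift k hm
  simpa [shiftBy] using this

/-- The martingale property at an arbitrary time. -/
lemma mart_at (hμ : MartLaw p μ) (n : ℤ) (a : ι) {w : 𝒳 ι → ℝ}
    (hw : Measurable w) (hd : DependsOn w (Iic n))
    (hi : Integrable (fun x => w x * x (n + 1) a) μ) : ∫ x, w x * x (n + 1) a ∂μ = 0 := by
  have hm : Measurable fun x : 𝒳 ι => w x * x (n + 1) a :=
    hw.mul (measurable_coord _ _)
  have e : ∀ x : 𝒳 ι,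
      w (shiftBy (-n) x) * (shiftBy (-n) x) (n + 1) a = w (shiftBy (-n) x) * x 1 a := by
    intro x; simp [shiftBy]
  rw [← hμ.integral_shift (-n) hm]
  simp only [e]
  refine hμ.mart a _ (hw.comp (measurable_shiftBy _)) ?_ ?_
  · have := hd.comp_shiftBy (-n)
    simpa using this
  · have := ((hμ.measurePreserving (-n)).integrable_comp hm.aestronglyMeasurable).2 hi
    exact this.congr (ae_of_all _ e)

end MartLaw

end PathSpace

section Lindeberg

variable {ι : Type} [Fintype ι] [DecidableEq ι] {J : Type} [MeasurableSpace J]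
  {p c K : ℝ} {m : ℕ} {L : ℕ → ℝ} {h : ℕ → J → ℰ ι → ℝ}
  {G : ℕ → ι → J → ℰ ι → ℝ} {H : ℕ → ι → ι → J → ℰ ι → ℝ}

namespace JetSeq


lemma integrable_h (hJ : JetSeq p c K m L h G H) (hp : 0 ≤ p) {k : ℕ} (hk : k ≤ m) (j : J)
    (x : ℰ ι) : Integrable (fun z => h k j (x + z)) (stdG ι) := by
  have hm : Measurable fun z => h k j (x + z) :=
    (hJ.meas_h k hk).comp (measurable_const.prodMk (measurable_const_add x))
  have hi := (ExpGrowth.one_add_norm_rpow (ι := ι) hp).integrable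
  refine (hi.const_mul (K * (1 + ‖x‖) ^ p)).mono' hm.aestronglyMeasurable
    (ae_of_all _ fun z => ?_)
  rw [norm_eq_abs, mul_assoc, ← mul_rpow (by positivity) (by positivity)]
  refine (hJ.growth_h k hk j _).trans (mul_le_mul_of_nonneg_left ?_ hJ.K_nonneg)
  refine rpow_le_rpow (by positivity) ?_ hp
  nlinarith [norm_add_le x z, mul_nonneg (norm_nonneg x) (norm_nonneg z)]

/-- One backward heat step, up to second order. -/
lemma abs_heat_sub_le (hJ : JetSeq p c K m L h G H) (hp : 0 ≤ p) {k : ℕ} (hk : k < m) (j : J)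
    (x : ℰ ι) :
    |h k j x - h (k + 1) j x - (1 / 2) * ∑ a, ∑ b, H k a b j x * (1 : Matrix ι ι ℝ) a b|
      ≤ L k * gMom ι p := by
  have i0 : Integrable (fun z => h (k + 1) j (x + z) - h (k + 1) j x) (stdG ι) :=
    (hJ.integrable_h hp hk j x).sub (integrable_const _)
  have i1 : Integrable (fun z : ℰ ι => ∑ a, G k a j x * z a) (stdG ι) :=
    integrable_finsetSum _ fun a _ => (ExpGrowth.eval a).integrable.const_mul _
  have i2 : Integrable (fun z : ℰ ι => ∑ a, ∑ b, H k a b j x * (z a * z b))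
      (stdG ι) :=
    integrable_finsetSum _ fun a _ => integrable_finsetSum _ fun b _ =>
      ((ExpGrowth.eval a).mul (ExpGrowth.eval b)).integrable.const_mul _
  have i01 : Integrable (fun z => h (k + 1) j (x + z) - h (k + 1) j x - ∑ a, G k a j x * z a)
      (stdG ι) := i0.sub i1
  have e1 : ∫ z : ℰ ι, ∑ a, G k a j x * z a ∂(stdG ι) = 0 := by
    rw [integral_finsetSum _ fun a _ => (ExpGrowth.eval a).integrable.const_mul _]
    simp [integral_const_mul, integral_eval_stdG]
  have e2 : ∫ z : ℰ ι, ∑ a, ∑ b, H k a b j x * (z a * z b) ∂(stdG ι)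
      = ∑ a, ∑ b, H k a b j x * (1 : Matrix ι ι ℝ) a b := by
    rw [integral_finsetSum _ fun a _ => integrable_finsetSum _ fun b _ =>
      ((ExpGrowth.eval a).mul (ExpGrowth.eval b)).integrable.const_mul _]
    refine sum_congr rfl fun a _ => ?_
    rw [integral_finsetSum _ fun b _ =>
      ((ExpGrowth.eval a).mul (ExpGrowth.eval b)).integrable.const_mul _]
    refine sum_congr rfl fun b _ => ?_
    rw [integral_const_mul, integral_eval_mul_eval_stdG]
  have e : h k j x - h (k + 1) j x - (1 / 2) * ∑ a, ∑ b, H k a b j x * (1 : Matrix ι ι ℝ) a b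
      = ∫ z, (h (k + 1) j (x + z) - h (k + 1) j x - ∑ a, G k a j x * z a
        - (1 / 2) * ∑ a, ∑ b, H k a b j x * (z a * z b)) ∂(stdG ι) := by
    rw [integral_sub i01 (i2.const_mul _), integral_sub i0 i1,
      integral_sub (hJ.integrable_h hp hk j x) (integrable_const _), integral_const_mul, e1, e2,
      ← hJ.heat k hk]
    simp
  rw [e]
  refine abs_integral_le_integral_abs.trans ?_
  have hg := (ExpGrowth.one_add_norm_rpow (ι := ι) hp).integrable
  rw [gMom, ← integral_const_mul]
  refine integral_mono_of_nonneg (ae_of_all _ fun z => abs_nonneg _) (hg.const_mul _)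
    (ae_of_all _ fun z => ?_)
  refine (hJ.taylor k hk j x z).trans (mul_le_mul_of_nonneg_left ?_ (hJ.nonneg k hk))
  exact rpow_le_rpow (norm_nonneg _) (by linarith) hp

/-- One step of Lindeberg's replacement. -/
lemma abs_step_le (hJ : JetSeq p c K m L h G H) (hp : 0 ≤ p) {k : ℕ} (hk : k < m) (j : J)
    (x y : ℰ ι) :
    |h (k + 1) j (x + y) - h k j x - ∑ a, G k a j x * y a
      - (1 / 2) * ∑ a, ∑ b, H k a b j x * (y a * y b - (1 : Matrix ι ι ℝ) a b)|
      ≤ L k * (‖y‖ ^ p + gMom ι p) := by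
  have h1 := hJ.abs_heat_sub_le hp hk j x
  have h2 := hJ.taylor k hk j x y
  have e : (1 / 2) * ∑ a, ∑ b, H k a b j x * (y a * y b - (1 : Matrix ι ι ℝ) a b)
      = (1 / 2) * ∑ a, ∑ b, H k a b j x * (y a * y b)
        - (1 / 2) * ∑ a, ∑ b, H k a b j x * (1 : Matrix ι ι ℝ) a b := by
    simp only [mul_sub, sum_sub_distrib]
  rw [e]
  rw [abs_le] at h1 h2 ⊢
  constructor <;> linarith [h1.1, h1.2, h2.1, h2.2]

end JetSeq

variable {μ : Measure (𝒳 ι)}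

/-- A bound on the correlation between the centred products over `2 ^ r` steps and weights of the
past of controlled size. -/
def WeightBound (p c : ℝ) (μ : Measure (𝒳 ι)) (r : ℕ) (B : ℝ) : Prop :=
  ∀ w : 𝒳 ι → ℝ, Measurable w → DependsOn w (Iic 0) →
    (∀ x, |w x| ≤ ‖blockSum (-((2 ^ r : ℕ) : ℤ)) (2 ^ r) x‖ ^ (p - 2)
      + c * ((2 ^ r : ℕ) : ℝ) ^ ((p - 2) / 2)) →
    ∀ a b, |∫ x, w x * blockXi 0 (2 ^ r) a b x ∂μ| ≤ B

lemma WeightBound.nonneg [Nonempty ι] {r : ℕ} {B : ℝ} (hB : WeightBound p c μ r B)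
    (hc : 0 ≤ c) : 0 ≤ B := by
  obtain ⟨a⟩ := ‹Nonempty ι›
  refine (abs_nonneg _).trans (hB (fun _ => 0) measurable_const ?_ (fun x => ?_) a a)
  · intro x y _; rfl
  · rw [abs_zero]; positivity

lemma WeightBound.shift (hμ : MartLaw p μ) {r : ℕ} {B : ℝ} (hB : WeightBound p c μ r B) {ρ : ℝ}
    (hρ : 0 ≤ ρ) (n : ℤ) {w : 𝒳 ι → ℝ} (hw : Measurable w)
    (hd : DependsOn w (Iic (n + (2 ^ r : ℕ))))
    (hb : ∀ x, |w x| ≤ ρ * (‖blockSum n (2 ^ r) x‖ ^ (p - 2)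
      + c * ((2 ^ r : ℕ) : ℝ) ^ ((p - 2) / 2))) (a b : ι) :
    |∫ x, w x * blockXi (n + (2 ^ r : ℕ)) (2 ^ r) a b x ∂μ| ≤ ρ * B := by
  rcases hρ.eq_or_lt with rfl | hρ
  · have : ∀ x, w x = 0 := fun x => abs_nonpos_iff.1 (by simpa using hb x)
    simp [this]
  obtain ⟨s, hs⟩ : ∃ s : ℤ, s = n + (2 ^ r : ℕ) := ⟨_, rfl⟩
  have hm : Measurable fun x => w x * blockXi s (2 ^ r) a b x :=
    hw.mul (measurable_blockXi _ _ _ _)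
  rw [← hs, ← hμ.integral_shift (-s) hm]
  have h1 := hB (fun x => ρ⁻¹ * w (shiftBy (-s) x))
    ((hw.comp (measurable_shiftBy _)).const_mul _) ?_ (fun x => ?_) a b
  · have e : ∀ x, ρ⁻¹ * w (shiftBy (-s) x) * blockXi 0 (2 ^ r) a b x
        = ρ⁻¹ * (w (shiftBy (-s) x) * blockXi s (2 ^ r) a b (shiftBy (-s) x)) := by
      intro x; rw [blockXi_shiftBy]; ring_nf
    simp only [e] at h1
    rw [integral_const_mul, abs_mul, abs_of_nonneg (by positivity), inv_mul_le_iff₀ hρ] at h1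
    exact h1
  · intro x y hxy
    have := hd.comp_shiftBy (-s)
    exact congrArg (ρ⁻¹ * ·) (this fun i hi => hxy i (by simpa [hs] using hi))
  · rw [abs_mul, abs_of_nonneg (by positivity), inv_mul_le_iff₀ hρ]
    have := hb (shiftBy (-s) x)
    rwa [blockSum_shiftBy, show n + -s = -((2 ^ r : ℕ) : ℤ) by rw [hs]; ring] at this

lemma nonneg_of_abs_le_mul_rpow {X V : Type*} [Nonempty X] [NormedAddCommGroup V] {w : X → ℝ}
    {A : X → V} {C q : ℝ} (hb : ∀ x, |w x| ≤ C * (1 + ‖A x‖) ^ q) : 0 ≤ C :=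
  nonneg_of_mul_nonneg_left ((abs_nonneg _).trans (hb (Classical.arbitrary X))) (by positivity)

lemma MartLaw.integrable_mul_blockXi (hμ : MartLaw p μ) (hp : 2 ≤ p)
    {A : 𝒳 ι → ℰ ι} (hA : MemLp A (ofReal p) μ)
    {w : 𝒳 ι → ℝ} (hw : Measurable w) {C : ℝ}
    (hb : ∀ x, |w x| ≤ C * (1 + ‖A x‖) ^ (p - 2)) (s : ℤ) (n : ℕ) (a b : ι) :
    Integrable (fun x => w x * blockXi s n a b x) μ := by
  simp only [blockXi, mul_sum]
  refine integrable_finsetSum _ fun l _ => ?_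
  refine hμ.integrable_of_le (by linarith) hA (hμ.memLp_coord (s + l + 1)) (C := C)
    (hw.mul (((measurable_coord _ _).mul (measurable_coord _ _)).sub_const _)) fun x => ?_
  have h1 := PiLp.norm_apply_le (x (s + l + 1)) a
  have h2 := PiLp.norm_apply_le (x (s + l + 1)) b
  rw [norm_eq_abs] at h1 h2
  have h3 : |(1 : Matrix ι ι ℝ) a b| ≤ 1 := by
    rw [one_apply]; split_ifs <;> simp
  have h4 : |x (s + l + 1) a * x (s + l + 1) b - (1 : Matrix ι ι ℝ) a b|
      ≤ (1 + ‖A x‖ + ‖x (s + l + 1)‖) ^ (2 : ℝ) := by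
    refine (abs_sub _ _).trans ?_
    rw [abs_mul, rpow_two]
    have := mul_le_mul h1 h2 (abs_nonneg _) (norm_nonneg _)
    nlinarith [norm_nonneg (A x), norm_nonneg (x (s + l + 1)),
      mul_nonneg (norm_nonneg (A x)) (norm_nonneg (x (s + l + 1)))]
  have hC := nonneg_of_abs_le_mul_rpow hb
  have h5 : |w x| ≤ C * (1 + ‖A x‖ + ‖x (s + l + 1)‖) ^ (p - 2) :=
    (hb x).trans (mul_le_mul_of_nonneg_left (rpow_le_rpow (by positivity)
      (by linarith [norm_nonneg (x (s + l + 1))]) (by linarith)) hC)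
  rw [abs_mul]
  refine (mul_le_mul h5 h4 (abs_nonneg _) (by positivity)).trans (le_of_eq ?_)
  rw [mul_assoc, ← rpow_add (by positivity)]
  ring_nf

variable {i : 𝒳 ι → J}

lemma JetSeq.measurable_H_blockSum (hJ : JetSeq p c K m L h G H) (hi : Measurable i) {k : ℕ}
    (hk : k < m) (a b : ι) : Measurable fun x => H k a b (i x) (blockSum 0 k x) :=
  (hJ.meas_H k hk a b).comp (hi.prodMk (measurable_blockSum 0 k))

lemma JetSeq.integrable_H_mul_blockXi (hJ : JetSeq p c K m L h G H) (hμ : MartLaw p μ)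
    (hp : 2 ≤ p) (hi : Measurable i) {k : ℕ} (hk : k < m) (s : ℤ) (n : ℕ) (a b : ι) :
    Integrable (fun x => H k a b (i x) (blockSum 0 k x) * blockXi s n a b x) μ :=
  hμ.integrable_mul_blockXi hp (hμ.memLp_blockSum 0 k) (hJ.measurable_H_blockSum hi hk a b)
    (fun x => hJ.growth_H k hk a b (i x) _) s n a b

/-- The dyadic averaging of the second order terms. -/
lemma JetSeq.abs_sum_H_sub_le [Nonempty ι] (hJ : JetSeq p c K m L h G H) (hμ : MartLaw p μ)
    (hp : 2 ≤ p) (hc : 0 ≤ c) (hi : Measurable i) (hd : DependsOn i (Iic 0)) (a b : ι)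
    {B : ℕ → ℝ} (N : ℕ) (hB : ∀ r < N, WeightBound p c μ r (B r)) :
    ∀ s : ℕ, s + 2 ^ N ≤ m →
      |∑ k ∈ range (2 ^ N), ∫ x, H (s + k) a b (i x) (blockSum 0 (s + k) x)
          * blockXi (s + k : ℕ) 1 a b x ∂μ
        - ∫ x, H s a b (i x) (blockSum 0 s x) * blockXi s (2 ^ N) a b x ∂μ|
      ≤ (∑ r ∈ range N, B r / 2 ^ r) * ∑ k ∈ range (2 ^ N), L (s + k) := by
  induction N with
  | zero => intro s hs; simp
  | succ N IH =>
    intro s hs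
    have IH' := IH fun r hr => hB r (by omega)
    have hN : 2 ^ (N + 1) = 2 ^ N + 2 ^ N := by ring
    have hpos : 0 < 2 ^ N := by positivity
    obtain ⟨t, ht⟩ : ∃ t : ℕ, t = s + 2 ^ N := ⟨_, rfl⟩
    have h1 := IH' s (by omega)
    have h2 := IH' t (by omega)
    have hsm : s < m := by omega
    have htm : t < m := by omega
    have hBN := (hB N (by omega)).nonneg hc
    have hLt := hJ.nonneg t htm
    have h3 : |∫ x, (H t a b (i x) (blockSum 0 t x) - H s a b (i x) (blockSum 0 s x))
        * blockXi t (2 ^ N) a b x ∂μ| ≤ L t * B N := by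
      have := (hB N (by omega)).shift hμ hLt s
        (w := fun x => H t a b (i x) (blockSum 0 t x) - H s a b (i x) (blockSum 0 s x))
        ((hJ.measurable_H_blockSum hi htm a b).sub (hJ.measurable_H_blockSum hi hsm a b)) ?_
        (fun x => ?_) a b
      · rw [ht]; rw [ht] at this; exact_mod_cast this
      · intro x y hxy
        have e0 : i x = i y := hd fun l hl => hxy l (by
          simp only [mem_Iic] at hl ⊢; have : (0 : ℤ) ≤ (2 ^ N : ℕ) := by positivity
          omega)
        have e1 : blockSum 0 t x = blockSum 0 t y := dependsOn_blockSum 0 t fun l hl => hxy l (by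
          simp only [mem_Iic] at hl ⊢; rw [ht] at hl; push_cast at hl ⊢; linarith)
        have e2 : blockSum 0 s x = blockSum 0 s y := dependsOn_blockSum 0 s fun l hl => hxy l (by
          simp only [mem_Iic] at hl ⊢; have : (0 : ℤ) ≤ (2 ^ N : ℕ) := by positivity
          omega)
        simp only [e0, e1, e2]
      · have h4 := hJ.holder s t (by omega) htm a b (i x) (blockSum 0 t x) (blockSum 0 s x)
        have e1 : blockSum 0 t x - blockSum 0 s x = blockSum s (2 ^ N) x := by
          rw [ht, blockSum_add, zero_add, add_sub_cancel_left]
        rwa [e1, show t - s = 2 ^ N by omega] at h4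
    have h4 : L t * B N ≤ B N / 2 ^ N * ∑ k ∈ range (2 ^ (N + 1)), L (s + k) := by
      have h5 : (2 ^ N : ℝ) * L t ≤ ∑ k ∈ range (2 ^ N), L (t + k) := by
        have := Finset.card_nsmul_le_sum (range (2 ^ N)) (fun k => L (t + k)) (L t)
          fun k hk => hJ.mono t (t + k) (by omega) (by have := Finset.mem_range.1 hk; omega)
        simpa using this
      have h6 : 0 ≤ ∑ k ∈ range (2 ^ N), L (s + k) := sum_nonneg fun k hk =>
        hJ.nonneg _ (by have := Finset.mem_range.1 hk; omega)
      have h7 : ∑ k ∈ range (2 ^ (N + 1)), L (s + k)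
          = ∑ k ∈ range (2 ^ N), L (s + k) + ∑ k ∈ range (2 ^ N), L (t + k) := by
        rw [hN, sum_range_add, ht]; simp only [add_assoc]
      have h8 : (0 : ℝ) < 2 ^ N := by positivity
      rw [div_mul_eq_mul_div, le_div_iff₀ h8]
      nlinarith
    have e1 : ∫ x, H s a b (i x) (blockSum 0 s x) * blockXi s (2 ^ (N + 1)) a b x ∂μ
        = ∫ x, H s a b (i x) (blockSum 0 s x) * blockXi s (2 ^ N) a b x ∂μ
          + ∫ x, H s a b (i x) (blockSum 0 s x) * blockXi t (2 ^ N) a b x ∂μ := by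
      rw [← integral_add (hJ.integrable_H_mul_blockXi hμ hp hi hsm _ _ a b)
        (hJ.integrable_H_mul_blockXi hμ hp hi hsm _ _ a b)]
      refine integral_congr_ae (ae_of_all _ fun x => ?_)
      simp only [hN, blockXi_add, ht, Nat.cast_add, mul_add]
    have e2 : ∫ x, (H t a b (i x) (blockSum 0 t x) - H s a b (i x) (blockSum 0 s x))
          * blockXi t (2 ^ N) a b x ∂μ
        = ∫ x, H t a b (i x) (blockSum 0 t x) * blockXi t (2 ^ N) a b x ∂μ
          - ∫ x, H s a b (i x) (blockSum 0 s x) * blockXi t (2 ^ N) a b x ∂μ := by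
      rw [← integral_sub (hJ.integrable_H_mul_blockXi hμ hp hi htm _ _ a b)
        (hJ.integrable_H_mul_blockXi hμ hp hi hsm _ _ a b)]
      simp only [sub_mul]
    have e3 : ∀ F : ℕ → ℝ, ∑ k ∈ range (2 ^ (N + 1)), F (s + k)
        = ∑ k ∈ range (2 ^ N), F (s + k) + ∑ k ∈ range (2 ^ N), F (t + k) := by
      intro F; rw [hN, sum_range_add, ht]; simp only [add_assoc]
    rw [e3 fun k => ∫ x, H k a b (i x) (blockSum 0 k x) * blockXi (k : ℕ) 1 a b x ∂μ, e1,
      sum_range_succ, add_mul]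
    rw [e2] at h3
    have h9 := h3.trans h4
    have h10 := e3 L
    rw [h10] at h9 ⊢
    rw [mul_add (∑ r ∈ range N, B r / 2 ^ r)]
    rw [abs_le] at h1 h2 h9 ⊢
    constructor <;> linarith [h1.1, h1.2, h2.1, h2.2, h9.1, h9.2]

lemma JetSeq.integrable_h_blockSum (hJ : JetSeq p c K m L h G H) (hμ : MartLaw p μ)
    (hp : 0 ≤ p) (hi : Measurable i) {k : ℕ} (hk : k ≤ m) (n : ℕ) :
    Integrable (fun x => h k (i x) (blockSum 0 n x)) μ := by
  refine hμ.integrable_of_le hp (hμ.memLp_blockSum 0 n) (MemLp.zero (ε := ℰ ι))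
    (C := K) ((hJ.meas_h k hk).comp (hi.prodMk (measurable_blockSum 0 n))) fun x => ?_
  simpa using hJ.growth_h k hk (i x) (blockSum 0 n x)

/-- One step of Lindeberg's replacement, in mean. -/
lemma JetSeq.abs_integral_step_le (hJ : JetSeq p c K m L h G H) (hμ : MartLaw p μ)
    (hp : 2 ≤ p) (hi : Measurable i) (hd : DependsOn i (Iic 0)) {k : ℕ} (hk : k < m) :
    |∫ x, h (k + 1) (i x) (blockSum 0 (k + 1) x) ∂μ - ∫ x, h k (i x) (blockSum 0 k x) ∂μ
      - (1 / 2) * ∑ a, ∑ b, ∫ x, H k a b (i x) (blockSum 0 k x) * blockXi k 1 a b x ∂μ|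
      ≤ L k * (∫ x, ‖x 0‖ ^ p ∂μ + gMom ι p) := by
  have := hμ.prob
  have i0 := hJ.integrable_h_blockSum hμ (by linarith) hi hk (k + 1)
  have i1 := hJ.integrable_h_blockSum hμ (by linarith) hi hk.le k
  have iG : ∀ a, Integrable (fun x => G k a (i x) (blockSum 0 k x) * x (k + 1) a) μ := by
    intro a
    refine hμ.integrable_of_le (by linarith) (hμ.memLp_blockSum 0 k) (hμ.memLp_coord (k + 1))
      (C := K) (((hJ.meas_G k hk a).comp (hi.prodMk (measurable_blockSum 0 k))).mul
        (measurable_coord _ _)) fun x => ?_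
    have h1 := hJ.growth_G k hk a (i x) (blockSum 0 k x)
    have h2 := PiLp.norm_apply_le (x (k + 1)) a
    rw [norm_eq_abs] at h2
    have hK := hJ.K_nonneg
    have h3 : K * (1 + ‖blockSum 0 k x‖) ^ (p - 1)
        ≤ K * (1 + ‖blockSum 0 k x‖ + ‖x (k + 1)‖) ^ (p - 1) :=
      mul_le_mul_of_nonneg_left (rpow_le_rpow (by positivity)
        (by linarith [norm_nonneg (x (k + 1))]) (by linarith)) hK
    have h4 : |x (k + 1) a| ≤ 1 + ‖blockSum 0 k x‖ + ‖x (k + 1)‖ := by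
      linarith [norm_nonneg (blockSum 0 k x)]
    rw [abs_mul]
    refine (mul_le_mul (h1.trans h3) h4 (abs_nonneg _) (by positivity)).trans (le_of_eq ?_)
    rw [mul_assoc, ← rpow_add_one (by positivity), sub_add_cancel]
  have i2 : Integrable (fun x => ∑ a, G k a (i x) (blockSum 0 k x) * x (k + 1) a) μ :=
    integrable_finsetSum _ fun a _ => iG a
  have i3 : Integrable (fun x => ∑ a, ∑ b, H k a b (i x) (blockSum 0 k x) * blockXi k 1 a b x) μ :=
    integrable_finsetSum _ fun a _ => integrable_finsetSum _ fun b _ =>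
      hJ.integrable_H_mul_blockXi hμ hp hi hk k 1 a b
  have e2 : ∫ x, ∑ a, G k a (i x) (blockSum 0 k x) * x (k + 1) a ∂μ = 0 := by
    rw [integral_finsetSum _ fun a _ => iG a]
    refine sum_eq_zero fun a _ => hμ.mart_at k a
      ((hJ.meas_G k hk a).comp (hi.prodMk (measurable_blockSum 0 k))) ?_ (iG a)
    intro x y hxy
    have e0 : i x = i y := hd fun l hl => hxy l (by
      simp only [mem_Iic] at hl ⊢; omega)
    have e1 : blockSum 0 k x = blockSum 0 k y := dependsOn_blockSum 0 k fun l hl => hxy l (by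
      simp only [mem_Iic] at hl ⊢; omega)
    simp only [e0, e1]
  have e3 : ∫ x, ∑ a, ∑ b, H k a b (i x) (blockSum 0 k x) * blockXi k 1 a b x ∂μ
      = ∑ a, ∑ b, ∫ x, H k a b (i x) (blockSum 0 k x) * blockXi k 1 a b x ∂μ := by
    rw [integral_finsetSum _ fun a _ => integrable_finsetSum _ fun b _ =>
      hJ.integrable_H_mul_blockXi hμ hp hi hk k 1 a b]
    exact sum_congr rfl fun a _ => integral_finsetSum _ fun b _ =>
      hJ.integrable_H_mul_blockXi hμ hp hi hk k 1 a b
  have i01 : Integrable (fun x => h (k + 1) (i x) (blockSum 0 (k + 1) x)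
      - h k (i x) (blockSum 0 k x)) μ := i0.sub i1
  have i012 : Integrable (fun x => h (k + 1) (i x) (blockSum 0 (k + 1) x)
      - h k (i x) (blockSum 0 k x) - ∑ a, G k a (i x) (blockSum 0 k x) * x (k + 1) a) μ :=
    i01.sub i2
  have e : ∫ x, h (k + 1) (i x) (blockSum 0 (k + 1) x) ∂μ - ∫ x, h k (i x) (blockSum 0 k x) ∂μ
      - (1 / 2) * ∑ a, ∑ b, ∫ x, H k a b (i x) (blockSum 0 k x) * blockXi k 1 a b x ∂μ
      = ∫ x, (h (k + 1) (i x) (blockSum 0 (k + 1) x) - h k (i x) (blockSum 0 k x)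
        - ∑ a, G k a (i x) (blockSum 0 k x) * x (k + 1) a
        - (1 / 2) * ∑ a, ∑ b, H k a b (i x) (blockSum 0 k x) * blockXi k 1 a b x) ∂μ := by
    rw [integral_sub i012 (i3.const_mul _), integral_sub i01 i2, integral_sub i0 i1,
      integral_const_mul, e2, e3, sub_zero]
  obtain ⟨hn, hn'⟩ := hμ.integral_norm_coord (by linarith) (k + 1)
  rw [e]
  refine abs_integral_le_integral_abs.trans ?_
  refine (integral_mono_of_nonneg (ae_of_all _ fun x => abs_nonneg _)
    ((hn.add (integrable_const (gMom ι p))).const_mul (L k)) (ae_of_all _ fun x => ?_)).trans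
    (le_of_eq ?_)
  · have h1 := hJ.abs_step_le (by linarith) hk (i x) (blockSum 0 k x) (x (k + 1))
    have e1 : blockSum 0 (k + 1) x = blockSum 0 k x + x (k + 1) := by
      rw [blockSum_succ, zero_add]
    have e2 : ∀ a b, blockXi k 1 a b x
        = x (k + 1) a * x (k + 1) b - (1 : Matrix ι ι ℝ) a b := by
      intro a b; simp [blockXi]
    simp only [e1, e2]
    exact h1
  · rw [integral_const_mul, integral_add' hn (integrable_const _), hn']
    simp

/-- Lindeberg's replacement over `2 ^ N` steps. -/
theorem JetSeq.lindeberg [Nonempty ι] {N : ℕ} (hJ : JetSeq p c K (2 ^ N) L h G H)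
    (hμ : MartLaw p μ) (hp : 2 ≤ p) (hc : 0 ≤ c) (hi : Measurable i)
    (hd : DependsOn i (Iic 0)) {B : ℕ → ℝ} (hB : ∀ r < N, WeightBound p c μ r (B r)) :
    |∫ x, h (2 ^ N) (i x) (blockSum 0 (2 ^ N) x) ∂μ - ∫ x, h 0 (i x) 0 ∂μ
      - (1 / 2) * ∑ a, ∑ b, ∫ x, H 0 a b (i x) 0 * blockXi 0 (2 ^ N) a b x ∂μ|
      ≤ (∫ x, ‖x 0‖ ^ p ∂μ + gMom ι p
        + Fintype.card ι ^ 2 * ∑ r ∈ range N, B r / 2 ^ r)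
        * ∑ k ∈ range (2 ^ N), L k := by
  have h1 : ∀ a b, |∑ k ∈ range (2 ^ N), ∫ x, H k a b (i x) (blockSum 0 k x)
          * blockXi (k : ℕ) 1 a b x ∂μ
        - ∫ x, H 0 a b (i x) 0 * blockXi 0 (2 ^ N) a b x ∂μ|
      ≤ (∑ r ∈ range N, B r / 2 ^ r) * ∑ k ∈ range (2 ^ N), L k := by
    intro a b
    have := hJ.abs_sum_H_sub_le hμ hp hc hi hd a b N hB 0 (by simp)
    simpa using this
  have h2 := abs_sum_le_sum_abs (fun k => ∫ x, h (k + 1) (i x) (blockSum 0 (k + 1) x) ∂μ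
      - ∫ x, h k (i x) (blockSum 0 k x) ∂μ
      - (1 / 2) * ∑ a, ∑ b, ∫ x, H k a b (i x) (blockSum 0 k x) * blockXi (k : ℕ) 1 a b x ∂μ)
      (range (2 ^ N))
  have h3 := h2.trans (sum_le_sum fun k hk =>
    hJ.abs_integral_step_le hμ hp hi hd (Finset.mem_range.1 hk))
  rw [sum_sub_distrib, Finset.sum_range_sub
    (fun k => ∫ x, h k (i x) (blockSum 0 k x) ∂μ), ← sum_mul, ← mul_sum,
    Finset.sum_comm] at h3
  have h4 : |∑ a, ∑ b, (∑ k ∈ range (2 ^ N), ∫ x, H k a b (i x) (blockSum 0 k x)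
          * blockXi (k : ℕ) 1 a b x ∂μ
        - ∫ x, H 0 a b (i x) 0 * blockXi 0 (2 ^ N) a b x ∂μ)|
      ≤ Fintype.card ι ^ 2 * ((∑ r ∈ range N, B r / 2 ^ r)
        * ∑ k ∈ range (2 ^ N), L k) := by
    refine (abs_sum_le_sum_abs _ _).trans ?_
    refine (sum_le_sum fun a _ => (abs_sum_le_sum_abs _ _).trans
      (sum_le_sum fun b _ => h1 a b)).trans (le_of_eq ?_)
    simp; ring
  have e : ∑ a, ∑ b, (∑ k ∈ range (2 ^ N), ∫ x, H k a b (i x) (blockSum 0 k x)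
          * blockXi (k : ℕ) 1 a b x ∂μ
        - ∫ x, H 0 a b (i x) 0 * blockXi 0 (2 ^ N) a b x ∂μ)
      = ∑ a, ∑ k ∈ range (2 ^ N), ∑ b, ∫ x, H k a b (i x) (blockSum 0 k x)
          * blockXi (k : ℕ) 1 a b x ∂μ
        - ∑ a, ∑ b, ∫ x, H 0 a b (i x) 0 * blockXi 0 (2 ^ N) a b x ∂μ := by
    simp only [sum_sub_distrib]
    congr 1
    exact sum_congr rfl fun a _ => Finset.sum_comm
  rw [e] at h4
  simp only [blockSum_zero] at h3
  have h5 : 0 ≤ |∑ a, ∑ k ∈ range (2 ^ N), ∑ b, ∫ x, H k a b (i x) (blockSum 0 k x)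
          * blockXi (k : ℕ) 1 a b x ∂μ
        - ∑ a, ∑ b, ∫ x, H 0 a b (i x) 0 * blockXi 0 (2 ^ N) a b x ∂μ| := abs_nonneg _
  have h6 := h5.trans h4
  rw [abs_le] at h3 h4 ⊢
  constructor <;> linarith [h3.1, h3.2, h4.1, h4.2]

lemma MartLaw.integral_blockXi (hμ : MartLaw p μ) (hp : 2 ≤ p) (s : ℤ) (n : ℕ) (a b : ι) :
    Integrable (blockXi s n a b) μ ∧ ∫ x, blockXi s n a b x ∂μ = 0 := by
  have := hμ.prob
  have key : ∀ s n, Integrable (blockXi s n a b) μ := fun s n => by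
    simpa using hμ.integrable_mul_blockXi hp (hμ.memLp_coord 0) (w := fun _ => 1) (C := 1)
      measurable_const (fun x => by
        rw [abs_one, one_mul]
        exact one_le_rpow (by linarith [norm_nonneg (x 0)]) (by linarith)) s n a b
  have h1 : ∀ s, ∫ x, blockXi s 1 a b x ∂μ = 0 := by
    intro s
    have hs := hμ.integral_shift (-(s + 1)) (measurable_blockXi s 1 a b)
    rw [← hs]
    have e : ∀ x : 𝒳 ι, blockXi s 1 a b (shiftBy (-(s + 1)) x)
        = blockXi (-1) 1 a b x := by
      intro x; rw [blockXi_shiftBy]; congr 1; ring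
    have i1 := key (-1) 1
    have e2 : ∀ x : 𝒳 ι, blockXi (-1) 1 a b x
        = x 0 a * x 0 b - (1 : Matrix ι ι ℝ) a b := by
      intro x; simp [blockXi]
    have i2 : Integrable (fun x : 𝒳 ι => x 0 a * x 0 b) μ := by
      refine (i1.add (integrable_const ((1 : Matrix ι ι ℝ) a b))).congr (ae_of_all _ fun x => ?_)
      simp only [Pi.add_apply, e2, sub_add_cancel]
    simp only [e, e2]
    rw [integral_sub i2 (integrable_const _), hμ.cov]
    simp
  refine ⟨key s n, ?_⟩
  induction n with
  | zero => simp [blockXi]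
  | succ n IH =>
    simp only [blockXi_add]
    rw [integral_add (key _ _) (key _ _), IH, h1, zero_add]

/-- Comparison of truncated moments of the partial sums with the Gaussian ones. -/
theorem MartLaw.integral_posPow_le [Nonempty ι] (hμ : MartLaw p μ) (hp : 2 < p) (hp3 : p ≤ 3)
    {N : ℕ} {B : ℕ → ℝ} (hB : ∀ r < N, WeightBound p (gMom ι (p - 2)) μ r (B r))
    (a : ι) {s l : ℝ} (hs : |s| = 1) (hl : 0 ≤ l) :
    ∫ x, posPow p (s * blockSum 0 (2 ^ N) x a - l) ∂μ
      ≤ ∫ z, posPow p (s * (√((2 ^ N : ℕ) : ℝ) * z a) - l) ∂(stdG ι)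
        + (∫ x, ‖x 0‖ ^ p ∂μ + gMom ι p
          + Fintype.card ι ^ 2 * ∑ r ∈ range N, B r / 2 ^ r) * (p * (p - 1) * 2 ^ N) := by
  have := hμ.prob
  obtain ⟨K, h, G, H, hJ, h1, h2⟩ := exists_jetSeq_posPow hp hp3 a hs hl (2 ^ N)
  have := hJ.lindeberg hμ hp.le (gMom_nonneg _) (i := fun _ => ()) measurable_const
    (fun _ _ _ => rfl) hB
  simp only [h1, h2, integral_const_mul, (hμ.integral_blockXi hp.le _ _ _ _).2, mul_zero,
    Finset.sum_const_zero, sub_zero, integral_const, probReal_univ, smul_eq_mul,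
    sum_const, card_range, nsmul_eq_mul] at this
  have h3 := (abs_le.1 this).2
  push_cast at h3 ⊢
  rw [mul_comm (p * (p - 1))]
  linarith

end Lindeberg

section Decay

variable {ι : Type} [Fintype ι] [DecidableEq ι] {p : ℝ} {μ : Measure (𝒳 ι)}

/-- Pairs of random variables bounding a weight: the first one has a tail of Gaussian type for the
scale `ρ`, the second one is bounded by `K₂` in `L^(p/(p-2))`. -/
structure WeightSplit (p : ℝ) (μ : Measure (𝒳 ι)) (ρ K₁ K₂ : ℝ)
    (w₁ w₂ : 𝒳 ι → ℝ) : Prop where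
  meas₁ : Measurable w₁
  meas₂ : Measurable w₂
  nonneg₁ : ∀ x, 0 ≤ w₁ x
  nonneg₂ : ∀ x, 0 ≤ w₂ x
  tail : ∀ σ, 0 ≤ σ → μ.real {x | ρ * σ ^ (p - 2) ≤ w₁ x} ≤ K₁ * exp (-2 * σ ^ 2)
  int₂ : Integrable (fun x => w₂ x ^ (p / (p - 2))) μ
  mom₂ : ∫ x, w₂ x ^ (p / (p - 2)) ∂μ ≤ K₂ ^ (p / (p - 2))
  nonneg : 0 ≤ ρ ∧ 0 ≤ K₁ ∧ 0 ≤ K₂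

/-- The decay of the correlations between the past and the products of coordinates of the partial
sums. -/
def DecayBound (p : ℝ) (μ : Measure (𝒳 ι)) (α β : ℕ → ℝ) : Prop :=
  ∀ n : ℕ, 1 ≤ n → ∀ (w w₁ w₂ : 𝒳 ι → ℝ) (ρ K₁ K₂ : ℝ),
    Measurable w → DependsOn w (Iic 0) → WeightSplit p μ ρ K₁ K₂ w₁ w₂ →
    (∀ x, |w x| ≤ w₁ x + w₂ x) →
    (∃ A : 𝒳 ι → ℰ ι, MemLp A (ofReal p) μ ∧
      ∃ C : ℝ, ∀ x, |w x| ≤ C * (1 + ‖A x‖) ^ (p - 2)) →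
    ∀ a b, |∫ x, w x * (blockSum 0 n x a * blockSum 0 n x b - n * (1 : Matrix ι ι ℝ) a b) ∂μ|
      ≤ K₁ * ρ * α n + K₂ * β n

lemma MartLaw.integral_mul_eq_zero_of_le (hμ : MartLaw p μ) (hp : 2 ≤ p)
    {A : 𝒳 ι → ℰ ι} (hA : MemLp A (ofReal p) μ)
    {w : 𝒳 ι → ℝ} (hw : Measurable w) (hd : DependsOn w (Iic 0)) {C : ℝ}
    (hb : ∀ x, |w x| ≤ C * (1 + ‖A x‖) ^ (p - 2)) (n : ℕ) (a b : ι) :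
    Integrable (fun x => w x * blockSum 0 n x a * x (n + 1) b) μ ∧
    ∫ x, w x * blockSum 0 n x a * x (n + 1) b ∂μ = 0 := by
  have hi : Integrable (fun x => w x * blockSum 0 n x a * x (n + 1) b) μ := by
    have hB : MemLp (fun x => ‖blockSum 0 n x‖ + ‖x (n + 1)‖) (ofReal p) μ :=
      (hμ.memLp_blockSum 0 n).norm.add (hμ.memLp_coord (n + 1)).norm
    have hAB : MemLp (fun x => 1 + ‖A x‖ + (‖blockSum 0 n x‖ + ‖x (n + 1)‖))
        (ofReal p) μ := by
      have := hμ.prob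
      exact ((memLp_const (1 : ℝ)).add hA.norm).add hB
    have := hμ.prob
    have hq := hAB.integrable_norm_rpow'
    rw [toReal_ofReal (by linarith)] at hq
    have hmb : Measurable fun x : 𝒳 ι => blockSum 0 n x a :=
      (by fun_prop : Measurable fun y : ℰ ι => y a).comp (measurable_blockSum 0 n)
    refine (hq.const_mul C).mono' ((hw.mul hmb).mul (measurable_coord _ _)).aestronglyMeasurable
      (ae_of_all _ fun x => ?_)
    have h1 := PiLp.norm_apply_le (blockSum 0 n x) a
    have h2 := PiLp.norm_apply_le (x (n + 1)) b
    rw [norm_eq_abs] at h1 h2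
    obtain ⟨Z, hZ⟩ : ∃ Z, Z = 1 + ‖A x‖ + (‖blockSum 0 n x‖ + ‖x (n + 1)‖) := ⟨_, rfl⟩
    have hZ0 : 0 < Z := by rw [hZ]; positivity
    have hC := nonneg_of_abs_le_mul_rpow hb
    have h3 : |w x| ≤ C * Z ^ (p - 2) := (hb x).trans (mul_le_mul_of_nonneg_left
      (rpow_le_rpow (by positivity)
        (by rw [hZ]; linarith [norm_nonneg (blockSum 0 n x), norm_nonneg (x (n + 1))])
        (by linarith)) hC)
    have h4 : |blockSum 0 n x a| ≤ Z := by
      linarith [norm_nonneg (A x), norm_nonneg (x (n + 1))]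
    have h5 : |x (n + 1) b| ≤ Z := by
      linarith [norm_nonneg (A x), norm_nonneg (blockSum 0 n x)]
    rw [← hZ, norm_eq_abs, norm_eq_abs, abs_mul, abs_mul, abs_of_pos hZ0]
    refine (mul_le_mul (mul_le_mul h3 h4 (abs_nonneg _) (by positivity)) h5 (abs_nonneg _)
      (by positivity)).trans (le_of_eq ?_)
    rw [mul_assoc C, mul_assoc C, ← rpow_add_one hZ0.ne', ← rpow_add_one hZ0.ne']
    ring_nf
  refine ⟨hi, hμ.mart_at n b (hw.mul ((by fun_prop : Measurable fun y : ℰ ι =>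
    y a).comp (measurable_blockSum 0 n))) ?_ hi⟩
  intro x y hxy
  have e0 : w x = w y := hd fun l hl => hxy l (by
    simp only [mem_Iic] at hl ⊢; omega)
  have e1 : blockSum 0 n x = blockSum 0 n y := dependsOn_blockSum 0 n fun l hl => hxy l (by
    simp only [mem_Iic] at hl ⊢; omega)
  simp only [e0, e1]

/-- Orthogonality reduces products of partial sums to sums of products. -/
lemma MartLaw.integral_mul_blockSum_sub (hμ : MartLaw p μ) (hp : 2 ≤ p)
    {A : 𝒳 ι → ℰ ι} (hA : MemLp A (ofReal p) μ)
    {w : 𝒳 ι → ℝ} (hw : Measurable w) (hd : DependsOn w (Iic 0)) {C : ℝ}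
    (hb : ∀ x, |w x| ≤ C * (1 + ‖A x‖) ^ (p - 2)) (a b : ι) (n : ℕ) :
    Integrable (fun x => w x * (blockSum 0 n x a * blockSum 0 n x b
      - n * (1 : Matrix ι ι ℝ) a b)) μ ∧
    ∫ x, w x * (blockSum 0 n x a * blockSum 0 n x b - n * (1 : Matrix ι ι ℝ) a b) ∂μ
      = ∫ x, w x * blockXi 0 n a b x ∂μ := by
  induction n with
  | zero => simp [blockXi]
  | succ n IH =>
    obtain ⟨i1, e1⟩ := IH
    obtain ⟨i2, e2⟩ := hμ.integral_mul_eq_zero_of_le hp hA hw hd hb n a b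
    obtain ⟨i3, e3⟩ := hμ.integral_mul_eq_zero_of_le hp hA hw hd hb n b a
    have i4 := hμ.integrable_mul_blockXi hp hA hw hb n 1 a b
    have i5 := hμ.integrable_mul_blockXi hp hA hw hb 0 n a b
    have e : ∀ x, w x * (blockSum 0 (n + 1) x a * blockSum 0 (n + 1) x b
        - (n + 1 : ℕ) * (1 : Matrix ι ι ℝ) a b)
        = w x * (blockSum 0 n x a * blockSum 0 n x b - n * (1 : Matrix ι ι ℝ) a b)
          + (w x * blockSum 0 n x a * x (n + 1) b + w x * blockSum 0 n x b * x (n + 1) a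
          + w x * blockXi n 1 a b x) := by
      intro x
      simp only [blockSum_succ, blockXi, Finset.sum_range_one, PiLp.add_apply, zero_add,
        Nat.cast_zero, add_zero]
      push_cast
      ring
    have i6 : Integrable (fun x => w x * blockSum 0 n x a * x (n + 1) b
        + w x * blockSum 0 n x b * x (n + 1) a) μ := i2.add i3
    have i7 : Integrable (fun x => w x * blockSum 0 n x a * x (n + 1) b
        + w x * blockSum 0 n x b * x (n + 1) a + w x * blockXi n 1 a b x) μ := i6.add i4
    simp only [e]
    refine ⟨i1.add i7, ?_⟩
    rw [integral_add i1 i7, integral_add i6 i4, integral_add i2 i3, e1, e2, e3]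
    simp only [blockXi_add, mul_add, zero_add]
    rw [integral_add i5 i4]

lemma WeightSplit.shift (hμ : MartLaw p μ) {ρ K₁ K₂ : ℝ} {w₁ w₂ : 𝒳 ι → ℝ}
    (h : WeightSplit p μ ρ K₁ K₂ w₁ w₂) (k : ℤ) :
    WeightSplit p μ ρ K₁ K₂ (fun x => w₁ (shiftBy k x)) (fun x => w₂ (shiftBy k x)) := by
  have hm := hμ.measurePreserving k
  refine ⟨h.meas₁.comp (measurable_shiftBy k), h.meas₂.comp (measurable_shiftBy k),
    fun x => h.nonneg₁ _, fun x => h.nonneg₂ _, fun σ hσ => ?_, ?_, ?_, h.nonneg⟩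
  · have hs : MeasurableSet {x | ρ * σ ^ (p - 2) ≤ w₁ x} :=
      measurableSet_le measurable_const h.meas₁
    have := hm.measureReal_preimage hs.nullMeasurableSet
    exact (le_of_eq this).trans (h.tail σ hσ)
  · exact (hm.integrable_comp (h.meas₂.pow_const _).aestronglyMeasurable).2 h.int₂
  · rw [hμ.integral_shift k (f := fun x => w₂ x ^ (p / (p - 2))) (h.meas₂.pow_const _)]
    exact h.mom₂

lemma DecayBound.average (hμ : MartLaw p μ) (hp : 2 ≤ p) {α β : ℕ → ℝ} (hα : ∀ n, 0 ≤ α n)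
    (hβ : ∀ n, 0 ≤ β n) (hD : DecayBound p μ α β) {ρ K₁ K₂ : ℝ}
    {w w₁ w₂ : 𝒳 ι → ℝ} (hw : Measurable w) (hd : DependsOn w (Iic 0))
    (hs : WeightSplit p μ ρ K₁ K₂ w₁ w₂) (hle : ∀ x, |w x| ≤ w₁ x + w₂ x)
    {A : 𝒳 ι → ℰ ι} (hA : MemLp A (ofReal p) μ)
    {C : ℝ} (hb : ∀ x, |w x| ≤ C * (1 + ‖A x‖) ^ (p - 2)) (n : ℕ) (a b : ι) :
    n * |∫ x, w x * blockXi 0 n a b x ∂μ|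
      ≤ 2 * ∑ j ∈ range n, (K₁ * ρ * α (j + 1) + K₂ * β (j + 1)) := by
  obtain ⟨hρ, hK₁, hK₂⟩ := hs.nonneg
  obtain ⟨Z, hZ⟩ : ∃ Z : ℕ → ℝ, ∀ j, Z j = K₁ * ρ * α j + K₂ * β j := ⟨_, fun _ => rfl⟩
  have hZ0 : ∀ j, 0 ≤ Z j := fun j => by
    rw [hZ]; have := hα j; have := hβ j; positivity
  obtain ⟨Y, hY⟩ : ∃ Y : ℕ → ℝ, ∀ j, Y j = if j = 0 then 0 else Z j := ⟨_, fun _ => rfl⟩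
  have h1 : ∀ j, |∫ x, w x * blockXi 0 (j + 1) a b x ∂μ| ≤ Z (j + 1) := by
    intro j
    rw [← (hμ.integral_mul_blockSum_sub hp hA hw hd hb a b (j + 1)).2, hZ]
    exact hD (j + 1) (by omega) w w₁ w₂ ρ K₁ K₂ hw hd hs hle ⟨A, hA, C, hb⟩ a b
  have h2 : ∀ (s : ℕ) k, |∫ x, w x * blockXi s k a b x ∂μ| ≤ Y k := by
    intro s k
    rcases Nat.eq_zero_or_pos k with rfl | hk
    · simp [blockXi, hY]
    rw [hY, if_neg hk.ne', hZ]
    have hm : Measurable fun x => w x * blockXi s k a b x := hw.mul (measurable_blockXi _ _ _ _)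
    rw [← hμ.integral_shift (-s) hm]
    simp only [blockXi_shiftBy, add_neg_cancel]
    have hA' : MemLp (fun x => A (shiftBy (-s) x)) (ofReal p) μ :=
      hA.comp_measurePreserving (hμ.measurePreserving (-s))
    have hw' : Measurable fun x => w (shiftBy (-s) x) := hw.comp (measurable_shiftBy (-s))
    have hd' : DependsOn (fun x => w (shiftBy (-s) x)) (Iic 0) :=
      (hd.comp_shiftBy (-s)).mono (Set.Iic_subset_Iic.2 (by omega))
    have hb' : ∀ x, |w (shiftBy (-s) x)| ≤ C * (1 + ‖A (shiftBy (-s) x)‖) ^ (p - 2) :=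
      fun x => hb _
    rw [← (hμ.integral_mul_blockSum_sub hp hA' hw' hd' hb' a b k).2]
    exact hD k hk _ _ _ ρ K₁ K₂ hw' hd' (hs.shift hμ (-s)) (fun x => hle _) ⟨_, hA', C, hb'⟩ a b
  have h3 : ∀ j ∈ range n, |∫ x, w x * blockXi 0 n a b x ∂μ|
      ≤ Z (j + 1) + Y (n - 1 - j) := by
    intro j hj
    have hj' := Finset.mem_range.1 hj
    have e : n = (j + 1) + (n - 1 - j) := by omega
    have e1 : ∫ x, w x * blockXi 0 n a b x ∂μ = ∫ x, w x * blockXi 0 (j + 1) a b x ∂μ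
        + ∫ x, w x * blockXi (j + 1 : ℕ) (n - 1 - j) a b x ∂μ := by
      rw [← integral_add (hμ.integrable_mul_blockXi hp hA hw hb _ _ a b)
        (hμ.integrable_mul_blockXi hp hA hw hb _ _ a b)]
      refine integral_congr_ae (ae_of_all _ fun x => ?_)
      conv_lhs => rw [e]
      simp only [blockXi_add, zero_add, mul_add]
    rw [e1]
    exact (abs_add_le _ _).trans (add_le_add (h1 j) (h2 _ _))
  have h5 : ∑ j ∈ range n, Y (n - 1 - j) ≤ ∑ j ∈ range n, Z (j + 1) := by
    rw [Finset.sum_range_reflect Y n]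
    rcases n with _ | n
    · simp
    · rw [Finset.sum_range_succ', sum_range_succ]
      have e : ∀ k ∈ range n, Y (k + 1) = Z (k + 1) := fun k _ => by rw [hY]; simp
      rw [sum_congr rfl e, hY 0, if_pos rfl]
      linarith [hZ0 (n + 1)]
  have h6 := sum_le_sum h3
  rw [sum_const, card_range, nsmul_eq_mul, sum_add_distrib] at h6
  simp only [← hZ]
  linarith

end Decay

section GaussianPosPow

variable {ι : Type} [Fintype ι] {p : ℝ}

lemma posPow_le_exp (hp : 2 < p) (hp3 : p ≤ 3) (u : ℝ) {t : ℝ} (ht : 1 ≤ t) :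
    posPow p u ≤ 8 * exp (t * u) := by
  rcases le_total u 0 with hu | hu
  · rw [posPow, max_eq_right hu, zero_rpow (by linarith)]
    positivity
  · rw [posPow, max_eq_left hu]
    have h1 : u ^ p ≤ u ^ 2 + u ^ 3 := by
      rcases le_total u 1 with h | h
      · have : u ^ p ≤ u ^ (2 : ℝ) := by
          rcases hu.eq_or_lt with rfl | hu
          · rw [zero_rpow (by linarith)]; positivity
          · exact Real.rpow_le_rpow_of_exponent_ge hu h hp.le
        rw [rpow_two] at this
        have : 0 ≤ u ^ 3 := by positivity
        linarith
      · have : u ^ p ≤ u ^ (3 : ℝ) := rpow_le_rpow_of_exponent_le h hp3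
        rw [show (3 : ℝ) = (3 : ℕ) by norm_num, rpow_natCast] at this
        have : 0 ≤ u ^ 2 := by positivity
        linarith
    have h2 : u ^ 2 ≤ 2 * exp u := by
      have := Real.pow_div_factorial_le_exp u hu 2
      simp [Nat.factorial] at this
      linarith
    have h3 : u ^ 3 ≤ 6 * exp u := by
      have := Real.pow_div_factorial_le_exp u hu 3
      simp [Nat.factorial] at this
      linarith
    have h4 : exp u ≤ exp (t * u) := Real.exp_le_exp.2 (by nlinarith)
    linarith

lemma integral_exp_eval_stdG (a : ι) (t : ℝ) :
    Integrable (fun z : ℰ ι => exp (t * z a)) (stdG ι) ∧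
    ∫ z, exp (t * z a) ∂(stdG ι) = exp (t ^ 2 / 2) := by
  have h := mgf_gaussianReal (map_eval_stdG a) t
  simp only [mgf, zero_mul, NNReal.coe_one, one_mul, zero_add] at h
  refine ⟨?_, h⟩
  by_contra hi
  rw [integral_undef hi] at h
  exact (exp_pos _).ne h

/-- Truncated moments of a standard Gaussian variable. -/
lemma integral_posPow_stdG_le (hp : 2 < p) (hp3 : p ≤ 3) (a : ι) {s l : ℝ} (hs : |s| = 1)
    (hl : 0 ≤ l) :
    ∫ z, posPow p (s * z a - l) ∂(stdG ι) ≤ 16 * exp (-l ^ 2 / 2) := by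
  obtain ⟨hi, he⟩ := integral_exp_eval_stdG a ((l + 1) * s)
  have hs2 : s ^ 2 = 1 := by rw [← sq_abs, hs, one_pow]
  refine (integral_mono_of_nonneg (ae_of_all _ fun z => posPow_nonneg _ _)
    (hi.const_mul (8 * exp (-(l + 1) * l))) (ae_of_all _ fun z => ?_)).trans ?_
  · refine (posPow_le_exp hp hp3 _ (by linarith : 1 ≤ l + 1)).trans (le_of_eq ?_)
    simp only
    rw [mul_assoc, ← exp_add]
    ring_nf
  · rw [integral_const_mul, he, mul_assoc, ← exp_add, mul_pow, hs2]
    have e : -(l + 1) * l + (l + 1) ^ 2 * 1 / 2 = 1 / 2 + -l ^ 2 / 2 := by ring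
    have h2 : exp (1 / 2) ≤ 2 := by
      have h := Real.exp_bound_div_one_sub_of_interval (x := 1 / 2) (by norm_num) (by norm_num)
      norm_num at h ⊢
      linarith
    rw [e, exp_add]
    nlinarith [exp_pos (-l ^ 2 / 2)]

lemma posPow_mul_const {c : ℝ} (hc : 0 ≤ c) (t : ℝ) : posPow p (c * t) = c ^ p * posPow p t := by
  rw [posPow, posPow, ← mul_rpow hc (le_max_right _ _), mul_max_of_nonneg _ _ hc, mul_zero]

lemma integral_posPow_scaled_le (hp : 2 < p) (hp3 : p ≤ 3) (a : ι) {s l σ : ℝ} (hs : |s| = 1)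
    (hl : 0 ≤ l) (hσ : 0 ≤ σ) :
    ∫ z, posPow p (s * (σ * z a) - l * σ) ∂(stdG ι)
      ≤ σ ^ p * (16 * exp (-l ^ 2 / 2)) := by
  have e : ∀ z : ℰ ι, posPow p (s * (σ * z a) - l * σ)
      = σ ^ p * posPow p (s * z a - l) := fun z => by
    rw [← posPow_mul_const hσ]; congr 1; ring
  simp only [e]
  rw [integral_const_mul]
  exact mul_le_mul_of_nonneg_left (integral_posPow_stdG_le hp hp3 a hs hl) (by positivity)

end GaussianPosPow

section TruncatedMoments

variable {ι : Type} [Fintype ι] [DecidableEq ι] {p : ℝ} {μ : Measure (𝒳 ι)}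

/-- The truncated moments of the partial sums over `n` steps are at most the Gaussian ones, up to
an error `D * n`. -/
def TruncBound (p : ℝ) (μ : Measure (𝒳 ι)) (n : ℕ) (D : ℝ) : Prop :=
  ∀ (a : ι) (s l : ℝ), |s| = 1 → 0 ≤ l →
    ∫ x, posPow p (s * blockSum 0 n x a - l) ∂μ
      ≤ ∫ z, posPow p (s * (√(n : ℝ) * z a) - l) ∂(stdG ι) + D * n

lemma posPow_abs_sub_le (q u l : ℝ) :
    posPow q (|u| - l) ≤ posPow q (1 * u - l) + posPow q (-1 * u - l) := by
  have h1 := posPow_nonneg q (1 * u - l)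
  have h2 := posPow_nonneg q (-1 * u - l)
  rcases abs_choice u with h | h <;> rw [h]
  · rw [one_mul] at *; linarith
  · rw [neg_one_mul] at *; linarith

lemma measurable_blockSum_apply (t : ℤ) (n : ℕ) (a : ι) :
    Measurable fun x : 𝒳 ι => blockSum t n x a :=
  (by fun_prop : Measurable fun y : ℰ ι => y a).comp (measurable_blockSum t n)

lemma MartLaw.integrable_posPow (hμ : MartLaw p μ) (hp : 0 ≤ p) (t : ℤ) (n : ℕ) (a : ι)
    {s l : ℝ} (hs : |s| ≤ 1) (hl : 0 ≤ l) :
    Integrable (fun x : 𝒳 ι => posPow p (s * blockSum t n x a - l)) μ := by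
  refine hμ.integrable_of_le hp (hμ.memLp_blockSum t n) (hμ.memLp_blockSum t n) (C := 1)
    ((continuous_posPow hp).measurable.comp
      (((measurable_blockSum_apply t n a).const_mul s).sub_const l)) fun x => ?_
  rw [abs_of_nonneg (posPow_nonneg _ _), one_mul]
  have h1 := PiLp.norm_apply_le (blockSum t n x) a
  rw [norm_eq_abs] at h1
  have h2 : s * blockSum t n x a ≤ |blockSum t n x a| := (le_abs_self _).trans (by
    rw [abs_mul]; exact mul_le_of_le_one_left (abs_nonneg _) hs)
  exact rpow_le_rpow (le_max_right _ _) (max_le (by linarith [norm_nonneg (blockSum t n x)])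
    (by positivity)) hp

lemma MartLaw.integrable_posPow_abs (hμ : MartLaw p μ) (hp : 0 ≤ p) (t : ℤ) (n : ℕ) (a : ι)
    {l : ℝ} (hl : 0 ≤ l) : Integrable (fun x : 𝒳 ι => posPow p (|blockSum t n x a| - l)) μ := by
  refine ((hμ.integrable_posPow hp t n a (s := 1) (by simp) hl).add
    (hμ.integrable_posPow hp t n a (s := -1) (by simp) hl)).mono'
    ((continuous_posPow hp).measurable.comp
      ((measurable_blockSum_apply t n a).abs.sub_const l)).aestronglyMeasurable
    (ae_of_all _ fun x => ?_)
  rw [norm_eq_abs, abs_of_nonneg (posPow_nonneg _ _)]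
  exact posPow_abs_sub_le _ _ _

lemma TruncBound.integral_abs_le (hμ : MartLaw p μ) (hp : 2 < p) (hp3 : p ≤ 3) {n : ℕ} {D : ℝ}
    (hT : TruncBound p μ n D) (t : ℤ) (a : ι) {l : ℝ} (hl : 0 ≤ l) :
    ∫ x, posPow p (|blockSum t n x a| - l * √n) ∂μ
      ≤ √n ^ p * (32 * exp (-l ^ 2 / 2)) + 2 * D * n := by
  have hp0 : 0 ≤ p := by linarith
  have hl' : 0 ≤ l * √(n : ℝ) := by positivity
  have hm : Measurable fun x : 𝒳 ι =>
      posPow p (|blockSum t n x a| - l * √n) := (continuous_posPow hp0).measurable.comp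
      ((measurable_blockSum_apply t n a).abs.sub_const _)
  rw [← hμ.integral_shift (-t) hm]
  simp only [blockSum_shiftBy, add_neg_cancel]
  have i1 := hμ.integrable_posPow hp0 0 n a (s := 1) (by simp) hl'
  have i2 := hμ.integrable_posPow hp0 0 n a (s := -1) (by simp) hl'
  have h1 := hT a 1 _ (by simp) hl'
  have h2 := hT a (-1) _ (by simp) hl'
  have h3 := integral_posPow_scaled_le (ι := ι) hp hp3 a (s := 1) (by simp) hl
    (sqrt_nonneg (n : ℝ))
  have h4 := integral_posPow_scaled_le (ι := ι) hp hp3 a (s := -1) (by simp) hl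
    (sqrt_nonneg (n : ℝ))
  have h5 := integral_mono_of_nonneg (ae_of_all μ fun x => posPow_nonneg p _) (i1.add i2)
    (ae_of_all _ fun x => posPow_abs_sub_le p (blockSum 0 n x a) (l * √(n : ℝ)))
  rw [integral_add' i1 i2] at h5
  linarith

lemma natCast_two_pow_le_exp (r : ℕ) : ((2 ^ r : ℕ) : ℝ) ≤ exp (2 * r) := by
  have : (2 : ℝ) ≤ exp 2 := by linarith [add_one_le_exp (2 : ℝ)]
  rw [mul_comm, Real.exp_nat_mul]
  push_cast
  exact pow_le_pow_left₀ (by norm_num) this r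

lemma exp_le_natCast_two_pow (r : ℕ) : exp (r / 2) ≤ ((2 ^ r : ℕ) : ℝ) := by
  have h : exp (1 / 2) ≤ 2 := by
    have h := Real.exp_bound_div_one_sub_of_interval (x := 1 / 2) (by norm_num) (by norm_num)
    norm_num at h ⊢
    linarith
  rw [show (r : ℝ) / 2 = r * (1 / 2) by ring, Real.exp_nat_mul]
  push_cast
  exact pow_le_pow_left₀ (exp_pos _).le h r

lemma sqrt_rpow_eq {n : ℝ} (hn : 0 ≤ n) (q : ℝ) : √n ^ q = n ^ (q / 2) := by
  rw [sqrt_eq_rpow, ← rpow_mul hn]; ring_nf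

lemma sqrt_rpow_mul_exp_le {p : ℝ} (hp : p ≤ 4) (r : ℕ) :
    √((2 ^ r : ℕ) : ℝ) ^ p * exp (-(2 * √(r : ℝ)) ^ 2 / 2) ≤ (2 ^ r : ℕ) := by
  have h1 : (1 : ℝ) ≤ (2 ^ r : ℕ) := by exact_mod_cast Nat.one_le_two_pow
  rw [show -(2 * √(r : ℝ)) ^ 2 / 2 = -(2 * r) by rw [mul_pow, sq_sqrt (by positivity)]; ring,
    Real.exp_neg, ← div_eq_mul_inv, div_le_iff₀ (exp_pos _), sqrt_rpow_eq (by linarith)]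
  refine (rpow_le_rpow_of_exponent_le h1 (by linarith : p / 2 ≤ 2)).trans ?_
  rw [rpow_two, sq]
  exact mul_le_mul_of_nonneg_left (natCast_two_pow_le_exp r) (by linarith)

lemma TruncBound.integral_excess_le (hμ : MartLaw p μ) (hp : 2 < p) (hp3 : p ≤ 3) {r : ℕ}
    {D : ℝ} (hD : 1 ≤ D) (hT : TruncBound p μ (2 ^ r) D) (t : ℤ) (a : ι) :
    ∫ x, posPow p (|blockSum t (2 ^ r) x a| - 2 * √r * √((2 ^ r : ℕ) : ℝ)) ∂μ
      ≤ 34 * D * (2 ^ r : ℕ) := by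
  refine (hT.integral_abs_le hμ hp hp3 t a (by positivity)).trans ?_
  obtain ⟨n, hn⟩ : ∃ n : ℝ, n = ((2 ^ r : ℕ) : ℝ) := ⟨_, rfl⟩
  have hn1 : 1 ≤ n := by rw [hn]; exact_mod_cast Nat.one_le_two_pow
  rw [← hn]
  have h4 := hn ▸ sqrt_rpow_mul_exp_le (p := p) (by linarith) r
  nlinarith

lemma TruncBound.tail_le (hμ : MartLaw p μ) (hp : 2 < p) (hp3 : p ≤ 3) {r : ℕ}
    {D : ℝ} (hD : 1 ≤ D) (hT : TruncBound p μ (2 ^ r) D) (t : ℤ) (a : ι) {s : ℝ} (hs : 1 ≤ s)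
    (hsr : s ≤ 4 * √r) :
    μ.real {x : 𝒳 ι | s * √((2 ^ r : ℕ) : ℝ) ≤ |blockSum t (2 ^ r) x a|}
      ≤ 272 * D * exp (-((p - 2) / 64) * s ^ 2) := by
  have := hμ.prob
  have h1 := hT.integral_abs_le hμ hp hp3 t a (l := s / 2) (by positivity)
  have h2 := mul_meas_ge_le_integral_of_nonneg (ae_of_all _ fun x => posPow_nonneg p _)
    (hμ.integrable_posPow_abs (by linarith) t (2 ^ r) a
      (by positivity : 0 ≤ s / 2 * √((2 ^ r : ℕ) : ℝ))) ((s / 2 * √((2 ^ r : ℕ) : ℝ)) ^ p)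
  obtain ⟨n, hn⟩ : ∃ n : ℝ, n = ((2 ^ r : ℕ) : ℝ) := ⟨_, rfl⟩
  have hn1 : 1 ≤ n := by rw [hn]; exact_mod_cast Nat.one_le_two_pow
  rw [← hn] at h1 h2 ⊢
  obtain ⟨X, hX⟩ : ∃ X, X = exp (-((p - 2) / 64) * s ^ 2) := ⟨_, rfl⟩
  have hs0 : 0 ≤ s / 2 * √n := by positivity
  have h3 : μ.real {x : 𝒳 ι | s * √n ≤ |blockSum t (2 ^ r) x a|}
      ≤ μ.real {x : 𝒳 ι | (s / 2 * √n) ^ p ≤ posPow p (|blockSum t (2 ^ r) x a| - s / 2 * √n)} := by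
    refine measureReal_mono fun x hx => ?_
    simp only [Set.mem_ofPred_eq] at hx ⊢
    refine rpow_le_rpow hs0 (le_max_of_le_left ?_) (by linarith)
    linarith
  have h4 : exp (-(s / 2) ^ 2 / 2) ≤ X := by
    rw [hX]; apply Real.exp_le_exp.2; nlinarith [sq_nonneg s]
  have h5 : n ≤ √n ^ p * X := by
    have e1 : √n ^ p = n * n ^ ((p - 2) / 2) := by
      rw [sqrt_rpow_eq (by linarith), ← rpow_one_add' (by linarith) (by linarith)]
      ring_nf
    have e2 : s ^ 2 ≤ 16 * r := by
      have := pow_le_pow_left₀ (by linarith) hsr 2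
      rw [mul_pow, sq_sqrt (by positivity)] at this
      linarith
    have e3 : exp ((p - 2) / 64 * s ^ 2) ≤ n ^ ((p - 2) / 2) := by
      refine le_trans ?_ (rpow_le_rpow (exp_pos _).le
        (hn ▸ exp_le_natCast_two_pow r) (by linarith : 0 ≤ (p - 2) / 2))
      rw [← Real.exp_mul]
      apply Real.exp_le_exp.2
      nlinarith
    have e4 : exp ((p - 2) / 64 * s ^ 2) * X = 1 := by
      rw [hX, ← exp_add]; simp
    have hX0 : 0 < X := hX ▸ exp_pos _
    rw [e1]
    have := mul_le_mul_of_nonneg_right e3 hX0.le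
    nlinarith
  have h6 : 1 / 8 ≤ (s / 2) ^ p := by
    have e1 : ((1 : ℝ) / 2) ^ p ≤ (s / 2) ^ p :=
      rpow_le_rpow (by norm_num) (by linarith) (by linarith)
    have e2 : ((1 : ℝ) / 2) ^ (3 : ℝ) ≤ (1 / 2) ^ p :=
      Real.rpow_le_rpow_of_exponent_ge (by norm_num) (by norm_num) hp3
    have e3 : ((1 : ℝ) / 2) ^ (3 : ℝ) = 1 / 8 := by
      rw [show (3 : ℝ) = (3 : ℕ) by norm_num, rpow_natCast]; norm_num
    linarith
  have hsp : 0 < √n ^ p := by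
    have : 0 < √n := Real.sqrt_pos.2 (by linarith)
    positivity
  have h7 := (mul_le_mul_of_nonneg_left h3 (by positivity : 0 ≤ (s / 2 * √n) ^ p)).trans
    (h2.trans h1)
  rw [mul_rpow (by positivity) (sqrt_nonneg _)] at h7
  rw [← hX]
  have h8 : √n ^ p * (1 / 8 * μ.real {x : 𝒳 ι | s * √n ≤ |blockSum t (2 ^ r) x a|})
      ≤ √n ^ p * (34 * D * X) := by
    have e1 : √n ^ p * (1 / 8 * μ.real {x : 𝒳 ι | s * √n ≤ |blockSum t (2 ^ r) x a|})
        ≤ (s / 2) ^ p * √n ^ p * μ.real {x : 𝒳 ι | s * √n ≤ |blockSum t (2 ^ r) x a|} := by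
      rw [mul_comm ((s / 2) ^ p), mul_assoc]
      exact mul_le_mul_of_nonneg_left (mul_le_mul_of_nonneg_right h6 measureReal_nonneg) hsp.le
    have e2 : √n ^ p * (32 * exp (-(s / 2) ^ 2 / 2)) ≤ √n ^ p * (32 * D * X) := by
      refine mul_le_mul_of_nonneg_left ?_ hsp.le
      have : 0 < X := hX ▸ exp_pos _
      nlinarith
    have e3 := mul_le_mul_of_nonneg_left h5 (by linarith : 0 ≤ 2 * D)
    linarith
  have := le_of_mul_le_mul_left h8 hsp
  linarith

end TruncatedMoments

section WeightRecursion

variable {ι : Type} [Fintype ι] [DecidableEq ι] {p : ℝ} {μ : Measure (𝒳 ι)}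

lemma norm_rpow_le_sum {q : ℝ} (hq : 0 < q) (hq1 : q ≤ 1) (y : ℰ ι) :
    ‖y‖ ^ q ≤ ∑ a, |y a| ^ q := by
  have h1 : ‖y‖ ≤ ∑ a, |y a| := by
    rw [EuclideanSpace.norm_eq, sqrt_le_left (sum_nonneg fun _ _ => abs_nonneg _)]
    simp only [norm_eq_abs]
    exact Finset.sum_sq_le_sq_sum_of_nonneg fun _ _ => abs_nonneg _
  have h2 : ∀ s : Finset ι, (∑ a ∈ s, |y a|) ^ q ≤ ∑ a ∈ s, |y a| ^ q := by
    intro s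
    induction s using Finset.induction_on with
    | empty => simp [zero_rpow hq.ne']
    | insert a s ha IH =>
      rw [sum_insert ha, sum_insert ha]
      refine (Real.rpow_add_le_add_rpow (abs_nonneg _)
        (sum_nonneg fun _ _ => abs_nonneg _) hq.le hq1).trans ?_
      linarith
  exact (rpow_le_rpow (norm_nonneg _) h1 hq.le).trans (h2 _)

lemma rpow_le_min_add_posPow {q : ℝ} (hq : 0 < q) (hq1 : q ≤ 1) {u θ : ℝ} (hu : 0 ≤ u)
    (hθ : 0 ≤ θ) : u ^ q ≤ min u (2 * θ) ^ q + 2 * posPow q (u - θ) := by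
  rcases le_total u (2 * θ) with h | h
  · rw [min_eq_left h]
    linarith [posPow_nonneg q (u - θ)]
  · have h1 : (u / 2) ^ q ≤ posPow q (u - θ) :=
      rpow_le_rpow (by positivity) (le_max_of_le_left (by linarith)) hq.le
    have h2 : (1 / 2 : ℝ) ≤ (1 / 2) ^ q := by
      have := Real.rpow_le_rpow_of_exponent_ge (by norm_num : (0 : ℝ) < 1 / 2) (by norm_num) hq1
      rwa [rpow_one] at this
    have h3 : (u / 2) ^ q = u ^ q * (1 / 2) ^ q := by
      rw [← mul_rpow hu (by norm_num)]; ring_nf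
    have h4 : 0 ≤ u ^ q := by positivity
    have h5 : 0 ≤ min u (2 * θ) ^ q := by positivity
    nlinarith

lemma posPow_rpow {q p : ℝ} (hq : 0 < q) (t : ℝ) : posPow q t ^ (p / q) = posPow p t := by
  rw [posPow, posPow, ← rpow_mul (le_max_right _ _)]
  congr 1; field_simp

set_option maxHeartbeats 1000000 in
lemma TruncBound.exists_weightSplit [Nonempty ι] (hμ : MartLaw p μ) (hp : 2 < p) (hp3 : p ≤ 3)
    {c : ℝ} (hc : 0 ≤ c) {r : ℕ} {D : ℝ} (hD : 1 ≤ D) (hT : TruncBound p μ (2 ^ r) D) (t : ℤ) :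
    ∃ w₁ w₂, WeightSplit p μ ((c + Fintype.card ι * √(128 / (p - 2)) ^ (p - 2))
        * √((2 ^ r : ℕ) : ℝ) ^ (p - 2))
      ((8 + 272 * Fintype.card ι) * D)
      (68 * Fintype.card ι * D * ((2 ^ r : ℕ) : ℝ) ^ ((p - 2) / p)) w₁ w₂ ∧
      ∀ x, ‖blockSum t (2 ^ r) x‖ ^ (p - 2) + c * √((2 ^ r : ℕ) : ℝ) ^ (p - 2)
        ≤ w₁ x + w₂ x := by
  have := hμ.prob
  obtain ⟨n, hn⟩ : ∃ n : ℝ, n = ((2 ^ r : ℕ) : ℝ) := ⟨_, rfl⟩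
  have hn1 : 1 ≤ n := by rw [hn]; exact_mod_cast Nat.one_le_two_pow
  obtain ⟨q, hq⟩ : ∃ q, q = p - 2 := ⟨_, rfl⟩
  have hq0 : 0 < q := by linarith
  have hq1 : q ≤ 1 := by linarith
  obtain ⟨d, hd⟩ : ∃ d : ℝ, d = Fintype.card ι := ⟨_, rfl⟩
  have hd1 : 1 ≤ d := by rw [hd]; exact_mod_cast Fintype.card_pos
  obtain ⟨A, hA⟩ : ∃ A, A = √(128 / q) := ⟨_, rfl⟩
  have hA2 : A ^ 2 = 128 / q := by rw [hA, sq_sqrt (by positivity)]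
  have hA1 : 1 ≤ A := by
    rw [hA, Real.one_le_sqrt, le_div_iff₀ hq0]; linarith
  obtain ⟨θ, hθ⟩ : ∃ θ, θ = 2 * √(r : ℝ) * √n := ⟨_, rfl⟩
  have hθ0 : 0 ≤ θ := by rw [hθ]; positivity
  have hsn : 0 < √n := Real.sqrt_pos.2 (by linarith)
  have hm := fun a : ι => measurable_blockSum_apply t (2 ^ r) a
  have hcard : (Finset.univ : Finset ι).card = Fintype.card ι := card_univ
  rw [← hn, ← hq, ← hd, ← hA]
  have hpow : ∀ x : 𝒳 ι,
      (∑ a, 2 * posPow q (|blockSum t (2 ^ r) x a| - θ)) ^ (p / q)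
        ≤ d ^ (p / q - 1) * ∑ a, 2 ^ (p / q) * posPow p (|blockSum t (2 ^ r) x a| - θ) := by
    intro x
    have h1 : 1 ≤ p / q := by rw [le_div_iff₀ hq0]; linarith
    have h2 := Real.rpow_sum_le_const_mul_sum_rpow_of_nonneg Finset.univ h1
      (f := fun a => 2 * posPow q (|blockSum t (2 ^ r) x a| - θ))
      (fun a _ => mul_nonneg two_pos.le (posPow_nonneg _ _))
    rw [hcard, ← hd] at h2
    refine h2.trans (le_of_eq ?_)
    congr 1
    refine sum_congr rfl fun a _ => ?_
    rw [mul_rpow two_pos.le (posPow_nonneg _ _), posPow_rpow hq0]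
  have hi : Integrable (fun x : 𝒳 ι => d ^ (p / q - 1)
      * ∑ a, 2 ^ (p / q) * posPow p (|blockSum t (2 ^ r) x a| - θ)) μ :=
    (integrable_finsetSum _ fun a _ =>
      (hμ.integrable_posPow_abs (by linarith) t (2 ^ r) a hθ0).const_mul _).const_mul _
  have hm2 : Measurable fun x : 𝒳 ι =>
      ∑ a, 2 * posPow q (|blockSum t (2 ^ r) x a| - θ) :=
    Finset.measurable_sum _ fun a _ => ((continuous_posPow hq0.le).measurable.comp
      ((hm a).abs.sub_const θ)).const_mul 2
  have hw2 : ∀ x : 𝒳 ι,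
      0 ≤ ∑ a, 2 * posPow q (|blockSum t (2 ^ r) x a| - θ) := fun x =>
    sum_nonneg fun a _ => mul_nonneg two_pos.le (posPow_nonneg _ _)
  refine ⟨fun x => (∑ a, min |blockSum t (2 ^ r) x a| (2 * θ) ^ q) + c * √n ^ q,
    fun x => ∑ a, 2 * posPow q (|blockSum t (2 ^ r) x a| - θ), ⟨?_, hm2, ?_, hw2, ?_, ?_, ?_, ?_⟩,
    ?_⟩
  · exact (Finset.measurable_sum _ fun a _ =>
      ((hm a).abs.min measurable_const).pow_const q).add_const _
  · intro x
    exact add_nonneg (sum_nonneg fun a _ => by positivity) (by positivity)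
  · intro σ hσ
    rw [← hq]
    rcases lt_or_ge σ 1 with h1 | h1
    · refine measureReal_le_one.trans ?_
      have e1 : exp 2 ≤ 8 := by
        have := Real.exp_one_lt_d9
        rw [show (2 : ℝ) = 1 + 1 by norm_num, exp_add]
        nlinarith [exp_pos 1]
      have e2 : exp (-2) ≤ exp (-2 * σ ^ 2) := Real.exp_le_exp.2 (by nlinarith)
      have e3 : exp (-2) * exp 2 = 1 := by rw [← exp_add]; simp
      have e4 := exp_pos (-2)
      have e5 : 8 ≤ (8 + 272 * d) * D := by nlinarith
      nlinarith
    · have hsub : {x : 𝒳 ι | (c + d * A ^ q) * √n ^ q * σ ^ q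
          ≤ (∑ a, min |blockSum t (2 ^ r) x a| (2 * θ) ^ q) + c * √n ^ q}
          ⊆ ⋃ a, {x | A * σ * √n ≤ |blockSum t (2 ^ r) x a| ∧ A * σ ≤ 4 * √r} := by
        intro x hx
        simp only [Set.mem_ofPred_eq, Set.mem_iUnion] at hx ⊢
        by_contra hcon
        push Not at hcon
        have e0 : ∀ a, min |blockSum t (2 ^ r) x a| (2 * θ) < A * σ * √n := by
          intro a
          rcases lt_or_ge |blockSum t (2 ^ r) x a| (A * σ * √n) with h | h
          · exact min_lt_of_left_lt h
          · refine min_lt_of_right_lt ?_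
            have := mul_lt_mul_of_pos_right (hcon a h) hsn
            rw [hθ]; linarith
        have e1 : ∑ a, min |blockSum t (2 ^ r) x a| (2 * θ) ^ q
            < ∑ _a : ι, (A * σ * √n) ^ q :=
          Finset.sum_lt_sum_of_nonempty Finset.univ_nonempty fun a _ =>
            Real.rpow_lt_rpow (le_min (abs_nonneg _) (by positivity)) (e0 a) hq0
        rw [sum_const, hcard, nsmul_eq_mul, ← hd,
          mul_rpow (by positivity) hsn.le, mul_rpow (by positivity) hσ] at e1
        have e2 : 1 ≤ σ ^ q := one_le_rpow h1 hq0.le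
        have e3 : 0 ≤ c * √n ^ q := by positivity
        nlinarith
      refine (measureReal_mono hsub).trans ?_
      rcases lt_or_ge (4 * √(r : ℝ)) (A * σ) with h2 | h2
      · have : (⋃ a : ι, {x : 𝒳 ι |
            A * σ * √n ≤ |blockSum t (2 ^ r) x a| ∧ A * σ ≤ 4 * √r}) = ∅ := by
          simp only [Set.iUnion_eq_empty]
          intro a
          ext x
          simp only [Set.mem_ofPred_eq, Set.mem_empty_iff_false, iff_false, not_and]
          intro _; linarith
        rw [this, measureReal_empty]
        positivity
      · refine (measureReal_iUnion_fintype_le _).trans ?_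
        have e1 : ∀ a : ι, μ.real {x : 𝒳 ι |
            A * σ * √n ≤ |blockSum t (2 ^ r) x a| ∧ A * σ ≤ 4 * √r}
            ≤ 272 * D * exp (-2 * σ ^ 2) := by
          intro a
          have h3 := hT.tail_le hμ hp hp3 hD t a (s := A * σ) (by nlinarith) h2
          rw [← hn, ← hq, mul_pow, hA2] at h3
          refine (measureReal_mono fun x hx => hx.1).trans (h3.trans (le_of_eq ?_))
          congr 2; field_simp; norm_num
        refine (sum_le_sum fun a _ => e1 a).trans ?_
        rw [sum_const, hcard, nsmul_eq_mul, ← hd]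
        have : 0 < exp (-2 * σ ^ 2) := exp_pos _
        nlinarith [mul_pos (by linarith : 0 < D) this]
  · rw [← hq]
    refine hi.mono' (hm2.pow_const _).aestronglyMeasurable (ae_of_all _ fun x => ?_)
    rw [norm_eq_abs, abs_of_nonneg (rpow_nonneg (hw2 x) _)]
    exact hpow x
  · rw [← hq]
    refine (integral_mono_of_nonneg (ae_of_all _ fun x => rpow_nonneg (hw2 x) _) hi
      (ae_of_all _ hpow)).trans ?_
    rw [integral_const_mul, integral_finsetSum _ fun a _ =>
      (hμ.integrable_posPow_abs (by linarith) t (2 ^ r) a hθ0).const_mul _]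
    have e1 : ∀ a : ι, ∫ x, 2 ^ (p / q) * posPow p (|blockSum t (2 ^ r) x a| - θ) ∂μ
        ≤ 2 ^ (p / q) * (34 * D * n) := by
      intro a
      rw [integral_const_mul, hθ, hn]
      exact mul_le_mul_of_nonneg_left (hT.integral_excess_le hμ hp hp3 hD t a) (by positivity)
    have e2 := sum_le_sum fun a (_ : a ∈ Finset.univ) => e1 a
    rw [sum_const, hcard, nsmul_eq_mul, ← hd] at e2
    refine (mul_le_mul_of_nonneg_left e2 (by positivity)).trans ?_
    have hpq : 1 ≤ p / q := by rw [le_div_iff₀ hq0]; linarith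
    rw [show 68 * d * D * n ^ (q / p) = 2 * (d * ((34 * D) * n ^ (q / p))) by ring,
      mul_rpow two_pos.le (by positivity), mul_rpow (by positivity) (by positivity),
      mul_rpow (by positivity) (by positivity), ← rpow_mul (by positivity) (q / p),
      show q / p * (p / q) = 1 by field_simp, rpow_one, Real.rpow_sub_one (by positivity)]
    have e3 : 34 * D ≤ (34 * D) ^ (p / q) := Real.self_le_rpow_of_one_le (by linarith) hpq
    have e4 : 0 ≤ 2 ^ (p / q) * (d ^ (p / q) * n) := by positivity
    have e5 : d ^ (p / q) / d * (d * (2 ^ (p / q) * (34 * D * n)))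
        = 2 ^ (p / q) * (d ^ (p / q) * n) * (34 * D) := by field_simp
    rw [e5]
    refine (mul_le_mul_of_nonneg_left e3 e4).trans (le_of_eq (by ring))
  · exact ⟨by positivity, by positivity, by positivity⟩
  · intro x
    have h1 := norm_rpow_le_sum hq0 hq1 (blockSum t (2 ^ r) x)
    have h2 := sum_le_sum fun a (_ : a ∈ (Finset.univ : Finset ι)) =>
      rpow_le_min_add_posPow hq0 hq1 (abs_nonneg (blockSum t (2 ^ r) x a)) hθ0
    rw [sum_add_distrib] at h2
    linarith

/-- The averages of the correlation bounds over dyadic blocks. -/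
def dyadicRate (p : ℝ) (α β : ℕ → ℝ) (r : ℕ) : ℝ :=
  ((2 ^ r : ℕ) : ℝ) ^ (-(3 - p / 2)) * ∑ j ∈ range (2 ^ r), α (j + 1)
    + ((2 ^ r : ℕ) : ℝ) ^ (-(1 + 2 / p)) * ∑ j ∈ range (2 ^ r), β (j + 1)

lemma dyadicRate_nonneg {α β : ℕ → ℝ} (hα : ∀ n, 0 ≤ α n) (hβ : ∀ n, 0 ≤ β n) (r : ℕ) :
    0 ≤ dyadicRate p α β r :=
  add_nonneg (mul_nonneg (by positivity) (sum_nonneg fun _ _ => hα _))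
    (mul_nonneg (by positivity) (sum_nonneg fun _ _ => hβ _))

lemma TruncBound.weightBound [Nonempty ι] (hμ : MartLaw p μ) (hp : 2 < p) (hp3 : p ≤ 3)
    {c : ℝ} (hc : 0 ≤ c) {α β : ℕ → ℝ} (hα : ∀ n, 0 ≤ α n) (hβ : ∀ n, 0 ≤ β n)
    (hdec : DecayBound p μ α β) :
    ∃ C, 0 ≤ C ∧ ∀ (r : ℕ) (D : ℝ), 1 ≤ D → TruncBound p μ (2 ^ r) D →
      WeightBound p c μ r (2 ^ r * (C * D * dyadicRate p α β r)) := by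
  obtain ⟨d, hd⟩ : ∃ d : ℝ, d = Fintype.card ι := ⟨_, rfl⟩
  obtain ⟨R, hR⟩ : ∃ R : ℝ, R = c + d * √(128 / (p - 2)) ^ (p - 2) := ⟨_, rfl⟩
  have hd0 : 0 ≤ d := by rw [hd]; positivity
  have hR0 : 0 ≤ R := by rw [hR]; positivity
  obtain ⟨C, hC, hC1, hC2⟩ : ∃ C : ℝ, 0 ≤ C ∧ 2 * ((8 + 272 * d) * R) ≤ C ∧ 2 * (68 * d) ≤ C :=
    ⟨2 * ((8 + 272 * d) * R) + 2 * (68 * d), by positivity, by linarith, by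
      have : 0 ≤ (8 + 272 * d) * R := by positivity
      linarith⟩
  refine ⟨C, hC, fun r D hD hT w hw hdw hle a b => ?_⟩
  obtain ⟨w₁, w₂, hs, h12⟩ := hT.exists_weightSplit hμ hp hp3 hc hD (-((2 ^ r : ℕ) : ℤ))
  have hpos : (0 : ℝ) < ((2 ^ r : ℕ) : ℝ) := by positivity
  have hgrow : ∀ x, |w x| ≤ (1 + c * √((2 ^ r : ℕ) : ℝ) ^ (p - 2))
      * (1 + ‖blockSum (-((2 ^ r : ℕ) : ℤ)) (2 ^ r) x‖) ^ (p - 2) := by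
    intro x
    have h1 := hle x
    rw [← sqrt_rpow_eq (by positivity)] at h1
    have h2 : ‖blockSum (-((2 ^ r : ℕ) : ℤ)) (2 ^ r) x‖ ^ (p - 2)
        ≤ (1 + ‖blockSum (-((2 ^ r : ℕ) : ℤ)) (2 ^ r) x‖) ^ (p - 2) :=
      rpow_le_rpow (norm_nonneg _) (by linarith) (by linarith)
    have h3 : 1 ≤ (1 + ‖blockSum (-((2 ^ r : ℕ) : ℤ)) (2 ^ r) x‖) ^ (p - 2) :=
      one_le_rpow (by linarith [norm_nonneg (blockSum (-((2 ^ r : ℕ) : ℤ)) (2 ^ r) x)])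
        (by linarith)
    have h4 : 0 ≤ c * √((2 ^ r : ℕ) : ℝ) ^ (p - 2) := by positivity
    nlinarith
  have havg := hdec.average hμ hp.le hα hβ hw hdw hs (fun x => by
    have := hle x
    rw [← sqrt_rpow_eq (by positivity)] at this
    exact this.trans (h12 x)) (hμ.memLp_blockSum _ _) hgrow (2 ^ r) a b
  rw [← hd, ← hR] at havg
  rw [sum_add_distrib, ← mul_sum, ← mul_sum] at havg
  rw [dyadicRate]
  obtain ⟨Sα, hSα⟩ : ∃ S, S = ∑ j ∈ range (2 ^ r), α (j + 1) := ⟨_, rfl⟩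
  obtain ⟨Sβ, hSβ⟩ : ∃ S, S = ∑ j ∈ range (2 ^ r), β (j + 1) := ⟨_, rfl⟩
  have hSα0 : 0 ≤ Sα := hSα ▸ sum_nonneg fun _ _ => hα _
  have hSβ0 : 0 ≤ Sβ := hSβ ▸ sum_nonneg fun _ _ => hβ _
  rw [← hSα, ← hSβ] at havg ⊢
  have hcast : ((2 ^ r : ℕ) : ℝ) = 2 ^ r := by push_cast; rfl
  rw [sqrt_rpow_eq hpos.le] at havg
  rw [← hcast]
  obtain ⟨n, hn⟩ : ∃ n : ℝ, n = ((2 ^ r : ℕ) : ℝ) := ⟨_, rfl⟩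
  rw [← hn] at havg hpos ⊢
  have e1 : n ^ ((p - 2) / 2) = n * (n * n ^ (-(3 - p / 2))) := by
    rw [← rpow_one_add' hpos.le (by linarith), ← rpow_one_add' hpos.le (by linarith)]
    ring_nf
  have e2 : n ^ ((p - 2) / p) = n * (n * n ^ (-(1 + 2 / p))) := by
    have : 0 < 2 / p := by positivity
    have h2p : 2 / p < 1 := by rw [div_lt_one] <;> linarith
    rw [← rpow_one_add' hpos.le (by linarith), ← rpow_one_add' hpos.le (by linarith)]
    congr 1; field_simp; ring
  rw [e1, e2] at havg
  have e3 : 0 ≤ n * (D * (n ^ (-(3 - p / 2)) * Sα)) := by positivity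
  have e4 : 0 ≤ n * (D * (n ^ (-(1 + 2 / p)) * Sβ)) := by positivity
  refine le_of_mul_le_mul_left (havg.trans ?_) hpos
  have e5 := mul_le_mul_of_nonneg_left (mul_le_mul_of_nonneg_right hC1 e3) hpos.le
  have e6 := mul_le_mul_of_nonneg_left (mul_le_mul_of_nonneg_right hC2 e4) hpos.le
  linarith

end WeightRecursion

lemma summable_dyadic {κ : ℝ} (hκ : 0 < κ) {f : ℕ → ℝ} (hf : ∀ j, 0 ≤ f j)
    (h : Summable fun j : ℕ => ((j + 1 : ℕ) : ℝ) ^ (-κ) * f j) :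
    Summable fun r : ℕ => ((2 ^ r : ℕ) : ℝ) ^ (-κ) * ∑ j ∈ range (2 ^ r), f j := by
  obtain ⟨T, hT⟩ : ∃ T : ℕ → ℝ, ∀ r, T r = ((2 ^ r : ℕ) : ℝ) ^ (-κ)
    * ∑ j ∈ range (2 ^ r), f j := ⟨_, fun _ => rfl⟩
  have hT0 : ∀ r, 0 ≤ T r := fun r => by
    rw [hT]; exact mul_nonneg (by positivity) (sum_nonneg fun _ _ => hf _)
  have hθ : (2 : ℝ) ^ (-κ) < 1 := Real.rpow_lt_one_of_one_lt_of_neg (by norm_num) (by linarith)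
  have key : ∀ R, ∑ r ∈ range R, (1 - 2 ^ (-κ)) * T r + T R
      ≤ ∑ j ∈ range (2 ^ R), ((j + 1 : ℕ) : ℝ) ^ (-κ) * f j := by
    intro R
    induction R with
    | zero => simp [hT]
    | succ R IH =>
      rw [sum_range_succ, pow_succ, mul_two, sum_range_add]
      have h1 : T (R + 1) = 2 ^ (-κ) * T R + ∑ j ∈ range (2 ^ R),
          ((2 ^ (R + 1) : ℕ) : ℝ) ^ (-κ) * f (2 ^ R + j) := by
        rw [hT, hT, ← mul_sum, pow_succ, mul_two, sum_range_add, mul_add,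
          ← mul_assoc, ← mul_rpow (by norm_num) (by positivity)]
        congr 3
        push_cast; ring
      have h2 : ∑ j ∈ range (2 ^ R), ((2 ^ (R + 1) : ℕ) : ℝ) ^ (-κ) * f (2 ^ R + j)
          ≤ ∑ j ∈ range (2 ^ R), ((2 ^ R + j + 1 : ℕ) : ℝ) ^ (-κ) * f (2 ^ R + j) := by
        refine sum_le_sum fun j hj => mul_le_mul_of_nonneg_right ?_ (hf _)
        refine rpow_le_rpow_of_nonpos (by positivity) ?_ (by linarith)
        have := Finset.mem_range.1 hj
        exact_mod_cast (by rw [pow_succ]; omega)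
      linarith
  have h3 : Summable fun r => (1 - 2 ^ (-κ)) * T r := by
    refine summable_of_sum_range_le (c := ∑' j : ℕ, ((j + 1 : ℕ) : ℝ) ^ (-κ) * f j)
      (fun r => mul_nonneg (by linarith) (hT0 r)) fun R => ?_
    have := h.sum_le_tsum (range (2 ^ R)) fun j _ => mul_nonneg (by positivity) (hf j)
    linarith [key R, hT0 R]
  simp only [← hT]
  exact (summable_mul_left_iff (by linarith : (1 : ℝ) - 2 ^ (-κ) ≠ 0)).1 h3

section WeightRecursion

variable {ι : Type} [Fintype ι] [DecidableEq ι] {p : ℝ} {μ : Measure (𝒳 ι)}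

lemma TruncBound.mono {n : ℕ} {D D' : ℝ} (hT : TruncBound p μ n D) (h : D ≤ D') :
    TruncBound p μ n D' := fun a s l hs hl => (hT a s l hs hl).trans (by gcongr)

theorem MartLaw.exists_weightBound [Nonempty ι] (hμ : MartLaw p μ) (hp : 2 < p) (hp3 : p ≤ 3)
    {α β : ℕ → ℝ} (hα : ∀ n, 0 ≤ α n) (hβ : ∀ n, 0 ≤ β n) (hdec : DecayBound p μ α β)
    (sα : Summable fun j : ℕ => ((j + 1 : ℕ) : ℝ) ^ (-(3 - p / 2)) * α (j + 1))
    (sβ : Summable fun j : ℕ => ((j + 1 : ℕ) : ℝ) ^ (-(1 + 2 / p)) * β (j + 1)) :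
    ∃ b : ℕ → ℝ, (∀ r, WeightBound p (gMom ι (p - 2)) μ r (b r)) ∧
      (Summable fun r => b r / 2 ^ r) ∧ ∃ D, 1 ≤ D ∧ ∀ N, TruncBound p μ (2 ^ N) D := by
  obtain ⟨C, hC, hstep⟩ := TruncBound.weightBound hμ hp hp3 (gMom_nonneg (ι := ι) (p - 2))
    hα hβ hdec
  have ha0 := dyadicRate_nonneg (p := p) hα hβ
  have hsum : Summable (dyadicRate p α β) :=
    (summable_dyadic (by linarith) (fun j => hα (j + 1)) sα).add
      (summable_dyadic (by positivity) (fun j => hβ (j + 1)) sβ)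
  obtain ⟨e, he⟩ : ∃ e, e = p * (p - 1) := ⟨_, rfl⟩
  have he0 : 0 ≤ e := by rw [he]; nlinarith
  obtain ⟨C₀, hC₀⟩ : ∃ C₀, C₀ = ∫ x, ‖x 0‖ ^ p ∂μ + gMom ι p := ⟨_, rfl⟩
  have hC₀0 : 0 ≤ C₀ := by
    rw [hC₀]; exact add_nonneg (integral_nonneg fun _ => by positivity) (gMom_nonneg _)
  obtain ⟨κ, hκ⟩ : ∃ κ : ℝ, κ = e * (Fintype.card ι ^ 2 * C) := ⟨_, rfl⟩
  have hκ0 : 0 ≤ κ := by rw [hκ]; positivity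
  obtain ⟨D, hD⟩ : ∃ D : ℕ → ℝ, ∀ N, D N = (1 + e * C₀)
    * ∏ r ∈ range N, (1 + κ * dyadicRate p α β r) := ⟨_, fun _ => rfl⟩
  have hD1 : ∀ N, 1 ≤ D N := fun N => by
    rw [hD]
    refine one_le_mul_of_one_le_of_one_le (by nlinarith) ?_
    have := Finset.prod_le_prod (s := range N) (f := fun _ => (1 : ℝ))
      (fun _ _ => zero_le_one) fun r _ =>
      (by nlinarith [mul_nonneg hκ0 (ha0 r)] : (1 : ℝ) ≤ 1 + κ * dyadicRate p α β r)
    simpa using this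
  have hDs : ∀ N, D N = 1 + e * C₀ + ∑ r ∈ range N, κ * (D r * dyadicRate p α β r) := by
    intro N
    induction N with
    | zero => simp [hD]
    | succ N IH =>
      rw [sum_range_succ, ← add_assoc, ← IH, hD (N + 1), Finset.prod_range_succ,
        ← mul_assoc, ← hD]
      ring
  have hDb : ∀ N, D N ≤ (1 + e * C₀) * exp (κ * ∑' r, dyadicRate p α β r) := by
    intro N
    rw [hD]
    refine mul_le_mul_of_nonneg_left ?_ (by positivity)
    refine (Finset.prod_le_prod (fun r _ => by nlinarith [mul_nonneg hκ0 (ha0 r)]) fun r _ =>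
      (by linarith [add_one_le_exp (κ * dyadicRate p α β r)] :
        1 + κ * dyadicRate p α β r ≤ exp (κ * dyadicRate p α β r))).trans ?_
    rw [← Real.exp_sum, ← mul_sum]
    exact Real.exp_le_exp.2 (mul_le_mul_of_nonneg_left
      (hsum.sum_le_tsum _ fun r _ => ha0 r) hκ0)
  have htr : ∀ N, (∀ r < N, WeightBound p (gMom ι (p - 2)) μ r
      (2 ^ r * (C * D r * dyadicRate p α β r))) → TruncBound p μ (2 ^ N) (D N) := by
    intro N hN a s l hs hl
    refine (hμ.integral_posPow_le hp hp3 hN a hs hl).trans ?_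
    have e1 : ∀ r, 2 ^ r * (C * D r * dyadicRate p α β r) / 2 ^ r
        = C * (D r * dyadicRate p α β r) := fun r => by field_simp
    simp only [e1]
    rw [← hC₀, ← he, hDs N, ← mul_sum, ← mul_sum, hκ]
    push_cast
    have : (0 : ℝ) < 2 ^ N := by positivity
    nlinarith
  have hall : ∀ N, ∀ r < N, WeightBound p (gMom ι (p - 2)) μ r
      (2 ^ r * (C * D r * dyadicRate p α β r)) := by
    intro N
    induction N with
    | zero => intro r hr; omega
    | succ N IH =>
      intro r hr
      rcases Nat.lt_succ_iff_lt_or_eq.1 hr with h | rfl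
      · exact IH r h
      · exact hstep _ _ (hD1 _) (htr _ IH)
  refine ⟨_, fun r => hall (r + 1) r (by omega), ?_,
    (1 + e * C₀) * exp (κ * ∑' r, dyadicRate p α β r), (hD1 0).trans (hDb 0),
    fun N => (htr N (hall N)).mono (hDb N)⟩
  refine Summable.of_nonneg_of_le (fun r => ?_) (fun r => ?_)
    (hsum.mul_left (C * ((1 + e * C₀) * exp (κ * ∑' r, dyadicRate p α β r))))
  · have := hD1 r; have := ha0 r; positivity
  · have : 2 ^ r * (C * D r * dyadicRate p α β r) / 2 ^ r
        = C * D r * dyadicRate p α β r := by field_simp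
    rw [this]
    exact mul_le_mul_of_nonneg_right (mul_le_mul_of_nonneg_left (hDb r) hC) (ha0 r)

end WeightRecursion

section CouplingRate

/-- The rate of the smoothed approximation of Lipschitz functionals over `2 ^ N` steps. -/
def couplingRate (p : ℝ) (N : ℕ) : ℝ :=
  if p = 3 then N + 1 else ((2 ^ N : ℕ) : ℝ) ^ ((3 - p) / 2)

lemma couplingRate_ge_one {p : ℝ} (hp3 : p ≤ 3) (N : ℕ) : 1 ≤ couplingRate p N := by
  rw [couplingRate]
  split_ifs
  · linarith [(Nat.cast_nonneg N : (0 : ℝ) ≤ N)]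
  · exact one_le_rpow (by exact_mod_cast Nat.one_le_two_pow) (by linarith)

lemma exists_sum_rpow_le {p : ℝ} (hp : 2 < p) (hp3 : p ≤ 3) :
    ∃ C, 0 ≤ C ∧ ∀ N : ℕ, ∑ k ∈ range (2 ^ N), √(((2 ^ N : ℕ) : ℝ) - k) ^ (1 - p)
      ≤ C * couplingRate p N := by
  have e : ∀ m : ℕ, ∑ k ∈ range m, √((m : ℝ) - k) ^ (1 - p)
      = ∑ j ∈ range m, ((j + 1 : ℕ) : ℝ) ^ ((1 - p) / 2) := by
    intro m
    rw [← Finset.sum_range_reflect]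
    refine sum_congr rfl fun j hj => ?_
    have := Finset.mem_range.1 hj
    have e1 : (m : ℝ) - (m - 1 - j : ℕ) = ((j + 1 : ℕ) : ℝ) := by
      rw [Nat.cast_sub (by omega), Nat.cast_sub (by omega)]; push_cast; ring
    rw [e1, sqrt_rpow_eq (by positivity)]
  simp only [e]
  have hstep : ∀ N : ℕ, ∑ j ∈ range (2 ^ (N + 1)), ((j + 1 : ℕ) : ℝ) ^ ((1 - p) / 2)
      ≤ ∑ j ∈ range (2 ^ N), ((j + 1 : ℕ) : ℝ) ^ ((1 - p) / 2)
        + ((2 ^ N : ℕ) : ℝ) ^ ((3 - p) / 2) := by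
    intro N
    rw [pow_succ, mul_two, sum_range_add]
    have hpos : (0 : ℝ) < ((2 ^ N : ℕ) : ℝ) := by positivity
    have h1 : ∑ j ∈ range (2 ^ N), ((2 ^ N + j + 1 : ℕ) : ℝ) ^ ((1 - p) / 2)
        ≤ ∑ _j ∈ range (2 ^ N), ((2 ^ N : ℕ) : ℝ) ^ ((1 - p) / 2) :=
      sum_le_sum fun j _ => rpow_le_rpow_of_nonpos hpos
        (by exact_mod_cast (by omega)) (by linarith)
    rw [sum_const, card_range, nsmul_eq_mul] at h1
    rw [show (3 - p) / 2 = 1 + (1 - p) / 2 by ring, rpow_add hpos, rpow_one]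
    linarith
  rcases eq_or_ne p 3 with h3 | h3
  · refine ⟨1, zero_le_one, fun N => ?_⟩
    rw [couplingRate, if_pos h3, one_mul]
    induction N with
    | zero => simp
    | succ N IH =>
      have := hstep N
      rw [h3, sub_self, zero_div, Real.rpow_zero] at this
      rw [h3] at IH ⊢
      push_cast at *
      linarith
  · have h3' : 0 < (3 - p) / 2 := by
      have := lt_of_le_of_ne hp3 h3
      linarith
    obtain ⟨θ, hθ⟩ : ∃ θ : ℝ, θ = 2 ^ ((3 - p) / 2) := ⟨_, rfl⟩
    have hθ1 : 0 < θ - 1 := by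
      have := Real.one_lt_rpow (by norm_num : (1 : ℝ) < 2) h3'
      rw [hθ]; linarith
    have hpw : ∀ N : ℕ, ((2 ^ N : ℕ) : ℝ) ^ ((3 - p) / 2) = θ ^ N := by
      intro N
      push_cast
      rw [hθ, ← rpow_natCast, ← rpow_natCast, ← rpow_mul (by norm_num),
        ← rpow_mul (by norm_num), mul_comm]
    refine ⟨1 + (θ - 1)⁻¹, by positivity, fun N => ?_⟩
    rw [couplingRate, if_neg h3, hpw]
    have hK : (1 + (θ - 1)⁻¹) * (θ - 1) = θ := by field_simp; ring
    induction N with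
    | zero => simpa using hθ1.le
    | succ N IH =>
      have h1 := hstep N
      rw [hpw] at h1
      have h2 : 0 < θ ^ N := pow_pos (by linarith) _
      rw [pow_succ θ, mul_comm (θ ^ N), ← mul_assoc]
      have h3 : (1 + (θ - 1)⁻¹) * θ = (1 + (θ - 1)⁻¹) + θ := by linarith
      rw [h3, add_mul]
      nlinarith

end CouplingRate

section LipschitzFunctionals

variable {ι : Type} [Fintype ι] [DecidableEq ι] {p : ℝ} {μ : Measure (𝒳 ι)}

lemma one_le_gMom {q : ℝ} (hq : 0 ≤ q) : 1 ≤ gMom ι q := by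
  have h := integral_mono (μ := stdG ι) (integrable_const (1 : ℝ))
    (ExpGrowth.one_add_norm_rpow hq).integrable fun z =>
      one_le_rpow (by linarith [norm_nonneg z]) hq
  simpa [gMom] using h

lemma WeightBound.mono {c c' : ℝ} {r : ℕ} {B : ℝ} (hB : WeightBound p c' μ r B) (h : c ≤ c') :
    WeightBound p c μ r B := fun w hw hd hle => hB w hw hd fun x => (hle x).trans (by gcongr)

lemma integrable_of_lipschitz_stdG {f : ℰ ι → ℝ} (hf : LipschitzWith 1 f)
    (x : ℰ ι) (σ : ℝ) : Integrable (fun z => f (x + σ • z)) (stdG ι) :=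
  (ExpGrowth.of_lipschitz hf x σ).integrable

lemma abs_smooth_sub_le {f : ℰ ι → ℝ} (hf : LipschitzWith 1 f)
    (x : ℰ ι) (σ τ : ℝ) :
    |smooth f σ x - smooth f τ x| ≤ |σ - τ| * gMom ι 1 := by
  rw [smooth, smooth, ← integral_sub (integrable_of_lipschitz_stdG hf x σ)
    (integrable_of_lipschitz_stdG hf x τ), gMom, ← integral_const_mul]
  refine abs_integral_le_integral_abs.trans (integral_mono_of_nonneg (ae_of_all _ fun _ =>
    abs_nonneg _) ((ExpGrowth.one_add_norm_rpow zero_le_one).integrable.const_mul _)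
    (ae_of_all _ fun z => ?_))
  simp only [rpow_one]
  refine (abs_sub_le_of_lipschitz hf _ _).trans ?_
  rw [add_sub_add_left_eq_sub, ← sub_smul, norm_smul, norm_eq_abs]
  exact mul_le_mul_of_nonneg_left (by linarith) (abs_nonneg _)

lemma smooth_zero (f : ℰ ι → ℝ) (x : ℰ ι) : smooth f 0 x = f x := by
  simp [smooth]

lemma smooth_sub_const {f : ℰ ι → ℝ} (hf : LipschitzWith 1 f) (c σ : ℝ)
    (x : ℰ ι) : smooth (fun y => f y - c) σ x = smooth f σ x - c := by
  rw [smooth, smooth, integral_sub (integrable_of_lipschitz_stdG hf x σ) (integrable_const c)]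
  simp

/-- Approximation of the block `blockSum 0 (2 ^ N)` by a Gaussian vector, tested against Lipschitz
functions that depend on the past. -/
abbrev LipschitzBound (p : ℝ) (μ : Measure (𝒳 ι)) (N : ℕ) (C : ℝ) : Prop :=
  ∀ (J : Type) [MeasurableSpace J] (i : 𝒳 ι → J)
    (f : J → ℰ ι → ℝ), Measurable i → DependsOn i (Iic 0) →
    Measurable (uncurry f) → (∀ j, LipschitzWith 1 (f j)) →
    |∫ x, (f (i x) (blockSum 0 (2 ^ N) x) - smooth (f (i x)) (√((2 ^ N : ℕ) : ℝ)) 0) ∂μ|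
      ≤ C * couplingRate p N

/-- Lipschitz functionals depending on the past: replacing a block by a Gaussian vector. -/
theorem MartLaw.exists_lipschitz_bound [Nonempty ι] (hμ : MartLaw p μ) (hp : 2 < p) (hp3 : p ≤ 3)
    {b : ℕ → ℝ} (hb : ∀ r, WeightBound p (gMom ι (p - 2)) μ r (b r))
    (hs : Summable fun r => b r / 2 ^ r) :
    ∃ C, 0 ≤ C ∧ ∀ N, LipschitzBound p μ N C := by
  have := hμ.prob
  obtain ⟨C₁, hC₁, hjet⟩ := exists_jetSeq_lipschitz (ι := ι) hp hp3
  obtain ⟨C₂, hC₂, hsum⟩ := exists_sum_rpow_le hp hp3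
  have hb' : ∀ r, WeightBound p 1 μ r (b r) := fun r =>
    (hb r).mono (one_le_gMom (by linarith))
  have hb0 : ∀ r, 0 ≤ b r / 2 ^ r := fun r => by
    have := (hb' r).nonneg zero_le_one
    positivity
  obtain ⟨S, hS⟩ : ∃ S, S = ∑' r, b r / 2 ^ r := ⟨_, rfl⟩
  have hS0 : 0 ≤ S := hS ▸ tsum_nonneg hb0
  obtain ⟨C₀, hC₀⟩ : ∃ C₀, C₀ = ∫ x, ‖x 0‖ ^ p ∂μ + gMom ι p := ⟨_, rfl⟩
  have hC₀0 : 0 ≤ C₀ := by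
    rw [hC₀]; exact add_nonneg (integral_nonneg fun _ => by positivity) (gMom_nonneg _)
  obtain ⟨d, hd⟩ : ∃ d : ℝ, d = Fintype.card ι := ⟨_, rfl⟩
  have hd0 : 0 ≤ d := by rw [hd]; positivity
  have hg0 := gMom_nonneg (ι := ι) 1
  refine ⟨(C₀ + d ^ 2 * S) * (C₁ * C₂) + d ^ 2 * (C₁ * S) + 2 * gMom ι 1, by positivity,
    fun N J _ i f hi hdi hf hl => ?_⟩
  obtain ⟨δ, hδ⟩ : ∃ δ, δ = couplingRate p N := ⟨_, rfl⟩
  have hδ1 : 1 ≤ δ := hδ ▸ couplingRate_ge_one hp3 N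
  obtain ⟨m, hm⟩ : ∃ m : ℝ, m = ((2 ^ N : ℕ) : ℝ) := ⟨_, rfl⟩
  have hm1 : 1 ≤ m := by rw [hm]; exact_mod_cast Nat.one_le_two_pow
  have hf0 : Measurable fun j => f j 0 :=
    hf.comp (measurable_id.prodMk measurable_const)
  have hlg : ∀ j, LipschitzWith 1 fun y => f j y - f j 0 := fun j => by
    simpa using (hl j).sub (LipschitzWith.const (f j 0))
  obtain ⟨K, h, G, H, hJ, h1, h2, h3⟩ := hjet J (fun j y => f j y - f j 0)
    (hf.sub (hf0.comp measurable_fst)) hlg (fun j => sub_self _) (2 ^ N)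
  have hlin := hJ.lindeberg hμ hp.le zero_le_one hi hdi (N := N) fun r _ => hb' r
  -- the second order term at time zero
  have hquad : ∀ a b', |∫ x, H 0 a b' (i x) 0 * blockXi 0 (2 ^ N) a b' x ∂μ| ≤ C₁ * S * δ := by
    intro a b'
    have hρ : 0 ≤ C₁ * (√m)⁻¹ * (m ^ ((p - 2) / 2))⁻¹ := by positivity
    have e := (hb' N).shift hμ hρ (-((2 ^ N : ℕ) : ℤ)) (w := fun x => H 0 a b' (i x) 0)
      ((hJ.meas_H 0 (by positivity) a b').comp (hi.prodMk measurable_const))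
      (by
        rw [neg_add_cancel]
        intro x y hxy
        simp only [hdi hxy])
      (fun x => by
        have e1 := h3 (by positivity) a b' (i x) 0
        rw [← hm] at e1 ⊢
        refine e1.trans ?_
        have e2 : C₁ * (√m)⁻¹ = C₁ * (√m)⁻¹ * (m ^ ((p - 2) / 2))⁻¹ * m ^ ((p - 2) / 2) := by
          have : 0 < m ^ ((p - 2) / 2) := by positivity
          field_simp
        rw [one_mul]
        nth_rw 1 [e2]
        refine mul_le_mul_of_nonneg_left ?_ hρ
        linarith [rpow_nonneg (norm_nonneg
          (blockSum (-((2 ^ N : ℕ) : ℤ)) (2 ^ N) x)) (p - 2)]) a b'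
    rw [neg_add_cancel] at e
    refine e.trans ?_
    have e3 : b N = m * (b N / 2 ^ N) := by rw [hm]; push_cast; field_simp
    have e4 : b N / 2 ^ N ≤ S := hS ▸ hs.le_tsum N fun j _ => hb0 j
    have e5 : (√m)⁻¹ * (m ^ ((p - 2) / 2))⁻¹ * m = m ^ ((3 - p) / 2) := by
      rw [sqrt_eq_rpow, ← rpow_neg (by linarith), ← rpow_neg (by linarith),
        ← rpow_add (by linarith), ← rpow_add_one (by linarith)]
      ring_nf
    have e6 : m ^ ((3 - p) / 2) ≤ δ := by
      rw [hδ, couplingRate, hm]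
      split_ifs with h
      · rw [h, sub_self, zero_div, Real.rpow_zero]
        linarith [(Nat.cast_nonneg N : (0 : ℝ) ≤ N)]
      · exact le_rfl
    have e7 : C₁ * (√m)⁻¹ * (m ^ ((p - 2) / 2))⁻¹ * b N
        = C₁ * ((b N / 2 ^ N) * m ^ ((3 - p) / 2)) := by
      rw [← e5]; nth_rw 1 [e3]; ring
    rw [e7, mul_assoc]
    refine mul_le_mul_of_nonneg_left ?_ hC₁
    exact mul_le_mul e4 e6 (by positivity) hS0
  have hquad' : |(1 / 2) * ∑ a, ∑ b', ∫ x, H 0 a b' (i x) 0 * blockXi 0 (2 ^ N) a b' x ∂μ|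
      ≤ d ^ 2 * (C₁ * S) * δ := by
    rw [abs_mul, abs_of_pos (by norm_num : (0 : ℝ) < 1 / 2)]
    have e1 : |∑ a, ∑ b', ∫ x, H 0 a b' (i x) 0 * blockXi 0 (2 ^ N) a b' x ∂μ|
        ≤ ∑ _a : ι, ∑ _b : ι, C₁ * S * δ :=
      (abs_sum_le_sum_abs _ _).trans (sum_le_sum fun a _ =>
        (abs_sum_le_sum_abs _ _).trans (sum_le_sum fun b' _ => hquad a b'))
    simp only [sum_const, card_univ, nsmul_eq_mul, ← hd] at e1
    have : 0 ≤ d ^ 2 * (C₁ * S) * δ := by positivity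
    nlinarith
  have hrhs : (C₀ + d ^ 2 * ∑ r ∈ range N, b r / 2 ^ r)
      * ∑ k ∈ range (2 ^ N), C₁ * √(((2 ^ N : ℕ) : ℝ) - k) ^ (1 - p)
      ≤ (C₀ + d ^ 2 * S) * (C₁ * C₂) * δ := by
    rw [mul_assoc, ← mul_sum]
    have e1 : ∑ r ∈ range N, b r / 2 ^ r ≤ S := hS ▸ hs.sum_le_tsum _ fun j _ => hb0 j
    have e2 := hsum N
    rw [← hδ] at e2
    refine mul_le_mul ?_ ?_ ?_ (by positivity)
    · nlinarith [sq_nonneg d]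
    · rw [mul_assoc]; exact mul_le_mul_of_nonneg_left e2 hC₁
    · exact mul_nonneg hC₁ (sum_nonneg fun k _ => by positivity)
  rw [← hC₀, ← hd] at hlin
  have hmain : |∫ x, h (2 ^ N) (i x) (blockSum 0 (2 ^ N) x) ∂μ - ∫ x, h 0 (i x) 0 ∂μ|
      ≤ (C₀ + d ^ 2 * S) * (C₁ * C₂) * δ + d ^ 2 * (C₁ * S) * δ := by
    have e1 := abs_le.1 (hlin.trans hrhs)
    have e2 := abs_le.1 hquad'
    exact abs_le.2 ⟨by linarith, by linarith⟩
  have i1 := hJ.integrable_h_blockSum hμ (by linarith) hi le_rfl (2 ^ N)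
  have i2 : Integrable (fun x => h 0 (i x) 0) μ := by
    have := hJ.integrable_h_blockSum hμ (by linarith) hi (k := 0) (by positivity) 0
    simpa using this
  have i3 : Integrable (fun x => h (2 ^ N) (i x) (blockSum 0 (2 ^ N) x) - h 0 (i x) 0) μ :=
    i1.sub i2
  rw [← integral_sub i1 i2] at hmain
  have hpt : ∀ x, |(f (i x) (blockSum 0 (2 ^ N) x) - smooth (f (i x)) (√((2 ^ N : ℕ) : ℝ)) 0)
      - (h (2 ^ N) (i x) (blockSum 0 (2 ^ N) x) - h 0 (i x) 0)| ≤ 2 * gMom ι 1 := by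
    intro x
    rw [h1, h2, smooth_sub_const (hl _), smooth_sub_const (hl _), ← hm]
    have e1 := abs_smooth_sub_le (hl (i x)) (blockSum 0 (2 ^ N) x) 0 1
    have e2 := abs_smooth_sub_le (hl (i x)) 0 (√m) (√(m + 1))
    rw [smooth_zero] at e1
    have e3 : |√m - √(m + 1)| ≤ 1 := by
      have f1 : √m ≤ √(m + 1) := sqrt_le_sqrt (by linarith)
      have f2 : √(m + 1) ≤ √m + 1 := by
        rw [sqrt_le_left (by positivity)]
        nlinarith [sq_sqrt (by linarith : (0 : ℝ) ≤ m), sqrt_nonneg m]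
      rw [abs_le]; constructor <;> linarith
    have e4 := e2.trans (mul_le_mul_of_nonneg_right e3 hg0)
    have e5 : |(0 : ℝ) - 1| * gMom ι 1 = gMom ι 1 := by simp
    rw [e5] at e1
    have g1 := abs_le.1 e1
    have g2 := abs_le.1 e4
    push_cast at *
    exact abs_le.2 ⟨by linarith, by linarith⟩
  have hmeas : Measurable fun x => f (i x) (blockSum 0 (2 ^ N) x)
      - smooth (f (i x)) (√((2 ^ N : ℕ) : ℝ)) 0 := by
    refine (hf.comp (hi.prodMk (measurable_blockSum 0 (2 ^ N)))).sub ?_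
    exact (measurable_smooth hf _).comp (hi.prodMk measurable_const)
  have i4 : Integrable (fun x => (f (i x) (blockSum 0 (2 ^ N) x)
      - smooth (f (i x)) (√((2 ^ N : ℕ) : ℝ)) 0)
      - (h (2 ^ N) (i x) (blockSum 0 (2 ^ N) x) - h 0 (i x) 0)) μ :=
    (integrable_const (2 * gMom ι 1)).mono' (hmeas.aestronglyMeasurable.sub
      i3.aestronglyMeasurable) (ae_of_all _ hpt)
  have e6 : ∫ x, (f (i x) (blockSum 0 (2 ^ N) x) - smooth (f (i x)) (√((2 ^ N : ℕ) : ℝ)) 0) ∂μ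
      = ∫ x, (f (i x) (blockSum 0 (2 ^ N) x) - smooth (f (i x)) (√((2 ^ N : ℕ) : ℝ)) 0
        - (h (2 ^ N) (i x) (blockSum 0 (2 ^ N) x) - h 0 (i x) 0)) ∂μ
        + ∫ x, (h (2 ^ N) (i x) (blockSum 0 (2 ^ N) x) - h 0 (i x) 0) ∂μ := by
    rw [← integral_add i4 i3]; simp
  have e7 := norm_integral_le_of_norm_le_const (ae_of_all μ fun x =>
    (norm_eq_abs _).le.trans (hpt x))
  rw [probReal_univ, mul_one, norm_eq_abs] at e7
  rw [e6, ← hδ]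
  refine (abs_add_le _ _).trans ((add_le_add e7 hmain).trans ?_)
  nlinarith

end LipschitzFunctionals

section FiniteTransport

variable {I : Type*} [Fintype I] {E : Type*} [PseudoMetricSpace E]

/-- Kantorovich–Rubinstein duality on a finite set of points. -/
lemma exists_coupling_le_of_lipschitz (y : I → E) {a b : I → ℝ} (ha : ∀ i, 0 ≤ a i)
    (hb : ∀ i, 0 ≤ b i) (ha1 : ∑ i, a i = 1) (hb1 : ∑ i, b i = 1) {t : ℝ}
    (h : ∀ f : I → ℝ, (∀ i j, |f i - f j| ≤ dist (y i) (y j)) → ∑ i, f i * (a i - b i) ≤ t) :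
    ∃ π : I → I → ℝ, (∀ i j, 0 ≤ π i j) ∧ (∀ i, ∑ j, π i j = a i) ∧ (∀ j, ∑ i, π i j = b j) ∧
      ∑ i, ∑ j, π i j * dist (y i) (y j) ≤ t := by
  classical
  have hne : Nonempty I := by
    by_contra hI
    rw [not_nonempty_iff] at hI
    simp at ha1
  obtain ⟨S, hS⟩ : ∃ S : Set (I → I → ℝ),
    S = {π | (∀ i j, 0 ≤ π i j) ∧ ∀ i, ∑ j, π i j = a i} := ⟨_, rfl⟩
  obtain ⟨L, hL⟩ : ∃ L : (I → I → ℝ) → (I → ℝ) × ℝ,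
    ∀ π, L π = (fun j => ∑ i, π i j, ∑ i, ∑ j, π i j * dist (y i) (y j)) := ⟨_, fun _ => rfl⟩
  have hSc : IsCompact S := by
    have hbox : IsCompact (Set.pi Set.univ fun i => Set.pi Set.univ fun _ : I =>
        Set.Icc (0 : ℝ) (a i)) :=
      isCompact_univ_pi fun i => isCompact_univ_pi fun _ => isCompact_Icc
    refine hbox.of_isClosed_subset ?_ ?_
    · rw [hS]
      refine IsClosed.inter ?_ ?_
      · change IsClosed {π : I → I → ℝ | ∀ i j, 0 ≤ π i j}
        simp only [Set.ofPred_forall]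
        exact isClosed_iInter fun i => isClosed_iInter fun j =>
          isClosed_le continuous_const (by fun_prop)
      · change IsClosed {π : I → I → ℝ | ∀ i, ∑ j, π i j = a i}
        simp only [Set.ofPred_forall]
        exact isClosed_iInter fun i => isClosed_eq (by fun_prop) continuous_const
    · intro π hπ
      rw [hS] at hπ
      simp only [Set.mem_pi, Set.mem_univ, forall_true_left, Set.mem_Icc]
      exact fun i j => ⟨hπ.1 i j, (hπ.2 i) ▸
        Finset.single_le_sum (fun k _ => hπ.1 i k) (mem_univ j)⟩
  have hLc : Continuous L := by
    rw [show L = _ from funext hL]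
    fun_prop
  have hKconv : Convex ℝ (L '' S) := by
    rintro _ ⟨π, hπ, rfl⟩ _ ⟨π', hπ', rfl⟩ u v hu hv huv
    rw [hS] at hπ hπ'
    refine ⟨u • π + v • π', ?_, ?_⟩
    · rw [hS]
      refine ⟨fun i j => ?_, fun i => ?_⟩
      · have h1 := mul_nonneg hu (hπ.1 i j)
        have h2 := mul_nonneg hv (hπ'.1 i j)
        simp only [Pi.add_apply, Pi.smul_apply, smul_eq_mul]
        linarith
      · simp only [Pi.add_apply, Pi.smul_apply, smul_eq_mul, sum_add_distrib,
          ← mul_sum, hπ.2 i, hπ'.2 i, ← add_mul, huv, one_mul]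
    · simp only [hL, Prod.smul_mk, Prod.mk_add_mk, Prod.mk.injEq]
      refine ⟨?_, ?_⟩
      · ext j
        simp only [Pi.add_apply, Pi.smul_apply, smul_eq_mul, sum_add_distrib,
          ← mul_sum]
      · simp only [Pi.add_apply, Pi.smul_apply, smul_eq_mul, add_mul, sum_add_distrib,
          mul_sum, mul_assoc]
  by_contra hcon
  have hdisj : Disjoint (L '' S) ({b} ×ˢ Iic t) := by
    rw [Set.disjoint_left]
    rintro _ ⟨π, hπ, rfl⟩ h2
    rw [hL] at h2
    rw [hS] at hπ
    exact hcon ⟨π, hπ.1, hπ.2, fun j => congrFun h2.1 j, h2.2⟩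
  obtain ⟨φ, u, v, h1, huv, h2⟩ := geometric_hahn_banach_compact_closed hKconv
    (hSc.image hLc) ((convex_singleton b).prod (convex_Iic t))
    (isClosed_singleton.prod isClosed_Iic) hdisj
  obtain ⟨g, hg⟩ : ∃ g : I → ℝ, ∀ j, g j = φ (Pi.single j 1, 0) := ⟨_, fun _ => rfl⟩
  obtain ⟨κ, hκ⟩ : ∃ κ, κ = -φ (0, 1) := ⟨_, rfl⟩
  have hφ : ∀ (z : I → ℝ) (s : ℝ), φ (z, s) = ∑ j, z j * g j - κ * s := by
    intro z s
    have e1 : (z, s) = ∑ j, z j • ((Pi.single j 1, 0) : (I → ℝ) × ℝ)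
        + s • ((0, 1) : (I → ℝ) × ℝ) := by
      refine Prod.ext ?_ ?_
      · ext k
        simp [Prod.fst_sum, Finset.sum_apply, Pi.single_apply]
      · simp [Prod.snd_sum]
    rw [e1, map_add, map_sum]
    simp only [map_smul, smul_eq_mul, hg, hκ]
    ring
  have hκ0 : 0 ≤ κ := by
    by_contra hneg
    push Not at hneg
    obtain ⟨s, hs1, hs2⟩ : ∃ s ≤ t, ∑ j, b j * g j - κ * s ≤ v := by
      refine ⟨min t ((∑ j, b j * g j - v) / κ), min_le_left _ _, ?_⟩
      have := mul_le_mul_of_nonpos_left (min_le_right t ((∑ j, b j * g j - v) / κ)) hneg.le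
      rw [mul_div_cancel₀ _ hneg.ne] at this
      linarith
    have := h2 (b, s) ⟨rfl, hs1⟩
    rw [hφ] at this
    linarith
  have hmax : ∀ i, ∃ j, ∀ k, g k - κ * dist (y i) (y k) ≤ g j - κ * dist (y i) (y j) := fun i =>
    Finite.exists_max fun k => g k - κ * dist (y i) (y k)
  choose J hJ using hmax
  obtain ⟨F, hF⟩ : ∃ F : I → ℝ, ∀ i, F i = g (J i) - κ * dist (y i) (y (J i)) :=
    ⟨_, fun _ => rfl⟩
  have hFg : ∀ i, g i ≤ F i := fun i => by
    have := hJ i i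
    rw [dist_self] at this
    rw [hF]; linarith
  have hFlip : ∀ i k, F k - F i ≤ κ * dist (y i) (y k) := fun i k => by
    have e1 := hJ i (J k)
    have e2 := mul_le_mul_of_nonneg_left (dist_triangle (y i) (y k) (y (J k))) hκ0
    rw [hF, hF]; linarith
  have hA : ∑ i, a i * F i < u := by
    have := h1 (L fun i j => if j = J i then a i else 0) ⟨_, by
      rw [hS]
      exact ⟨fun i j => by dsimp only; split_ifs <;> simp [ha i], fun i => by simp⟩, rfl⟩
    rw [hL, hφ] at this
    refine lt_of_eq_of_lt ?_ this
    simp only [sum_mul]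
    rw [Finset.sum_comm, mul_sum, ← sum_sub_distrib]
    refine sum_congr rfl fun i _ => ?_
    simp only [ite_mul, zero_mul, Finset.sum_ite_eq', mem_univ, if_true]
    rw [hF]; ring
  have hB : v < ∑ j, b j * F j - κ * t := by
    have := h2 (b, t) ⟨rfl, (le_refl t : t ≤ t)⟩
    rw [hφ] at this
    have e1 := sum_le_sum fun j (_ : j ∈ Finset.univ) =>
      mul_le_mul_of_nonneg_left (hFg j) (hb j)
    linarith
  rcases hκ0.eq_or_lt with hκz | hκp
  · obtain ⟨i0⟩ := hne
    have hconst : ∀ i, F i = F i0 := fun i => by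
      have e1 := hFlip i i0
      have e2 := hFlip i0 i
      rw [← hκz, zero_mul] at e1 e2
      linarith
    simp only [hconst, ← sum_mul, ha1, hb1] at hA hB
    rw [← hκz] at hB
    linarith
  · have := h (fun i => -(F i / κ)) fun i j => by
      have e1 := hFlip i j
      have e2 := hFlip j i
      rw [dist_comm] at e2
      rw [show -(F i / κ) - -(F j / κ) = (F j - F i) / κ by ring, abs_div, abs_of_pos hκp,
        div_le_iff₀ hκp, abs_le]
      constructor <;> linarith
    have e3 : ∑ i, -(F i / κ) * (a i - b i) = (∑ j, b j * F j - ∑ i, a i * F i) / κ := by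
      rw [← sum_sub_distrib, sum_div]
      exact sum_congr rfl fun i _ => by ring
    rw [e3, div_le_iff₀ hκp] at this
    linarith

/-- A coupling of `a` and `b` modified into a coupling of `a'` and `b`. -/
def adjustCoupling (π : I → I → ℝ) (a b a' : I → ℝ) (i j : I) : ℝ :=
  min (a' i) (a i) / a i * π i j
    + (a' i - min (a' i) (a i)) * (b j - ∑ k, min (a' k) (a k) / a k * π k j)
      / ∑ k, (a' k - min (a' k) (a k))

variable {π : I → I → ℝ} {a b a' : I → ℝ}

lemma adjustCoupling_spec (ha' : ∀ i, 0 ≤ a' i) (ha1 : ∑ i, a' i = 1) (hb1 : ∑ j, b j = 1)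
    (hπ : ∀ i j, 0 ≤ π i j) (h1 : ∀ i, ∑ j, π i j = a i) (h2 : ∀ j, ∑ i, π i j = b j) :
    (∀ i j, 0 ≤ adjustCoupling π a b a' i j) ∧ (∀ i, ∑ j, adjustCoupling π a b a' i j = a' i) ∧
    (∀ j, ∑ i, adjustCoupling π a b a' i j = b j) ∧
    ∀ (c : I → I → ℝ) (M : ℝ), (∀ i j, 0 ≤ c i j) → (∀ i j, c i j ≤ M) →
      ∑ i, ∑ j, adjustCoupling π a b a' i j * c i j
        ≤ ∑ i, ∑ j, π i j * c i j + M * ∑ i, |a' i - a i| := by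
  have ha : ∀ i, 0 ≤ a i := fun i => h1 i ▸ sum_nonneg fun j _ => hπ i j
  obtain ⟨q, hq⟩ : ∃ q : I → ℝ, ∀ i, q i = min (a' i) (a i) := ⟨_, fun _ => rfl⟩
  have hq0 : ∀ i, 0 ≤ q i := fun i => hq i ▸ le_min (ha' i) (ha i)
  have hq1 : ∀ i, q i / a i ≤ 1 := fun i =>
    div_le_one_of_le₀ (hq i ▸ min_le_right _ _) (ha i)
  have hqa : ∀ i, q i / a i * a i = q i := fun i => by
    rcases (ha i).eq_or_lt with h | h
    · rw [← h, mul_zero]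
      exact ((hq0 i).antisymm (by rw [hq, ← h]; exact min_le_right _ _))
    · field_simp
  obtain ⟨ρ, hρ⟩ : ∃ ρ : I → ℝ, ∀ i, ρ i = a' i - q i := ⟨_, fun _ => rfl⟩
  obtain ⟨τ, hτ⟩ : ∃ τ : I → ℝ, ∀ j, τ j = b j - ∑ k, q k / a k * π k j := ⟨_, fun _ => rfl⟩
  obtain ⟨ε, hε⟩ : ∃ ε, ε = ∑ k, ρ k := ⟨_, rfl⟩
  have hρ0 : ∀ i, 0 ≤ ρ i := fun i => by
    rw [hρ, hq]; linarith [min_le_left (a' i) (a i)]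
  have hqπ : ∀ i j, q i / a i * π i j ≤ π i j := fun i j =>
    mul_le_of_le_one_left (hπ i j) (hq1 i)
  have hτ0 : ∀ j, 0 ≤ τ j := fun j => by
    rw [hτ, ← h2 j]; linarith [sum_le_sum fun i (_ : i ∈ Finset.univ) => hqπ i j]
  have hε0 : 0 ≤ ε := hε ▸ sum_nonneg fun i _ => hρ0 i
  have hτε : ∑ j, τ j = ε := by
    simp only [hτ, hε, hρ, sum_sub_distrib, hb1, ha1]
    rw [Finset.sum_comm]
    simp only [← mul_sum, h1, hqa]
  have hadj : ∀ i j, adjustCoupling π a b a' i j = q i / a i * π i j + ρ i * τ j / ε :=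
    fun i j => by simp only [adjustCoupling, hρ, hτ, hε, hq]
  have hρε : ∀ i, ρ i * ε / ε = ρ i := fun i => by
    rcases hε0.eq_or_lt with h | h
    · have : ρ i = 0 := (Finset.sum_eq_zero_iff_of_nonneg fun k _ => hρ0 k).1
        (hε.symm.trans h.symm) i (mem_univ i)
      rw [this, zero_mul, zero_div]
    · field_simp
  have hτε' : ∀ j, ε * τ j / ε = τ j := fun j => by
    rcases hε0.eq_or_lt with h | h
    · have : τ j = 0 := (Finset.sum_eq_zero_iff_of_nonneg fun k _ => hτ0 k).1
        (hτε.trans h.symm) j (mem_univ j)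
      rw [this, mul_zero, zero_div]
    · field_simp
  have hrow : ∀ i, ∑ j, ρ i * τ j / ε = ρ i := fun i => by
    rw [← sum_div, ← mul_sum, hτε, hρε]
  have hcol : ∀ j, ∑ i, ρ i * τ j / ε = τ j := fun j => by
    rw [← sum_div, ← sum_mul, ← hε, hτε']
  have hpos : ∀ i j, 0 ≤ ρ i * τ j / ε := fun i j =>
    div_nonneg (mul_nonneg (hρ0 i) (hτ0 j)) hε0
  simp only [hadj]
  refine ⟨fun i j => add_nonneg (mul_nonneg (div_nonneg (hq0 i) (ha i)) (hπ i j)) (hpos i j),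
    fun i => ?_, fun j => ?_, fun c M hc hM => ?_⟩
  · rw [sum_add_distrib, ← mul_sum, h1, hqa, hrow, hρ]; ring
  · rw [sum_add_distrib, hcol, hτ]; ring
  · have e1 : ∀ i j, (q i / a i * π i j + ρ i * τ j / ε) * c i j
        ≤ π i j * c i j + M * (ρ i * τ j / ε) := fun i j => by
      have f1 := mul_le_mul_of_nonneg_right (hqπ i j) (hc i j)
      have f2 := mul_le_mul_of_nonneg_left (hM i j) (hpos i j)
      linarith
    refine (sum_le_sum fun i _ => sum_le_sum fun j _ => e1 i j).trans ?_
    simp only [sum_add_distrib, ← mul_sum, hrow]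
    have hM0 : 0 ≤ M := by
      by_contra hM0
      have hne : Nonempty I := by
        by_contra hI
        rw [not_nonempty_iff] at hI
        simp at ha1
      obtain ⟨i⟩ := hne
      linarith [hc i i, hM i i]
    gcongr with i _
    rw [hρ, hq]
    rcases le_total (a' i) (a i) with h | h
    · rw [min_eq_left h, sub_self]; exact abs_nonneg _
    · rw [min_eq_right h]; exact le_abs_self _

lemma exists_coupling_lipschitz (y : I → E) {a b : I → ℝ} (ha : ∀ i, 0 ≤ a i)
    (hb : ∀ i, 0 ≤ b i) (ha1 : ∑ i, a i = 1) (hb1 : ∑ i, b i = 1) {η : ℝ} (hη : 0 < η) :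
    ∃ (π : I → I → ℝ) (F : E → ℝ), (∀ i j, 0 ≤ π i j) ∧ (∀ i, ∑ j, π i j = a i) ∧
      (∀ j, ∑ i, π i j = b j) ∧ LipschitzWith 1 F ∧
      ∑ i, ∑ j, π i j * dist (y i) (y j) ≤ ∑ i, F (y i) * (a i - b i) + η := by
  have hne : Nonempty I := by
    by_contra hI
    rw [not_nonempty_iff] at hI
    simp at ha1
  obtain ⟨i0⟩ := hne
  obtain ⟨V, hV⟩ : ∃ V : Set ℝ, V = {v | ∃ F : E → ℝ, LipschitzWith 1 F ∧
    v = ∑ i, F (y i) * (a i - b i)} := ⟨_, rfl⟩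
  have hbdd : BddAbove V := by
    refine ⟨∑ i, dist (y i) (y i0) * |a i - b i|, ?_⟩
    rw [hV]
    rintro _ ⟨F, hF, rfl⟩
    have e1 : ∑ i, F (y i) * (a i - b i) = ∑ i, (F (y i) - F (y i0)) * (a i - b i) := by
      simp only [sub_mul, sum_sub_distrib, ← mul_sum, ha1, hb1, sub_self, mul_zero,
        sub_zero]
    rw [e1]
    refine sum_le_sum fun i _ => (le_abs_self _).trans ?_
    rw [abs_mul]
    refine mul_le_mul_of_nonneg_right ?_ (abs_nonneg _)
    have := hF.dist_le_mul (y i) (y i0)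
    rwa [NNReal.coe_one, one_mul, Real.dist_eq] at this
  have hVne : V.Nonempty := by
    rw [hV]
    exact ⟨_, fun _ => 0, LipschitzWith.const' 0 |>.weaken zero_le_one, rfl⟩
  obtain ⟨v, hv, hvs⟩ := exists_lt_of_lt_csSup hVne (sub_lt_self (sSup V) hη)
  obtain ⟨F, hF, hFv⟩ : v ∈ {v | ∃ F : E → ℝ, LipschitzWith 1 F ∧
    v = ∑ i, F (y i) * (a i - b i)} := hV ▸ hv
  obtain ⟨π, h0, h1, h2, h3⟩ := exists_coupling_le_of_lipschitz y ha hb ha1 hb1 (t := sSup V) (by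
    intro f hf
    refine le_csSup hbdd ?_
    have hyf : ∀ i j, y i = y j → f i = f j := fun i j h => by
      have := hf i j
      rw [h, dist_self] at this
      exact sub_eq_zero.1 (abs_nonpos_iff.1 this)
    have hfac : ∀ i, (f ∘ Function.surjInv (Set.rangeFactorization_surjective (f := y)))
        ⟨y i, Set.mem_range_self i⟩ = f i := fun i => by
      refine hyf _ _ ?_
      have := Function.surjInv_eq (Set.rangeFactorization_surjective (f := y))
        ⟨y i, Set.mem_range_self i⟩
      exact congrArg Subtype.val this
    obtain ⟨f₀, hf₀⟩ : ∃ f₀ : E → ℝ, ∀ i, f₀ (y i) = f i := by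
      classical
      refine ⟨fun e => if h : e ∈ Set.range y then
        (f ∘ Function.surjInv (Set.rangeFactorization_surjective (f := y))) ⟨e, h⟩ else 0,
        fun i => ?_⟩
      beta_reduce
      rw [dif_pos (Set.mem_range_self i)]
      exact hfac i
    have hlip : LipschitzOnWith 1 f₀ (Set.range y) := by
      refine LipschitzOnWith.of_dist_le_mul ?_
      rintro _ ⟨i, rfl⟩ _ ⟨j, rfl⟩
      rw [hf₀, hf₀, NNReal.coe_one, one_mul, Real.dist_eq]
      exact hf i j
    obtain ⟨G, hG, hGe⟩ := hlip.extend_real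
    rw [hV]
    refine ⟨G, hG, sum_congr rfl fun i _ => ?_⟩
    rw [← hGe (Set.mem_range_self i), hf₀])
  exact ⟨π, F, h0, h1, h2, hF, by rw [← hFv]; linarith⟩

/-- A measurable family of couplings that is almost optimal, with almost optimal potentials that
depend only on a finite label. -/
lemma exists_measurable_coupling {𝓔 : Type*} [MeasurableSpace 𝓔] (y : I → E) {α : 𝓔 → I → ℝ}
    {b : I → ℝ} (hαm : ∀ i, Measurable fun e => α e i) (hα : ∀ e i, 0 ≤ α e i)
    (hα1 : ∀ e, ∑ i, α e i = 1) (hb : ∀ i, 0 ≤ b i) (hb1 : ∑ i, b i = 1) {η : ℝ} (hη : 0 < η) :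
    ∃ (N : ℕ) (c : 𝓔 → I → Fin (N + 1)) (F : (I → Fin (N + 1)) → E → ℝ) (π : 𝓔 → I → I → ℝ),
      Measurable c ∧ (∀ j, LipschitzWith 1 (F j)) ∧ (∀ i j, Measurable fun e => π e i j) ∧
      (∀ e i j, 0 ≤ π e i j) ∧ (∀ e i, ∑ j, π e i j = α e i) ∧ (∀ e j, ∑ i, π e i j = b j) ∧
      ∀ e, ∑ i, ∑ j, π e i j * dist (y i) (y j)
        ≤ ∑ i, F (c e) (y i) * (α e i - b i) + η := by
  classical
  obtain ⟨M, hM⟩ : ∃ M, ∀ i j, dist (y i) (y j) ≤ M := by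
    obtain ⟨M, hM⟩ := Set.Finite.bddAbove (Set.finite_range fun q : I × I => dist (y q.1) (y q.2))
    exact ⟨M, fun i j => hM ⟨(i, j), rfl⟩⟩
  obtain ⟨N, hN⟩ := exists_nat_gt (4 * |M| * Fintype.card I / η)
  have hN0 : (0 : ℝ) < N := lt_of_le_of_lt (by positivity) hN
  obtain ⟨c, hc⟩ : ∃ c : 𝓔 → I → Fin (N + 1), ∀ e i, c e i = Fin.ofNat (N + 1) ⌊N * α e i⌋₊ :=
    ⟨_, fun _ _ => rfl⟩
  have hcm : Measurable c := by
    refine measurable_pi_iff.2 fun i => ?_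
    simp only [hc]
    exact (measurable_of_countable (Fin.ofNat (N + 1))).comp
      (Nat.measurable_floor.comp ((hαm i).const_mul _))
  have hα_le : ∀ e i, α e i ≤ 1 := fun e i => by
    rw [← hα1 e]
    exact Finset.single_le_sum (fun k _ => hα e k) (mem_univ i)
  have hcv : ∀ e i, ((c e i : Fin (N + 1)) : ℕ) = ⌊N * α e i⌋₊ := fun e i => by
    rw [hc, Fin.val_ofNat]
    refine Nat.mod_eq_of_lt (Nat.lt_succ_of_le (Nat.floor_le_of_le ?_))
    exact mul_le_of_le_one_right hN0.le (hα_le e i)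
  have hclose : ∀ e e', c e = c e' → ∀ i, |α e i - α e' i| ≤ 1 / N := by
    intro e e' h i
    have h1 : ⌊N * α e i⌋₊ = ⌊N * α e' i⌋₊ := by rw [← hcv, ← hcv, h]
    have a1 := Nat.floor_le (mul_nonneg hN0.le (hα e i))
    have a2 := Nat.floor_le (mul_nonneg hN0.le (hα e' i))
    have a3 := Nat.lt_floor_add_one (N * α e i)
    have a4 := Nat.lt_floor_add_one (N * α e' i)
    rw [h1] at a1 a3
    have a5 : |α e i - α e' i| * N = |N * α e i - N * α e' i| := by
      rw [← mul_sub, abs_mul, abs_of_pos hN0, mul_comm]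
    rw [le_div_iff₀ hN0, a5, abs_le]
    constructor <;> linarith
  have hrep : ∀ j : I → Fin (N + 1), ∃ (a : I → ℝ) (π : I → I → ℝ) (F : E → ℝ),
      LipschitzWith 1 F ∧ ∀ e, c e = j →
        (∀ i j, 0 ≤ π i j) ∧ (∀ i, ∑ j, π i j = a i) ∧ (∀ j, ∑ i, π i j = b j) ∧
        ∑ i, a i = 1 ∧ (∀ i, |α e i - a i| ≤ 1 / N) ∧
        ∑ i, ∑ j, π i j * dist (y i) (y j) ≤ ∑ i, F (y i) * (a i - b i) + η / 2 := by
    intro j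
    by_cases hj : ∃ e, c e = j
    · obtain ⟨e0, he0⟩ := hj
      obtain ⟨π, F, h0, h1, h2, hF, h3⟩ :=
        exists_coupling_lipschitz y (hα e0) hb (hα1 e0) hb1 (half_pos hη)
      exact ⟨α e0, π, F, hF, fun e he => ⟨h0, h1, h2, hα1 e0, hclose e e0 (he.trans he0.symm), h3⟩⟩
    · exact ⟨0, 0, fun _ => 0, LipschitzWith.const' 0 |>.weaken zero_le_one,
        fun e he => (hj ⟨e, he⟩).elim⟩
  choose a π F hF h using hrep
  refine ⟨N, c, F, fun e => adjustCoupling (π (c e)) (a (c e)) b (α e), hcm, hF, fun i j => ?_,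
    fun e => ?_, fun e => ?_, fun e => ?_, fun e => ?_⟩
  · have hm : ∀ {γ : Type} [MeasurableSpace γ] (G : (I → Fin (N + 1)) → γ),
        Measurable fun e => G (c e) := fun G => (measurable_of_countable G).comp hcm
    have m1 : ∀ k, Measurable fun e => a (c e) k := fun k => hm fun j => a j k
    have m2 : ∀ k l, Measurable fun e => π (c e) k l := fun k l => hm fun j => π j k l
    have m3 : ∀ k, Measurable fun e => min (α e k) (a (c e) k) := fun k => (hαm k).min (m1 k)
    simp only [adjustCoupling]
    refine (((m3 i).div (m1 i)).mul (m2 i j)).add ((((hαm i).sub (m3 i)).mul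
      (measurable_const.sub (measurable_fun_sum _ fun k _ =>
        ((m3 k).div (m1 k)).mul (m2 k j)))).div
      (measurable_fun_sum _ fun k _ => (hαm k).sub (m3 k)))
  all_goals obtain ⟨g0, g1, g2, g3, g4, g5⟩ := h (c e) e rfl
  all_goals obtain ⟨s0, s1, s2, s3⟩ := adjustCoupling_spec (hα e) (hα1 e) hb1 g0 g1 g2
  · exact s0
  · exact s1
  · exact s2
  · have hM0 : ∀ i j, dist (y i) (y j) ≤ |M| := fun i j => (hM i j).trans (le_abs_self M)
    have e1 := s3 (fun i j => dist (y i) (y j)) |M| (fun _ _ => dist_nonneg) hM0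
    have hne : Nonempty I := by
      by_contra hI
      rw [not_nonempty_iff] at hI
      simp at hb1
    obtain ⟨i0⟩ := hne
    have hsum : ∑ i, |α e i - a (c e) i| ≤ Fintype.card I * (1 / N) := by
      refine (sum_le_sum fun i _ => g4 i).trans ?_
      rw [sum_const, card_univ, nsmul_eq_mul]
    have e2 : ∑ i, F (c e) (y i) * (a (c e) i - b i) - ∑ i, F (c e) (y i) * (α e i - b i)
        ≤ |M| * ∑ i, |α e i - a (c e) i| := by
      have e3 : ∑ i, F (c e) (y i) * (a (c e) i - b i) - ∑ i, F (c e) (y i) * (α e i - b i)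
          = ∑ i, (F (c e) (y i) - F (c e) (y i0)) * (a (c e) i - α e i) := by
        have : ∑ i, F (c e) (y i0) * (a (c e) i - α e i) = 0 := by
          rw [← mul_sum, sum_sub_distrib, g3, hα1, sub_self, mul_zero]
        rw [← sum_sub_distrib, ← sub_zero (∑ i, _), ← this, ← sum_sub_distrib]
        exact sum_congr rfl fun i _ => by ring
      rw [e3, mul_sum]
      refine sum_le_sum fun i _ => (le_abs_self _).trans ?_
      rw [abs_mul, abs_sub_comm (a (c e) i)]
      refine mul_le_mul_of_nonneg_right ?_ (abs_nonneg _)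
      have := (hF (c e)).dist_le_mul (y i) (y i0)
      rw [NNReal.coe_one, one_mul, Real.dist_eq] at this
      exact this.trans (hM0 _ _)
    have e4 : |M| * ∑ i, |α e i - a (c e) i| ≤ η / 4 := by
      refine (mul_le_mul_of_nonneg_left hsum (abs_nonneg M)).trans ?_
      rw [div_lt_iff₀ hη] at hN
      rw [mul_one_div, ← mul_div_assoc, div_le_iff₀ hN0]
      linarith
    linarith

end FiniteTransport

section Label

variable {E : Type*} [NormedAddCommGroup E] [MeasurableSpace E] [BorelSpace E]
  [SecondCountableTopology E]

lemma exists_finite_label {ρ : Measure E} [IsFiniteMeasure ρ] (hρ : Integrable (fun y => y) ρ)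
    {η : ℝ} (hη : 0 < η) :
    ∃ (n : ℕ) (lab : E → Fin n) (y : Fin n → E), Measurable lab ∧
      ∫ v, ‖v - y (lab v)‖ ∂ρ ≤ η := by
  obtain ⟨s, hs, hsm⟩ := (memLp_one_iff_integrable.2 hρ).exists_simpleFunc_eLpNorm_sub_lt
    ENNReal.one_ne_top (ε := ofReal η) (by simpa using hη)
  obtain ⟨n, ⟨q⟩⟩ := Finite.exists_equiv_fin s.range
  refine ⟨n, fun v => q ⟨s v, s.mem_range_self v⟩, fun i => (q.symm i : E), ?_, ?_⟩
  · exact (measurable_of_countable q).comp (s.measurable.subtype_mk)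
  · simp only [Equiv.symm_apply_apply]
    rw [eLpNorm_one_eq_lintegral_enorm] at hs
    change ∫ v, ‖((fun y : E => y) - ⇑s) v‖ ∂ρ ≤ η
    rw [integral_norm_eq_lintegral_enorm
      (hρ.aestronglyMeasurable.sub s.measurable.aestronglyMeasurable)]
    exact ENNReal.toReal_le_of_le_ofReal hη.le hs.le

variable {X 𝓔 : Type*} [MeasurableSpace X] [MeasurableSpace 𝓔]

lemma exists_cond_weights {n : ℕ} {μ : Measure X} [IsProbabilityMeasure μ] {r : X → 𝓔}
    {l : X → Fin n} (hr : Measurable r) (hl : Measurable l) :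
    ∃ α : 𝓔 → Fin n → ℝ, (∀ i, Measurable fun e => α e i) ∧ (∀ e i, 0 ≤ α e i) ∧
      (∀ e, ∑ i, α e i = 1) ∧
      ∀ Φ : 𝓔 → Fin n → ℝ≥0∞, (∀ i, Measurable fun e => Φ e i) →
        ∫⁻ x, Φ (r x) (l x) ∂μ = ∫⁻ x, ∑ i, Φ (r x) i * ofReal (α (r x) i) ∂μ := by
  have hne : Nonempty (Fin n) := by
    have : Nonempty X := μ.nonempty_of_neZero
    exact this.map l
  refine ⟨fun e i => (condDistrib l r μ e).real {i}, fun i => ?_, fun _ _ => measureReal_nonneg,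
    fun e => ?_, fun Φ hΦ => ?_⟩
  · exact ((condDistrib l r μ).measurable_coe (measurableSet_singleton i)).ennreal_toReal
  · rw [sum_measureReal_singleton]
    simp
  · have hm : Measurable (uncurry Φ) := by
      have : uncurry Φ = fun q : 𝓔 × Fin n => ∑ i, if q.2 = i then Φ q.1 i else 0 := by
        ext q; simp [uncurry]
      rw [this]
      exact measurable_fun_sum _ fun i _ => Measurable.ite
        (measurable_snd (measurableSet_singleton i)) ((hΦ i).comp measurable_fst) measurable_const
    have h1 : ∫⁻ x, Φ (r x) (l x) ∂μ
        = ∫⁻ q, uncurry Φ q ∂(μ.map fun x => (r x, l x)) := by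
      rw [lintegral_map hm (hr.prodMk hl)]; rfl
    rw [h1, ← compProd_map_condDistrib hl.aemeasurable, Measure.lintegral_compProd hm,
      lintegral_map hm.lintegral_kernel_prod_right' hr]
    refine lintegral_congr fun x => ?_
    rw [lintegral_fintype]
    refine sum_congr rfl fun i _ => ?_
    rw [ofReal_measureReal]; rfl

end Label

section CouplingDensity

/-- The density, with respect to independence, of a finite coupling. -/
def couplingDensity {n : ℕ} (π : Fin n → Fin n → ℝ) (a b : Fin n → ℝ) (i j : Fin n) : ℝ≥0∞ :=
  if a i = 0 then 1 else ofReal (π i j / (a i * b j))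

variable {n : ℕ} {π : Fin n → Fin n → ℝ} {a b : Fin n → ℝ}

lemma mul_couplingDensity (hπ : ∀ i j, 0 ≤ π i j) (h1 : ∀ i, ∑ j, π i j = a i)
    (h2 : ∀ j, ∑ i, π i j = b j) (i j : Fin n) :
    ofReal (a i) * couplingDensity π a b i j * ofReal (b j)
      = ofReal (π i j) := by
  have ha : 0 ≤ a i := h1 i ▸ sum_nonneg fun j _ => hπ i j
  have hb : 0 ≤ b j := h2 j ▸ sum_nonneg fun i _ => hπ i j
  have hπa : π i j ≤ a i := h1 i ▸ Finset.single_le_sum (fun k _ => hπ i k) (mem_univ j)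
  have hπb : π i j ≤ b j := h2 j ▸ Finset.single_le_sum (fun k _ => hπ k j) (mem_univ i)
  unfold couplingDensity
  split_ifs with h
  · rw [h, ENNReal.ofReal_zero, zero_mul, zero_mul,
      le_antisymm (h ▸ hπa) (hπ i j), ENNReal.ofReal_zero]
  · rw [← ofReal_mul ha, ← ofReal_mul
      (mul_nonneg ha (div_nonneg (hπ i j) (mul_nonneg ha hb)))]
    congr 1
    rcases hb.eq_or_lt with hb0 | hb0
    · rw [← hb0, mul_zero]
      exact (le_antisymm (hb0 ▸ hπb) (hπ i j)).symm
    · field_simp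

lemma sum_couplingDensity_mul (hπ : ∀ i j, 0 ≤ π i j) (h1 : ∀ i, ∑ j, π i j = a i)
    (h2 : ∀ j, ∑ i, π i j = b j) (hb1 : ∑ j, b j = 1) (i : Fin n) :
    ∑ j, couplingDensity π a b i j * ofReal (b j) = 1 := by
  have ha : 0 ≤ a i := h1 i ▸ sum_nonneg fun j _ => hπ i j
  have hb : ∀ j, 0 ≤ b j := fun j => h2 j ▸ sum_nonneg fun i _ => hπ i j
  by_cases h : a i = 0
  · simp only [couplingDensity, h, if_true, one_mul]
    rw [← ofReal_sum_of_nonneg fun j _ => hb j, hb1, ENNReal.ofReal_one]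
  · have h0 : ofReal (a i) ≠ 0 := by
      rw [Ne, ENNReal.ofReal_eq_zero, not_le]; exact lt_of_le_of_ne ha (Ne.symm h)
    have h3 : ofReal (a i) * ∑ j, couplingDensity π a b i j * ofReal (b j)
        = ofReal (a i) := by
      simp only [mul_sum, ← mul_assoc, mul_couplingDensity hπ h1 h2]
      rw [← ofReal_sum_of_nonneg fun j _ => hπ i j, h1]
    exact (ENNReal.mul_right_inj h0 ofReal_ne_top).1 (h3.trans (mul_one _).symm)

lemma sum_mul_couplingDensity (hπ : ∀ i j, 0 ≤ π i j) (h1 : ∀ i, ∑ j, π i j = a i)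
    (h2 : ∀ j, ∑ i, π i j = b j) {j : Fin n} (hj : b j ≠ 0) :
    ∑ i, ofReal (a i) * couplingDensity π a b i j = 1 := by
  have hb : 0 ≤ b j := h2 j ▸ sum_nonneg fun i _ => hπ i j
  have h0 : ofReal (b j) ≠ 0 := by
    rw [Ne, ENNReal.ofReal_eq_zero, not_le]; exact lt_of_le_of_ne hb (Ne.symm hj)
  have h3 : (∑ i, ofReal (a i) * couplingDensity π a b i j) * ofReal (b j)
      = 1 * ofReal (b j) := by
    simp only [sum_mul, mul_couplingDensity hπ h1 h2]
    rw [← ofReal_sum_of_nonneg fun i _ => hπ i j, h2, one_mul]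
  exact (ENNReal.mul_left_inj h0 ofReal_ne_top).1 h3

lemma integrable_comp_lipschitz {X E J : Type*} [MeasurableSpace X] [NormedAddCommGroup E]
    [MeasurableSpace E] [MeasurableSpace J] {μ : Measure X} [IsFiniteMeasure μ]
    {F : J → E → ℝ} (hFm : Measurable fun q : J × E => F q.1 q.2) {A : ℝ}
    (hFA : ∀ j v, |F j v| ≤ A + ‖v‖) {s : X → J} {q : X → E} (hs : Measurable s)
    (hq : Measurable q) (hqi : Integrable q μ) : Integrable (fun u => F (s u) (q u)) μ :=
  Integrable.mono' ((integrable_const A).add hqi.norm)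
    (hFm.comp (hs.prodMk hq)).aestronglyMeasurable (ae_of_all _ fun _ => hFA _ _)

variable {Z E X 𝓔 : Type*} [MeasurableSpace Z] [NormedAddCommGroup E] [MeasurableSpace E]
  [BorelSpace E] [SecondCountableTopology E] [MeasurableSpace X] [MeasurableSpace 𝓔]

theorem exists_coupling_density {μ : Measure X} [IsProbabilityMeasure μ] {ν : Measure Z}
    [IsProbabilityMeasure ν] {r : X → 𝓔} {f : X → E} {g : Z → E} (hr : Measurable r)
    (hfm : Measurable f) (hgm : Measurable g) (hf : Integrable f μ) (hg : Integrable g ν)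
    {δ η : ℝ} (hη : 0 < η)
    (hδ : ∀ (J : Type) [MeasurableSpace J] [Finite J] [MeasurableSingletonClass J] (c : 𝓔 → J)
      (F : J → E → ℝ), Measurable c → (∀ j, LipschitzWith 1 (F j)) →
      ∫ x, (F (c (r x)) (f x) - ∫ z, F (c (r x)) (g z) ∂ν) ∂μ ≤ δ) :
    ∃ w : (𝓔 × E) × Z → ℝ≥0∞, Measurable w ∧ (∀ q, ∫⁻ z, w (q, z) ∂ν = 1) ∧
      (∀ (φ : 𝓔 → ℝ≥0∞) (ψ : Z → ℝ≥0∞), Measurable φ → Measurable ψ →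
        ∫⁻ x, φ (r x) * ∫⁻ z, ψ z * w ((r x, f x), z) ∂ν ∂μ
          = (∫⁻ x, φ (r x) ∂μ) * ∫⁻ z, ψ z ∂ν) ∧
      ∫⁻ x, ∫⁻ z, ‖f x - g z‖ₑ * w ((r x, f x), z) ∂ν ∂μ ≤ ofReal (δ + η) := by
  obtain ⟨κ, hκ, hκη⟩ : ∃ κ : ℝ, 0 < κ ∧ 5 * κ ≤ η := ⟨η / 5, by positivity, by linarith⟩
  have hρ : Integrable (fun y => y) (μ.map f + ν.map g) := by
    refine Integrable.add_measure ?_ ?_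
    · exact (integrable_map_measure aestronglyMeasurable_id hfm.aemeasurable).2 hf
    · exact (integrable_map_measure aestronglyMeasurable_id hgm.aemeasurable).2 hg
  obtain ⟨n, lab, y, hlab, hy⟩ := exists_finite_label hρ hκ
  have hym : Measurable fun v => y (lab v) := (measurable_of_countable y).comp hlab
  obtain ⟨M, hM0, hM⟩ : ∃ M : ℝ, 0 ≤ M ∧ ∀ i, ‖y i‖ ≤ M := by
    obtain ⟨M, hM⟩ := Set.Finite.bddAbove (Set.finite_range fun i => ‖y i‖)
    exact ⟨|M|, abs_nonneg M, fun i => (hM ⟨i, rfl⟩).trans (le_abs_self M)⟩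
  have hyf : Integrable (fun x => y (lab (f x))) μ :=
    Integrable.of_bound (hym.comp hfm).aestronglyMeasurable M (ae_of_all _ fun _ => hM _)
  have hyg : Integrable (fun z => y (lab (g z))) ν :=
    Integrable.of_bound (hym.comp hgm).aestronglyMeasurable M (ae_of_all _ fun _ => hM _)
  have hfl : Integrable (fun x => ‖f x - y (lab (f x))‖) μ := (hf.sub hyf).norm
  have hgl : Integrable (fun z => ‖g z - y (lab (g z))‖) ν := (hg.sub hyg).norm
  have hlow : ∫ x, ‖f x - y (lab (f x))‖ ∂μ + ∫ z, ‖g z - y (lab (g z))‖ ∂ν ≤ κ := by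
    have hm : Measurable fun v => ‖v - y (lab v)‖ := (measurable_id.sub hym).norm
    rw [integral_add_measure, integral_map hfm.aemeasurable hm.aestronglyMeasurable,
      integral_map hgm.aemeasurable hm.aestronglyMeasurable] at hy
    · exact hy
    · exact (integrable_map_measure hm.aestronglyMeasurable hfm.aemeasurable).2 hfl
    · exact (integrable_map_measure hm.aestronglyMeasurable hgm.aemeasurable).2 hgl
  obtain ⟨α, hαm, hα, hα1, hαΦ⟩ := exists_cond_weights (μ := μ) hr (hlab.comp hfm)
  simp only [Function.comp_apply] at hαΦ
  have hlg : Measurable fun z => lab (g z) := hlab.comp hgm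
  obtain ⟨b, hbd⟩ : ∃ b : Fin n → ℝ, ∀ j, b j = (ν.map fun z => lab (g z)).real {j} :=
    ⟨_, fun _ => rfl⟩
  have : IsProbabilityMeasure (ν.map fun z => lab (g z)) :=
    Measure.isProbabilityMeasure_map hlg.aemeasurable
  have hb : ∀ j, 0 ≤ b j := fun j => hbd j ▸ measureReal_nonneg
  have hbν : ∀ Ψ : Fin n → ℝ≥0∞, ∫⁻ z, Ψ (lab (g z)) ∂ν = ∑ j, Ψ j * ofReal (b j) := by
    intro Ψ
    rw [← lintegral_map (f := Ψ) (measurable_of_countable _) hlg, lintegral_fintype]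
    refine sum_congr rfl fun j _ => ?_
    rw [hbd, ofReal_measureReal]
  have hbν' : ∀ Ψ : Fin n → ℝ, ∫ z, Ψ (lab (g z)) ∂ν = ∑ j, Ψ j * b j := by
    intro Ψ
    rw [← integral_map (f := Ψ) hlg.aemeasurable
      (measurable_of_countable _).aestronglyMeasurable, integral_fintype Integrable.of_finite]
    refine sum_congr rfl fun j _ => ?_
    rw [hbd, smul_eq_mul, mul_comm]
  have hb1 : ∑ j, b j = 1 := by
    have := hbν' fun _ => 1
    simpa using this.symm
  obtain ⟨N, c, F, π, hc, hF, hπm, hπ, h1, h2, hcost⟩ :=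
    exists_measurable_coupling y hαm hα hα1 hb hb1 hκ
  obtain ⟨W, hW⟩ : ∃ W : 𝓔 → Fin n → Fin n → ℝ≥0∞,
      ∀ e, W e = couplingDensity (π e) (α e) b := ⟨_, fun _ => rfl⟩
  have hWm : ∀ i j, Measurable fun e => W e i j := by
    intro i j
    simp only [hW, couplingDensity]
    exact Measurable.ite (hαm i (measurableSet_singleton 0)) measurable_const
      ((hπm i j).div ((hαm i).mul_const _)).ennreal_ofReal
  have hWm' : Measurable fun q : 𝓔 × (Fin n × Fin n) => W q.1 q.2.1 q.2.2 :=
    measurable_from_prod_countable_left fun q => hWm q.1 q.2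
  have hwm : Measurable fun q : (𝓔 × E) × Z => W q.1.1 (lab q.1.2) (lab (g q.2)) := by
    exact hWm'.comp (measurable_fst.fst.prodMk ((hlab.comp measurable_fst.snd).prodMk
      (hlab.comp (hgm.comp measurable_snd))))
  have hmain : ∀ (φ : 𝓔 → ℝ≥0∞) (ψ : Z → ℝ≥0∞), Measurable φ → Measurable ψ →
        ∫⁻ x, φ (r x) * ∫⁻ z, ψ z * W (r x) (lab (f x)) (lab (g z)) ∂ν ∂μ
          = (∫⁻ x, φ (r x) ∂μ) * ∫⁻ z, ψ z ∂ν := by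
    intro φ ψ hφ hψ
    have hm : ∀ i, Measurable fun q : 𝓔 × Z => ψ q.2 * W q.1 i (lab (g q.2)) := fun i =>
      (hψ.comp measurable_snd).mul (hWm'.comp (measurable_fst.prodMk
        (measurable_const.prodMk (hlg.comp measurable_snd))))
    rw [hαΦ (fun e i => φ e * ∫⁻ z, ψ z * W e i (lab (g z)) ∂ν) fun i =>
      hφ.mul (hm i).lintegral_prod_right',
      ← lintegral_mul_const _ (show Measurable fun x => φ (r x) from hφ.comp hr)]
    refine lintegral_congr fun x => ?_
    have hae : ∀ᵐ z ∂ν, b (lab (g z)) ≠ 0 := by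
      obtain ⟨Ψ, hΨ⟩ : ∃ Ψ : Fin n → ℝ≥0∞, ∀ j, Ψ j = if b j = 0 then 1 else 0 := ⟨_, fun _ => rfl⟩
      have h0 : ∫⁻ z, Ψ (lab (g z)) ∂ν = 0 := by
        rw [hbν]
        refine sum_eq_zero fun j _ => ?_
        rw [hΨ]
        split_ifs with h <;> simp [h]
      rw [lintegral_eq_zero_iff (show Measurable fun z => Ψ (lab (g z)) from
        (measurable_of_countable _).comp hlg)] at h0
      filter_upwards [h0] with z hz h
      simp [hΨ, h] at hz
    simp only [mul_assoc, ← mul_sum]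
    congr 1
    have hmz : ∀ i, Measurable fun z => ψ z * W (r x) i (lab (g z)) := fun i =>
      (hm i).comp measurable_prodMk_left
    simp only [← lintegral_mul_const _ (hmz _)]
    rw [← lintegral_finsetSum _ fun i _ => (hmz i).mul_const _]
    refine lintegral_congr_ae ?_
    filter_upwards [hae] with z hz
    have := sum_mul_couplingDensity (hπ (r x)) (h1 (r x)) (h2 (r x)) hz
    simp only [mul_assoc, ← mul_sum, hW]
    simp only [mul_comm (ofReal _)] at this
    rw [this, mul_one]
  have hmain1 : ∀ e i, ∫⁻ z, W e i (lab (g z)) ∂ν = 1 := fun e i => by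
    rw [hbν (W e i), hW]
    exact sum_couplingDensity_mul (hπ e) (h1 e) (h2 e) hb1 i
  have hFm : Measurable fun q : (Fin n → Fin (N + 1)) × E => F q.1 q.2 :=
    measurable_from_prod_countable_right fun j => (hF j).continuous.measurable
  obtain ⟨A, hA⟩ : ∃ A, ∀ j, |F j 0| ≤ A := by
    obtain ⟨A, hA⟩ := Set.Finite.bddAbove (Set.finite_range fun j => |F j 0|)
    exact ⟨A, fun j => hA ⟨j, rfl⟩⟩
  have hFA : ∀ j v, |F j v| ≤ A + ‖v‖ := fun j v => by
    have e1 := (hF j).dist_le_mul v 0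
    rw [NNReal.coe_one, one_mul, Real.dist_eq, dist_zero_right] at e1
    have e2 := abs_add_le (F j v - F j 0) (F j 0)
    rw [sub_add_cancel] at e2
    linarith [hA j]
  have hFy : ∀ j i, |F j (y i)| ≤ A + M := fun j i => (hFA j _).trans (by linarith [hM i])
  have hcr : Measurable fun x => c (r x) := hc.comp hr
  have hintα : Integrable (fun x => ∑ i, F (c (r x)) (y i) * α (r x) i) μ := by
    refine integrable_finsetSum _ fun i _ => ?_
    refine Integrable.mono' (integrable_const (A + M))
      ((hFm.comp (hcr.prodMk measurable_const)).mul ((hαm i).comp hr)).aestronglyMeasurable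
      (ae_of_all _ fun x => ?_)
    rw [norm_mul, norm_eq_abs, norm_eq_abs, abs_of_nonneg (hα _ _)]
    refine (mul_le_of_le_one_right (abs_nonneg _) ?_).trans (hFy _ _)
    rw [← hα1 (r x)]
    exact Finset.single_le_sum (fun k _ => hα (r x) k) (mem_univ i)
  have i1 : Integrable (fun x => F (c (r x)) (y (lab (f x)))) μ :=
    integrable_comp_lipschitz hFm hFA hcr (hym.comp hfm) hyf
  have e4 : ∀ x i, 0 ≤ F (c (r x)) (y i) + (A + M) := fun x i => by
    linarith [neg_abs_le (F (c (r x)) (y i)), hFy (c (r x)) i]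
  have e3 : ∀ x, ∑ i, F (c (r x)) (y i) * α (r x) i + (A + M)
      = ∑ i, (F (c (r x)) (y i) + (A + M)) * α (r x) i := fun x => by
    simp only [add_mul, sum_add_distrib, ← mul_sum, hα1, mul_one]
  have hswap : ∫ x, ∑ i, F (c (r x)) (y i) * α (r x) i ∂μ
      = ∫ x, F (c (r x)) (y (lab (f x))) ∂μ := by
    have e1 := hαΦ (fun e i => ofReal (F (c e) (y i) + (A + M))) fun i =>
      ((hFm.comp (hc.prodMk measurable_const)).add_const _).ennreal_ofReal
    have e2 : ∀ x, ∑ i, ofReal (F (c (r x)) (y i) + (A + M)) * ofReal (α (r x) i)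
        = ofReal (∑ i, F (c (r x)) (y i) * α (r x) i + (A + M)) := fun x => by
      rw [e3, ofReal_sum_of_nonneg fun i _ => mul_nonneg (e4 _ i) (hα _ i)]
      exact sum_congr rfl fun i _ => (ofReal_mul (e4 _ i)).symm
    simp only [e2] at e1
    have i2 := i1.add (integrable_const (A + M))
    have i3 := hintα.add (integrable_const (A + M))
    have p2 : ∀ x, 0 ≤ ∑ i, F (c (r x)) (y i) * α (r x) i + (A + M) := fun x => by
      rw [e3]
      exact sum_nonneg fun i _ => mul_nonneg (e4 _ i) (hα _ i)
    have e5 := congrArg ENNReal.toReal e1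
    rw [← integral_eq_lintegral_of_nonneg_ae (ae_of_all _ fun x => e4 _ _) i2.aestronglyMeasurable,
      ← integral_eq_lintegral_of_nonneg_ae (ae_of_all _ p2) i3.aestronglyMeasurable,
      integral_add i1 (integrable_const _), integral_add hintα (integrable_const _)] at e5
    linarith
  have mfin : ∀ G : (Fin n → Fin (N + 1)) → ℝ, Integrable (fun x => G (c (r x))) μ := fun G => by
    obtain ⟨B, hB⟩ := Set.Finite.bddAbove (Set.finite_range fun j => |G j|)
    exact Integrable.of_bound ((measurable_of_countable G).comp hcr).aestronglyMeasurable B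
      (ae_of_all _ fun x => hB ⟨_, rfl⟩)
  have j4 : Integrable (fun x => ∑ i, F (c (r x)) (y i) * b i) μ :=
    mfin fun j => ∑ i, F j (y i) * b i
  have hH : ∫ x, (∑ i, F (c (r x)) (y i) * (α (r x) i - b i) + κ) ∂μ ≤ δ + 2 * κ := by
    have d1 := hδ _ c F hc hF
    have j1 : Integrable (fun x => F (c (r x)) (f x)) μ :=
      integrable_comp_lipschitz hFm hFA hcr hfm hf
    have j2 : Integrable (fun x => ∫ z, F (c (r x)) (g z) ∂ν) μ :=
      mfin fun j => ∫ z, F j (g z) ∂ν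
    have q1 : ∀ j v i, F j (y i) ≤ F j v + ‖v - y i‖ := fun j v i => by
      have := (hF j).dist_le_mul (y i) v
      rw [NNReal.coe_one, one_mul, Real.dist_eq, dist_comm, dist_eq_norm] at this
      linarith [le_abs_self (F j (y i) - F j v)]
    have q2 : ∀ j v i, F j v ≤ F j (y i) + ‖v - y i‖ := fun j v i => by
      have := (hF j).dist_le_mul v (y i)
      rw [NNReal.coe_one, one_mul, Real.dist_eq, dist_eq_norm] at this
      linarith [le_abs_self (F j v - F j (y i))]
    have q3 : ∫ x, F (c (r x)) (y (lab (f x))) ∂μ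
        ≤ ∫ x, F (c (r x)) (f x) ∂μ + ∫ x, ‖f x - y (lab (f x))‖ ∂μ := by
      rw [← integral_add j1 hfl]
      exact integral_mono i1 (j1.add hfl) fun x => q1 _ _ _
    have q4 : ∀ j, ∫ z, F j (g z) ∂ν
        ≤ ∑ i, F j (y i) * b i + ∫ z, ‖g z - y (lab (g z))‖ ∂ν := fun j => by
      rw [← hbν' fun i => F j (y i)]
      have k1 : Integrable (fun z => F j (g z)) ν :=
        integrable_comp_lipschitz hFm hFA measurable_const hgm hg
      have k2 : Integrable (fun z => F j (y (lab (g z)))) ν :=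
        integrable_comp_lipschitz hFm hFA measurable_const (hym.comp hgm) hyg
      rw [← integral_add k2 hgl]
      exact integral_mono k1 (k2.add hgl) fun z => q2 _ _ _
    have q5 : ∫ x, ∫ z, F (c (r x)) (g z) ∂ν ∂μ
        ≤ ∫ x, ∑ i, F (c (r x)) (y i) * b i ∂μ + ∫ z, ‖g z - y (lab (g z))‖ ∂ν := by
      have := integral_mono j2 (j4.add (integrable_const (∫ z, ‖g z - y (lab (g z))‖ ∂ν)))
        fun x => q4 (c (r x))
      rw [integral_add' j4 (integrable_const _)] at this
      simpa using this
    rw [integral_sub j1 j2] at d1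
    have q6 : ∫ x, (∑ i, F (c (r x)) (y i) * (α (r x) i - b i) + κ) ∂μ
        = ∫ x, ∑ i, F (c (r x)) (y i) * α (r x) i ∂μ
          - ∫ x, ∑ i, F (c (r x)) (y i) * b i ∂μ + κ := by
      have e1 : Integrable (fun x => ∑ i, F (c (r x)) (y i) * α (r x) i
          - ∑ i, F (c (r x)) (y i) * b i) μ := hintα.sub j4
      simp only [mul_sub, sum_sub_distrib]
      rw [integral_add e1 (integrable_const _), integral_sub hintα j4]
      simp
    rw [q6, hswap]
    linarith
  have hHi : Integrable (fun x => ∑ i, F (c (r x)) (y i) * (α (r x) i - b i) + κ) μ := by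
    refine ((hintα.sub j4).add (integrable_const κ)).congr (ae_of_all _ fun x => ?_)
    simp only [Pi.add_apply, Pi.sub_apply, mul_sub, sum_sub_distrib]
  have hδ0 : 0 ≤ δ := by
    simpa using hδ Unit (fun _ => ()) (fun _ _ => 0) measurable_const
      fun _ => (LipschitzWith.const' 0).weaken zero_le_one
  have hmid : ∫⁻ x, ∫⁻ z, edist (y (lab (f x))) (y (lab (g z))) *
      W (r x) (lab (f x)) (lab (g z)) ∂ν ∂μ ≤ ofReal (δ + 2 * κ) := by
    have e1 : ∀ x, ∫⁻ z, edist (y (lab (f x))) (y (lab (g z))) *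
        W (r x) (lab (f x)) (lab (g z)) ∂ν = (fun e i => ∑ j, edist (y i) (y j) * W e i j *
          ofReal (b j)) (r x) (lab (f x)) := fun x =>
      hbν fun j => edist (y (lab (f x))) (y j) * W (r x) (lab (f x)) j
    rw [lintegral_congr e1, hαΦ (fun e i => ∑ j, edist (y i) (y j) * W e i j *
          ofReal (b j)) fun i => measurable_fun_sum _ fun j _ =>
      ((hWm i j).const_mul _).mul_const _]
    have e2 : ∀ x, ∑ i, (∑ j, edist (y i) (y j) * W (r x) i j * ofReal (b j)) *
        ofReal (α (r x) i) = ofReal (∑ i, ∑ j, π (r x) i j * dist (y i) (y j)) := by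
      intro x
      rw [ofReal_sum_of_nonneg fun i _ => sum_nonneg fun j _ =>
        mul_nonneg (hπ _ i j) dist_nonneg]
      refine sum_congr rfl fun i _ => ?_
      rw [ofReal_sum_of_nonneg fun j _ => mul_nonneg (hπ _ i j) dist_nonneg,
        sum_mul]
      refine sum_congr rfl fun j _ => ?_
      rw [ofReal_mul (hπ _ i j), ← edist_dist,
        ← mul_couplingDensity (hπ (r x)) (h1 (r x)) (h2 (r x)), hW]
      ring
    simp only [e2]
    refine (lintegral_mono fun x => ofReal_le_ofReal (hcost (r x))).trans ?_
    rw [← ofReal_integral_eq_lintegral_ofReal hHi (ae_of_all _ fun x =>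
      (sum_nonneg fun i _ => sum_nonneg fun j _ =>
        mul_nonneg (hπ _ i j) dist_nonneg).trans (hcost (r x)))]
    exact ofReal_le_ofReal hH
  refine ⟨fun q => W q.1.1 (lab q.1.2) (lab (g q.2)), hwm, fun q => hmain1 q.1 (lab q.2), hmain, ?_⟩
  have hfle : ∀ x, Measurable fun z => W (r x) (lab (f x)) (lab (g z)) := fun x =>
    (measurable_of_countable _).comp hlg
  have hmg : Measurable fun z => ‖g z - y (lab (g z))‖ₑ := (hgm.sub (hym.comp hgm)).enorm
  have hme : ∀ x, Measurable fun z => edist (y (lab (f x))) (y (lab (g z))) := fun x =>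
    (measurable_of_countable fun j => edist (y (lab (f x))) (y j)).comp hlg
  have hpt : ∀ x, ∫⁻ z, ‖f x - g z‖ₑ * W (r x) (lab (f x)) (lab (g z)) ∂ν
      ≤ ‖f x - y (lab (f x))‖ₑ + ∫⁻ z, edist (y (lab (f x))) (y (lab (g z))) *
        W (r x) (lab (f x)) (lab (g z)) ∂ν
        + 1 * ∫⁻ z, ‖g z - y (lab (g z))‖ₑ * W (r x) (lab (f x)) (lab (g z)) ∂ν := by
    intro x
    have e1 : ‖f x - y (lab (f x))‖ₑ
        = ∫⁻ z, ‖f x - y (lab (f x))‖ₑ * W (r x) (lab (f x)) (lab (g z)) ∂ν := by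
      rw [lintegral_const_mul _ (hfle x), hmain1, mul_one]
    rw [e1, one_mul, ← lintegral_add_left ((hfle x).const_mul _),
      ← lintegral_add_right _ (show Measurable fun z => ‖g z - y (lab (g z))‖ₑ *
        W (r x) (lab (f x)) (lab (g z)) from hmg.mul (hfle x))]
    refine lintegral_mono fun z => ?_
    simp only [← add_mul]
    refine mul_le_mul_left ?_ _
    rw [← edist_eq_enorm_sub, ← edist_eq_enorm_sub, ← edist_eq_enorm_sub,
      edist_comm (g z) (y (lab (g z)))]
    exact edist_triangle4 _ _ _ _
  have hmX : Measurable fun x => ‖f x - y (lab (f x))‖ₑ := (hfm.sub (hym.comp hfm)).enorm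
  have hmW : Measurable fun q : X × Z => W (r q.1) (lab (f q.1)) (lab (g q.2)) :=
    hWm'.comp ((hr.comp measurable_fst).prodMk ((hlab.comp (hfm.comp measurable_fst)).prodMk
      (hlg.comp measurable_snd)))
  have hm3 : Measurable fun x => 1 * ∫⁻ z, ‖g z - y (lab (g z))‖ₑ *
      W (r x) (lab (f x)) (lab (g z)) ∂ν :=
    (((hmg.comp measurable_snd).mul hmW).lintegral_prod_right').const_mul 1
  refine (lintegral_mono hpt).trans ?_
  rw [lintegral_add_right _ hm3, lintegral_add_left hmX, hmain (fun _ => 1) _ measurable_const hmg,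
    lintegral_const, measure_univ, mul_one, one_mul]
  have hl1 : ∫⁻ x, ‖f x - y (lab (f x))‖ₑ ∂μ
      = ofReal (∫ x, ‖f x - y (lab (f x))‖ ∂μ) :=
    (ofReal_integral_norm_eq_lintegral_enorm (hf.sub hyf)).symm
  have hl2 : ∫⁻ z, ‖g z - y (lab (g z))‖ₑ ∂ν
      = ofReal (∫ z, ‖g z - y (lab (g z))‖ ∂ν) :=
    (ofReal_integral_norm_eq_lintegral_enorm (hg.sub hyg)).symm
  have n1 : 0 ≤ ∫ x, ‖f x - y (lab (f x))‖ ∂μ := integral_nonneg fun _ => norm_nonneg _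
  have n2 : 0 ≤ ∫ z, ‖g z - y (lab (g z))‖ ∂ν := integral_nonneg fun _ => norm_nonneg _
  refine (add_le_add_left (add_le_add_right hmid _) _).trans ?_
  rw [hl1, hl2, ← ofReal_add n1 (by linarith), ← ofReal_add (by linarith) n2]
  exact ofReal_le_ofReal (by linarith)

end CouplingDensity

section Randomization

/-- The law of a sequence of independent uniform random variables. -/
def uniformSeq : Measure (ℕ → unitInterval) := Measure.infinitePi fun _ => volume

instance : IsProbabilityMeasure uniformSeq := by unfold uniformSeq; infer_instance

lemma lintegral_uniformSeq_mul {k : ℕ} {H : (ℕ → unitInterval) → ℝ≥0∞} {G : unitInterval → ℝ≥0∞}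
    (hH : Measurable H) (hHd : DependsOn H (Iio k)) (hG : Measurable G) :
    ∫⁻ u, H u * G (u k) ∂uniformSeq = (∫⁻ u, H u ∂uniformSeq) * ∫⁻ v, G v := by
  have hind : iIndepFun (fun (i : ℕ) (u : ℕ → unitInterval) => u i) uniformSeq :=
    iIndepFun_infinitePi (X := fun _ v => v) fun _ => measurable_id
  have h2 := hind.indepFun_finset (range k) {k} (by simp) fun i => measurable_pi_apply i
  have hext : ∀ u : ℕ → unitInterval, H u = H fun i => if h : i ∈ range k then
      (fun j : range k => u j) ⟨i, h⟩ else 0 := fun u => hHd fun i hi => by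
    simp [Finset.mem_range, Set.mem_Iio.1 hi]
  have hm : Measurable fun v : range k → unitInterval => H fun i =>
      if h : i ∈ range k then v ⟨i, h⟩ else 0 := by
    refine hH.comp (measurable_pi_iff.2 fun i => ?_)
    by_cases h : i ∈ range k
    · simp only [h, dite_true]; exact measurable_pi_apply _
    · simp only [h, dite_false]; exact measurable_const
  have hm' : Measurable fun v : ({k} : Finset ℕ) → unitInterval => G (v ⟨k, by simp⟩) :=
    hG.comp (measurable_pi_apply (⟨k, by simp⟩ : ({k} : Finset ℕ)))
  have h3 : IndepFun H (fun u => G (u k)) uniformSeq := by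
    rw [show H = _ from funext hext]
    exact h2.comp hm hm'
  have h4 := lintegral_mul_eq_lintegral_mul_lintegral_of_indepFun hH
    (hG.comp (measurable_pi_apply k)) h3
  have h5 : ∫⁻ v, G v = ∫⁻ u, G (u k) ∂uniformSeq := by
    rw [← (measurePreserving_eval_infinitePi (fun _ : ℕ => (volume : Measure unitInterval))
      k).map_eq,
      lintegral_map hG (measurable_pi_apply k)]
    rfl
  rw [h5]
  exact h4

variable {E S Z : Type*} [MeasurableSpace E] [MeasurableSpace S] [MeasurableSpace Z]
  {μ : Measure (ℤ → E)} {ν : Measure Z}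

/-- Functions of the past up to time `t` and of the first `k` uniform variables. -/
def IsPast {β : Type*} (t : ℤ) (k : ℕ) (H : (ℤ → E) × (ℕ → unitInterval) → β) : Prop :=
  ∀ q q', (∀ n ≤ t, q.1 n = q'.1 n) → (∀ j < k, q.2 j = q'.2 j) → H q = H q'

lemma lintegral_mul_randomized {t : ℤ} {k : ℕ} {s : (ℤ → E) → S} (hs : Measurable s)
    {w : S × Z → ℝ≥0∞} (hw : Measurable w)
    (hind : ∀ (φ : (ℤ → E) → ℝ≥0∞) (ψ : Z → ℝ≥0∞), Measurable φ → DependsOn φ (Iic t) →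
      Measurable ψ → ∫⁻ x, φ x * ∫⁻ z, ψ z * w (s x, z) ∂ν ∂μ = (∫⁻ x, φ x ∂μ) * ∫⁻ z, ψ z ∂ν)
    {Θ : S × unitInterval → Z} (hΘ : Measurable Θ)
    (hΘw : ∀ q, (volume : Measure unitInterval).map (fun v => Θ (q, v))
      = ν.withDensity fun z => w (q, z))
    {H : (ℤ → E) × (ℕ → unitInterval) → ℝ≥0∞} (hH : Measurable H) (hHp : IsPast t k H)
    {ψ : Z → ℝ≥0∞} (hψ : Measurable ψ) :
    ∫⁻ q, H q * ψ (Θ (s q.1, q.2 k)) ∂(μ.prod uniformSeq)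
      = (∫⁻ q, H q ∂(μ.prod uniformSeq)) * ∫⁻ z, ψ z ∂ν := by
  have hm : Measurable fun q : (ℤ → E) × (ℕ → unitInterval) => ψ (Θ (s q.1, q.2 k)) :=
    hψ.comp (hΘ.comp ((hs.comp measurable_fst).prodMk
      ((measurable_pi_apply k).comp measurable_snd)))
  rw [lintegral_prod _ (show Measurable fun q : (ℤ → E) × (ℕ → unitInterval) =>
      H q * ψ (Θ (s q.1, q.2 k)) from hH.mul hm).aemeasurable,
    lintegral_prod _ hH.aemeasurable, ← hind _ _ hH.lintegral_prod_right' _ hψ]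
  · refine lintegral_congr fun x => ?_
    have hm2 : Measurable fun v => Θ (s x, v) := hΘ.comp measurable_prodMk_left
    have := lintegral_uniformSeq_mul (k := k) (H := fun u => H (x, u))
      (G := fun v => ψ (Θ (s x, v))) (hH.comp measurable_prodMk_left)
      (fun u u' h => hHp _ _ (fun _ _ => rfl) h) (hψ.comp hm2)
    rw [this, ← lintegral_map hψ hm2, hΘw, lintegral_withDensity_eq_lintegral_mul _
      (show Measurable fun z => w (s x, z) from hw.comp measurable_prodMk_left) hψ]
    simp only [Pi.mul_apply, mul_comm (w _)]
  · exact fun x x' h => lintegral_congr fun u => hHp _ _ h fun _ _ => rfl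

lemma lintegral_randomized {k : ℕ} {s : (ℤ → E) → S} (hs : Measurable s)
    {w : S × Z → ℝ≥0∞} (hw : Measurable w) {Θ : S × unitInterval → Z} (hΘ : Measurable Θ)
    (hΘw : ∀ q, (volume : Measure unitInterval).map (fun v => Θ (q, v))
      = ν.withDensity fun z => w (q, z))
    {F : (ℤ → E) × Z → ℝ≥0∞} (hF : Measurable F) :
    ∫⁻ q, F (q.1, Θ (s q.1, q.2 k)) ∂(μ.prod uniformSeq)
      = ∫⁻ x, ∫⁻ z, F (x, z) * w (s x, z) ∂ν ∂μ := by
  have hm : Measurable fun q : (ℤ → E) × (ℕ → unitInterval) => F (q.1, Θ (s q.1, q.2 k)) :=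
    hF.comp (measurable_fst.prodMk (hΘ.comp ((hs.comp measurable_fst).prodMk
      ((measurable_pi_apply k).comp measurable_snd))))
  rw [lintegral_prod _ hm.aemeasurable]
  refine lintegral_congr fun x => ?_
  have hm2 : Measurable fun v => Θ (s x, v) := hΘ.comp measurable_prodMk_left
  have hFx : Measurable fun z => F (x, z) := hF.comp measurable_prodMk_left
  have := lintegral_uniformSeq_mul (k := k) (H := fun _ => 1)
      (G := fun v => F (x, Θ (s x, v))) measurable_const (fun _ _ _ => rfl) (hFx.comp hm2)
  simp only [one_mul, lintegral_const, measure_univ] at this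
  rw [this, ← lintegral_map (f := fun z => F (x, z)) hFx hm2, hΘw,
    lintegral_withDensity_eq_lintegral_mul _
      (show Measurable fun z => w (s x, z) from hw.comp measurable_prodMk_left) hFx]
  simp only [Pi.mul_apply, mul_comm (w _)]

/-- The blocks are independent as soon as each is independent of the past. -/
lemma iIndepFun_randomized [IsProbabilityMeasure μ] [IsProbabilityMeasure ν]
    {t : ℕ → ℤ} (ht : Monotone t) {s : ℕ → (ℤ → E) → S}
    (hs : ∀ k, Measurable (s k)) (hsd : ∀ k, DependsOn (s k) (Iic (t (k + 1))))
    {Θ : ℕ → S × unitInterval → Z} (hΘ : ∀ k, Measurable (Θ k))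
    (hprod : ∀ k (H : (ℤ → E) × (ℕ → unitInterval) → ℝ≥0∞) (ψ : Z → ℝ≥0∞), Measurable H →
      IsPast (t k) k H → Measurable ψ →
      ∫⁻ q, H q * ψ (Θ k (s k q.1, q.2 k)) ∂(μ.prod uniformSeq)
        = (∫⁻ q, H q ∂(μ.prod uniformSeq)) * ∫⁻ z, ψ z ∂ν) :
    iIndepFun (fun k q => Θ k (s k q.1, q.2 k)) (μ.prod uniformSeq) ∧
      ∀ k, (μ.prod uniformSeq).map (fun q => Θ k (s k q.1, q.2 k)) = ν := by
  have hm : ∀ k, Measurable fun q : (ℤ → E) × (ℕ → unitInterval) => Θ k (s k q.1, q.2 k) :=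
    fun k => (hΘ k).comp (((hs k).comp measurable_fst).prodMk
      ((measurable_pi_apply k).comp measurable_snd))
  have hmap : ∀ k, (μ.prod uniformSeq).map (fun q => Θ k (s k q.1, q.2 k)) = ν := fun k => by
    ext A hA
    have := hprod k (fun _ => 1) (A.indicator 1) measurable_const (fun _ _ _ _ => rfl)
      (measurable_one.indicator hA)
    simp only [one_mul, lintegral_const, measure_univ, lintegral_indicator_one hA] at this
    rw [← this, Measure.map_apply (hm k) hA, ← lintegral_indicator_one (hm k hA)]
    rfl
  refine ⟨?_, hmap⟩
  have key : ∀ (A : ℕ → Set Z), (∀ k, MeasurableSet (A k)) → ∀ k,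
      ∫⁻ q, ∏ j ∈ range k, (A j).indicator 1 (Θ j (s j q.1, q.2 j)) ∂(μ.prod uniformSeq)
        = ∏ j ∈ range k, ν (A j) := by
    intro A hA k
    induction k with
    | zero => simp
    | succ k ih =>
      simp only [Finset.prod_range_succ]
      rw [hprod k _ ((A k).indicator 1) _ _ (measurable_one.indicator (hA k)), ih,
        lintegral_indicator_one (hA k)]
      · exact Finset.measurable_fun_prod _ fun j _ => (measurable_one.indicator (hA j)).comp (hm j)
      · intro q q' h1 h2
        refine prod_congr rfl fun j hj => ?_
        have hjk := Finset.mem_range.1 hj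
        rw [hsd j fun i hi => h1 i (hi.trans (ht hjk)), h2 j hjk]
  rw [iIndepFun_iff_measure_inter_preimage_eq_mul]
  classical
  intro F A hA
  obtain ⟨K, hK⟩ : ∃ K, F ⊆ range K := ⟨F.sup id + 1, fun i hi =>
    Finset.mem_range.2 (Nat.lt_succ_of_le (Finset.le_sup (f := id) hi))⟩
  have hA' : ∀ k, MeasurableSet (if k ∈ F then A k else Set.univ) := fun k => by
    split_ifs with h
    exacts [hA k h, MeasurableSet.univ]
  have h1 := key _ hA' K
  have h2 : ∏ j ∈ range K, ν (if j ∈ F then A j else Set.univ) = ∏ j ∈ F, ν (A j) := by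
    rw [← Finset.prod_subset hK fun j _ hj => by simp [hj]]
    exact prod_congr rfl fun j hj => by simp [hj]
  have h3 : ∀ q : (ℤ → E) × (ℕ → unitInterval), ∏ j ∈ range K,
      (if j ∈ F then A j else Set.univ).indicator (1 : Z → ℝ≥0∞) (Θ j (s j q.1, q.2 j))
      = (⋂ j ∈ F, (fun q : (ℤ → E) × (ℕ → unitInterval) =>
        Θ j (s j q.1, q.2 j)) ⁻¹' A j).indicator 1 q := fun q => by
    rw [← Finset.prod_subset hK fun j _ hj => by simp [hj]]
    by_cases hq : ∀ j ∈ F, Θ j (s j q.1, q.2 j) ∈ A j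
    · rw [Set.indicator_of_mem (by simpa using hq)]
      exact Finset.prod_eq_one fun j hj => by simp [hj, hq j hj]
    · rw [Set.indicator_of_notMem (by simpa using hq)]
      push Not at hq
      obtain ⟨j, hj, hjA⟩ := hq
      exact Finset.prod_eq_zero hj (by simp [hj, hjA])
  simp only [h3] at h1
  rw [lintegral_indicator_one (Finset.measurableSet_biInter _ fun j hj => hm j (hA j hj)), h2] at h1
  rw [h1]
  refine prod_congr rfl fun j hj => ?_
  rw [← Measure.map_apply (hm j) (hA j hj), hmap]

end Randomization

section BlockTransport

variable {ι : Type} [Fintype ι] {p : ℝ} {μ : Measure (𝒳 ι)}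

lemma map_sum_eq_scaledG {Ω : Type*} [MeasurableSpace Ω] {P : Measure Ω} [IsProbabilityMeasure P]
    {N : ℕ → Ω → ℰ ι} (hm : ∀ i, Measurable (N i)) (hN : iIndepFun N P)
    (hmap : ∀ i, P.map (N i) = stdG ι) (I : Finset ℕ) :
    P.map (fun ω => ∑ i ∈ I, N i ω) = scaledG ι (I.card : ℝ) := by
  classical
  induction I using Finset.induction_on with
  | empty => simp [scaledG]
  | insert i I hi ih =>
    have h1 : IndepFun (fun ω => ∑ j ∈ I, N j ω) (N i) P := by
      have := hN.indepFun_finsetSum_of_notMem₀ (fun j => (hm j).aemeasurable) hi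
      simpa only [Finset.sum_fn] using this
    have h2 := h1.map_add_eq_map_conv_map (by fun_prop) (hm i)
    have e : scaledG ι (1 : ℝ) = stdG ι := by simp [scaledG]
    rw [ih, hmap i, ← e, scaledG_conv (by positivity) zero_le_one] at h2
    rw [Finset.card_insert_of_notMem hi, Nat.cast_succ, ← h2]
    congr 1
    ext1 ω
    rw [sum_insert hi, add_comm]
    rfl

lemma isPast_indepFun {E : Type*} [MeasurableSpace E] {μ : Measure (ℤ → E)}
    [IsProbabilityMeasure μ] {Z : Type*} [MeasurableSpace Z] {ν : Measure Z}
    [IsProbabilityMeasure ν] {t : ℤ} {k : ℕ} {G : (ℤ → E) × (ℕ → unitInterval) → Z}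
    (hG : Measurable G) (hmap : (μ.prod uniformSeq).map G = ν)
    (hprod : ∀ (H : (ℤ → E) × (ℕ → unitInterval) → ℝ≥0∞) (ψ : Z → ℝ≥0∞), Measurable H →
      IsPast t k H → Measurable ψ →
      ∫⁻ q, H q * ψ (G q) ∂(μ.prod uniformSeq)
        = (∫⁻ q, H q ∂(μ.prod uniformSeq)) * ∫⁻ z, ψ z ∂ν)
    {H : (ℤ → E) × (ℕ → unitInterval) → ℝ} (hH : Measurable H) (hHp : IsPast t k H) :
    IndepFun H G (μ.prod uniformSeq) := by
  rw [indepFun_iff_measure_inter_preimage_eq_mul]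
  intro A B hA hB
  have h := hprod ((H ⁻¹' A).indicator 1) (B.indicator 1) (measurable_one.indicator (hH hA))
    (fun q q' h1 h2 => by
      classical
      simp only [Set.indicator]
      exact if_congr (by rw [Set.mem_preimage, Set.mem_preimage, hHp q q' h1 h2]) rfl rfl)
    (measurable_one.indicator hB)
  rw [lintegral_indicator_one (hH hA), lintegral_indicator_one hB, ← hmap,
    Measure.map_apply hG hB] at h
  rw [← h, ← lintegral_indicator_one ((hH hA).inter (hG hB))]
  refine lintegral_congr fun q => ?_
  by_cases h1 : H q ∈ A <;> by_cases h2 : G q ∈ B <;> simp [Set.indicator, h1, h2]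

/-- The path up to time `t`. -/
def pastPath {E : Type*} [Zero E] (t : ℤ) (x : ℤ → E) : ℤ → E := fun n => if n ≤ t then x n else 0

lemma measurable_pastPath {E : Type*} [Zero E] [MeasurableSpace E] (t : ℤ) :
    Measurable (pastPath t : (ℤ → E) → ℤ → E) := by
  refine measurable_pi_iff.2 fun n => ?_
  by_cases h : n ≤ t
  · simp only [pastPath, h, if_true]; exact measurable_pi_apply _
  · simp only [pastPath, h, if_false]; exact measurable_const

lemma dependsOn_pastPath {E : Type*} [Zero E] (t : ℤ) :
    DependsOn (pastPath t : (ℤ → E) → ℤ → E) (Iic t) := fun x y h => by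
  ext1 n
  by_cases hn : n ≤ t
  · simp [pastPath, hn, h n hn]
  · simp [pastPath, hn]

lemma eq_comp_pastPath {E F : Type*} [Zero E] {t : ℤ} {φ : (ℤ → E) → F}
    (hφ : DependsOn φ (Iic t)) (x : ℤ → E) : φ (pastPath t x) = φ x :=
  hφ fun n hn => by simp [pastPath, Set.mem_Iic.1 hn]

/-- Coupling of one block with Gaussian variables that are independent of the past. -/
lemma MartLaw.exists_block_transport [DecidableEq ι] [Nonempty ι] (hμ : MartLaw p μ) (hp : 2 < p)
    {C : ℝ} {N : ℕ} (hC : LipschitzBound p μ N C) (t : ℤ) (k : ℕ) {I : Finset ℕ}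
    (hI : I.card = 2 ^ N) :
    ∃ Θ : ((𝒳 ι) × ℰ ι) × unitInterval →
        ℕ → ℰ ι, Measurable Θ ∧
      (∀ (H : 𝒵 ι → ℝ≥0∞)
        (ψ : (ℕ → ℰ ι) → ℝ≥0∞), Measurable H → IsPast t k H → Measurable ψ →
        ∫⁻ q, H q * ψ (Θ ((pastPath t q.1, blockSum t (2 ^ N) q.1), q.2 k)) ∂(μ.prod uniformSeq)
          = (∫⁻ q, H q ∂(μ.prod uniformSeq)) * ∫⁻ z, ψ z ∂(Measure.infinitePi fun _ => stdG ι)) ∧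
      ∫⁻ q, ‖blockSum t (2 ^ N) q.1
          - ∑ i ∈ I, Θ ((pastPath t q.1, blockSum t (2 ^ N) q.1), q.2 k) i‖ₑ ∂(μ.prod uniformSeq)
        ≤ ofReal (C * couplingRate p N + 1) := by
  have := hμ.prob
  have hp1 : (1 : ℝ≥0∞) ≤ ofReal p := by
    rw [← ENNReal.ofReal_one]; exact ofReal_le_ofReal (by linarith)
  obtain ⟨ν, hν⟩ : ∃ ν : Measure (ℕ → ℰ ι),
    ν = Measure.infinitePi fun _ => stdG ι := ⟨_, rfl⟩
  have hνp : IsProbabilityMeasure ν := by rw [hν]; infer_instance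
  obtain ⟨g, hg⟩ : ∃ g : (ℕ → ℰ ι) → ℰ ι, ∀ z, g z = ∑ i ∈ I, z i :=
    ⟨_, fun _ => rfl⟩
  have hgm : Measurable g := by
    rw [show g = fun z => ∑ i ∈ I, z i from funext hg]; fun_prop
  have hgmap : ν.map g = scaledG ι ((2 ^ N : ℕ) : ℝ) := by
    rw [show g = fun z => ∑ i ∈ I, z i from funext hg, ← hI, hν]
    refine map_sum_eq_scaledG (N := fun (i : ℕ) (z : ℕ → ℰ ι) => z i)
      (fun i => measurable_pi_apply i)
      (iIndepFun_infinitePi (X := fun _ z => z) fun _ => measurable_id) (fun i => ?_) I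
    exact (measurePreserving_eval_infinitePi (fun _ : ℕ => stdG ι) i).map_eq
  have hgint : ∀ f : ℰ ι → ℝ, Measurable f →
      ∫ z, f (g z) ∂ν = smooth f (√((2 ^ N : ℕ) : ℝ)) 0 := fun f hf => by
    rw [← integral_map (φ := g) hgm.aemeasurable hf.aestronglyMeasurable, hgmap,
      integral_scaledG f hf]
    simp [smooth]
  have hgi : Integrable g ν := by
    have h1 : Integrable (fun z : ℰ ι => z) (ν.map g) := by
      rw [hgmap, scaledG]
      rw [integrable_map_measure (by fun_prop) (by fun_prop)]
      exact ((IsGaussian.integrable_id (μ := stdG ι)).smul (√((2 ^ N : ℕ) : ℝ)) :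
        Integrable (fun z : ℰ ι => √((2 ^ N : ℕ) : ℝ) • z) (stdG ι))
    exact (integrable_map_measure (by fun_prop) hgm.aemeasurable).1 h1
  have hfi : Integrable (blockSum t (2 ^ N) : 𝒳 ι → _) μ :=
    (hμ.memLp_blockSum t (2 ^ N)).integrable hp1
  obtain ⟨w, hw, hw1, hw2, hw3⟩ := exists_coupling_density (μ := μ) (ν := ν)
    (measurable_pastPath t) (measurable_blockSum t (2 ^ N)) hgm hfi hgi (δ := C * couplingRate p N)
    one_pos (by
      intro J _ _ _ c F hc hF
      have hFm : Measurable (uncurry F) :=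
        measurable_from_prod_countable_right fun j => (hF j).continuous.measurable
      simp only [hgint _ (hF _).continuous.measurable]
      have hm : Measurable fun x : 𝒳 ι => F (c (pastPath t x))
          (blockSum t (2 ^ N) x) - smooth (F (c (pastPath t x))) (√((2 ^ N : ℕ) : ℝ)) 0 :=
        (hFm.comp ((hc.comp (measurable_pastPath t)).prodMk (measurable_blockSum t _))).sub
          ((measurable_of_countable fun j => smooth (F j) (√((2 ^ N : ℕ) : ℝ)) 0).comp
            (hc.comp (measurable_pastPath t)))
      rw [← hμ.integral_shift (-t) hm]
      have := hC J (fun x => c (pastPath t (shiftBy (-t) x))) F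
        (hc.comp ((measurable_pastPath t).comp (measurable_shiftBy _)))
        (fun x y h => by
          show c _ = c _
          congr 1
          refine dependsOn_pastPath t fun n hn => h _ ?_
          simp only [mem_Iic] at hn ⊢
          omega) hFm hF
      simp only [blockSum_shiftBy, add_neg_cancel]
      exact (le_abs_self _).trans this)
  obtain ⟨κ, hκ⟩ : ∃ κ : Kernel ((𝒳 ι) × ℰ ι)
      (ℕ → ℰ ι), ∀ q, κ q = ν.withDensity fun z => w (q, z) := by
    refine ⟨Kernel.withDensity (Kernel.const _ ν) fun q z => w (q, z), fun q => ?_⟩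
    rw [Kernel.withDensity_apply _ (show Measurable (uncurry fun q z => w (q, z)) from hw),
      Kernel.const_apply]
  have hκM : IsMarkovKernel κ := ⟨fun q => ⟨by
    rw [hκ, withDensity_apply _ MeasurableSet.univ, Measure.restrict_univ, hw1]⟩⟩
  obtain ⟨Θ, hΘ, hΘκ⟩ := κ.exists_measurable_map_eq_unitInterval
  have hs : Measurable fun x : 𝒳 ι => (pastPath t x, blockSum t (2 ^ N) x) :=
    (measurable_pastPath t).prodMk (measurable_blockSum t _)
  refine ⟨uncurry Θ, hΘ, fun H ψ hH hHp hψ => ?_, ?_⟩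
  · rw [← hν]
    refine lintegral_mul_randomized hs hw (fun φ ψ hφ hφd hψ => ?_) hΘ
      (fun q => (hΘκ q).trans (hκ q)) hH hHp hψ
    have := hw2 φ ψ hφ hψ
    simpa only [eq_comp_pastPath hφd] using this
  · refine le_trans (le_of_eq ?_) hw3
    have := lintegral_randomized (μ := μ) (ν := ν) (k := k) hs hw hΘ
      (fun q => (hΘκ q).trans (hκ q)) (F := fun y => ‖blockSum t (2 ^ N) y.1 - g y.2‖ₑ)
      (((measurable_blockSum t _).comp measurable_fst).sub (hgm.comp measurable_snd)).enorm
    simpa only [hg] using this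

/-- Coupling of consecutive blocks with one sequence of independent Gaussian variables. -/
theorem MartLaw.exists_block_coupling [DecidableEq ι] [Nonempty ι] (hμ : MartLaw p μ) (hp : 2 < p)
    {C : ℝ} (hC : ∀ N, LipschitzBound p μ N C) (n t : ℕ → ℕ)
    (ht : ∀ k, t (k + 1) = t k + 2 ^ n k) :
    ∃ N : ℕ → 𝒵 ι → ℰ ι,
      (∀ i, Measurable (N i)) ∧ iIndepFun N (μ.prod uniformSeq) ∧
      (∀ i, (μ.prod uniformSeq).map (N i) = stdG ι) ∧
      ∀ k, IsPast (t (k + 1)) (k + 1) (fun q => ∑ i ∈ Finset.Ioc (t k) (t (k + 1)), N i q) ∧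
        ∫⁻ q, ‖blockSum (t k) (2 ^ n k) q.1 - ∑ i ∈ Finset.Ioc (t k) (t (k + 1)), N i q‖ₑ
          ∂(μ.prod uniformSeq) ≤ ofReal (C * couplingRate p (n k) + 1) ∧
        ∀ H : 𝒵 ι → ℝ, Measurable H →
          IsPast (t k) k H → MemLp H 2 (μ.prod uniformSeq) → ∀ a,
          ∫ q, H q * (blockSum (t k) (2 ^ n k) q.1
            - ∑ i ∈ Finset.Ioc (t k) (t (k + 1)), N i q) a ∂(μ.prod uniformSeq) = 0 := by
  have := hμ.prob
  have hmono : StrictMono t := strictMono_nat_of_lt_succ fun k => by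
    rw [ht]; exact Nat.lt_add_of_pos_right (by positivity)
  have hcard : ∀ k, (Finset.Ioc (t k) (t (k + 1))).card = 2 ^ n k := fun k => by
    rw [Nat.card_Ioc, ht, Nat.add_sub_cancel_left]
  choose Θ hΘ hΘH hΘc using fun k => hμ.exists_block_transport hp (hC (n k)) (t k) k (hcard k)
  have hs : ∀ k, Measurable fun x : 𝒳 ι =>
      (pastPath (t k) x, blockSum (t k) (2 ^ n k) x) := fun k =>
    (measurable_pastPath _).prodMk (measurable_blockSum _ _)
  have hsd : ∀ k, DependsOn (fun x : 𝒳 ι =>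
      (pastPath (t k) x, blockSum (t k) (2 ^ n k) x)) (Iic ((t (k + 1) : ℕ) : ℤ)) := by
    intro k x y h
    have h1 : (t k : ℤ) + (2 ^ n k : ℕ) = (t (k + 1) : ℕ) := by rw [ht]; push_cast; rfl
    refine Prod.ext (dependsOn_pastPath _ fun i hi => h i ?_) (dependsOn_blockSum _ _ ?_)
    · simp only [mem_Iic] at hi ⊢
      exact hi.trans (by exact_mod_cast hmono.monotone (Nat.le_succ k))
    · rwa [h1]
  obtain ⟨Z, hZ⟩ : ∃ Z : ℕ → 𝒵 ι →
      ℕ → ℰ ι, ∀ k q, Z k q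
        = Θ k ((pastPath (t k) q.1, blockSum (t k) (2 ^ n k) q.1), q.2 k) := ⟨_, fun _ _ => rfl⟩
  have hZm : ∀ k, Measurable (Z k) := fun k => by
    rw [show Z k = _ from funext (hZ k)]
    exact (hΘ k).comp (((hs k).comp measurable_fst).prodMk
      ((measurable_pi_apply k).comp measurable_snd))
  obtain ⟨hind, hZν⟩ := iIndepFun_randomized (t := fun k => ((t k : ℕ) : ℤ))
    (fun i j h => Int.ofNat_le.2 (hmono.monotone h)) hs hsd hΘ hΘH
  have hind' : iIndepFun Z (μ.prod uniformSeq) := by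
    rw [show Z = _ from funext fun k => funext (hZ k)]; exact hind
  have hZν' : ∀ k, (μ.prod uniformSeq).map (Z k) = Measure.infinitePi fun _ => stdG ι := fun k => by
    rw [show Z k = _ from funext (hZ k)]; exact hZν k
  have hc : ∀ k i, Measurable fun q => Z k q i := fun k i => (measurable_pi_apply i).comp (hZm k)
  have hmap : ∀ k i, (μ.prod uniformSeq).map (fun q => Z k q i) = stdG ι := fun k i => by
    have : (fun q => Z k q i) = (fun z : ℕ → ℰ ι => z i) ∘ Z k := rfl
    rw [this, ← Measure.map_map (measurable_pi_apply i) (hZm k), hZν']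
    exact (measurePreserving_eval_infinitePi (fun _ : ℕ => stdG ι) i).map_eq
  have hcol : ∀ k, iIndepFun (fun i q => Z k q i) (μ.prod uniformSeq) := fun k => by
    refine (iIndepFun_iff_map_fun_eq_infinitePi_map (hc k)).2 ?_
    simp only [hmap]
    exact hZν' k
  have hall : iIndepFun (fun (r : ℕ × ℕ) q => Z r.1 q r.2) (μ.prod uniformSeq) :=
    iIndepFun_uncurry' (X := fun k i q => Z k q i)
      hc hind' hcol
  have hex : ∀ i, ∃ k, i ≤ t (k + 1) := fun i => ⟨i, (Nat.le_succ i).trans (hmono.le_apply)⟩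
  obtain ⟨κ, hκ⟩ : ∃ κ : ℕ → ℕ, ∀ k, ∀ i ∈ Finset.Ioc (t k) (t (k + 1)), κ i = k := by
    refine ⟨fun i => Nat.find (hex i), fun k i hi => ?_⟩
    rw [Finset.mem_Ioc] at hi
    refine (Nat.find_eq_iff _).2 ⟨hi.2, fun j hj h => ?_⟩
    exact absurd (h.trans (hmono.monotone hj)) (not_le.2 hi.1)
  have hsum : ∀ k q, ∑ i ∈ Finset.Ioc (t k) (t (k + 1)), Z (κ i) q i
      = ∑ i ∈ Finset.Ioc (t k) (t (k + 1)), Z k q i := fun k q =>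
    sum_congr rfl fun i hi => by rw [hκ k i hi]
  refine ⟨fun i q => Z (κ i) q i, fun i => hc _ _,
    hall.precomp (g := fun i => (κ i, i)) fun i j h => (Prod.ext_iff.1 h).2,
    fun i => hmap _ _, fun k => ⟨?_, ?_, ?_⟩⟩
  · intro q q' h1 h2
    have := hsd k (x := q.1) (y := q'.1) fun i hi => h1 i hi
    simp only [hsum]
    simp only [hZ, this, h2 k (Nat.lt_succ_self k)]
  · simp only [hsum]
    simp only [hZ]
    exact hΘc k
  · intro H hH hHp hH2 a
    simp only [hsum]
    have hiH : IndepFun H (Z k) (μ.prod uniformSeq) :=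
      isPast_indepFun (hZm k) (hZν' k) (by simpa only [← hZ] using hΘH k) hH hHp
    have hZ2 : ∀ i, MemLp (fun q => Z k q i a) 2 (μ.prod uniformSeq) := fun i => by
      have h1 : MemLp (fun z : ℰ ι => z a) 2
          ((μ.prod uniformSeq).map fun q => Z k q i) := by
        rw [hmap]
        have h2 : MemLp (fun r : ℝ => r) 2 ((stdG ι).map fun z => z a) := by
          rw [map_eval_stdG]; exact memLp_id_gaussianReal 2
        exact (memLp_map_measure_iff (by fun_prop) (by fun_prop)).1 h2
      exact (memLp_map_measure_iff (by fun_prop)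
        (hc k i).aemeasurable).1 h1
    have hx2 : ∀ l, MemLp (fun q : 𝒵 ι => q.1 l a) 2
        (μ.prod uniformSeq) := fun l => by
      have h1 : MemLp (fun x : 𝒳 ι => x l) 2 μ :=
        (hμ.memLp_coord l).mono_exponent (by
          rw [show (2 : ℝ≥0∞) = ofReal 2 by simp]
          exact ofReal_le_ofReal hp.le)
      have h2 : MemLp (fun x : 𝒳 ι => x l a) 2 μ :=
        h1.mono (measurable_coord l a).aestronglyMeasurable
          (ae_of_all _ fun x => PiLp.norm_apply_le _ a)
      exact h2.comp_fst uniformSeq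
    have hG0 : ∀ i, ∫ q, H q * Z k q i a ∂(μ.prod uniformSeq) = 0 := fun i => by
      have hm : Measurable fun z : ℕ → ℰ ι => z i a :=
        (show Measurable fun y : ℰ ι => y a by fun_prop).comp (measurable_pi_apply i)
      have h1 : IndepFun H (fun q => Z k q i a) (μ.prod uniformSeq) := hiH.comp measurable_id hm
      rw [h1.integral_fun_mul_eq_mul_integral hH.aestronglyMeasurable (hZ2 i).1]
      have h2 : ∫ q, Z k q i a ∂(μ.prod uniformSeq) = ∫ z, z a ∂(stdG ι) := by
        rw [← hmap k i, integral_map (hc k i).aemeasurable (by fun_prop)]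
      rw [h2, integral_eval_stdG, mul_zero]
    have hB0 : ∀ l : ℕ, ∫ q, H q * q.1 ((t k : ℤ) + l + 1) a ∂(μ.prod uniformSeq) = 0 := by
      intro l
      have hi : Integrable (fun q => H q * q.1 ((t k : ℤ) + l + 1) a) (μ.prod uniformSeq) :=
        hH2.integrable_mul (hx2 _)
      rw [integral_prod_symm _ hi]
      refine integral_eq_zero_of_ae ?_
      filter_upwards [hi.prod_left_ae] with u hu
      exact hμ.mart_at _ a (hH.comp measurable_prodMk_right)
        (fun x y h => hHp _ _ (fun i hi => h i (by simp only [mem_Iic]; omega))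
          fun _ _ => rfl) hu
    have e : ∀ q : 𝒵 ι,
        H q * (blockSum (t k) (2 ^ n k) q.1 - ∑ i ∈ Finset.Ioc (t k) (t (k + 1)), Z k q i) a
        = ∑ l ∈ range (2 ^ n k), H q * q.1 ((t k : ℤ) + l + 1) a
          - ∑ i ∈ Finset.Ioc (t k) (t (k + 1)), H q * Z k q i a := fun q => by
      simp only [blockSum, PiLp.sub_apply, mul_sub, ← mul_sum, WithLp.ofLp_sum,
        Finset.sum_apply]
    simp only [e]
    have i1 : ∀ l ∈ range (2 ^ n k),
        Integrable (fun q => H q * q.1 ((t k : ℤ) + l + 1) a) (μ.prod uniformSeq) :=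
      fun l _ => hH2.integrable_mul (hx2 _)
    have i2 : ∀ i ∈ Finset.Ioc (t k) (t (k + 1)),
        Integrable (fun q => H q * Z k q i a) (μ.prod uniformSeq) :=
      fun i _ => hH2.integrable_mul (hZ2 i)
    rw [integral_sub (integrable_finsetSum _ i1) (integrable_finsetSum _ i2),
      integral_finsetSum _ i1, integral_finsetSum _ i2]
    simp [hB0, hG0]

end BlockTransport

section MaximalInequality

/-- A derivative of `posPow p (|x| - l)`. -/
def posPowSlope (p l x : ℝ) : ℝ := p * (SignType.sign x : ℝ) * posPow (p - 1) (|x| - l)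

lemma rpow_add_le_rpow {p u v : ℝ} (hp : 1 ≤ p) (hu : 0 < u) (hv : 0 ≤ v) :
    u ^ p + p * u ^ (p - 1) * (v - u) ≤ v ^ p := by
  have h := one_add_mul_self_le_rpow_one_add (s := v / u - 1)
    (by linarith [div_nonneg hv hu.le]) hp
  rw [add_sub_cancel, div_rpow hv hu.le, le_div_iff₀ (rpow_pos_of_pos hu p)] at h
  refine le_trans (le_of_eq ?_) h
  rw [Real.rpow_sub_one hu.ne']
  field_simp

lemma sign_mul_le_abs (x y : ℝ) : (SignType.sign x : ℝ) * y ≤ |y| := by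
  rcases lt_trichotomy x 0 with h | h | h
  · simp [sign_neg h, neg_le_abs]
  · simp [h]
  · simp [sign_pos h, le_abs_self]

lemma posPowSlope_mul_le {p l : ℝ} (hp : 1 < p) (x y : ℝ) :
    posPow p (|x| - l) + posPowSlope p l x * (y - x) ≤ posPow p (|y| - l) := by
  rcases le_or_gt (|x| - l) 0 with h | h
  · rw [posPowSlope, posPow, posPow, max_eq_right h, zero_rpow (by linarith),
      zero_rpow (by linarith)]
    simpa using posPow_nonneg _ _
  · have h1 := rpow_add_le_rpow hp.le h (le_max_right (|y| - l) 0)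
    rw [posPowSlope, posPow, posPow, posPow, max_eq_left h.le]
    refine le_trans ?_ h1
    have h2 : (SignType.sign x : ℝ) * (y - x) ≤ max (|y| - l) 0 - (|x| - l) := by
      have h3 := sign_mul_le_abs x y
      have h4 : (SignType.sign x : ℝ) * x = |x| := sign_mul_self x
      have h5 := le_max_left (|y| - l) 0
      rw [mul_sub, h4]
      linarith
    have h3 : 0 ≤ p * (|x| - l) ^ (p - 1) := mul_nonneg (by linarith) (rpow_nonneg h.le _)
    nlinarith [mul_le_mul_of_nonneg_left h2 h3]

lemma abs_posPowSlope_le {p l : ℝ} (hp : 1 < p) (hl : 0 ≤ l) (x : ℝ) :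
    |posPowSlope p l x| ≤ p * |x| ^ (p - 1) := by
  have h1 : |(SignType.sign x : ℝ)| ≤ 1 := by
    rcases lt_trichotomy x 0 with h | h | h
    · simp [sign_neg h]
    · simp [h]
    · simp [sign_pos h]
  have h2 : posPow (p - 1) (|x| - l) ≤ |x| ^ (p - 1) :=
    rpow_le_rpow (le_max_right _ _) (max_le (by linarith) (abs_nonneg _)) (by linarith)
  rw [posPowSlope, abs_mul, abs_mul, abs_of_pos (by linarith : 0 < p),
    abs_of_nonneg (posPow_nonneg _ _), mul_assoc]
  refine mul_le_mul_of_nonneg_left ?_ (by linarith)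
  calc _ ≤ 1 * posPow (p - 1) (|x| - l) := mul_le_mul_of_nonneg_right h1 (posPow_nonneg _ _)
    _ ≤ _ := by rwa [one_mul]

lemma measurable_posPowSlope {p l : ℝ} (hp : 1 < p) : Measurable (posPowSlope p l) := by
  have h1 : Measurable fun x : ℝ => (SignType.sign x : ℝ) := by
    have : (fun x : ℝ => (SignType.sign x : ℝ))
        = fun x => if 0 < x then 1 else if x < 0 then -1 else 0 := by
      ext1 x
      rcases lt_trichotomy x 0 with h | h | h
      · simp [sign_neg h, h, h.le.not_gt]
      · simp [h]
      · simp [sign_pos h, h]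
    rw [this]
    exact Measurable.ite measurableSet_Ioi measurable_const
      (Measurable.ite measurableSet_Iio measurable_const measurable_const)
  exact (h1.const_mul p).mul ((continuous_posPow (by linarith)).measurable.comp
    (continuous_abs.measurable.sub_const l))

variable {Ω : Type*} [MeasurableSpace Ω] {P : Measure Ω}

lemma integrable_posPow_of_memLp {p l : ℝ} (hp : 0 < p) (hl : 0 ≤ l) {f : Ω → ℝ} (hf : Measurable f)
    (hfp : MemLp f (ofReal p) P) : Integrable (fun ω => posPow p (|f ω| - l)) P := by
  have h := hfp.integrable_norm_rpow (by simpa using hp) (by simp)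
  rw [toReal_ofReal hp.le] at h
  refine h.mono' ((continuous_posPow hp.le).measurable.comp
    (hf.abs.sub_const l)).aestronglyMeasurable (ae_of_all _ fun ω => ?_)
  rw [norm_eq_abs, norm_eq_abs, abs_of_nonneg (posPow_nonneg _ _)]
  exact rpow_le_rpow (le_max_right _ _) (max_le (by linarith) (abs_nonneg _)) hp.le

/-- Doob's maximal inequality for sums of orthogonal increments, with truncated moments. -/
lemma maximal_posPow [IsProbabilityMeasure P] {p l c : ℝ} (hp : 1 < p) (hl : 0 ≤ l) (hc : 0 < c)
    {X : ℕ → Ω → ℝ}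
    (hX : ∀ i, Measurable (X i)) (hXp : ∀ i, MemLp (X i) (ofReal p) P)
    (hort : ∀ k (H : (ℕ → ℝ) → ℝ), Measurable H → DependsOn H (Iio k) →
      MemLp (fun ω => H fun i => X i ω) (ofReal (p / (p - 1))) P →
      ∫ ω, H (fun i => X i ω) * X k ω ∂P = 0) (m : ℕ) :
    P {ω | ∃ j ≤ m, l + c ≤ |∑ i ∈ range j, X i ω|}
      ≤ ofReal (c ^ (-p) * ∫ ω, posPow p (|∑ i ∈ range m, X i ω| - l) ∂P) := by
  classical
  have hp0 : 0 < p := by linarith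
  obtain ⟨T, hT⟩ : ∃ T : ℕ → (ℕ → ℝ) → ℝ, ∀ j v, T j v = ∑ i ∈ range j, v i :=
    ⟨_, fun _ _ => rfl⟩
  have hTm : ∀ j, Measurable (T j) := fun j => by
    rw [show T j = _ from funext (hT j)]; fun_prop
  have hTd : ∀ j, DependsOn (T j) (Iio j) := fun j v w h => by
    rw [hT, hT]
    exact sum_congr rfl fun i hi => h i (by simpa using hi)
  obtain ⟨A, hA⟩ : ∃ A : ℕ → Set (ℕ → ℝ), ∀ k v, v ∈ A k ↔
      l + c ≤ |T k v| ∧ ∀ j < k, |T j v| < l + c :=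
    ⟨fun k => {v | l + c ≤ |T k v| ∧ ∀ j < k, |T j v| < l + c}, fun _ _ => Iff.rfl⟩
  have hAm : ∀ k, MeasurableSet (A k) := fun k => by
    have : A k = {v | l + c ≤ |T k v|} ∩ ⋂ j ∈ range k, {v | |T j v| < l + c} := by
      ext v; simp [hA]
    rw [this]
    exact (measurableSet_le measurable_const (hTm k).abs).inter
      (Finset.measurableSet_biInter _ fun j _ => measurableSet_lt (hTm j).abs measurable_const)
  obtain ⟨H, hH⟩ : ∃ H : ℕ → (ℕ → ℝ) → ℝ, ∀ k v, H k v =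
      (A k).indicator (fun v => posPowSlope p l (T k v)) v := ⟨_, fun _ _ => rfl⟩
  have hHm : ∀ k, Measurable (H k) := fun k => by
    rw [show H k = _ from funext (hH k)]
    exact ((measurable_posPowSlope hp).comp (hTm k)).indicator (hAm k)
  have hHd : ∀ k, DependsOn (H k) (Iio k) := fun k v w h => by
    have h1 : ∀ j ≤ k, T j v = T j w := fun j hj => hTd j fun i hi => h i (lt_of_lt_of_le hi hj)
    have h2 : v ∈ A k ↔ w ∈ A k := by
      rw [hA, hA, h1 k le_rfl]
      exact and_congr_right fun _ => forall₂_congr fun j hj => by rw [h1 j hj.le]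
    rw [hH, hH, Set.indicator, Set.indicator]
    exact if_congr h2 (by rw [h1 k le_rfl]) rfl
  have hTp : ∀ k, MemLp (fun ω => T k fun i => X i ω) (ofReal p) P := fun k => by
    simp only [hT]
    exact memLp_finsetSum _ fun i _ => hXp i
  have hXm : Measurable fun ω => fun i => X i ω := measurable_pi_iff.2 hX
  have hHp : ∀ k, MemLp (fun ω => H k fun i => X i ω) (ofReal (p / (p - 1))) P := fun k => by
    have h1 := (hTp k).norm_rpow_div (ofReal (p - 1))
    rw [toReal_ofReal (by linarith), ← ENNReal.ofReal_div_of_pos (by linarith)] at h1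
    refine (h1.const_mul p).mono ((hHm k).comp hXm).aestronglyMeasurable (ae_of_all _ fun ω => ?_)
    have h2 := abs_posPowSlope_le hp hl (T k fun i => X i ω)
    rw [norm_eq_abs, hH]
    refine le_trans ?_ (h2.trans (le_of_eq ?_))
    · rw [Set.indicator]
      split_ifs
      · exact le_rfl
      · rw [abs_zero]; exact abs_nonneg _
    · rw [norm_eq_abs, norm_eq_abs,
        abs_of_nonneg (mul_nonneg hp0.le (rpow_nonneg (abs_nonneg _) _))]
  have hconj : Real.HolderConjugate (p / (p - 1)) p :=
    ((Real.holderConjugate_iff_eq_conjExponent hp).2 rfl).symm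
  have hHX : ∀ k i, Integrable (fun ω => H k (fun i => X i ω) * X i ω) P := fun k i => by
    have := hconj.ennrealOfReal
    exact (hHp k).integrable_mul (hXp i)
  have hH0 : ∀ k i, k ≤ i → ∫ ω, H k (fun i => X i ω) * X i ω ∂P = 0 := fun k i hki =>
    hort i (H k) (hHm k) (fun v w h => hHd k fun j hj => h j (lt_of_lt_of_le hj hki)) (hHp k)
  have hpt : ∀ v, {v | ∃ j ≤ m, l + c ≤ |T j v|}.indicator (fun _ => c ^ p) v
      + ∑ k ∈ range (m + 1), ∑ i ∈ Finset.Ico k m, H k v * v i ≤ posPow p (|T m v| - l) := by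
    intro v
    by_cases hv : ∃ j ≤ m, l + c ≤ |T j v|
    · rw [Set.indicator_of_mem (by exact hv)]
      have hex : ∃ j, l + c ≤ |T j v| := hv.imp fun j hj => hj.2
      obtain ⟨k, hk, hlt⟩ : ∃ k, l + c ≤ |T k v| ∧ ∀ j < k, |T j v| < l + c :=
        ⟨Nat.find hex, Nat.find_spec hex, fun j hj => not_le.1 (Nat.find_min hex hj)⟩
      have hkm : k ≤ m := by
        obtain ⟨j, hj, hj'⟩ := hv
        by_contra h
        exact absurd hj' (not_le.2 (hlt j (by omega)))
      have hother : ∀ i, i ≠ k → H i v = 0 := fun i hi => by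
        rw [hH, Set.indicator_of_notMem]
        rw [hA]
        rintro ⟨h1, h2⟩
        rcases lt_or_gt_of_ne hi with h | h
        · exact absurd h1 (not_le.2 (hlt i h))
        · exact absurd hk (not_le.2 (h2 k h))
      rw [Finset.sum_eq_single k]
      · have h1 : H k v = posPowSlope p l (T k v) := by
          rw [hH, Set.indicator_of_mem ((hA k v).2 ⟨hk, hlt⟩)]
        have h2 := posPowSlope_mul_le (l := l) hp (T k v) (T m v)
        have h3 : T m v - T k v = ∑ i ∈ Finset.Ico k m, v i := by
          rw [hT, hT, Finset.sum_Ico_eq_sub _ hkm]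
        have h4 : c ^ p ≤ posPow p (|T k v| - l) :=
          rpow_le_rpow hc.le ((by linarith : c ≤ |T k v| - l).trans (le_max_left _ _)) hp0.le
        rw [← mul_sum, ← h3, h1]
        linarith
      · intro i _ hi
        simp [hother i hi]
      · intro h
        exact absurd (Finset.mem_range.2 (Nat.lt_succ_of_le hkm)) h
    · rw [Set.indicator_of_notMem (by exact hv)]
      have : ∀ k ∈ range (m + 1), H k v = 0 := fun k hk => by
        rw [hH, Set.indicator_of_notMem]
        rw [hA]
        exact fun h => hv ⟨k, Nat.lt_succ_iff.1 (Finset.mem_range.1 hk), h.1⟩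
      rw [sum_eq_zero fun k hk => by simp [this k hk], add_zero]
      exact posPow_nonneg _ _
  have hEm : MeasurableSet {ω | ∃ j ≤ m, l + c ≤ |∑ i ∈ range j, X i ω|} := by
    have : {ω | ∃ j ≤ m, l + c ≤ |∑ i ∈ range j, X i ω|}
        = ⋃ j ∈ range (m + 1), {ω | l + c ≤ |∑ i ∈ range j, X i ω|} := by
      ext ω; simp
    rw [this]
    exact Finset.measurableSet_biUnion _ fun j _ => measurableSet_le measurable_const
      (measurable_fun_sum _ fun i _ => hX i).abs
  have hint : ∫ ω, {ω | ∃ j ≤ m, l + c ≤ |∑ i ∈ range j, X i ω|}.indicator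
        (fun _ => c ^ p) ω ∂P
      + ∫ ω, ∑ k ∈ range (m + 1), ∑ i ∈ Finset.Ico k m, H k (fun i => X i ω) * X i ω ∂P
      ≤ ∫ ω, posPow p (|∑ i ∈ range m, X i ω| - l) ∂P := by
    have i1 : Integrable ({ω | ∃ j ≤ m, l + c ≤ |∑ i ∈ range j, X i ω|}.indicator
        (fun _ => c ^ p)) P := (integrable_const _).indicator hEm
    have i2 : Integrable (fun ω => ∑ k ∈ range (m + 1), ∑ i ∈ Finset.Ico k m,
        H k (fun i => X i ω) * X i ω) P :=
      integrable_finsetSum _ fun k _ => integrable_finsetSum _ fun i _ => hHX k i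
    rw [← integral_add i1 i2]
    refine integral_mono (i1.add i2) ?_ fun ω => ?_
    · have := integrable_posPow_of_memLp (P := P) hp0 hl ((hTm m).comp hXm) (hTp m)
      simpa only [hT, Function.comp_apply] using this
    · have := hpt fun i => X i ω
      simpa only [hT, Set.indicator, Set.mem_ofPred_eq] using this
  rw [integral_finsetSum _ fun k _ => integrable_finsetSum _ fun i _ => hHX k i,
    sum_eq_zero, add_zero, integral_indicator hEm, setIntegral_const, smul_eq_mul] at hint
  · rw [← ENNReal.ofReal_toReal (measure_ne_top P _)]
    refine ofReal_le_ofReal ?_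
    rw [rpow_neg hc.le, ← div_eq_inv_mul, le_div_iff₀ (rpow_pos_of_pos hc p)]
    exact hint
  · intro k _
    rw [integral_finsetSum _ fun i _ => hHX k i]
    exact sum_eq_zero fun i hi => hH0 k i (Finset.mem_Ico.1 hi).1

end MaximalInequality

section BlockLengths

/-- The size `2 ^ (2 L / p) (L + 1) ^ γ` of the blocks at times of order `2 ^ L`. -/
def blockSize (p γ : ℝ) (L : ℕ) : ℝ := (2 : ℝ) ^ (2 * L / p) * ((L : ℝ) + 1) ^ γ

lemma blockSize_pos (p γ : ℝ) (L : ℕ) : 0 < blockSize p γ L := by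
  unfold blockSize; positivity

lemma exists_block_exponent {p γ : ℝ} (hp : 2 < p) (hγ : 0 ≤ γ) (hγ1 : γ ≤ 1) :
    ∃ r : ℕ → ℕ, ∃ c : ℝ, 0 < c ∧ ∀ L, r L ≤ L ∧ (2 : ℝ) ^ r L ≤ blockSize p γ L ∧
      c * blockSize p γ L ≤ (2 : ℝ) ^ r L := by
  obtain ⟨X, hX⟩ : ∃ X : ℕ → ℝ, ∀ L : ℕ, X L = 2 * L / p + γ * Real.logb 2 ((L : ℝ) + 1) :=
    ⟨_, fun _ => rfl⟩
  have hX2 : ∀ L, (2 : ℝ) ^ X L = blockSize p γ L := fun L => by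
    rw [hX, rpow_add (by norm_num), mul_comm γ, rpow_mul (by norm_num),
      Real.rpow_logb (by norm_num) (by norm_num) (by positivity), blockSize]
  have hX0 : ∀ L, 0 ≤ X L := fun L => by
    rw [hX]
    have : 0 ≤ Real.logb 2 ((L : ℝ) + 1) := Real.logb_nonneg (by norm_num) (by simp)
    have : 0 ≤ 2 * (L : ℝ) / p := by positivity
    positivity
  obtain ⟨a, ha⟩ : ∃ a, a = (1 - 2 / p) * Real.log 2 := ⟨_, rfl⟩
  have ha0 : 0 < a := by
    have : 2 / p < 1 := by rw [div_lt_one (by linarith)]; exact hp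
    rw [ha]
    exact mul_pos (by linarith) (Real.log_pos (by norm_num))
  have hgrow : ∀ L : ℕ, blockSize p γ L ≤ (1 + 1 / a) * (2 : ℝ) ^ L := fun L => by
    have h1 : ((L : ℝ) + 1) ^ γ ≤ (L : ℝ) + 1 := by
      conv_rhs => rw [← rpow_one ((L : ℝ) + 1)]
      exact rpow_le_rpow_of_exponent_le (by simp) hγ1
    have h2 : (L : ℝ) + 1 ≤ (1 + 1 / a) * exp (a * L) := by
      have h3 := add_one_le_exp (a * L)
      have h4 : (0 : ℝ) ≤ L := by positivity
      have h5 : (1 : ℝ) ≤ exp (a * L) := Real.one_le_exp (by positivity)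
      have h6 : (L : ℝ) ≤ 1 / a * exp (a * L) := by
        rw [div_mul_eq_mul_div, le_div_iff₀ ha0]; linarith
      linarith
    have h3 : (2 : ℝ) ^ (2 * L / p) * exp (a * L) = (2 : ℝ) ^ L := by
      rw [Real.rpow_def_of_pos (by norm_num), ← exp_add, ← rpow_natCast,
        Real.rpow_def_of_pos (by norm_num), ha]
      congr 1
      ring
    calc blockSize p γ L ≤ (2 : ℝ) ^ (2 * L / p) * ((1 + 1 / a) * exp (a * L)) :=
          mul_le_mul_of_nonneg_left (h1.trans h2) (by positivity)
      _ = _ := by rw [← h3]; ring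
  refine ⟨fun L => min L ⌊X L⌋₊, min (1 / 2) (1 / (1 + 1 / a)), by positivity, fun L =>
    ⟨min_le_left _ _, ?_, ?_⟩⟩
  · calc (2 : ℝ) ^ min L ⌊X L⌋₊ ≤ (2 : ℝ) ^ ⌊X L⌋₊ :=
          pow_le_pow_right₀ (by norm_num) (min_le_right _ _)
      _ ≤ (2 : ℝ) ^ X L := by
          rw [← rpow_natCast]
          exact rpow_le_rpow_of_exponent_le (by norm_num) (Nat.floor_le (hX0 L))
      _ = _ := hX2 L
  · beta_reduce
    rcases le_total L ⌊X L⌋₊ with h | h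
    · rw [min_eq_left h]
      have h1 := mul_le_mul_of_nonneg_right (min_le_right (1 / 2) (1 / (1 + 1 / a)))
        (blockSize_pos p γ L).le
      refine h1.trans ?_
      rw [one_div_mul_eq_div, div_le_iff₀ (by positivity), mul_comm]
      exact hgrow L
    · rw [min_eq_right h]
      have h1 := mul_le_mul_of_nonneg_right (min_le_left (1 / 2) (1 / (1 + 1 / a)))
        (blockSize_pos p γ L).le
      refine h1.trans ?_
      have h2 : (2 : ℝ) ^ X L ≤ 2 ^ ((⌊X L⌋₊ : ℝ) + 1) :=
        rpow_le_rpow_of_exponent_le (by norm_num) (Nat.lt_floor_add_one _).le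
      rw [rpow_add (by norm_num), rpow_one, rpow_natCast, hX2] at h2
      linarith

lemma exists_block_times {r : ℕ → ℕ} (hr : ∀ L, r L ≤ L) :
    ∃ t K : ℕ → ℕ, t 0 = 0 ∧ (∀ k, t (k + 1) = t k + 2 ^ r (Nat.log 2 (t k))) ∧ StrictMono t ∧
      (∀ L k, k < K L ↔ t k < 2 ^ (L + 1)) ∧ (∀ L, t (K L) ≤ 2 ^ (L + 2)) ∧
      ∀ k, t (k + 1) ≤ 4 * 2 ^ Nat.log 2 (t k) := by
  obtain ⟨t, ht0, hts⟩ : ∃ t : ℕ → ℕ, t 0 = 0 ∧ ∀ k, t (k + 1) = t k + 2 ^ r (Nat.log 2 (t k)) :=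
    ⟨fun k => Nat.rec 0 (fun _ s => s + 2 ^ r (Nat.log 2 s)) k, rfl, fun _ => rfl⟩
  have hmono : StrictMono t := strictMono_nat_of_lt_succ fun k => by
    rw [hts]; exact Nat.lt_add_of_pos_right (by positivity)
  have hex : ∀ L, ∃ k, 2 ^ (L + 1) ≤ t k := fun L => ⟨_, hmono.id_le (2 ^ (L + 1))⟩
  have hr2 : ∀ L, 2 ^ r L ≤ 2 ^ L := fun L => Nat.pow_le_pow_right (by norm_num) (hr L)
  have hK : ∀ L k, k < Nat.find (hex L) ↔ t k < 2 ^ (L + 1) := fun L k => by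
    constructor
    · intro h
      exact not_le.1 (Nat.find_min (hex L) h)
    · intro h
      by_contra h'
      exact absurd (Nat.find_spec (hex L)) (not_le.2
        (lt_of_le_of_lt (hmono.monotone (not_lt.1 h')) h))
  refine ⟨t, fun L => Nat.find (hex L), ht0, hts, hmono, hK, fun L => ?_, fun k => ?_⟩
  · obtain ⟨k, hk⟩ : ∃ k, Nat.find (hex L) = k + 1 := by
      refine Nat.exists_eq_succ_of_ne_zero fun h => ?_
      have := (hK L 0).2 (by rw [ht0]; positivity)
      omega
    have h1 := (hK L k).1 (by omega)
    beta_reduce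
    rw [hk, hts]
    have h2 : Nat.log 2 (t k) ≤ L := by
      rcases Nat.eq_zero_or_pos (t k) with h | h
      · simp [h]
      · exact Nat.lt_succ_iff.1 (Nat.log_lt_of_lt_pow h.ne' h1)
    have h3 := (hr2 (Nat.log 2 (t k))).trans (Nat.pow_le_pow_right (by norm_num) h2)
    rw [pow_succ] at h1
    rw [pow_succ, pow_succ]
    omega
  · have h1 : t k < 2 ^ (Nat.log 2 (t k) + 1) := Nat.lt_pow_succ_log_self (by norm_num) _
    have h2 := hr2 (Nat.log 2 (t k))
    rw [pow_succ] at h1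
    rw [hts]
    omega

lemma mul_rpow_le_rpow_sub {q s m : ℝ} (hq : 0 ≤ q) (hq1 : q ≤ 1) (hs : 0 ≤ s) (hm : 0 < m) :
    q * m * (s + m) ^ (q - 1) ≤ (s + m) ^ q - s ^ q := by
  have hT : 0 < s + m := by linarith
  have h1 := rpow_one_add_le_one_add_mul_self (s := -(m / (s + m)))
    (by rw [neg_le_neg_iff, div_le_one hT]; linarith) hq hq1
  have h2 : 1 + -(m / (s + m)) = s / (s + m) := by field_simp; ring
  rw [h2, div_rpow hs hT.le, div_le_iff₀ (rpow_pos_of_pos hT q)] at h1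
  rw [Real.rpow_sub_one hT.ne']
  have h3 : q * m * ((s + m) ^ q / (s + m)) = q * (m / (s + m)) * (s + m) ^ q := by ring
  rw [h3]
  linarith

lemma sum_block_variance_le {p γ C : ℝ} (hp : 2 < p) (hγ : 0 ≤ γ) (hC : 0 ≤ C) {r t K : ℕ → ℕ}
    {V : ℕ → ℝ} (ht0 : t 0 = 0) (hts : ∀ k, t (k + 1) = t k + 2 ^ r (Nat.log 2 (t k)))
    (hK : ∀ L k, k < K L ↔ t k < 2 ^ (L + 1)) (hKt : ∀ L, t (K L) ≤ 2 ^ (L + 2))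
    (h4 : ∀ k, t (k + 1) ≤ 4 * 2 ^ Nat.log 2 (t k))
    (hV : ∀ k, V k ≤ C * ((Nat.log 2 (t k) : ℝ) + 1) ^ γ *
      (2 : ℝ) ^ ((2 / p - 1) * Nat.log 2 (t k)) * (2 : ℝ) ^ r (Nat.log 2 (t k))) (L : ℕ) :
    ∑ k ∈ range (K L), V k ≤ C * (8 * p) * blockSize p γ L := by
  obtain ⟨q, hq⟩ : ∃ q, q = 2 / p := ⟨_, rfl⟩
  have hq0 : 0 < q := by rw [hq]; positivity
  have hq1 : q < 1 := by rw [hq, div_lt_one (by linarith)]; exact hp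
  have hstep : ∀ k < K L, V k ≤ C * ((L : ℝ) + 1) ^ γ * (4 / q) *
      ((t (k + 1) : ℝ) ^ q - (t k : ℝ) ^ q) := fun k hk => by
    have hl : Nat.log 2 (t k) ≤ L := by
      rcases Nat.eq_zero_or_pos (t k) with h | h
      · simp [h]
      · exact Nat.lt_succ_iff.1 (Nat.log_lt_of_lt_pow h.ne' ((hK L k).1 hk))
    obtain ⟨l, hl'⟩ : ∃ l, l = Nat.log 2 (t k) := ⟨_, rfl⟩
    obtain ⟨m, hm⟩ : ∃ m : ℝ, m = (2 : ℝ) ^ r l := ⟨_, rfl⟩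
    have hm0 : 0 < m := by rw [hm]; positivity
    have hts' : (t (k + 1) : ℝ) = t k + m := by rw [hts, hm, hl']; push_cast; rfl
    have h5 : (t k : ℝ) + m ≤ 4 * 2 ^ l := by rw [← hts', hl']; exact_mod_cast h4 k
    have h6 := mul_rpow_le_rpow_sub hq0.le hq1.le (Nat.cast_nonneg (t k) : (0 : ℝ) ≤ t k) hm0
    have h7 : (2 : ℝ) ^ ((q - 1) * l) ≤ 4 * ((t k : ℝ) + m) ^ (q - 1) := by
      have h8 : (4 * (2 : ℝ) ^ l) ^ (q - 1) ≤ ((t k : ℝ) + m) ^ (q - 1) :=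
        rpow_le_rpow_of_nonpos (by positivity) h5 (by linarith)
      have h9 : (4 : ℝ)⁻¹ ≤ 4 ^ (q - 1) := by
        rw [← Real.rpow_neg_one]
        exact rpow_le_rpow_of_exponent_le (by norm_num) (by linarith)
      rw [mul_rpow (by norm_num) (by positivity), ← rpow_natCast 2 l,
        ← rpow_mul (by norm_num), mul_comm (l : ℝ)] at h8
      have h10 : 0 < (2 : ℝ) ^ ((q - 1) * l) := by positivity
      nlinarith
    have h8 : ((l : ℝ) + 1) ^ γ ≤ ((L : ℝ) + 1) ^ γ :=
      rpow_le_rpow (by positivity) (by rw [hl']; exact_mod_cast Nat.succ_le_succ hl) hγ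
    refine (hV k).trans ?_
    rw [← hq, ← hl', ← hm, hts']
    calc C * ((l : ℝ) + 1) ^ γ * (2 : ℝ) ^ ((q - 1) * l) * m
        ≤ C * ((L : ℝ) + 1) ^ γ * (4 * ((t k : ℝ) + m) ^ (q - 1)) * m := by gcongr
      _ = C * ((L : ℝ) + 1) ^ γ * (4 / q) * (q * m * ((t k : ℝ) + m) ^ (q - 1)) := by
          field_simp
      _ ≤ _ := mul_le_mul_of_nonneg_left h6 (by positivity)
  refine (sum_le_sum fun k hk => hstep k (Finset.mem_range.1 hk)).trans ?_
  rw [← mul_sum, Finset.sum_range_sub fun k => (t k : ℝ) ^ q, ht0, Nat.cast_zero,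
    zero_rpow hq0.ne', sub_zero]
  have h1 : (t (K L) : ℝ) ^ q ≤ 4 * (2 : ℝ) ^ (2 * L / p) := by
    have h2 : (t (K L) : ℝ) ≤ 4 * 2 ^ L := by
      have : (t (K L) : ℝ) ≤ 2 ^ (L + 2) := by exact_mod_cast hKt L
      rw [pow_add] at this; linarith
    refine (rpow_le_rpow (by positivity) h2 hq0.le).trans ?_
    rw [mul_rpow (by norm_num) (by positivity), ← rpow_natCast 2 L,
      ← rpow_mul (by norm_num), show (L : ℝ) * q = 2 * L / p by rw [hq]; ring]
    refine mul_le_mul_of_nonneg_right ?_ (by positivity)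
    conv_rhs => rw [← rpow_one 4]
    exact rpow_le_rpow_of_exponent_le (by norm_num) hq1.le
  calc C * ((L : ℝ) + 1) ^ γ * (4 / q) * (t (K L) : ℝ) ^ q
      ≤ C * ((L : ℝ) + 1) ^ γ * (4 / q) * (4 * (2 : ℝ) ^ (2 * L / p)) :=
        mul_le_mul_of_nonneg_left h1 (by positivity)
    _ = _ := by rw [hq, blockSize]; field_simp; ring

end BlockLengths

section Discrepancy

lemma sq_sub_le_posPow {p b g ρ : ℝ} (hp : 2 < p) (hρ : 0 < ρ) :
    (b - g) ^ 2 ≤ 4 * ρ * |b - g|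
      + 16 * ρ ^ (2 - p) * (posPow p (|b| - ρ) + posPow p (|g| - ρ)) := by
  have hpos : 0 ≤ posPow p (|b| - ρ) + posPow p (|g| - ρ) :=
    add_nonneg (posPow_nonneg _ _) (posPow_nonneg _ _)
  have hρp : 0 < ρ ^ (2 - p) := rpow_pos_of_pos hρ _
  rw [← sq_abs]
  rcases le_total |b - g| (4 * ρ) with h | h
  · have : 0 ≤ 16 * ρ ^ (2 - p) * (posPow p (|b| - ρ) + posPow p (|g| - ρ)) := by positivity
    nlinarith [abs_nonneg (b - g)]
  · have key : ∀ u, |b - g| ≤ 2 * |u| →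
        |b - g| ^ 2 ≤ 16 * ρ ^ (2 - p) * posPow p (|u| - ρ) := fun u hu => by
      have hv : ρ ≤ |u| - ρ := by linarith
      have hv0 : 0 < |u| - ρ := by linarith
      rw [posPow, max_eq_left hv0.le]
      have h1 : (|u| - ρ) ^ 2 ≤ ρ ^ (2 - p) * (|u| - ρ) ^ p := by
        rw [show (|u| - ρ) ^ 2 = (|u| - ρ) ^ (2 - p) * (|u| - ρ) ^ p by
          rw [← rpow_add hv0, sub_add_cancel, rpow_two]]
        exact mul_le_mul_of_nonneg_right (rpow_le_rpow_of_nonpos hρ hv (by linarith))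
          (by positivity)
      nlinarith [abs_nonneg (b - g)]
    have h2 : 0 ≤ 4 * ρ * |b - g| := by positivity
    have h3 := abs_sub b g
    rcases le_total |b| |g| with h' | h'
    · have := key g (by linarith)
      nlinarith [posPow_nonneg p (|b| - ρ)]
    · have := key b (by linarith)
      nlinarith [posPow_nonneg p (|g| - ρ)]

lemma integral_sq_sub_le {Ω : Type*} [MeasurableSpace Ω] {P : Measure Ω} [IsProbabilityMeasure P]
    {p ρ M U : ℝ} (hp : 2 < p) (hρ : 0 < ρ) {B G : Ω → ℝ} (hB : Measurable B) (hG : Measurable G)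
    (hBp : MemLp B (ofReal p) P) (hGp : MemLp G (ofReal p) P)
    (hM : ∫ ω, |B ω - G ω| ∂P ≤ M) (hBU : ∫ ω, posPow p (|B ω| - ρ) ∂P ≤ U)
    (hGU : ∫ ω, posPow p (|G ω| - ρ) ∂P ≤ U) :
    ∫ ω, (B ω - G ω) ^ 2 ∂P ≤ 4 * ρ * M + 32 * ρ ^ (2 - p) * U := by
  have h1 : (1 : ℝ≥0∞) ≤ ofReal p := by
    rw [ENNReal.one_le_ofReal]; linarith
  have i1 : Integrable (fun ω => 4 * ρ * |B ω - G ω|) P :=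
    (((hBp.sub hGp).integrable h1).abs).const_mul _
  have i2 := integrable_posPow_of_memLp (by linarith) hρ.le hB hBp
  have i3 := integrable_posPow_of_memLp (by linarith) hρ.le hG hGp
  have i4 : Integrable (fun ω => 16 * ρ ^ (2 - p) *
      (posPow p (|B ω| - ρ) + posPow p (|G ω| - ρ))) P := (i2.add i3).const_mul _
  have h2 := integral_mono_of_nonneg (ae_of_all P fun ω => sq_nonneg (B ω - G ω)) (i1.add i4)
    (ae_of_all _ fun ω => sq_sub_le_posPow (b := B ω) (g := G ω) hp hρ)
  rw [integral_add' i1 i4, integral_const_mul, integral_const_mul, integral_add i2 i3] at h2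
  have h3 : 0 < ρ ^ (2 - p) := rpow_pos_of_pos hρ _
  nlinarith [mul_le_mul_of_nonneg_left hM hρ.le, mul_le_mul_of_nonneg_left hBU h3.le,
    mul_le_mul_of_nonneg_left hGU h3.le]

lemma memLp_eval_stdG {ι : Type} [Fintype ι] (a : ι) (q : ℝ≥0) :
    MemLp (fun z : ℰ ι => z a) q (stdG ι) := by
  have h : MemLp (fun r : ℝ => r) q ((stdG ι).map fun z => z a) := by
    rw [map_eval_stdG]; exact memLp_id_gaussianReal q
  exact (memLp_map_measure_iff (by fun_prop) (by fun_prop)).1 h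

variable {ι : Type} [Fintype ι] {p : ℝ}

lemma posPow_sub_anti {q : ℝ} (hq : 0 ≤ q) (u : ℝ) {l l' : ℝ} (h : l ≤ l') :
    posPow q (u - l') ≤ posPow q (u - l) :=
  rpow_le_rpow (le_max_right _ _) (max_le_max (by linarith) le_rfl) hq

lemma integral_posPow_abs_scaledG_le (hp : 2 < p) (hp3 : p ≤ 3) (r : ℕ) (a : ι) {ρ : ℝ}
    (hρ : 2 * √r * √((2 ^ r : ℕ) : ℝ) ≤ ρ) :
    ∫ z, posPow p (|z a| - ρ) ∂(scaledG ι ((2 ^ r : ℕ) : ℝ)) ≤ 34 * (2 ^ r : ℕ) := by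
  obtain ⟨n, hn⟩ : ∃ n : ℝ, n = ((2 ^ r : ℕ) : ℝ) := ⟨_, rfl⟩
  have hn1 : 1 ≤ n := by rw [hn]; exact_mod_cast Nat.one_le_two_pow
  have hp0 : 0 ≤ p := by linarith
  rw [← hn] at hρ ⊢
  rw [integral_scaledG (fun z : ℰ ι => posPow p (|z a| - ρ))
    ((continuous_posPow hp0).measurable.comp ((by fun_prop : Measurable fun
      z : ℰ ι => |z a|).sub_const _))]
  simp only [PiLp.smul_apply, smul_eq_mul]
  have hmem : ∀ s : ℝ, Integrable (fun z : ℰ ι =>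
      posPow p (s * (√n * z a) - 2 * √r * √n)) (stdG ι) := fun s => by
    have h1 : MemLp (fun z : ℰ ι => s * (√n * z a)) (ofReal p) (stdG ι) :=
      ((memLp_eval_stdG a p.toNNReal).const_mul _).const_mul _
    refine (integrable_posPow_of_memLp (l := 2 * √r * √n) (by linarith) (by positivity)
      (by fun_prop) h1).mono' ((continuous_posPow hp0).measurable.comp
        (by fun_prop)).aestronglyMeasurable (ae_of_all _ fun z => ?_)
    rw [norm_eq_abs, abs_of_nonneg (posPow_nonneg _ _)]
    exact rpow_le_rpow (le_max_right _ _)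
      (max_le_max (sub_le_sub_right (le_abs_self _) _) le_rfl) hp0
  have h3 := integral_posPow_scaled_le (ι := ι) hp hp3 a (s := 1) (l := 2 * √r) (by simp)
    (by positivity) (sqrt_nonneg n)
  have h4 := integral_posPow_scaled_le (ι := ι) hp hp3 a (s := -1) (l := 2 * √r) (by simp)
    (by positivity) (sqrt_nonneg n)
  have h5 := integral_mono_of_nonneg (ae_of_all (stdG ι) fun z => posPow_nonneg p _)
    ((hmem 1).add (hmem (-1)))
    (ae_of_all _ fun z => (posPow_sub_anti hp0 |√n * z a| hρ).trans
      (posPow_abs_sub_le p (√n * z a) (2 * √r * √n)))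
  rw [integral_add' (hmem 1) (hmem (-1))] at h5
  have h7 := hn ▸ sqrt_rpow_mul_exp_le (p := p) (by linarith) r
  linarith

variable [DecidableEq ι] {μ : Measure (𝒳 ι)}

lemma TruncBound.integral_block_le (hμ : MartLaw p μ) (hp : 2 < p) (hp3 : p ≤ 3) {r : ℕ}
    {D : ℝ} (hD : 1 ≤ D) (hT : TruncBound p μ (2 ^ r) D) (t : ℤ) (a : ι) {ρ : ℝ}
    (hρ : 2 * √r * √((2 ^ r : ℕ) : ℝ) ≤ ρ) :
    ∫ x, posPow p (|blockSum t (2 ^ r) x a| - ρ) ∂μ ≤ 34 * D * (2 ^ r : ℕ) := by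
  refine le_trans ?_ (hT.integral_excess_le hμ hp hp3 hD t a)
  exact integral_mono_of_nonneg (ae_of_all _ fun x => posPow_nonneg _ _)
    (hμ.integrable_posPow_abs (by linarith) t (2 ^ r) a (by positivity))
    (ae_of_all _ fun x => posPow_sub_anti (by linarith) _ hρ)

/-- The exponent of `log n` in the block lengths. -/
def logExponent (p : ℝ) : ℝ := if p = 3 then 1 else 1 / p

lemma logExponent_nonneg (hp : 2 < p) : 0 ≤ logExponent p := by
  unfold logExponent; split_ifs <;> positivity

lemma logExponent_le_one (hp : 2 < p) : logExponent p ≤ 1 := by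
  unfold logExponent
  split_ifs
  · exact le_rfl
  · rw [div_le_one (by linarith)]; linarith

lemma discrepancy_le (hp : 2 < p) (hp3 : p ≤ 3) {C D : ℝ} (hD : 0 ≤ D) (r : ℕ) :
    4 * (2 * √((r : ℝ) + 1) * √((2 ^ r : ℕ) : ℝ)) * (C * couplingRate p r + 1)
      + 32 * (2 * √((r : ℝ) + 1) * √((2 ^ r : ℕ) : ℝ)) ^ (2 - p) * (34 * D * (2 ^ r : ℕ))
      ≤ (8 * (C + 1) + 1088 * D) *
        (((r : ℝ) + 1) ^ (logExponent p * p / 2) * ((2 ^ r : ℕ) : ℝ) ^ (2 - p / 2)) := by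
  have hrate := couplingRate_ge_one hp3 r
  have hprod : √((r : ℝ) + 1) * √((2 ^ r : ℕ) : ℝ) * couplingRate p r
      = ((r : ℝ) + 1) ^ (logExponent p * p / 2) * ((2 ^ r : ℕ) : ℝ) ^ (2 - p / 2) := by
    have hm : (0 : ℝ) < ((2 ^ r : ℕ) : ℝ) := by positivity
    rw [couplingRate, logExponent, sqrt_eq_rpow, sqrt_eq_rpow]
    split_ifs with h
    · subst h
      rw [mul_right_comm, ← rpow_add_one (by positivity)]
      norm_num
    · rw [mul_assoc, ← rpow_add hm]
      congr 2
      · field_simp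
      · ring
  obtain ⟨m, hm⟩ : ∃ m : ℝ, m = ((2 ^ r : ℕ) : ℝ) := ⟨_, rfl⟩
  have hm1 : 1 ≤ m := by rw [hm]; exact_mod_cast Nat.one_le_two_pow
  rw [← hm] at hprod ⊢
  have h1 : (2 * √((r : ℝ) + 1) * √m) ^ (2 - p) ≤ m ^ (1 - p / 2) := by
    have : m ^ (1 - p / 2) = √m ^ (2 - p) := by
      rw [sqrt_rpow_eq (by linarith)]; ring_nf
    rw [this]
    refine rpow_le_rpow_of_nonpos (by positivity) ?_ (by linarith)
    have : 1 ≤ √((r : ℝ) + 1) := Real.one_le_sqrt.2 (by simp)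
    nlinarith [sqrt_nonneg m]
  have h2 : m ^ (1 - p / 2) * m = m ^ (2 - p / 2) := by
    rw [← rpow_add_one (by positivity)]; ring_nf
  have h3 : m ^ (2 - p / 2) ≤ ((r : ℝ) + 1) ^ (logExponent p * p / 2) * m ^ (2 - p / 2) :=
    le_mul_of_one_le_left (by positivity)
      (one_le_rpow (by simp) (by have := logExponent_nonneg hp; positivity))
  have h4 : 4 * (2 * √((r : ℝ) + 1) * √m) * (C * couplingRate p r + 1)
      ≤ 8 * (C + 1) * (√((r : ℝ) + 1) * √m * couplingRate p r) := by
    have : 0 ≤ √((r : ℝ) + 1) * √m := by positivity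
    nlinarith
  have h5 : 32 * (2 * √((r : ℝ) + 1) * √m) ^ (2 - p) * (34 * D * m)
      ≤ 1088 * D * (m ^ (1 - p / 2) * m) := by
    have : 0 ≤ D * m := by positivity
    nlinarith
  rw [hprod] at h4
  rw [h2] at h5
  nlinarith [mul_le_mul_of_nonneg_left h3 hD]

lemma discrepancy_exponent_le (hp : 2 < p) {r L : ℕ} {c γ : ℝ} (hγ : 0 ≤ γ) (hc : 0 < c)
    (hr : r ≤ L) (hcr : c * blockSize p γ L ≤ (2 : ℝ) ^ r) :
    ((r : ℝ) + 1) ^ (γ * p / 2) * ((2 ^ r : ℕ) : ℝ) ^ (2 - p / 2)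
      ≤ c ^ (1 - p / 2) * ((L : ℝ) + 1) ^ γ * (2 : ℝ) ^ ((2 / p - 1) * L) * (2 : ℝ) ^ r := by
  have h1 : ((r : ℝ) + 1) ^ (γ * p / 2) ≤ ((L : ℝ) + 1) ^ (γ * p / 2) :=
    rpow_le_rpow (by positivity) (by exact_mod_cast Nat.succ_le_succ hr) (by positivity)
  have h2 : (((2 : ℝ) ^ r)) ^ (1 - p / 2) ≤ (c * blockSize p γ L) ^ (1 - p / 2) :=
    rpow_le_rpow_of_nonpos (mul_pos hc (blockSize_pos _ _ _)) hcr (by linarith)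
  have h3 : (c * blockSize p γ L) ^ (1 - p / 2) = c ^ (1 - p / 2) *
      ((2 : ℝ) ^ ((2 / p - 1) * L) * ((L : ℝ) + 1) ^ (γ * (1 - p / 2))) := by
    rw [mul_rpow hc.le (blockSize_pos _ _ _).le, blockSize,
      mul_rpow (by positivity) (by positivity), ← rpow_mul (by norm_num),
      ← rpow_mul (by positivity)]
    congr 3
    field_simp
  have h4 : ((L : ℝ) + 1) ^ (γ * p / 2) * ((L : ℝ) + 1) ^ (γ * (1 - p / 2))
      = ((L : ℝ) + 1) ^ γ := by
    rw [← rpow_add (by positivity)]; ring_nf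
  have h5 : ((2 ^ r : ℕ) : ℝ) ^ (2 - p / 2) = ((2 : ℝ) ^ r) ^ (1 - p / 2) * (2 : ℝ) ^ r := by
    rw [← rpow_add_one (by positivity)]; push_cast; ring_nf
  rw [h5, ← h4]
  rw [h3] at h2
  calc _ ≤ ((L : ℝ) + 1) ^ (γ * p / 2) * (c ^ (1 - p / 2) *
      ((2 : ℝ) ^ ((2 / p - 1) * L) * ((L : ℝ) + 1) ^ (γ * (1 - p / 2))) * (2 : ℝ) ^ r) := by
        gcongr
    _ = _ := by ring

end Discrepancy

section LevelProbabilities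

section Orthogonal

variable {Ω : Type*} [MeasurableSpace Ω] {P : Measure Ω}

lemma integral_sq_sum_eq {X : ℕ → Ω → ℝ} (hX2 : ∀ i, MemLp (X i) 2 P)
    (hort : ∀ k (H : (ℕ → ℝ) → ℝ), Measurable H → DependsOn H (Iio k) →
      MemLp (fun ω => H fun i => X i ω) 2 P → ∫ ω, H (fun i => X i ω) * X k ω ∂P = 0) (m : ℕ) :
    ∫ ω, (∑ i ∈ range m, X i ω) ^ 2 ∂P = ∑ i ∈ range m, ∫ ω, X i ω ^ 2 ∂P := by
  have hT : ∀ m, MemLp (fun ω => ∑ i ∈ range m, X i ω) 2 P := fun m =>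
    memLp_finsetSum _ fun i _ => hX2 i
  induction m with
  | zero => simp
  | succ m ih =>
    have h0 := hort m (fun v => ∑ i ∈ range m, v i) (by fun_prop)
      (fun v w h => sum_congr rfl fun i hi => h i (by simpa using hi)) (hT m)
    have i1 : Integrable (fun ω => (∑ i ∈ range m, X i ω) ^ 2) P := (hT m).integrable_sq
    have i2 : Integrable (fun ω => 2 * ((∑ i ∈ range m, X i ω) * X m ω)) P :=
      ((hT m).integrable_mul (hX2 m)).const_mul 2
    have i3 : Integrable (fun ω => X m ω ^ 2) P := (hX2 m).integrable_sq
    have e : ∀ ω, (∑ i ∈ range (m + 1), X i ω) ^ 2 = (∑ i ∈ range m, X i ω) ^ 2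
        + 2 * ((∑ i ∈ range m, X i ω) * X m ω) + X m ω ^ 2 := fun ω => by
      rw [sum_range_succ]; ring
    simp_rw [e]
    rw [integral_add (show Integrable (fun ω => (∑ i ∈ range m, X i ω) ^ 2
      + 2 * ((∑ i ∈ range m, X i ω) * X m ω)) P from i1.add i2) i3, integral_add i1 i2,
      integral_const_mul, h0, ih, sum_range_succ]
    ring

/-- Kolmogorov's maximal inequality for sums of orthogonal increments. -/
lemma maximal_sq [IsProbabilityMeasure P] {c : ℝ} (hc : 0 < c) {X : ℕ → Ω → ℝ}
    (hX : ∀ i, Measurable (X i)) (hX2 : ∀ i, MemLp (X i) 2 P)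
    (hort : ∀ k (H : (ℕ → ℝ) → ℝ), Measurable H → DependsOn H (Iio k) →
      MemLp (fun ω => H fun i => X i ω) 2 P → ∫ ω, H (fun i => X i ω) * X k ω ∂P = 0) (m : ℕ) :
    P {ω | ∃ j ≤ m, c ≤ |∑ i ∈ range j, X i ω|}
      ≤ ofReal (c ^ (-2 : ℝ) * ∑ i ∈ range m, ∫ ω, X i ω ^ 2 ∂P) := by
  have h := maximal_posPow (P := P) (p := 2) (l := 0) (c := c) (by norm_num) le_rfl hc hX
    (by simpa using hX2) (by
      have : ofReal (2 / (2 - 1)) = 2 := by norm_num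
      rwa [this]) m
  simp only [zero_add, sub_zero] at h
  have e : ∀ x : ℝ, posPow 2 |x| = x ^ 2 := fun x => by
    rw [posPow, max_eq_left (abs_nonneg x), rpow_two, sq_abs]
  simp_rw [e] at h
  rwa [integral_sq_sum_eq hX2 hort] at h

lemma indepFun_of_dependsOn_Iio {X : ℕ → Ω → ℝ} (hX : ∀ i, Measurable (X i)) (hind : iIndepFun X P)
    {k : ℕ} {H : (ℕ → ℝ) → ℝ} (hH : Measurable H) (hHd : DependsOn H (Iio k)) :
    IndepFun (fun ω => H fun i => X i ω) (X k) P := by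
  have h2 := hind.indepFun_finset (range k) {k} (by simp) hX
  have hm : Measurable fun v : range k → ℝ => H fun i =>
      if h : i ∈ range k then v ⟨i, h⟩ else 0 := by
    refine hH.comp (measurable_pi_iff.2 fun i => ?_)
    by_cases h : i ∈ range k
    · simp only [h, dif_pos]; exact measurable_pi_apply _
    · simp only [h, dif_neg, not_false_iff]; exact measurable_const
  have hm' : Measurable fun v : ({k} : Finset ℕ) → ℝ => v ⟨k, by simp⟩ := measurable_pi_apply _
  have e : (fun ω => H fun i => X i ω) = fun ω => H fun i => if h : i ∈ range k then
      (fun j : range k => X j ω) ⟨i, h⟩ else 0 := by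
    ext1 ω
    exact hHd fun i hi => by simp [Finset.mem_range, Set.mem_Iio.1 hi]
  rw [e]
  exact h2.comp hm hm'

end Orthogonal

variable {ι : Type} [Fintype ι] {p : ℝ}

lemma maximal_gaussian {Ω : Type*} [MeasurableSpace Ω] {P : Measure Ω} [IsProbabilityMeasure P]
    (hp : 2 < p) (hp3 : p ≤ 3) {N : ℕ → Ω → ℰ ι} (hN : ∀ i, Measurable (N i))
    (hind : iIndepFun N P) (hmap : ∀ i, P.map (N i) = stdG ι) (r : ℕ) (a : ι) {l : ℝ}
    (hl0 : 0 < l) (hl : 2 * √r * √((2 ^ r : ℕ) : ℝ) ≤ l) :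
    P {ω | ∃ j ≤ 2 ^ r, l + l ≤ |∑ i ∈ range j, N i ω a|}
      ≤ ofReal (l ^ (-p) * (34 * (2 ^ r : ℕ))) := by
  have hX : ∀ i, Measurable fun ω => N i ω a := fun i => by fun_prop
  have hindX : iIndepFun (fun i ω => N i ω a) P :=
    hind.comp (fun _ z => z a) fun _ => by fun_prop
  have hXq : ∀ i (q : ℝ≥0), MemLp (fun ω => N i ω a) q P := fun i q => by
    have h := memLp_eval_stdG a q
    rw [← hmap i] at h
    exact (memLp_map_measure_iff (by fun_prop) (hN i).aemeasurable).1 h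
  have h0 : ∀ i, ∫ ω, N i ω a ∂P = 0 := fun i => by
    have := integral_eval_stdG a
    rw [← hmap i, integral_map (hN i).aemeasurable (by fun_prop)] at this
    exact this
  refine (maximal_posPow (p := p) (by linarith) hl0.le hl0 hX (fun i => hXq i p.toNNReal)
    (fun k H hH hHd hH2 => ?_) _).trans (ofReal_le_ofReal
      (mul_le_mul_of_nonneg_left ?_ (by positivity)))
  · have := (indepFun_of_dependsOn_Iio hX hindX hH hHd).integral_fun_mul_eq_mul_integral
      hH2.aestronglyMeasurable (hX k).aestronglyMeasurable
    rw [this, h0, mul_zero]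
  · have h1 := map_sum_eq_scaledG hN hind hmap (range (2 ^ r))
    rw [card_range] at h1
    have h2 := integral_posPow_abs_scaledG_le (ι := ι) hp hp3 r a hl
    rw [← h1, integral_map (measurable_fun_sum _ fun i _ => hN i).aemeasurable] at h2
    · simpa using h2
    · exact ((continuous_posPow (by linarith)).measurable.comp ((by fun_prop : Measurable fun
      z : ℰ ι => |z a|).sub_const _)).aestronglyMeasurable

variable [DecidableEq ι] {μ : Measure (𝒳 ι)}

lemma TruncBound.maximal_block (hμ : MartLaw p μ) (hp : 2 < p) (hp3 : p ≤ 3) {r : ℕ}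
    {D : ℝ} (hD : 1 ≤ D) (hT : TruncBound p μ (2 ^ r) D) (t : ℤ) (a : ι) {l : ℝ}
    (hl0 : 0 < l) (hl : 2 * √r * √((2 ^ r : ℕ) : ℝ) ≤ l) :
    μ {x | ∃ j ≤ 2 ^ r, l + l ≤ |blockSum t j x a|}
      ≤ ofReal (l ^ (-p) * (34 * D * (2 ^ r : ℕ))) := by
  have := hμ.prob
  have hb : ∀ (j : ℕ) (x : 𝒳 ι),
      blockSum t j x a = ∑ i ∈ range j, x (t + i + 1) a := fun j x => by
    simp [blockSum]
  have h := maximal_posPow (P := μ) (p := p) (l := l) (c := l) (by linarith) hl0.le hl0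
    (X := fun i x => x (t + i + 1) a) (fun i => measurable_coord _ _)
    (fun i => (hμ.memLp_coord _).eval_piLp a)
    (fun k H hH hHd hH2 => ?_) (2 ^ r)
  · simp only [← hb] at h
    refine h.trans (ofReal_le_ofReal (mul_le_mul_of_nonneg_left ?_ (by positivity)))
    exact hT.integral_block_le hμ hp hp3 hD t a hl
  · have hconj : Real.HolderConjugate (p / (p - 1)) p :=
      ((Real.holderConjugate_iff_eq_conjExponent (by linarith)).2 rfl).symm
    have := hconj.ennrealOfReal
    refine hμ.mart_at (t + k) a (hH.comp (measurable_pi_iff.2 fun i => measurable_coord _ _)) ?_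
      (hH2.integrable_mul ((hμ.memLp_coord _).eval_piLp a))
    intro x y hxy
    refine hHd fun i hi => ?_
    have := Set.mem_Iio.1 hi
    dsimp only
    rw [hxy (t + i + 1) (by simp only [mem_Iic]; omega)]

end LevelProbabilities

section Levels

lemma ae_eventually_notMem_of_rpow_le {Ω : Type*} [MeasurableSpace Ω] {P : Measure Ω}
    {E : ℕ → Set Ω} {C e : ℝ} (hC : 0 ≤ C) (he : 1 < e)
    (h : ∀ L, P (E L) ≤ ofReal (C * ((L : ℝ) + 1) ^ (-e))) :
    ∀ᵐ ω ∂P, ∀ᶠ L in atTop, ω ∉ E L := by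
  refine ae_eventually_notMem (ne_top_of_le_ne_top ?_ (ENNReal.tsum_le_tsum h))
  have hs : Summable fun L : ℕ => C * ((L : ℝ) + 1) ^ (-e) := by
    have h1 : Summable fun L : ℕ => ((L : ℝ)) ^ (-e) := Real.summable_nat_rpow.2 (by linarith)
    have h2 := (summable_nat_add_iff 1).2 h1
    simpa using h2.mul_left C
  rw [← ENNReal.ofReal_tsum_of_nonneg (fun L => by positivity) hs]
  exact ofReal_ne_top

/-- The approximation error allowed at times of order `2 ^ L`. -/
def levelBound (p κ : ℝ) (L : ℕ) : ℝ := 2 * ((2 : ℝ) ^ (L / p) * ((L : ℝ) + 1) ^ κ)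

lemma levelBound_pos (p κ : ℝ) (L : ℕ) : 0 < levelBound p κ L := by
  unfold levelBound; positivity

lemma levelBound_rpow (p κ q : ℝ) (L : ℕ) :
    levelBound p κ L ^ q = 2 ^ q * ((2 : ℝ) ^ (L * q / p) * ((L : ℝ) + 1) ^ (κ * q)) := by
  rw [levelBound, mul_rpow (by norm_num) (by positivity),
    mul_rpow (by positivity) (by positivity), ← rpow_mul (by norm_num),
    ← rpow_mul (by positivity), div_mul_eq_mul_div]

lemma levelBound_neg_two_mul (p γ κ : ℝ) (L : ℕ) :
    levelBound p κ L ^ (-2 : ℝ) * blockSize p γ L = 4⁻¹ * ((L : ℝ) + 1) ^ (-(2 * κ - γ)) := by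
  have h1 : (2 : ℝ) ^ (-2 : ℝ) = 4⁻¹ := by
    rw [rpow_neg (by norm_num), rpow_two]; norm_num
  have h2 : (2 : ℝ) ^ (L * (-2) / p) * (2 : ℝ) ^ (2 * L / p) = 1 := by
    rw [← rpow_add (by norm_num)]
    rw [show (L : ℝ) * (-2) / p + 2 * L / p = 0 by ring, Real.rpow_zero]
  have h3 : ((L : ℝ) + 1) ^ (κ * (-2)) * ((L : ℝ) + 1) ^ γ = ((L : ℝ) + 1) ^ (-(2 * κ - γ)) := by
    rw [← rpow_add (by positivity)]; ring_nf
  rw [levelBound_rpow, blockSize, h1, ← h3]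
  calc _ = 4⁻¹ * ((2 : ℝ) ^ (L * (-2) / p) * (2 : ℝ) ^ (2 * L / p)) *
        (((L : ℝ) + 1) ^ (κ * (-2)) * ((L : ℝ) + 1) ^ γ) := by ring
    _ = _ := by rw [h2, mul_one]

lemma levelBound_neg_mul_le {p : ℝ} (hp : 2 < p) (κ : ℝ) (L : ℕ) :
    levelBound p κ L ^ (-p) * 2 ^ (L + 2) ≤ 4 * ((L : ℝ) + 1) ^ (-(κ * p)) := by
  have h1 : (2 : ℝ) ^ (-p) ≤ 1 := Real.rpow_le_one_of_one_le_of_nonpos (by norm_num) (by linarith)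
  have h2 : (2 : ℝ) ^ (L * -p / p) * (2 : ℝ) ^ L = 1 := by
    rw [mul_neg, neg_div, mul_div_cancel_right₀ _ (by linarith : p ≠ 0),
      rpow_neg (by norm_num), rpow_natCast, inv_mul_cancel₀ (by positivity)]
  rw [levelBound_rpow, pow_add, mul_neg κ]
  calc (2 : ℝ) ^ (-p) * ((2 : ℝ) ^ (L * -p / p) * ((L : ℝ) + 1) ^ (-(κ * p))) * (2 ^ L * 2 ^ 2)
      = (2 : ℝ) ^ (-p) * ((2 : ℝ) ^ (L * -p / p) * (2 : ℝ) ^ L) *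
        (4 * ((L : ℝ) + 1) ^ (-(κ * p))) := by ring
    _ ≤ 1 * 1 * (4 * ((L : ℝ) + 1) ^ (-(κ * p))) := by
        rw [h2]; exact mul_le_mul_of_nonneg_right (by linarith) (by positivity)
    _ = _ := by ring

lemma sqrt_block_le_levelBound {p γ κ : ℝ} (hκ : (1 + γ) / 2 ≤ κ) {r L : ℕ} (hr : r ≤ L)
    (hrb : (2 : ℝ) ^ r ≤ blockSize p γ L) :
    2 * √r * √((2 ^ r : ℕ) : ℝ) ≤ levelBound p κ L := by
  have h1 : √(r : ℝ) ≤ ((L : ℝ) + 1) ^ (1 / 2 : ℝ) := by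
    rw [← sqrt_eq_rpow]
    refine sqrt_le_sqrt ?_
    have : (r : ℝ) ≤ L := by exact_mod_cast hr
    linarith
  have h2 : √((2 ^ r : ℕ) : ℝ) ≤ (2 : ℝ) ^ (L / p) * ((L : ℝ) + 1) ^ (γ / 2) := by
    push_cast
    refine (sqrt_le_sqrt hrb).trans (le_of_eq ?_)
    rw [sqrt_eq_rpow, blockSize, mul_rpow (by positivity) (by positivity),
      ← rpow_mul (by norm_num), ← rpow_mul (by positivity)]
    congr 2 <;> ring
  have h3 : ((L : ℝ) + 1) ^ (1 / 2 : ℝ) * ((L : ℝ) + 1) ^ (γ / 2) ≤ ((L : ℝ) + 1) ^ κ := by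
    rw [← rpow_add (by positivity)]
    exact rpow_le_rpow_of_exponent_le (by simp) (by linarith)
  calc 2 * √(r : ℝ) * √((2 ^ r : ℕ) : ℝ)
      ≤ 2 * ((L : ℝ) + 1) ^ (1 / 2 : ℝ) * ((2 : ℝ) ^ (L / p) * ((L : ℝ) + 1) ^ (γ / 2)) := by
        gcongr
    _ = 2 * ((2 : ℝ) ^ (L / p) * (((L : ℝ) + 1) ^ (1 / 2 : ℝ) * ((L : ℝ) + 1) ^ (γ / 2))) := by
        ring
    _ ≤ levelBound p κ L := by rw [levelBound]; gcongr

lemma levelBound_mono {p κ : ℝ} (hp : 0 < p) (hκ : 0 ≤ κ) : Monotone (levelBound p κ) :=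
  fun L L' h => by
    have h' : (L : ℝ) ≤ L' := by exact_mod_cast h
    unfold levelBound
    have : (2 : ℝ) ^ ((L : ℝ) / p) ≤ (2 : ℝ) ^ ((L' : ℝ) / p) :=
      rpow_le_rpow_of_exponent_le (by norm_num) (by gcongr)
    gcongr

lemma isBigO_of_abs_le_levelBound {ι : Type*} [Fintype ι] {p κ C : ℝ} (hp : 0 < p) (hκ : 0 ≤ κ)
    {f : ℕ → ℰ ι}
    (h : ∀ a, ∀ᶠ n in atTop, |f n a| ≤ C * levelBound p κ (Nat.log 2 n)) :
    f =O[atTop] fun n : ℕ => (n : ℝ) ^ (1 / p) * Real.log n ^ κ := by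
  have h1 : ∀ᶠ n : ℕ in atTop, levelBound p κ (Nat.log 2 n)
      ≤ 2 * 4 ^ κ * ((n : ℝ) ^ (1 / p) * Real.log n ^ κ) := by
    filter_upwards [eventually_ge_atTop 3] with n hn
    have hn3 : (3 : ℝ) ≤ n := by exact_mod_cast hn
    have e1 : (2 : ℝ) ^ (Nat.log 2 n) ≤ n := by exact_mod_cast Nat.pow_log_le_self 2 (by omega)
    have e2 : (2 : ℝ) ^ ((Nat.log 2 n : ℝ) / p) ≤ (n : ℝ) ^ (1 / p) := by
      rw [div_eq_mul_one_div, rpow_mul (by norm_num), rpow_natCast]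
      exact rpow_le_rpow (by positivity) e1 (by positivity)
    have e3 : 1 ≤ Real.log n := by
      rw [Real.le_log_iff_exp_le (by linarith)]
      linarith [Real.exp_one_lt_d9]
    have e4 : (Nat.log 2 n : ℝ) + 1 ≤ 4 * Real.log n := by
      have := Real.log_le_log (by positivity) e1
      rw [Real.log_pow] at this
      have h2 := Real.log_two_gt_d9
      nlinarith [(Nat.cast_nonneg (Nat.log 2 n) : (0 : ℝ) ≤ _)]
    have e5 : ((Nat.log 2 n : ℝ) + 1) ^ κ ≤ 4 ^ κ * Real.log n ^ κ := by
      rw [← mul_rpow (by norm_num) (by linarith)]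
      exact rpow_le_rpow (by positivity) e4 hκ
    calc levelBound p κ (Nat.log 2 n)
        ≤ 2 * ((n : ℝ) ^ (1 / p) * (4 ^ κ * Real.log n ^ κ)) := by rw [levelBound]; gcongr
      _ = _ := by ring
  refine IsBigO.of_bound (Fintype.card ι * (|C| * (2 * 4 ^ κ))) ?_
  filter_upwards [eventually_all.2 h, h1] with n hn hn1
  have e1 : ‖f n‖ ≤ ∑ a, |f n a| := by
    rw [EuclideanSpace.norm_eq, sqrt_le_left (sum_nonneg fun _ _ => abs_nonneg _)]
    simp_rw [norm_eq_abs]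
    exact Finset.sum_sq_le_sq_sum_of_nonneg fun _ _ => abs_nonneg _
  have e2 : ∀ a, |f n a| ≤ |C| * (2 * 4 ^ κ) * ((n : ℝ) ^ (1 / p) * Real.log n ^ κ) := fun a =>
    calc |f n a| ≤ |C| * levelBound p κ (Nat.log 2 n) :=
          (hn a).trans (mul_le_mul_of_nonneg_right (le_abs_self C) (levelBound_pos _ _ _).le)
      _ ≤ |C| * (2 * 4 ^ κ * ((n : ℝ) ^ (1 / p) * Real.log n ^ κ)) :=
          mul_le_mul_of_nonneg_left hn1 (abs_nonneg C)
      _ = _ := by ring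
  have e3 : 0 ≤ (n : ℝ) ^ (1 / p) * Real.log n ^ κ :=
    mul_nonneg (by positivity) (rpow_nonneg (Real.log_natCast_nonneg n) _)
  rw [norm_eq_abs, abs_of_nonneg e3]
  refine e1.trans ((sum_le_sum fun a _ => e2 a).trans (le_of_eq ?_))
  rw [sum_const, card_univ, nsmul_eq_mul]
  ring

end Levels

section Paths

variable {E : Type*} [AddCommGroup E]

lemma sum_Ioc_eq_sum_range (s m : ℕ) (N : ℕ → E) :
    ∑ i ∈ Finset.Ioc s (s + m), N i = ∑ i ∈ range m, N (s + i + 1) := by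
  rw [← Finset.Ico_add_one_add_one_eq_Ioc, Finset.sum_Ico_eq_sum_range]
  congr 1
  · congr 1; omega
  · ext1 i; congr 1; omega

lemma blockSum_sub_sum_eq {t n : ℕ → ℕ} (ht0 : t 0 = 0) (hts : ∀ k, t (k + 1) = t k + 2 ^ n k)
    (x : ℤ → E) (N : ℕ → E) (k j : ℕ) :
    blockSum 0 (t k + j) x - ∑ i ∈ Finset.Icc 1 (t k + j), N i
      = ∑ i ∈ range k, (blockSum (t i) (2 ^ n i) x - ∑ l ∈ Finset.Ioc (t i) (t (i + 1)), N l)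
        + (blockSum (t k) j x - ∑ i ∈ range j, N (t k + i + 1)) := by
  have h1 : ∀ k, blockSum 0 (t k) x - ∑ i ∈ Finset.Ioc 0 (t k), N i
      = ∑ i ∈ range k,
        (blockSum (t i) (2 ^ n i) x - ∑ l ∈ Finset.Ioc (t i) (t (i + 1)), N l) := fun k => by
    induction k with
    | zero => simp [ht0]
    | succ k ih =>
      rw [sum_range_succ, ← ih, hts, blockSum_add, zero_add,
        ← Finset.sum_Ioc_consecutive N (Nat.zero_le (t k)) (Nat.le_add_right (t k) (2 ^ n k))]
      abel
  rw [← h1, blockSum_add, zero_add, ← sum_Ioc_eq_sum_range,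
    show Finset.Icc 1 (t k + j) = Finset.Ioc 0 (t k + j) from rfl,
    ← Finset.sum_Ioc_consecutive N (Nat.zero_le (t k)) (Nat.le_add_right (t k) j)]
  abel

end Paths

section StrongApproximation

variable {ι : Type} [Fintype ι]

lemma integral_abs_coord_le {Ω : Type*} [MeasurableSpace Ω] {P : Measure Ω}
    {Y : Ω → ℰ ι} (hY : Measurable Y) {M : ℝ} (hM0 : 0 ≤ M)
    (hM : ∫⁻ ω, ‖Y ω‖ₑ ∂P ≤ ofReal M) (a : ι) : ∫ ω, |Y ω a| ∂P ≤ M := by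
  have h := integral_norm_eq_lintegral_enorm (f := fun ω => Y ω a) (μ := P)
    (by fun_prop : Measurable fun ω => Y ω a).aestronglyMeasurable
  simp only [norm_eq_abs] at h
  rw [h]
  refine ENNReal.toReal_le_of_le_ofReal hM0 ((lintegral_mono fun ω => ?_).trans hM)
  rw [enorm_le_iff_norm_le]
  exact PiLp.norm_apply_le _ _

variable [DecidableEq ι] {p : ℝ} {μ : Measure (𝒳 ι)}

/-- Strong approximation of the partial sums by sums of independent standard Gaussian vectors. -/
abbrev GaussianApprox (p : ℝ) (μ : Measure (𝒳 ι)) (κ : ℝ) : Prop :=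
  ∃ N : ℕ → 𝒵 ι → ℰ ι,
    (∀ i, Measurable (N i)) ∧ iIndepFun N (μ.prod uniformSeq) ∧
    (∀ i, (μ.prod uniformSeq).map (N i) = stdG ι) ∧
    ∀ᵐ q ∂(μ.prod uniformSeq), (fun n : ℕ => blockSum 0 n q.1 - ∑ i ∈ Finset.Icc 1 n, N i q)
      =O[atTop] fun n : ℕ => (n : ℝ) ^ (1 / p) * Real.log n ^ κ

theorem MartLaw.exists_strong_approx [Nonempty ι] (hμ : MartLaw p μ) (hp : 2 < p) (hp3 : p ≤ 3)
    {C : ℝ} (hC0 : 0 ≤ C) (hC : ∀ N, LipschitzBound p μ N C)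
    {D : ℝ} (hD : 1 ≤ D) (hT : ∀ N, TruncBound p μ (2 ^ N) D)
    {κ : ℝ} (hκ : (1 + logExponent p) / 2 < κ) :
    GaussianApprox p μ κ := by
  have := hμ.prob
  obtain ⟨γ, hγ⟩ : ∃ γ, γ = logExponent p := ⟨_, rfl⟩
  have hγ0 : 0 ≤ γ := hγ ▸ logExponent_nonneg hp
  rw [← hγ] at hκ
  obtain ⟨r, c, hc, hr⟩ := exists_block_exponent (p := p) (γ := γ) hp hγ0
    (hγ ▸ logExponent_le_one hp)
  obtain ⟨t, K, ht0, hts, htm, hK, hKt, ht4⟩ := exists_block_times fun L => (hr L).1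
  obtain ⟨n, hn⟩ : ∃ n : ℕ → ℕ, ∀ k, n k = r (Nat.log 2 (t k)) := ⟨_, fun _ => rfl⟩
  have htn : ∀ k, t (k + 1) = t k + 2 ^ n k := fun k => by rw [hts, hn]
  obtain ⟨N, hNm, hNi, hNmap, hN⟩ := hμ.exists_block_coupling hp hC n t htn
  refine ⟨N, hNm, hNi, hNmap, ?_⟩
  obtain ⟨Q, hQ⟩ : ∃ Q, Q = μ.prod uniformSeq := ⟨_, rfl⟩
  have hQp : IsProbabilityMeasure Q := by rw [hQ]; infer_instance
  have hfst : MeasurePreserving Prod.fst Q μ := by rw [hQ]; exact measurePreserving_fst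
  rw [← hQ] at hNi hN ⊢
  have hNmap' : ∀ i, Q.map (N i) = stdG ι := by rw [hQ]; exact hNmap
  obtain ⟨Y, hY⟩ : ∃ Y : ℕ → 𝒵 ι → ℰ ι,
      ∀ k q, Y k q = blockSum (t k) (2 ^ n k) q.1 - ∑ i ∈ Finset.Ioc (t k) (t (k + 1)), N i q :=
    ⟨_, fun _ _ => rfl⟩
  have hGm : ∀ k, Measurable fun q => ∑ i ∈ Finset.Ioc (t k) (t (k + 1)), N i q := fun k =>
    measurable_fun_sum _ fun i _ => hNm i
  have hBm : ∀ k, Measurable fun q : 𝒵 ι =>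
      blockSum (t k) (2 ^ n k) q.1 := fun k => (measurable_blockSum _ _).comp measurable_fst
  have hYm : ∀ k, Measurable (Y k) := fun k => by
    rw [show Y k = _ from funext (hY k)]; exact (hBm k).sub (hGm k)
  have hYpast : ∀ k, IsPast (t (k + 1)) (k + 1) (Y k) := fun k q q' h h' => by
    have hG := (hN k).1 q q' h h'
    dsimp only at hG
    rw [hY, hY, hG, dependsOn_blockSum _ _ fun i hi => h i ?_]
    have := Set.mem_Iic.1 hi
    rw [htn]; push_cast at this ⊢; exact this
  have hGp : ∀ k a (s : ℝ≥0), MemLp (fun q => (∑ i ∈ Finset.Ioc (t k) (t (k + 1)), N i q) a) s Q :=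
    fun k a s => by
      simp only [WithLp.ofLp_sum, Finset.sum_apply]
      refine memLp_finsetSum _ fun i _ => ?_
      have h := memLp_eval_stdG a s
      rw [← hNmap' i] at h
      exact (memLp_map_measure_iff (by fun_prop) (hNm i).aemeasurable).1 h
  have hBp : ∀ k a, MemLp (fun q : 𝒵 ι =>
      blockSum (t k) (2 ^ n k) q.1 a) (ofReal p) Q := fun k a =>
    ((hμ.memLp_blockSum (t k) (2 ^ n k)).eval_piLp a).comp_measurePreserving hfst
  have hYp : ∀ k a, MemLp (fun q => Y k q a) (ofReal p) Q := fun k a => by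
    simp only [hY, PiLp.sub_apply]
    exact (hBp k a).sub (hGp k a p.toNNReal)
  have hYM : ∀ k a, ∫ q, |Y k q a| ∂Q ≤ C * couplingRate p (n k) + 1 := fun k a =>
    integral_abs_coord_le (hYm k) (by have := couplingRate_ge_one hp3 (n k); positivity)
      (by simpa only [hY] using (hN k).2.1) a
  obtain ⟨V, hV⟩ : ∃ V, V = (8 * (C + 1) + 1088 * D) * c ^ (1 - p / 2) := ⟨_, rfl⟩
  have hV0 : 0 ≤ V := by rw [hV]; positivity
  have hYV : ∀ k a, ∫ q, Y k q a ^ 2 ∂Q ≤ V * ((Nat.log 2 (t k) : ℝ) + 1) ^ γ *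
      (2 : ℝ) ^ ((2 / p - 1) * Nat.log 2 (t k)) * (2 : ℝ) ^ r (Nat.log 2 (t k)) := fun k a => by
    obtain ⟨ρ, hρ⟩ : ∃ ρ, ρ = 2 * √((n k : ℝ) + 1) * √((2 ^ n k : ℕ) : ℝ) := ⟨_, rfl⟩
    have hρ0 : 0 < ρ := by rw [hρ]; positivity
    have hρ1 : 2 * √(n k : ℝ) * √((2 ^ n k : ℕ) : ℝ) ≤ ρ := by
      rw [hρ]; gcongr; linarith
    have h1 := integral_sq_sub_le (U := 34 * D * (2 ^ n k : ℕ)) hp hρ0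
      (show Measurable fun q : 𝒵 ι =>
        blockSum (t k) (2 ^ n k) q.1 a from (measurable_blockSum_apply _ _ a).comp measurable_fst)
      (show Measurable fun q => (∑ i ∈ Finset.Ioc (t k) (t (k + 1)), N i q) a from
        (by fun_prop : Measurable fun z : ℰ ι => z a).comp (hGm k))
      (hBp k a) (hGp k a p.toNNReal)
      (by simpa only [hY, PiLp.sub_apply] using hYM k a) ?_ ?_
    · rw [hρ] at h1
      have h2 := discrepancy_le hp hp3 (C := C) (zero_le_one.trans hD) (n k)
      have h3 := discrepancy_exponent_le hp (r := n k) (L := Nat.log 2 (t k)) hγ0 hc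
        (hn k ▸ (hr _).1) (hn k ▸ (hr _).2.2)
      rw [← hγ] at h2
      simp only [hY, PiLp.sub_apply]
      refine h1.trans (h2.trans ((mul_le_mul_of_nonneg_left h3 (by positivity)).trans
        (le_of_eq ?_)))
      rw [hV, ← hn]; ring
    · have h2 := (hT (n k)).integral_block_le hμ hp hp3 hD (t k) a hρ1
      rw [← hfst.map_eq, integral_map measurable_fst.aemeasurable
        (show Measurable fun x : 𝒳 ι => posPow p (|blockSum (t k) (2 ^ n k) x a| - ρ) from
          (continuous_posPow (show (0 : ℝ) ≤ p by linarith)).measurable.comp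
            ((measurable_blockSum_apply _ _ a).abs.sub_const _)).aestronglyMeasurable] at h2
      exact h2
    · have h2 := integral_posPow_abs_scaledG_le (ι := ι) hp hp3 (n k) a hρ1
      have h3 := map_sum_eq_scaledG hNm hNi hNmap' (Finset.Ioc (t k) (t (k + 1)))
      rw [Nat.card_Ioc, htn, Nat.add_sub_cancel_left, ← htn] at h3
      rw [← h3, integral_map (hGm k).aemeasurable
        (show Measurable fun z : ℰ ι => posPow p (|z a| - ρ) from
          (continuous_posPow (show (0 : ℝ) ≤ p by linarith)).measurable.comp
            ((by fun_prop : Measurable fun z : ℰ ι => |z a|).sub_const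
              _)).aestronglyMeasurable] at h2
      refine h2.trans ?_
      have : (0 : ℝ) ≤ (2 ^ n k : ℕ) := by positivity
      nlinarith
  have hY2 : ∀ k a, MemLp (fun q => Y k q a) 2 Q := fun k a =>
    (hYp k a).mono_exponent (by rw [← ENNReal.ofReal_ofNat 2]; exact ofReal_le_ofReal hp.le)
  have hlog : ∀ {k L}, k < K L → Nat.log 2 (t k) ≤ L := fun {k L} hk => by
    rcases Nat.eq_zero_or_pos (t k) with h | h
    · simp [h]
    · exact Nat.lt_succ_iff.1 (Nat.log_lt_of_lt_pow h.ne' ((hK L k).1 hk))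
  have hlam : ∀ {k L}, k < K L → 2 * √(n k : ℝ) * √((2 ^ n k : ℕ) : ℝ) ≤ levelBound p κ L :=
    fun {k L} hk => by
      rw [hn]
      exact (sqrt_block_le_levelBound hκ.le (hr _).1 (hr _).2.1).trans
        (levelBound_mono (by linarith) (by linarith) (hlog hk))
  have hsum : ∀ L, ∑ k ∈ range (K L), ((2 ^ n k : ℕ) : ℝ) ≤ 2 ^ (L + 2) := fun L => by
    have h1 : ∀ m, ∑ k ∈ range m, 2 ^ n k = t m := fun m => by
      induction m with
      | zero => simp [ht0]
      | succ m ih => rw [sum_range_succ, ih, htn]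
    have := hKt L
    rw [← h1] at this
    exact_mod_cast this
  have hT1 : ∀ a, ∀ᵐ q ∂Q, ∀ᶠ L in atTop, q ∉ {q | ∃ j ≤ K L,
      levelBound p κ L ≤ |∑ i ∈ range j, Y i q a|} := fun a => by
    refine ae_eventually_notMem_of_rpow_le (C := V * (8 * p) * 4⁻¹) (e := 2 * κ - γ)
      (by positivity) (by linarith) fun L => ?_
    refine (maximal_sq (levelBound_pos p κ L) (fun i => by fun_prop) (fun i => hY2 i a) ?_
      (K L)).trans (ofReal_le_ofReal ?_)
    · intro k H hH hHd hH2
      simp only [hY k]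
      refine (hN k).2.2 _ (hH.comp (measurable_pi_iff.2 fun i => by fun_prop)) ?_ hH2 a
      intro q q' h h'
      refine hHd fun i hi => ?_
      have hik : i + 1 ≤ k := Set.mem_Iio.1 hi
      have := hYpast i q q' (fun j hj => h j (hj.trans (by exact_mod_cast htm.monotone hik)))
        (fun j hj => h' j (lt_of_lt_of_le hj hik))
      dsimp only
      rw [this]
    · have h1 := sum_block_variance_le hp hγ0 hV0 ht0 hts hK hKt ht4 (fun k => hYV k a) L
      refine (mul_le_mul_of_nonneg_left h1 (rpow_nonneg (levelBound_pos _ _ _).le _)).trans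
        (le_of_eq ?_)
      rw [mul_assoc (V * (8 * p)), ← levelBound_neg_two_mul p γ κ L]
      ring
  have hunion : ∀ (F : ℕ → ℕ → Set (𝒵 ι)) (A : ℝ),
      0 ≤ A → (∀ L, ∀ k < K L, Q (F L k) ≤
        ofReal (levelBound p κ L ^ (-p) * (A * (2 ^ n k : ℕ)))) →
      ∀ᵐ q ∂Q, ∀ᶠ L in atTop, q ∉ ⋃ k ∈ range (K L), F L k := fun F A hA hF => by
    refine ae_eventually_notMem_of_rpow_le (C := A * 4) (e := κ * p) (by positivity)
      (by nlinarith) fun L => ?_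
    refine (measure_biUnion_finset_le _ _).trans ((sum_le_sum fun k hk =>
      hF L k (Finset.mem_range.1 hk)).trans ?_)
    have hl : 0 ≤ levelBound p κ L ^ (-p) := rpow_nonneg (levelBound_pos _ _ _).le _
    rw [← ofReal_sum_of_nonneg fun k _ => by positivity, ← mul_sum,
      ← mul_sum]
    refine ofReal_le_ofReal ?_
    have h1 := levelBound_neg_mul_le hp κ L
    calc _ ≤ levelBound p κ L ^ (-p) * (A * 2 ^ (L + 2)) :=
          mul_le_mul_of_nonneg_left (mul_le_mul_of_nonneg_left (hsum L) hA) hl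
      _ = A * (levelBound p κ L ^ (-p) * 2 ^ (L + 2)) := by ring
      _ ≤ A * (4 * ((L : ℝ) + 1) ^ (-(κ * p))) := mul_le_mul_of_nonneg_left h1 hA
      _ = _ := by ring
  have hT2 : ∀ a, ∀ᵐ q ∂Q, ∀ᶠ L in atTop, q ∉ ⋃ k ∈ range (K L),
      {q : 𝒵 ι | ∃ j ≤ 2 ^ n k,
        levelBound p κ L + levelBound p κ L ≤ |blockSum (t k) j q.1 a|} := fun a => by
    refine hunion _ (34 * D) (by positivity) fun L k hk => ?_
    have h1 := (hT (n k)).maximal_block hμ hp hp3 hD (t k) a (levelBound_pos p κ L) (hlam hk)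
    refine le_trans (le_of_eq ?_) h1
    refine hfst.measure_preimage (s := {x | ∃ j ≤ 2 ^ n k, levelBound p κ L + levelBound p κ L ≤
      |blockSum (t k) j x a|}) (MeasurableSet.nullMeasurableSet ?_)
    rw [show {x : 𝒳 ι | ∃ j ≤ 2 ^ n k, levelBound p κ L + levelBound p κ L ≤
      |blockSum (t k) j x a|} = ⋃ j ∈ range (2 ^ n k + 1), {x : 𝒳 ι |
        levelBound p κ L + levelBound p κ L ≤ |blockSum (t k) j x a|} by ext x; simp]
    exact Finset.measurableSet_biUnion _ fun j _ => measurableSet_le measurable_const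
      (measurable_blockSum_apply _ _ a).abs
  have hT3 : ∀ a, ∀ᵐ q ∂Q, ∀ᶠ L in atTop, q ∉ ⋃ k ∈ range (K L), {q | ∃ j ≤ 2 ^ n k,
      levelBound p κ L + levelBound p κ L ≤ |∑ i ∈ range j, N (t k + i + 1) q a|} :=
    fun a => by
      refine hunion _ 34 (by positivity) fun L k hk => ?_
      exact maximal_gaussian hp hp3 (N := fun i => N (t k + i + 1)) (fun i => hNm _)
        (hNi.precomp fun i j h => by simpa using h) (fun i => hNmap' _) (n k) a
        (levelBound_pos p κ L) (hlam hk)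
  filter_upwards [ae_all_iff.2 hT1, ae_all_iff.2 hT2, ae_all_iff.2 hT3] with q h1 h2 h3
  refine isBigO_of_abs_le_levelBound (C := 5) (by linarith) (by linarith) fun a => ?_
  have hlogt : Tendsto (Nat.log 2) atTop atTop := by
    refine tendsto_atTop.2 fun b => ?_
    filter_upwards [eventually_ge_atTop (2 ^ b)] with m hm
    exact Nat.le_log_of_pow_le (by norm_num) hm
  filter_upwards [hlogt.eventually (h1 a), hlogt.eventually (h2 a), hlogt.eventually (h3 a),
    eventually_ge_atTop 1] with m g1 g2 g3 hm
  obtain ⟨L, hL⟩ : ∃ L, L = Nat.log 2 m := ⟨_, rfl⟩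
  rw [← hL] at g1 g2 g3 ⊢
  have hex : ∃ k, m ≤ t k := ⟨m, htm.id_le m⟩
  obtain ⟨k, hk⟩ : ∃ k, Nat.find hex = k + 1 := by
    refine Nat.exists_eq_succ_of_ne_zero fun h => ?_
    have := Nat.find_spec hex
    rw [h, ht0] at this
    omega
  have hk1 : t k < m := not_le.1 (Nat.find_min hex (by omega))
  have hk2 : m ≤ t (k + 1) := hk ▸ Nat.find_spec hex
  have hkK : k < K L := (hK L k).2 (hk1.trans (hL ▸ Nat.lt_pow_succ_log_self (by norm_num) m))
  obtain ⟨j, rfl⟩ : ∃ j, m = t k + j := ⟨m - t k, by omega⟩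
  have hj : j ≤ 2 ^ n k := by rw [htn] at hk2; omega
  have e1 : |∑ i ∈ range k, Y i q a| < levelBound p κ L :=
    not_le.1 fun h => g1 ⟨k, hkK.le, h⟩
  have e2 : |blockSum (t k) j q.1 a| < levelBound p κ L + levelBound p κ L :=
    not_le.1 fun h => g2 (Set.mem_biUnion (Finset.mem_coe.2 (Finset.mem_range.2 hkK)) ⟨j, hj, h⟩)
  have e3 : |∑ i ∈ range j, N (t k + i + 1) q a| < levelBound p κ L + levelBound p κ L :=
    not_le.1 fun h => g3 (Set.mem_biUnion (Finset.mem_coe.2 (Finset.mem_range.2 hkK)) ⟨j, hj, h⟩)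
  rw [blockSum_sub_sum_eq ht0 htn q.1 (fun i => N i q) k j]
  simp only [← hY, PiLp.add_apply, PiLp.sub_apply, WithLp.ofLp_sum, Finset.sum_apply]
  have e4 := abs_add_le (∑ i ∈ range k, Y i q a)
    (blockSum (t k) j q.1 a - ∑ i ∈ range j, N (t k + i + 1) q a)
  have e5 := abs_sub (blockSum (t k) j q.1 a) (∑ i ∈ range j, N (t k + i + 1) q a)
  linarith

end StrongApproximation

section Envelope

lemma stdNormalCDF_le {σ : ℝ} (hσ : 1 ≤ σ) :
    stdNormalCDF σ ≤ 1 - exp (-2 * σ ^ 2) / 4 := by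
  have h1 : stdNormalCDF σ = 1 - (gaussianReal 0 1).real (Ioi σ) := by
    rw [← Set.compl_Iic, probReal_compl_eq_one_sub measurableSet_Iic]
    simp [stdNormalCDF, measureReal_def]
  have h2 : (gaussianReal 0 1).real (Set.Ioc σ (σ + 1)) ≤ (gaussianReal 0 1).real (Ioi σ) :=
    measureReal_mono Set.Ioc_subset_Ioi_self
  have h3 : exp (-2 * σ ^ 2) / 4 ≤ ∫ x in Set.Ioc σ (σ + 1), gaussianPDFReal 0 1 x := by
    have h := setIntegral_ge_of_const_le_real (μ := volume) (s := Set.Ioc σ (σ + 1))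
      (f := gaussianPDFReal 0 1) (c := exp (-2 * σ ^ 2) / 4) measurableSet_Ioc (by simp)
      (fun x hx => ?_) (integrable_gaussianPDFReal 0 1).integrableOn
    · simpa using h
    · have hx0 : σ < x := hx.1
      have hx1 : x ≤ σ + 1 := hx.2
      have e1 : exp (-2 * σ ^ 2) ≤ exp (-x ^ 2 / 2) := Real.exp_le_exp.2 (by nlinarith)
      have e2 : √(2 * Real.pi) ≤ 4 := by
        rw [sqrt_le_left (by norm_num)]
        nlinarith [Real.pi_lt_four]
      have e3 : (4 : ℝ)⁻¹ ≤ (√(2 * Real.pi))⁻¹ := inv_anti₀ (by positivity) e2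
      simp only [gaussianPDFReal, sub_zero, NNReal.coe_one, mul_one]
      rw [div_eq_inv_mul]
      exact mul_le_mul e3 e1 (exp_pos _).le (by positivity)
  have h4 : (gaussianReal 0 1).real (Set.Ioc σ (σ + 1))
      = ∫ x in Set.Ioc σ (σ + 1), gaussianPDFReal 0 1 x := by
    rw [measureReal_def, gaussianReal_apply_eq_integral _ one_ne_zero,
      toReal_ofReal (integral_nonneg fun x => gaussianPDFReal_nonneg 0 1 x)]
  linarith

lemma le_max_stdNormalCDFInv {u σ : ℝ} (hu : 0 < u) (h : u < exp (-2 * σ ^ 2) / 2) :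
    σ ≤ max 1 (stdNormalCDFInv (1 - u / 2)) := by
  rcases le_total σ 1 with h1 | h1
  · exact h1.trans (le_max_left _ _)
  refine le_max_of_le_right (le_csInf ?_ fun x hx => ?_)
  · have h2 : Tendsto (fun x => stdNormalCDF x) atTop (𝓝 1) := by
      have := (ENNReal.tendsto_toReal (measure_ne_top _ _)).comp
        (tendsto_measure_Iic_atTop (gaussianReal 0 1))
      rwa [measure_univ, ENNReal.toReal_one] at this
    obtain ⟨x, hx⟩ := (h2.eventually_const_le (show 1 - u / 2 < 1 by linarith)).exists
    exact ⟨x, hx⟩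
  · by_contra hlt
    push Not at hlt
    have h2 : stdNormalCDF x ≤ stdNormalCDF σ :=
      ENNReal.toReal_mono (measure_ne_top _ _) (measure_mono (Set.Iic_subset_Iic.2 hlt.le))
    have h3 := stdNormalCDF_le h1
    have h4 : 1 - u / 2 ≤ stdNormalCDF x := hx
    linarith

variable {Ω : Type*} [MeasurableSpace Ω] {P : Measure Ω}

/-- A weight bounded in `L^(p/(p-2))` is integrated against the norm of `L^(p/2)`. -/
theorem lintegral_mul_le_eLpNorm {p : ℝ} (hp : 2 < p) {Y W : Ω → ℝ} (hY : Measurable Y)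
    (hW : Measurable W) (hW0 : ∀ ω, 0 ≤ W ω) {K : ℝ} (hK : 0 ≤ K)
    (hi : Integrable (fun ω => W ω ^ (p / (p - 2))) P)
    (hmom : ∫ ω, W ω ^ (p / (p - 2)) ∂P ≤ K ^ (p / (p - 2))) :
    ∫⁻ ω, ofReal (W ω) * ofReal |Y ω| ∂P
      ≤ ofReal K * eLpNorm Y (ofReal (p / 2)) P := by
  have hq : 0 < p / (p - 2) := div_pos (by linarith) (by linarith)
  have hpq : (p / (p - 2)).HolderConjugate (p / 2) := by
    rw [Real.holderConjugate_iff]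
    refine ⟨by rw [lt_div_iff₀] <;> linarith, ?_⟩
    rw [inv_div, inv_div]
    field_simp
    ring
  refine (ENNReal.lintegral_mul_le_Lp_mul_Lq P hpq hW.ennreal_ofReal.aemeasurable
    hY.abs.ennreal_ofReal.aemeasurable).trans (mul_le_mul' ?_ (le_of_eq ?_))
  · have h1 : ∫⁻ ω, ofReal (W ω) ^ (p / (p - 2)) ∂P
        ≤ ofReal (K ^ (p / (p - 2))) := by
      simp only [ENNReal.ofReal_rpow_of_nonneg (hW0 _) hq.le]
      rw [← ofReal_integral_eq_lintegral_ofReal hi (ae_of_all _ fun ω =>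
        rpow_nonneg (hW0 ω) _)]
      exact ofReal_le_ofReal hmom
    refine (ENNReal.rpow_le_rpow h1 (by positivity)).trans (le_of_eq ?_)
    rw [← ENNReal.ofReal_rpow_of_nonneg hK hq.le, ← ENNReal.rpow_mul, mul_one_div_cancel hq.ne',
      ENNReal.rpow_one]
  · rw [eLpNorm_eq_lintegral_rpow_enorm_toReal (by simp; linarith) ofReal_ne_top,
      toReal_ofReal (by linarith)]
    simp only [← Real.enorm_eq_ofReal_abs]

variable [IsProbabilityMeasure P]

lemma le_absQuantile {Y : Ω → ℝ} (hY : Measurable Y) {u t : ℝ} (hu : 0 < u)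
    (h : u < P.real {ω | t < |Y ω|}) : t ≤ absQuantile P Y u := by
  refine le_csInf ?_ fun x hx => ?_
  · have h1 : Tendsto (fun n : ℕ => P {ω | (n : ℝ) < |Y ω|}) atTop
        (𝓝 (P (⋂ n : ℕ, {ω | (n : ℝ) < |Y ω|}))) :=
      tendsto_measure_iInter_atTop
        (fun n => (measurableSet_lt measurable_const hY.abs).nullMeasurableSet)
        (fun n m hnm ω (hω : (m : ℝ) < |Y ω|) => lt_of_le_of_lt (Nat.cast_le.2 hnm) hω)
        ⟨0, measure_ne_top _ _⟩
    have h2 : (⋂ n : ℕ, {ω | (n : ℝ) < |Y ω|}) = ∅ := by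
      refine Set.eq_empty_of_forall_notMem fun ω hω => ?_
      obtain ⟨n, hn⟩ := exists_nat_ge |Y ω|
      exact (Set.mem_iInter.1 hω n).not_ge hn
    rw [h2, measure_empty] at h1
    have h3 := (ENNReal.tendsto_toReal ENNReal.zero_ne_top).comp h1
    obtain ⟨n, hn⟩ := (h3.eventually_le_const (show (0 : ℝ≥0∞).toReal < u by simpa)).exists
    exact ⟨n, hn⟩
  · by_contra hlt
    push Not at hlt
    have h1 : P.real {ω | t < |Y ω|} ≤ P.real {ω | x < |Y ω|} :=
      measureReal_mono fun ω hω => hlt.trans hω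
    have h2 : P.real {ω | x < |Y ω|} ≤ u := hx
    linarith

lemma setLIntegral_ite_le_ofReal {A : ℝ → Prop} [DecidablePred A] {M : ℝ}
    (h : ∀ s, 0 < s → A s → s ≤ M) :
    ∫⁻ s in Ioi (0 : ℝ), (if A s then 1 else 0) ≤ ofReal M := by
  calc _ ≤ ∫⁻ s in Ioi (0 : ℝ), (Set.Ioc 0 M).indicator 1 s := by
        refine setLIntegral_mono' measurableSet_Ioi fun s hs => ?_
        split_ifs with hA
        · rw [Set.indicator_of_mem (show s ∈ Set.Ioc 0 M from ⟨hs, h s hs hA⟩)]; simp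
        · exact zero_le
    _ ≤ ∫⁻ s, (Set.Ioc 0 M).indicator 1 s := setLIntegral_le_lintegral _ _
    _ = ofReal M := by
        rw [lintegral_indicator_one measurableSet_Ioc, Real.volume_Ioc, sub_zero]

/-- The envelope norm dominates the double integral of the volumes of the joint level sets. -/
lemma lintegral_min_le_envNorm {p : ℝ} (hp : 2 < p) {Y : Ω → ℝ} (hY : Measurable Y) {ρ : ℝ}
    (hρ : 0 < ρ) :
    ∫⁻ s in Ioi (0 : ℝ), ∫⁻ t in Ioi (0 : ℝ), ofReal
      (min (exp (-2 * ((s / ρ) ^ (1 / (p - 2))) ^ 2) / 2) (P.real {ω | t < |Y ω|}))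
      ≤ ofReal ρ * envNorm P p Y := by
  obtain ⟨h, hh⟩ : ∃ h : ℝ → ℝ, ∀ s, h s = exp (-2 * ((s / ρ) ^ (1 / (p - 2))) ^ 2) / 2 :=
    ⟨_, fun _ => rfl⟩
  obtain ⟨g, hg⟩ : ∃ g : ℝ → ℝ, ∀ t, g t = P.real {ω | t < |Y ω|} := ⟨_, fun _ => rfl⟩
  have hhm : Measurable h := by rw [show h = _ from funext hh]; fun_prop
  have hgm : Measurable g := by
    refine Antitone.measurable fun t t' htt => ?_
    rw [hg, hg]
    exact measureReal_mono fun ω hω => lt_of_le_of_lt htt hω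
  have hg1 : ∀ t, g t ≤ 1 := fun t => by rw [hg]; exact measureReal_le_one
  simp only [← hh, ← hg]
  have hm : ∀ f : ℝ → ℝ, Measurable f →
      Measurable fun q : ℝ × ℝ => if q.2 < f q.1 then (1 : ℝ≥0∞) else 0 := fun f hf =>
    Measurable.ite (measurableSet_lt measurable_snd (hf.comp measurable_fst)) measurable_const
      measurable_const
  have hm1 : ∀ u : ℝ, ∀ f : ℝ → ℝ, Measurable f →
      Measurable fun s => if u < f s then (1 : ℝ≥0∞) else 0 := fun u f hf =>
    Measurable.ite (measurableSet_lt measurable_const hf) measurable_const measurable_const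
  have hm2 : ∀ c : ℝ, Measurable fun u : ℝ => if u < c then (1 : ℝ≥0∞) else 0 := fun c =>
    Measurable.ite (measurableSet_lt measurable_id measurable_const) measurable_const
      measurable_const
  have hG : Measurable fun u => ∫⁻ t in Ioi (0 : ℝ), (if u < g t then (1 : ℝ≥0∞) else 0) :=
    Measurable.lintegral_prod_right' (f := fun q : ℝ × ℝ => if q.1 < g q.2 then (1 : ℝ≥0∞) else 0)
      (Measurable.ite (measurableSet_lt measurable_fst (hgm.comp measurable_snd)) measurable_const
      measurable_const)
  calc _ = ∫⁻ s in Ioi (0 : ℝ), ∫⁻ t in Ioi (0 : ℝ), ∫⁻ u in Ioo (0 : ℝ) 1,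
          (if u < h s then 1 else 0) * (if u < g t then 1 else 0) := by
        refine lintegral_congr fun s => lintegral_congr fun t => ?_
        have e : ∀ u : ℝ, ((if u < h s then 1 else 0) * (if u < g t then 1 else 0) : ℝ≥0∞)
            = (Iio (min (h s) (g t))).indicator 1 u := fun u => by
          by_cases h1 : u < h s <;> by_cases h2 : u < g t <;> simp [h1, h2]
        simp only [e]
        rw [lintegral_indicator_one measurableSet_Iio, Measure.restrict_apply measurableSet_Iio,
          Set.Iio_inter_Ioo, min_eq_left ((min_le_right _ _).trans (hg1 t)), Real.volume_Ioo,
          sub_zero]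
    _ = ∫⁻ s in Ioi (0 : ℝ), ∫⁻ u in Ioo (0 : ℝ) 1, (if u < h s then 1 else 0) *
          ∫⁻ t in Ioi (0 : ℝ), (if u < g t then 1 else 0) := by
        refine lintegral_congr fun s => ?_
        rw [lintegral_lintegral_swap]
        · exact lintegral_congr fun u => lintegral_const_mul _ (hm1 u g hgm)
        · exact (((hm2 (h s)).comp measurable_snd).mul (hm g hgm)).aemeasurable
    _ = ∫⁻ u in Ioo (0 : ℝ) 1, (∫⁻ s in Ioi (0 : ℝ), (if u < h s then 1 else 0)) *
          ∫⁻ t in Ioi (0 : ℝ), (if u < g t then 1 else 0) := by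
        rw [lintegral_lintegral_swap]
        · exact lintegral_congr fun u => lintegral_mul_const _ (hm1 u h hhm)
        · exact ((hm h hhm).mul (hG.comp measurable_snd)).aemeasurable
    _ ≤ ∫⁻ u in Ioo (0 : ℝ) 1, ofReal ρ * ofReal
          ((max 1 (stdNormalCDFInv (1 - u / 2))) ^ (p - 2) * absQuantile P Y u) := by
        refine setLIntegral_mono' measurableSet_Ioo fun u hu => ?_
        have hM : (0 : ℝ) ≤ max 1 (stdNormalCDFInv (1 - u / 2)) :=
          zero_le_one.trans (le_max_left _ _)
        rw [ofReal_mul (rpow_nonneg hM _), ← mul_assoc, ← ofReal_mul hρ.le]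
        refine mul_le_mul' (setLIntegral_ite_le_ofReal fun s hs hus => ?_)
          (setLIntegral_ite_le_ofReal fun t _ hut => le_absQuantile hY hu.1 (hg t ▸ hut))
        have h1 := le_max_stdNormalCDFInv hu.1 (hh s ▸ hus)
        have h2 := rpow_le_rpow (by positivity) h1 (show 0 ≤ p - 2 by linarith)
        rw [← rpow_mul (by positivity), one_div_mul_cancel (by linarith), rpow_one,
          div_le_iff₀ hρ, mul_comm] at h2
        exact h2
    _ = _ := by rw [lintegral_const_mul' _ _ ofReal_ne_top, envNorm]

/-- A weight with a tail of Gaussian type is integrated against the envelope norm. -/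
theorem lintegral_mul_le_envNorm {p : ℝ} (hp : 2 < p) {Y W : Ω → ℝ} (hY : Measurable Y)
    (hW : Measurable W) (hW0 : ∀ ω, 0 ≤ W ω) {ρ K : ℝ} (hρ : 0 ≤ ρ)
    (htail : ∀ σ, 0 ≤ σ → P.real {ω | ρ * σ ^ (p - 2) ≤ W ω} ≤ K * exp (-2 * σ ^ 2)) :
    ∫⁻ ω, ofReal (W ω) * ofReal |Y ω| ∂P
      ≤ ofReal (2 * K * ρ) * envNorm P p Y := by
  have hK : 1 ≤ K := by
    have := htail 0 le_rfl
    simpa [zero_rpow (show p - 2 ≠ 0 by linarith), hW0] using this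
  have hρ0 : 0 < ρ := by
    rcases hρ.lt_or_eq with h | h
    · exact h
    have h1 : Tendsto (fun σ : ℝ => K * exp (-σ)) atTop (𝓝 (K * 0)) :=
      (Real.tendsto_exp_neg_atTop_nhds_zero).const_mul K
    obtain ⟨σ, hσ, hσ1⟩ := ((h1.eventually_lt_const (show K * 0 < 1 by simp)).and
      (eventually_ge_atTop 1)).exists
    have h2 := htail σ (by linarith)
    simp only [← h, zero_mul, hW0, Set.ofPred_true, probReal_univ] at h2
    have h3 : exp (-2 * σ ^ 2) ≤ exp (-σ) := Real.exp_le_exp.2 (by nlinarith)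
    nlinarith
  have hq : p - 2 ≠ 0 := by linarith
  have e1 : ∫⁻ ω, ofReal (W ω) * ofReal |Y ω| ∂P = ∫⁻ s in Ioi (0 : ℝ),
      ∫⁻ t in Ioi (0 : ℝ), P ({ω | t < |Y ω|} ∩ {ω | s ≤ W ω}) := by
    have h1 := lintegral_withDensity_eq_lintegral_mul P (hY.abs.ennreal_ofReal) hW.ennreal_ofReal
    simp only [Pi.mul_apply, mul_comm (ofReal |Y _|)] at h1
    rw [← h1, lintegral_eq_lintegral_meas_le _ (ae_of_all _ hW0) hW.aemeasurable]
    refine lintegral_congr fun s => ?_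
    have hs : MeasurableSet {ω | s ≤ W ω} := measurableSet_le measurable_const hW
    rw [withDensity_apply _ hs, lintegral_eq_lintegral_meas_lt _ (ae_of_all _ fun _ => abs_nonneg _)
      hY.abs.aemeasurable]
    exact lintegral_congr fun t => Measure.restrict_apply (measurableSet_lt measurable_const hY.abs)
  rw [e1]
  calc _ ≤ ∫⁻ s in Ioi (0 : ℝ), ∫⁻ t in Ioi (0 : ℝ), ofReal (2 * K) *
        ofReal (min (exp (-2 * ((s / ρ) ^ (1 / (p - 2))) ^ 2) / 2)
          (P.real {ω | t < |Y ω|})) := by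
        refine setLIntegral_mono' measurableSet_Ioi fun s hs => lintegral_mono fun t => ?_
        have hs0 : 0 < s := hs
        rw [← ofReal_mul (by linarith), ← ofReal_measureReal]
        refine ofReal_le_ofReal ?_
        have h1 : P.real ({ω | t < |Y ω|} ∩ {ω | s ≤ W ω}) ≤ P.real {ω | t < |Y ω|} :=
          measureReal_mono Set.inter_subset_left
        have h2 : P.real ({ω | t < |Y ω|} ∩ {ω | s ≤ W ω}) ≤ P.real {ω | s ≤ W ω} :=
          measureReal_mono Set.inter_subset_right
        have h3 := htail ((s / ρ) ^ (1 / (p - 2))) (by positivity)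
        rw [← rpow_mul (by positivity), one_div_mul_cancel hq, rpow_one,
          mul_div_cancel₀ _ hρ0.ne'] at h3
        rw [mul_min_of_nonneg _ _ (by linarith)]
        refine le_min (by linarith) (h1.trans ?_)
        nlinarith [measureReal_nonneg (μ := P) (s := {ω | t < |Y ω|})]
    _ = ofReal (2 * K) * ∫⁻ s in Ioi (0 : ℝ), ∫⁻ t in Ioi (0 : ℝ),
        ofReal (min (exp (-2 * ((s / ρ) ^ (1 / (p - 2))) ^ 2) / 2)
          (P.real {ω | t < |Y ω|})) := by
        rw [← lintegral_const_mul' _ _ ofReal_ne_top]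
        exact lintegral_congr fun s => lintegral_const_mul' _ _ ofReal_ne_top
    _ ≤ ofReal (2 * K) * (ofReal ρ * envNorm P p Y) :=
        mul_le_mul_right (lintegral_min_le_envNorm hp hY hρ0) _
    _ = _ := by rw [ofReal_mul (show 0 ≤ 2 * K by linarith), mul_assoc]

end Envelope

section Whitening

/-- A positive semidefinite matrix is diagonalised to the identity on its range. -/
lemma Matrix.PosSemidef.exists_whitening {D : ℕ} {V : Matrix (Fin D) (Fin D) ℝ}
    (hV : V.PosSemidef) :
    ∃ (ι : Type) (_ : Fintype ι) (_ : DecidableEq ι) (A : Matrix ι (Fin D) ℝ)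
      (J : Matrix (Fin D) ι ℝ), A * V * A.transpose = 1 ∧ (1 - J * A) * V = 0 := by
  obtain ⟨U, l, hl, hVU, hU⟩ : ∃ (U : Matrix (Fin D) (Fin D) ℝ) (l : Fin D → ℝ), (∀ k, 0 ≤ l k) ∧
      V = U * diagonal l * U.transpose ∧ U.transpose * U = 1 := by
    refine ⟨hV.1.eigenvectorUnitary, hV.1.eigenvalues, hV.eigenvalues_nonneg, ?_, ?_⟩
    · conv_lhs => rw [hV.1.spectral_theorem]
      rw [Unitary.conjStarAlgAut_apply]
      simp [Matrix.star_eq_conjTranspose]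
    · have := Unitary.coe_star_mul_self hV.1.eigenvectorUnitary
      simpa [Matrix.star_eq_conjTranspose] using this
  have h1 : U.transpose * V = diagonal l * U.transpose := by
    rw [hVU, ← mul_assoc, ← mul_assoc, hU, one_mul]
  have h2 : U.transpose * V * U = diagonal l := by rw [h1, mul_assoc, hU, mul_one]
  obtain ⟨A, hA⟩ : ∃ A : Matrix {k // l k ≠ 0} (Fin D) ℝ, ∀ k i, A k i = (√(l k))⁻¹ * U i k :=
    ⟨fun k i => (√(l k))⁻¹ * U i k, fun _ _ => rfl⟩
  obtain ⟨J, hJ⟩ : ∃ J : Matrix (Fin D) {k // l k ≠ 0} ℝ, ∀ i k, J i k = √(l k) * U i k :=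
    ⟨fun i k => √(l k) * U i k, fun _ _ => rfl⟩
  have hs : ∀ k : {k // l k ≠ 0}, √(l k) ≠ 0 := fun k =>
    (Real.sqrt_pos.2 ((hl k).lt_of_ne' k.2)).ne'
  have hAV : ∀ k j, (A * V) k j = (√(l k))⁻¹ * (l k * U j k) := fun k j => by
    have e := congrFun (congrFun h1 k) j
    rw [Matrix.diagonal_mul, transpose_apply, mul_apply] at e
    simp only [transpose_apply] at e
    simp only [mul_apply, hA, mul_assoc]
    rw [← mul_sum, e]
  refine ⟨{k // l k ≠ 0}, inferInstance, inferInstance, A, J, ?_, ?_⟩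
  · ext k m
    have e := congrFun (congrFun hU k) m
    simp only [mul_apply, transpose_apply] at e
    rw [mul_apply]
    have e1 : ∀ j, (A * V) k j * A.transpose j m
        = (√(l k))⁻¹ * l k * (√(l m))⁻¹ * (U j k * U j m) := fun j => by
      rw [hAV, transpose_apply, hA]; ring
    simp only [e1]
    rw [← mul_sum, e]
    rcases eq_or_ne k m with rfl | hkm
    · rw [Matrix.one_apply_eq, Matrix.one_apply_eq, mul_one]
      have h3 := Real.mul_self_sqrt (hl k)
      have h4 := hs k
      field_simp
      nlinarith
    · rw [Matrix.one_apply_ne hkm, Matrix.one_apply_ne fun h => hkm (Subtype.ext h), mul_zero]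
  · rw [sub_mul, one_mul, sub_eq_zero, Matrix.mul_assoc]
    ext i j
    have e : V i j = ∑ k, l k * U i k * U j k := by
      conv_lhs => rw [hVU, mul_apply]
      simp only [Matrix.mul_diagonal, transpose_apply]
      exact sum_congr rfl fun k _ => by ring
    rw [e, mul_apply, ← Finset.sum_filter_of_ne (p := fun k => l k ≠ 0) fun k _ hk h =>
      hk (by rw [h]; ring), Finset.sum_subtype _ (p := fun k => l k ≠ 0) (by simp)]
    refine sum_congr rfl fun k _ => ?_
    rw [hAV, hJ]
    have := hs k
    field_simp

end Whitening

section Reduction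

/-- Stationary martingale differences with a moment of order `p`. -/
structure IsStationaryMDS {Ω : Type*} [mΩ : MeasurableSpace Ω] {D : ℕ} (p : ℝ) (P : Measure Ω)
    (ℱ : ℤ → MeasurableSpace Ω) (d : ℤ → Ω → ℰ (Fin D)) : Prop where
  mono : Monotone ℱ
  le : ∀ n, ℱ n ≤ mΩ
  adapted : ∀ n, StronglyMeasurable[ℱ n] (d n)
  condExp : P[d 1 | ℱ 0] =ᵐ[P] 0
  map_shift : ∀ k : ℤ, P.map (fun ω => fun n : ℤ => d (n + k) ω) = P.map fun ω => fun n : ℤ => d n ω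
  memLp : MemLp (d 0) (ofReal p) P

/-- The trajectory of the image of a sequence by a linear map. -/
def linearPath {E F : Type*} [NormedAddCommGroup E] [NormedSpace ℝ E] [NormedAddCommGroup F]
    [NormedSpace ℝ F] {Ω : Type*} (L : E →L[ℝ] F) (d : ℤ → Ω → E) (ω : Ω) : ℤ → F :=
  fun n => L (d n ω)

lemma blockSum_linearPath {Ω : Type*} {D : ℕ} {d : ℤ → Ω → ℰ (Fin D)} {ι : Type*} [Fintype ι]
    (L : ℰ (Fin D) →L[ℝ] ℰ ι) (n : ℕ) (ω : Ω) :
    blockSum 0 n (linearPath L d ω) = L (partialSum d n ω) := by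
  simp only [blockSum, linearPath, partialSum, ← map_sum]
  congr 1
  induction n with
  | zero => simp
  | succ n IH =>
    rw [sum_range_succ, IH, Nat.cast_succ, ← Finset.insert_Icc_right_eq_Icc_add_one,
      sum_insert (by simp), add_comm, zero_add]
    simp

variable {Ω : Type*} [MeasurableSpace Ω] {P : Measure Ω} {D : ℕ} {p : ℝ}
  {ℱ : ℤ → MeasurableSpace Ω} {d : ℤ → Ω → ℰ (Fin D)}

namespace IsStationaryMDS

lemma measurable (h : IsStationaryMDS p P ℱ d) (n : ℤ) : Measurable (d n) :=
  ((h.adapted n).mono (h.le n)).measurable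

lemma memLp_coord (h : IsStationaryMDS p P ℱ d) (n : ℤ) : MemLp (d n) (ofReal p) P := by
  have e := congrArg (Measure.map fun x : ℤ → ℰ (Fin D) => x 0) (h.map_shift n)
  rw [Measure.map_map (measurable_pi_apply 0) (measurable_pi_lambda _ fun k => h.measurable _),
    Measure.map_map (measurable_pi_apply 0) (measurable_pi_lambda _ fun k => h.measurable _)] at e
  have h1 : IdentDistrib (d n) (d 0) P P := by
    refine ⟨(h.measurable n).aemeasurable, (h.measurable 0).aemeasurable, ?_⟩
    simpa [Function.comp_def] using e
  exact h1.symm.memLp_iff.1 h.memLp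

variable {ι : Type} [Fintype ι]
  {L : ℰ (Fin D) →L[ℝ] ℰ ι}

lemma measurable_linearPath (h : IsStationaryMDS p P ℱ d) : Measurable (linearPath L d) :=
  measurable_pi_lambda _ fun n => L.continuous.measurable.comp (h.measurable n)

/-- Functionals of the past of the trajectory are measurable with respect to the past. -/
lemma stronglyMeasurable_comp_linearPath (h : IsStationaryMDS p P ℱ d)
    {w : 𝒳 ι → ℝ} (hw : Measurable w) (hd : DependsOn w (Iic 0)) :
    StronglyMeasurable[ℱ 0] fun ω => w (linearPath L d ω) := by
  have e : ∀ ω, w (linearPath L d ω) = w fun n => if n ≤ 0 then L (d n ω) else 0 := fun ω =>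
    hd fun n hn => by simp [linearPath, Set.mem_Iic.1 hn]
  simp only [e]
  have h1 : Measurable[ℱ 0] fun (ω : Ω) (n : ℤ) => if n ≤ 0 then L (d n ω) else 0 := by
    refine @measurable_pi_lambda _ _ _ (ℱ 0) _ _ fun n => ?_
    split_ifs with hn
    · exact L.continuous.measurable.comp ((h.adapted n).mono (h.mono hn)).measurable
    · exact measurable_const
  exact (hw.comp h1).stronglyMeasurable

lemma condExp_apply [IsProbabilityMeasure P] (h : IsStationaryMDS p P ℱ d) (hp : 1 ≤ p)
    (l : ℰ (Fin D) →L[ℝ] ℝ) : P[fun ω => l (d 1 ω) | ℱ 0] =ᵐ[P] 0 := by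
  have hi : Integrable (d 1) P := (h.memLp_coord 1).integrable (by simpa using hp)
  refine (ContinuousLinearMap.comp_condExp_comm hi l).symm.trans ?_
  filter_upwards [h.condExp] with ω hω
  simp [hω]

variable [DecidableEq ι]

theorem martLaw [IsProbabilityMeasure P] (h : IsStationaryMDS p P ℱ d) (hp : 1 ≤ p)
    (hcov : ∀ a b, ∫ ω, L (d 0 ω) a * L (d 0 ω) b ∂P = (1 : Matrix ι ι ℝ) a b) :
    MartLaw p (P.map (linearPath L d)) := by
  have hm := h.measurable_linearPath (L := L)
  refine ⟨Measure.isProbabilityMeasure_map hm.aemeasurable, fun k => ?_, fun a w hw hd hi => ?_,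
    ?_, fun a b => ?_⟩
  · have hL : Measurable fun (x : ℤ → ℰ (Fin D)) (n : ℤ) => L (x n) :=
      measurable_pi_lambda _ fun n => L.continuous.measurable.comp (measurable_pi_apply n)
    have e := congrArg (Measure.map fun (x : ℤ → ℰ (Fin D)) (n : ℤ) => L (x n))
      (h.map_shift k)
    rw [Measure.map_map hL (measurable_pi_lambda _ fun _ => h.measurable _),
      Measure.map_map hL (measurable_pi_lambda _ fun _ => h.measurable _)] at e
    rw [Measure.map_map (measurable_shiftBy k) hm]
    exact e
  · have hwm : AEStronglyMeasurable (fun x : 𝒳 ι => w x * x 1 a)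
        (P.map (linearPath L d)) := (hw.mul (measurable_coord 1 a)).aestronglyMeasurable
    rw [integrable_map_measure hwm hm.aemeasurable] at hi
    rw [integral_map hm.aemeasurable hwm]
    have hi1 : Integrable (fun ω => L (d 1 ω) a) P :=
      ((EuclideanSpace.proj a).comp L).integrable_comp
        ((h.memLp_coord 1).integrable (by simpa using hp))
    have e1 := condExp_mul_of_stronglyMeasurable_left (g := fun ω => L (d 1 ω) a)
      (h.stronglyMeasurable_comp_linearPath (L := L) hw hd) hi hi1
    have e2 : P[fun ω => L (d 1 ω) a | ℱ 0] =ᵐ[P] 0 :=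
      h.condExp_apply hp ((EuclideanSpace.proj a).comp L)
    rw [← integral_condExp (h.le 0)]
    refine integral_eq_zero_of_ae (e1.trans ?_)
    filter_upwards [e2] with ω hω
    simp [hω]
  · have h0 : Measurable fun x : 𝒳 ι => x 0 := measurable_pi_apply 0
    exact (memLp_map_measure_iff h0.aestronglyMeasurable hm.aemeasurable).2
      (L.comp_memLp' h.memLp)
  · rw [integral_map hm.aemeasurable
      (show Measurable fun x : 𝒳 ι => x 0 a * x 0 b from
        (measurable_coord 0 a).mul (measurable_coord 0 b)).aestronglyMeasurable]
    exact hcov a b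

end IsStationaryMDS

end Reduction

section ReductionDecay

/-- The deviation of a conditional expectation from the expectation. -/
def condDeviation {Ω : Type*} [MeasurableSpace Ω] (P : Measure Ω) (m : MeasurableSpace Ω)
    (X : Ω → ℝ) (ω : Ω) : ℝ := (P[X | m]) ω - ∫ ω', X ω' ∂P

variable {Ω : Type*} [mΩ : MeasurableSpace Ω] {P : Measure Ω} [IsProbabilityMeasure P] {D : ℕ}
  {p : ℝ} {ℱ : ℤ → MeasurableSpace Ω} {d : ℤ → Ω → ℰ (Fin D)}

lemma measurable_condDeviation {Ω : Type*} {m : MeasurableSpace Ω} [mΩ : MeasurableSpace Ω]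
    {P : Measure Ω} (hm : m ≤ mΩ) (X : Ω → ℝ) : Measurable (condDeviation P m X) :=
  (stronglyMeasurable_condExp.mono hm).measurable.sub_const _

lemma integral_mul_condDeviation {Ω : Type*} {m : MeasurableSpace Ω} [mΩ : MeasurableSpace Ω]
    {P : Measure Ω} [IsProbabilityMeasure P] (hm : m ≤ mΩ) {X W : Ω → ℝ}
    (hX : Integrable X P) (hWm : StronglyMeasurable[m] W) (hW : Integrable W P)
    (hWX : Integrable (fun ω => W ω * X ω) P) :
    ∫ ω, W ω * (X ω - ∫ ω', X ω' ∂P) ∂P = ∫ ω, W ω * condDeviation P m X ω ∂P := by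
  have e1 := condExp_mul_of_stronglyMeasurable_left hWm hWX hX
  have e2 : ∫ ω, W ω * X ω ∂P = ∫ ω, W ω * (P[X | m]) ω ∂P := by
    rw [← integral_condExp hm]
    exact integral_congr_ae e1
  have hi : Integrable (fun ω => W ω * (P[X | m]) ω) P := integrable_condExp.congr e1
  simp only [condDeviation, mul_sub]
  rw [integral_sub hWX (hW.mul_const _), integral_sub hi (hW.mul_const _), e2]

/-- The correlation with a weight is controlled by the envelope norm and the norm of
`L^(p/2)`. -/
lemma abs_integral_mul_le (hp : 2 < p) {Y W W₁ W₂ : Ω → ℝ} (hY : Measurable Y)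
    (hW₁ : Measurable W₁) (hW₂ : Measurable W₂) (h₁ : ∀ ω, 0 ≤ W₁ ω) (h₂ : ∀ ω, 0 ≤ W₂ ω)
    (hW : ∀ ω, |W ω| ≤ W₁ ω + W₂ ω) {ρ K₁ K₂ : ℝ} (hρ : 0 ≤ ρ) (hK₁ : 0 ≤ K₁) (hK₂ : 0 ≤ K₂)
    (htail : ∀ σ, 0 ≤ σ → P.real {ω | ρ * σ ^ (p - 2) ≤ W₁ ω} ≤ K₁ * exp (-2 * σ ^ 2))
    (hi : Integrable (fun ω => W₂ ω ^ (p / (p - 2))) P)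
    (hmom : ∫ ω, W₂ ω ^ (p / (p - 2)) ∂P ≤ K₂ ^ (p / (p - 2)))
    (hE : envNorm P p Y ≠ ⊤) (hL : eLpNorm Y (ofReal (p / 2)) P ≠ ⊤) :
    |∫ ω, W ω * Y ω ∂P| ≤ K₁ * ρ * (2 * (envNorm P p Y).toReal)
      + K₂ * (eLpNorm Y (ofReal (p / 2)) P).toReal := by
  have h1 : ∫⁻ ω, ofReal ‖W ω * Y ω‖ ∂P ≤ ofReal (2 * K₁ * ρ) * envNorm P p Y
      + ofReal K₂ * eLpNorm Y (ofReal (p / 2)) P := by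
    refine le_trans ?_ (add_le_add (lintegral_mul_le_envNorm hp hY hW₁ h₁ hρ htail)
      (lintegral_mul_le_eLpNorm hp hY hW₂ h₂ hK₂ hi hmom))
    rw [← lintegral_add_left (show Measurable fun ω => ofReal (W₁ ω) * ofReal |Y ω|
      from hW₁.ennreal_ofReal.mul hY.abs.ennreal_ofReal)]
    refine lintegral_mono fun ω => ?_
    rw [← add_mul, ← ofReal_add (h₁ ω) (h₂ ω),
      ← ofReal_mul (add_nonneg (h₁ ω) (h₂ ω)), norm_eq_abs, abs_mul]
    exact ofReal_le_ofReal (mul_le_mul_of_nonneg_right (hW ω) (abs_nonneg _))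
  have h2 : ofReal (2 * K₁ * ρ) * envNorm P p Y ≠ ⊤ :=
    ENNReal.mul_ne_top ofReal_ne_top hE
  have h3 : ofReal K₂ * eLpNorm Y (ofReal (p / 2)) P ≠ ⊤ :=
    ENNReal.mul_ne_top ofReal_ne_top hL
  have h4 := (norm_integral_le_lintegral_norm (fun ω => W ω * Y ω)).trans
    (ENNReal.toReal_mono (ENNReal.add_ne_top.2 ⟨h2, h3⟩) h1)
  rw [ENNReal.toReal_add h2 h3, toReal_mul, toReal_mul,
    toReal_ofReal (by positivity), toReal_ofReal hK₂, norm_eq_abs] at h4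
  refine h4.trans (le_of_eq (by ring))

variable {ι : Type} [Fintype ι]
  {L : ℰ (Fin D) →L[ℝ] ℰ ι} {A : Matrix ι (Fin D) ℝ}

/-- Integrability of the products of past weights and of products of partial sums. -/
lemma IsStationaryMDS.integrable_mul_partialSum (h : IsStationaryMDS p P ℱ d) (hp : 2 < p)
    {W : Ω → ℝ} (hW : Measurable W) {B : Ω → ℰ ι} (hB : MemLp B (ofReal p) P)
    {C : ℝ} (hC : ∀ ω, |W ω| ≤ C * (1 + ‖B ω‖) ^ (p - 2)) (n : ℕ) (i j : Fin D) :
    Integrable W P ∧ Integrable (fun ω => partialSum d n ω i * partialSum d n ω j) P ∧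
      Integrable (fun ω => W ω * (partialSum d n ω i * partialSum d n ω j)) P := by
  have hM : MemLp (fun ω => partialSum d n ω) (ofReal p) P :=
    memLp_finsetSum _ fun k _ => h.memLp_coord k
  obtain ⟨Z, hZ⟩ : ∃ Z : Ω → ℝ, ∀ ω, Z ω = 1 + ‖B ω‖ + ‖partialSum d n ω‖ := ⟨_, fun _ => rfl⟩
  have hZ1 : ∀ ω, 1 ≤ Z ω := fun ω => by
    rw [hZ]; linarith [norm_nonneg (B ω), norm_nonneg (partialSum d n ω)]
  have hZp : Integrable (fun ω => Z ω ^ p) P := by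
    have h1 : MemLp Z (ofReal p) P := by
      rw [show Z = _ from funext hZ]
      exact ((memLp_const (1 : ℝ)).add hB.norm).add hM.norm
    refine h1.integrable_norm_rpow'.congr (ae_of_all _ fun ω => ?_)
    simp only [toReal_ofReal (zero_le_two.trans hp.le), norm_eq_abs]
    rw [abs_of_nonneg (by linarith [hZ1 ω])]
  have hMm : Measurable fun ω => partialSum d n ω := measurable_fun_sum _ fun k _ =>
    h.measurable k
  have hMi : ∀ i, Measurable fun ω => partialSum d n ω i := fun i =>
    (by fun_prop : Measurable fun z : ℰ (Fin D) => z i).comp hMm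
  have hMZ : ∀ ω i, |partialSum d n ω i| ≤ Z ω := fun ω i => by
    have := PiLp.norm_apply_le (partialSum d n ω) i
    rw [norm_eq_abs] at this
    rw [hZ]; linarith [norm_nonneg (B ω)]
  have hWZ : ∀ ω, |W ω| ≤ |C| * Z ω ^ (p - 2) := fun ω => by
    refine (hC ω).trans (mul_le_mul (le_abs_self C) (rpow_le_rpow (by positivity) ?_
      (by linarith)) (by positivity) (abs_nonneg C))
    rw [hZ]; linarith [norm_nonneg (partialSum d n ω)]
  have hMM : ∀ ω, |partialSum d n ω i * partialSum d n ω j| ≤ Z ω ^ (2 : ℝ) := fun ω => by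
    rw [abs_mul, rpow_two, sq]
    exact mul_le_mul (hMZ ω i) (hMZ ω j) (abs_nonneg _) (by linarith [hZ1 ω])
  refine ⟨(hZp.const_mul |C|).mono' hW.aestronglyMeasurable (ae_of_all _ fun ω => ?_),
    hZp.mono' ((hMi i).mul (hMi j)).aestronglyMeasurable (ae_of_all _ fun ω => ?_),
    (hZp.const_mul |C|).mono' (hW.mul ((hMi i).mul (hMi j))).aestronglyMeasurable
      (ae_of_all _ fun ω => ?_)⟩ <;> rw [norm_eq_abs]
  · exact (hWZ ω).trans (mul_le_mul_of_nonneg_left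
      (rpow_le_rpow_of_exponent_le (hZ1 ω) (by linarith)) (abs_nonneg C))
  · exact (hMM ω).trans (rpow_le_rpow_of_exponent_le (hZ1 ω) hp.le)
  · rw [abs_mul]
    refine (mul_le_mul (hWZ ω) (hMM ω) (abs_nonneg _) ?_).trans (le_of_eq ?_)
    · have := hZ1 ω; positivity
    · rw [mul_assoc, ← rpow_add (by linarith [hZ1 ω])]; ring_nf

variable [DecidableEq ι]

theorem IsStationaryMDS.decayBound (h : IsStationaryMDS p P ℱ d) (hp : 2 < p)
    (hμ : MartLaw p (P.map (linearPath L d))) (hA : ∀ z a, L z a = ∑ i, A a i * z i)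
    {Y : ℕ → Fin D → Fin D → Ω → ℝ} (hY : ∀ n i j, Y n i j =
      condDeviation P (ℱ 0) fun ω => partialSum d n ω i * partialSum d n ω j)
    (hE : ∀ n, 1 ≤ n → ∀ i j, envNorm P p (Y n i j) ≠ ⊤)
    (hL : ∀ n, 1 ≤ n → ∀ i j, eLpNorm (Y n i j) (ofReal (p / 2)) P ≠ ⊤) :
    DecayBound p (P.map (linearPath L d))
      (fun n => (∑ a, ∑ i, |A a i|) ^ 2 * (2 * ∑ i, ∑ j, (envNorm P p (Y n i j)).toReal))
      (fun n => (∑ a, ∑ i, |A a i|) ^ 2 *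
        ∑ i, ∑ j, (eLpNorm (Y n i j) (ofReal (p / 2)) P).toReal) := by
  intro n hn w w₁ w₂ ρ K₁ K₂ hw hd hs hww ⟨B, hB, C, hC⟩ a b
  have hm := h.measurable_linearPath (L := L)
  have hBP : MemLp (fun ω => B (linearPath L d ω)) (ofReal p) P :=
    (memLp_map_measure_iff hB.1 hm.aemeasurable).1 hB
  have hbs : ∀ a, Measurable fun x : 𝒳 ι => blockSum 0 n x a := fun a =>
    (by fun_prop : Measurable fun y : ℰ ι => y a).comp (measurable_blockSum 0 n)
  have hexp : ∀ ω a b, blockSum 0 n (linearPath L d ω) a * blockSum 0 n (linearPath L d ω) b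
      = ∑ i, ∑ j, A a i * A b j * (partialSum d n ω i * partialSum d n ω j) := fun ω a b => by
    rw [blockSum_linearPath, hA, hA, sum_mul_sum]
    exact sum_congr rfl fun i _ => sum_congr rfl fun j _ => by ring
  have hint := fun i j => h.integrable_mul_partialSum hp (hw.comp hm) hBP (fun ω => hC _) n i j
  have hcov : ∑ i, ∑ j, A a i * A b j * ∫ ω, partialSum d n ω i * partialSum d n ω j ∂P
      = n * (1 : Matrix ι ι ℝ) a b := by
    obtain ⟨i1, e1⟩ := hμ.integral_mul_blockSum_sub hp.le hB (w := fun _ => 1) (C := 1)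
      measurable_const (fun _ _ _ => rfl) (fun x => by
        rw [abs_one, one_mul]
        exact one_le_rpow (by linarith [norm_nonneg (B x)]) (by linarith)) a b n
    simp only [one_mul] at e1
    rw [(hμ.integral_blockXi hp.le 0 n a b).2, integral_map hm.aemeasurable
      (show Measurable fun x : 𝒳 ι => blockSum 0 n x a * blockSum 0 n x b
        - n * (1 : Matrix ι ι ℝ) a b from
        ((hbs a).mul (hbs b)).sub_const _).aestronglyMeasurable] at e1
    simp only [hexp] at e1
    have i2 : ∀ i j, Integrable (fun ω => A a i * A b j *
        (partialSum d n ω i * partialSum d n ω j)) P := fun i j => (hint i j).2.1.const_mul _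
    rw [integral_sub (integrable_finsetSum _ fun i _ => integrable_finsetSum _ fun j _ => i2 i j)
      (integrable_const _), integral_const, probReal_univ, one_smul, sub_eq_zero,
      integral_finsetSum _ fun i _ => integrable_finsetSum _ fun j _ => i2 i j] at e1
    rw [← e1]
    refine sum_congr rfl fun i _ => ?_
    rw [integral_finsetSum _ fun j _ => i2 i j]
    exact sum_congr rfl fun j _ => (integral_const_mul _ _).symm
  rw [integral_map hm.aemeasurable
    (show Measurable fun x : 𝒳 ι => w x * (blockSum 0 n x a * blockSum 0 n x b
      - n * (1 : Matrix ι ι ℝ) a b) from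
      hw.mul (((hbs a).mul (hbs b)).sub_const _)).aestronglyMeasurable]
  have key : ∀ i j, |∫ ω, w (linearPath L d ω) * (partialSum d n ω i * partialSum d n ω j
      - ∫ ω', partialSum d n ω' i * partialSum d n ω' j ∂P) ∂P|
      ≤ K₁ * ρ * (2 * (envNorm P p (Y n i j)).toReal)
        + K₂ * (eLpNorm (Y n i j) (ofReal (p / 2)) P).toReal := fun i j => by
    rw [integral_mul_condDeviation (h.le 0) (hint i j).2.1
      (h.stronglyMeasurable_comp_linearPath (L := L) hw hd) (hint i j).1 (hint i j).2.2, ← hY]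
    refine abs_integral_mul_le hp (by rw [hY]; exact measurable_condDeviation (h.le 0) _)
      (hs.meas₁.comp hm) (hs.meas₂.comp hm) (fun _ => hs.nonneg₁ _) (fun _ => hs.nonneg₂ _)
      (fun _ => hww _) hs.nonneg.1 hs.nonneg.2.1 hs.nonneg.2.2 (fun σ hσ => ?_) ?_ ?_
      (hE n hn i j) (hL n hn i j)
    · have h1 := hs.tail σ hσ
      rwa [map_measureReal_apply hm (measurableSet_le measurable_const hs.meas₁)] at h1
    · exact (integrable_map_measure hs.int₂.1 hm.aemeasurable).1 hs.int₂
    · have h1 := hs.mom₂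
      rwa [integral_map hm.aemeasurable hs.int₂.1] at h1
  have hAle : ∀ a i, |A a i| ≤ ∑ a, ∑ i, |A a i| := fun a i =>
    (Finset.single_le_sum (f := fun i => |A a i|) (fun _ _ => abs_nonneg _)
      (mem_univ i)).trans
      (Finset.single_le_sum (f := fun a => ∑ i, |A a i|)
        (fun _ _ => sum_nonneg fun _ _ => abs_nonneg _) (mem_univ a))
  have i3 : ∀ i j, Integrable (fun ω => A a i * A b j * (w (linearPath L d ω) *
      (partialSum d n ω i * partialSum d n ω j
        - ∫ ω', partialSum d n ω' i * partialSum d n ω' j ∂P))) P := fun i j => by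
    simp only [mul_sub (w _)]
    exact ((hint i j).2.2.sub ((hint i j).1.mul_const _)).const_mul _
  have e3 : ∫ ω, w (linearPath L d ω) * (blockSum 0 n (linearPath L d ω) a *
      blockSum 0 n (linearPath L d ω) b - n * (1 : Matrix ι ι ℝ) a b) ∂P
      = ∑ i, ∑ j, A a i * A b j * ∫ ω, w (linearPath L d ω) *
        (partialSum d n ω i * partialSum d n ω j
          - ∫ ω', partialSum d n ω' i * partialSum d n ω' j ∂P) ∂P := by
    simp only [hexp, ← hcov, ← sum_sub_distrib, ← mul_sub, mul_sum,
      mul_left_comm (w _)]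
    rw [integral_finsetSum _ fun i _ => integrable_finsetSum _ fun j _ => i3 i j]
    refine sum_congr rfl fun i _ => ?_
    rw [integral_finsetSum _ fun j _ => i3 i j]
    exact sum_congr rfl fun j _ => integral_const_mul _ _
  rw [e3]
  obtain ⟨S, hS⟩ : ∃ S, S = ∑ a, ∑ i, |A a i| := ⟨_, rfl⟩
  rw [← hS] at hAle ⊢
  calc _ ≤ ∑ i, ∑ j, S ^ 2 * (K₁ * ρ * (2 * (envNorm P p (Y n i j)).toReal)
        + K₂ * (eLpNorm (Y n i j) (ofReal (p / 2)) P).toReal) := by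
        refine (abs_sum_le_sum_abs _ _).trans (sum_le_sum fun i _ =>
          (abs_sum_le_sum_abs _ _).trans (sum_le_sum fun j _ => ?_))
        rw [abs_mul, abs_mul, sq]
        exact mul_le_mul (mul_le_mul (hAle a i) (hAle b j) (abs_nonneg _)
          ((abs_nonneg _).trans (hAle a i))) (key i j) (abs_nonneg _) (mul_self_nonneg S)
    _ = _ := by
        simp only [mul_add, sum_add_distrib, ← mul_sum]
        ring

end ReductionDecay

section Main

/-- Strong approximation by partial sums of standard Gaussian variables. -/
theorem MartLaw.exists_gaussian_coupling {ι : Type} [Fintype ι] [DecidableEq ι]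
    {p : ℝ} {μ : Measure (𝒳 ι)} (hμ : MartLaw p μ) (hp : 2 < p) (hp3 : p ≤ 3)
    {α β : ℕ → ℝ} (hα : ∀ n, 0 ≤ α n) (hβ : ∀ n, 0 ≤ β n) (hdec : DecayBound p μ α β)
    (sα : Summable fun j : ℕ => ((j + 1 : ℕ) : ℝ) ^ (-(3 - p / 2)) * α (j + 1))
    (sβ : Summable fun j : ℕ => ((j + 1 : ℕ) : ℝ) ^ (-(1 + 2 / p)) * β (j + 1))
    {κ : ℝ} (hκ : (1 + logExponent p) / 2 < κ) :
    GaussianApprox p μ κ := by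
  rcases isEmpty_or_nonempty ι with hι | hι
  · have := hμ.prob
    have hs : ∀ {T : Type} [MeasurableSpace T] [Subsingleton T] {m₁ m₂ : Measure T},
        IsProbabilityMeasure m₁ → IsProbabilityMeasure m₂ → m₁ = m₂ := fun _ _ =>
      Measure.ext fun s _ => by
        rcases Set.eq_empty_or_nonempty s with rfl | hs
        · simp
        · rw [Subsingleton.eq_univ_of_nonempty hs, measure_univ, measure_univ]
    have h0 : ∀ i : ℕ, IsProbabilityMeasure ((μ.prod uniformSeq).map
        fun _ => (0 : ℰ ι)) := fun i =>
      Measure.isProbabilityMeasure_map measurable_const.aemeasurable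
    refine ⟨fun _ _ => 0, fun _ => measurable_const, ?_, fun i => hs (h0 i) inferInstance,
      ae_of_all _ fun q => ?_⟩
    · rw [iIndepFun_iff_map_fun_eq_infinitePi_map fun _ => measurable_const]
      exact hs (Measure.isProbabilityMeasure_map measurable_const.aemeasurable) inferInstance
    · exact (isBigO_zero _ _).congr_left fun n => Subsingleton.elim _ _
  · obtain ⟨b, hb, hs, B, hB, hT⟩ := hμ.exists_weightBound hp hp3 hα hβ hdec sα sβ
    obtain ⟨C, hC0, hC⟩ := hμ.exists_lipschitz_bound hp hp3 hb hs
    exact hμ.exists_strong_approx hp hp3 hC0 hC hB hT hκ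

/-- The linear images of the standard Gaussian law are centered Gaussian laws. -/
lemma isCenteredGaussianCov_map_stdG {ι : Type} [Fintype ι] {D : ℕ}
    {V : Matrix (Fin D) (Fin D) ℝ} {J : Matrix (Fin D) ι ℝ} (hJ : J * J.transpose = V)
    {T : ℰ ι →L[ℝ] ℰ (Fin D)}
    (hT : ∀ z i, T z i = ∑ a, J i a * z a) : IsCenteredGaussianCov D V ((stdG ι).map T) := by
  refine ⟨Measure.isProbabilityMeasure_map T.continuous.aemeasurable, fun t => ?_⟩
  obtain ⟨c, hc⟩ : ∃ c : ℰ ι, ∀ a, c a = ∑ i, t i * J i a :=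
    ⟨WithLp.toLp 2 fun a => ∑ i, t i * J i a, fun _ => rfl⟩
  have e1 : ∀ z, ∑ i, t i * T z i = innerSL ℝ c z := fun z => by
    rw [innerSL_apply_apply, PiLp.inner_apply]
    simp only [hT, mul_sum, hc, RCLike.inner_apply, conj_trivial]
    rw [Finset.sum_comm]
    exact sum_congr rfl fun a _ => sum_congr rfl fun i _ => by ring
  rw [Measure.map_map (by fun_prop) T.continuous.measurable,
    show (fun x : ℰ (Fin D) => ∑ i, t i * x i) ∘ T = innerSL ℝ c from funext e1,
    IsGaussian.map_eq_gaussianReal, integral_strongDual_stdGaussian, variance_dual_stdGaussian,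
    innerSL_apply_norm, EuclideanSpace.real_norm_sq_eq]
  congr 2
  simp only [hc, sq, ← hJ, mul_apply, transpose_apply, mul_sum,
    sum_mul]
  rw [Finset.sum_comm]
  refine sum_congr rfl fun i _ => ?_
  rw [Finset.sum_comm]
  exact sum_congr rfl fun j _ => sum_congr rfl fun a _ => by ring

lemma summable_mul_sum_toReal {D : ℕ} {x : ℕ → ℝ} (hx : ∀ n, 0 ≤ x n)
    {f : ℕ → Fin D → Fin D → ℝ≥0∞}
    (hf : ∀ i j, ∑' n, ofReal (x n) * f n i j < ⊤) :
    Summable fun n => x n * ∑ i, ∑ j, (f n i j).toReal := by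
  simp only [mul_sum]
  refine summable_sum fun i _ => summable_sum fun j _ => ?_
  simpa only [toReal_mul, toReal_ofReal (hx _)]
    using ENNReal.summable_toReal (hf i j).ne

variable {Ω : Type*} [MeasurableSpace Ω] {P : Measure Ω} [IsProbabilityMeasure P] {D : ℕ} {p : ℝ}
  {ℱ : ℤ → MeasurableSpace Ω} {d : ℤ → Ω → ℰ (Fin D)}

namespace IsStationaryMDS

lemma integrable_mul_apply (h : IsStationaryMDS p P ℱ d) (hp : 2 ≤ p) (a b : Fin D) :
    Integrable (fun ω => d 0 ω a * d 0 ω b) P := by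
  have h2 : MemLp (d 0) 2 P := h.memLp.mono_exponent (by
    rw [← ENNReal.ofReal_ofNat]; exact ofReal_le_ofReal hp)
  exact (h2.eval_piLp a).integrable_mul (h2.eval_piLp b)

lemma integral_mul_linear (h : IsStationaryMDS p P ℱ d) (hp : 2 ≤ p) {V : Matrix (Fin D) (Fin D) ℝ}
    (hV : ∀ a b, V a b = ∫ ω, d 0 ω a * d 0 ω b ∂P) (s t : Fin D → ℝ) :
    ∫ ω, (∑ i, s i * d 0 ω i) * (∑ i, t i * d 0 ω i) ∂P = ∑ i, ∑ j, s i * V i j * t j := by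
  have hi : ∀ i j, Integrable (fun ω => s i * t j * (d 0 ω i * d 0 ω j)) P := fun i j =>
    (h.integrable_mul_apply hp i j).const_mul _
  simp only [sum_mul_sum, mul_mul_mul_comm (s _)]
  rw [integral_finsetSum _ fun i _ => integrable_finsetSum _ fun j _ => hi i j]
  refine sum_congr rfl fun i _ => ?_
  rw [integral_finsetSum _ fun j _ => hi i j]
  refine sum_congr rfl fun j _ => ?_
  rw [integral_const_mul, hV]; ring

lemma posSemidef (h : IsStationaryMDS p P ℱ d) (hp : 2 ≤ p) {V : Matrix (Fin D) (Fin D) ℝ}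
    (hV : ∀ a b, V a b = ∫ ω, d 0 ω a * d 0 ω b ∂P) : V.PosSemidef := by
  refine Matrix.PosSemidef.of_dotProduct_mulVec_nonneg (Matrix.IsHermitian.ext fun i j => ?_)
    fun t => ?_
  · simp only [hV, star_trivial, mul_comm]
  · have e : star t ⬝ᵥ V.mulVec t = ∑ i, ∑ j, t i * V i j * t j := by
      simp [dotProduct, mulVec, mul_sum, mul_assoc]
    rw [e, ← h.integral_mul_linear hp hV]
    exact integral_nonneg fun ω => mul_self_nonneg _

/-- The differences lie in the range of the whitening. -/
lemma ae_eq_linear (h : IsStationaryMDS p P ℱ d) (hp : 2 ≤ p) {V : Matrix (Fin D) (Fin D) ℝ}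
    (hV : ∀ a b, V a b = ∫ ω, d 0 ω a * d 0 ω b ∂P) {R : Matrix (Fin D) (Fin D) ℝ}
    (hR : R * V = 0) : ∀ᵐ ω ∂P, ∀ n i, ∑ j, R i j * d n ω j = 0 := by
  rw [ae_all_iff]
  intro n
  rw [ae_all_iff]
  intro i
  have hm : Measurable fun x : ℤ → ℰ (Fin D) => ∑ j, R i j * x 0 j := by fun_prop
  have hs : MeasurableSet {x : ℤ → ℰ (Fin D) | ∑ j, R i j * x 0 j = 0} :=
    hm (measurableSet_singleton 0)
  have h0 : ∀ᵐ ω ∂P, ∑ j, R i j * d 0 ω j = 0 := by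
    have e := h.integral_mul_linear hp hV (R i) (R i)
    have e1 : ∑ k, ∑ j, R i k * V k j * R i j = 0 := by
      rw [Finset.sum_comm]
      refine sum_eq_zero fun j _ => ?_
      rw [← sum_mul, ← mul_apply, hR, Matrix.zero_apply, zero_mul]
    rw [e1, integral_eq_zero_iff_of_nonneg (fun ω => mul_self_nonneg _)] at e
    · exact e.mono fun ω hω => mul_self_eq_zero.1 hω
    · simp only [sum_mul_sum, mul_mul_mul_comm (R i _)]
      exact integrable_finsetSum _ fun k _ => integrable_finsetSum _ fun j _ =>
        (h.integrable_mul_apply hp k j).const_mul _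
  have hd : ∀ k : ℤ, Measurable fun (ω : Ω) (n : ℤ) => d (n + k) ω := fun k =>
    measurable_pi_lambda _ fun n => h.measurable _
  have h1 : ∀ᵐ x ∂(P.map fun ω => fun n : ℤ => d n ω), ∑ j, R i j * x 0 j = 0 :=
    (ae_map_iff (by simpa using (hd 0).aemeasurable) hs).2 h0
  rw [← h.map_shift n, ae_map_iff (hd n).aemeasurable hs] at h1
  simpa using h1

theorem exists_approx (h : IsStationaryMDS p P ℱ d) (hp : 2 < p) (hp3 : p ≤ 3)
    {Y : ℕ → Fin D → Fin D → Ω → ℝ} (hY : ∀ n i j, Y n i j =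
      condDeviation P (ℱ 0) fun ω => partialSum d n ω i * partialSum d n ω j)
    (hC1 : ∀ i j, ∑' n : ℕ, ofReal ((n + 1 : ℝ) ^ (-(3 - p / 2))) *
      envNorm P p (Y (n + 1) i j) < ⊤)
    (hC2 : ∀ i j, ∑' n : ℕ, ofReal ((n + 1 : ℝ) ^ (-(1 + 2 / p))) *
      eLpNorm (Y (n + 1) i j) (ofReal (p / 2)) P < ⊤)
    {κ : ℝ} (hκ : (1 + logExponent p) / 2 < κ) :
    ∃ (Ω' : Type) (_ : MeasurableSpace Ω') (P' : Measure Ω'), IsProbabilityMeasure P' ∧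
      ∃ (S : Ω' → ℕ → ℰ (Fin D)) (N : ℕ → Ω' → ℰ (Fin D)),
        Measure.map S P' = Measure.map (fun ω => fun n : ℕ => partialSum d n ω) P ∧
        iIndepFun N P' ∧
        (∀ i : ℕ, IsCenteredGaussianCov D
          (fun a b => ∫ ω, d 0 ω a * d 0 ω b ∂P) (Measure.map (N i) P')) ∧
        ∀ᵐ ω' ∂P', (fun n : ℕ => S ω' n - ∑ i ∈ Finset.Icc 1 n, N i ω')
          =O[atTop] fun n : ℕ => (n : ℝ) ^ (1 / p) * Real.log n ^ κ := by
  obtain ⟨V, hV⟩ : ∃ V : Matrix (Fin D) (Fin D) ℝ, V = fun a b => ∫ ω, d 0 ω a * d 0 ω b ∂P :=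
    ⟨_, rfl⟩
  have hV' : ∀ a b, V a b = ∫ ω, d 0 ω a * d 0 ω b ∂P := fun a b => by rw [hV]
  obtain ⟨ι, _, _, A, J, hA, hJ⟩ := (h.posSemidef hp.le hV').exists_whitening
  have hJV : J * J.transpose = V := by
    have e1 : V = J * A * V := by
      rwa [sub_mul, one_mul, sub_eq_zero] at hJ
    have e2 : V.transpose = V := by
      simpa using (h.posSemidef hp.le hV').1.eq
    calc J * J.transpose = J * (A * V * A.transpose) * J.transpose := by rw [hA, Matrix.mul_one]
      _ = J * A * (V.transpose * (J * A).transpose) := by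
        rw [Matrix.transpose_mul, e2]; simp only [Matrix.mul_assoc]
      _ = V := by rw [← Matrix.transpose_mul, ← e1, e2]; exact e1.symm
  obtain ⟨L, hL⟩ : ∃ L : ℰ (Fin D) →L[ℝ] ℰ ι,
      ∀ z a, L z a = ∑ i, A a i * z i :=
    ⟨(Matrix.toLpLin 2 2 A).toContinuousLinearMap, fun z a => by
      simp [Matrix.toLpLin_apply, mulVec, dotProduct]⟩
  obtain ⟨T, hT⟩ : ∃ T : ℰ ι →L[ℝ] ℰ (Fin D),
      ∀ z i, T z i = ∑ a, J i a * z a :=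
    ⟨(Matrix.toLpLin 2 2 J).toContinuousLinearMap, fun z a => by
      simp [Matrix.toLpLin_apply, mulVec, dotProduct]⟩
  have hμ : MartLaw p (P.map (linearPath L d)) := by
    refine h.martLaw (one_le_two.trans hp.le) fun a b => ?_
    simp only [hL]
    rw [h.integral_mul_linear hp.le hV', ← hA, mul_apply, Finset.sum_comm]
    refine sum_congr rfl fun j _ => ?_
    rw [mul_apply, sum_mul]; rfl
  have hTL : ∀ᵐ ω ∂P, ∀ n : ℕ, T (L (partialSum d n ω)) = partialSum d n ω := by
    filter_upwards [h.ae_eq_linear hp.le hV' hJ] with ω hω n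
    have e : ∀ n, T (L (d n ω)) = d n ω := fun n => by
      ext i
      have e1 := hω n i
      simp only [Matrix.sub_apply, sub_mul, sum_sub_distrib, one_apply, ite_mul,
        one_mul, zero_mul, Finset.sum_ite_eq, mem_univ, if_true, sub_eq_zero] at e1
      rw [hT, e1]
      simp only [hL, mul_apply, mul_sum, sum_mul, mul_assoc]
      exact Finset.sum_comm
    simp only [partialSum, map_sum, e]
  have hpos : ∀ (n : ℕ) (s : ℝ), ofReal ((n + 1 : ℝ) ^ s) ≠ 0 := fun n s => by
    have : (0 : ℝ) < (n + 1 : ℝ) ^ s := by positivity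
    simpa using this
  have hfin : ∀ {s : ℝ} {f : ℕ → Fin D → Fin D → ℝ≥0∞},
      (∀ i j, ∑' n : ℕ, ofReal ((n + 1 : ℝ) ^ s) * f (n + 1) i j < ⊤) →
      ∀ n, 1 ≤ n → ∀ i j, f n i j ≠ ⊤ := fun hf n hn i j e => by
    obtain ⟨m, rfl⟩ := Nat.exists_eq_add_of_le' hn
    refine ENNReal.ne_top_of_tsum_ne_top (hf i j).ne m ?_
    rw [e, ENNReal.mul_top (hpos m _)]
  have hdec := h.decayBound hp hμ hL hY (hfin (f := fun n i j => envNorm P p (Y n i j)) hC1)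
    (hfin (f := fun n i j => eLpNorm (Y n i j) (ofReal (p / 2)) P) hC2)
  have hsum : ∀ s : ℝ, ∀ n : ℕ, 0 ≤ (n + 1 : ℝ) ^ s := fun s n => by positivity
  obtain ⟨N, hNm, hNi, hNl, hN⟩ := hμ.exists_gaussian_coupling hp hp3
    (fun n => by positivity) (fun n => by positivity) hdec
    (((summable_mul_sum_toReal (hsum _) hC1).mul_left ((∑ a, ∑ i, |A a i|) ^ 2 * 2)).congr
      fun n => by push_cast; ring)
    (((summable_mul_sum_toReal (hsum _) hC2).mul_left ((∑ a, ∑ i, |A a i|) ^ 2)).congr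
      fun n => by push_cast; ring) hκ
  have := hμ.prob
  have hS : Measurable fun (x : 𝒳 ι) (n : ℕ) => T (blockSum 0 n x) :=
    measurable_pi_lambda _ fun n => T.continuous.measurable.comp (measurable_blockSum 0 n)
  refine ⟨_, inferInstance, (P.map (linearPath L d)).prod uniformSeq, inferInstance,
    fun q n => T (blockSum 0 n q.1), fun i q => T (N i q), ?_,
    hNi.comp (fun _ => T) fun _ => T.continuous.measurable, fun i => ?_, ?_⟩
  · rw [show (fun q : 𝒵 ι => fun n : ℕ =>
        T (blockSum 0 n q.1)) = (fun (x : 𝒳 ι) (n : ℕ) => T (blockSum 0 n x)) ∘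
        Prod.fst from rfl,
      ← Measure.map_map hS measurable_fst, Measure.map_fst_prod, measure_univ, one_smul,
      Measure.map_map hS h.measurable_linearPath]
    refine Measure.map_congr ?_
    filter_upwards [hTL] with ω hω
    funext n
    rw [Function.comp_apply, blockSum_linearPath, hω]
  · change IsCenteredGaussianCov D _ (Measure.map (T ∘ N i) _)
    rw [← hV, ← Measure.map_map T.continuous.measurable (hNm i), hNl]
    exact isCenteredGaussianCov_map_stdG hJV hT
  · filter_upwards [hN] with q hq
    refine ((T.isBigO_comp _ _).trans hq).congr_left fun n => ?_
    simp only [map_sub, map_sum]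

end IsStationaryMDS

end Main

/-- **Theorem 2.3 (ASIP, item 1).** -/
theorem asip_martingale_differences
    {Ω : Type*} [MeasurableSpace Ω] (P : Measure Ω) [IsProbabilityMeasure P]
    (D : ℕ) (p : ℝ) (hp : 2 < p) (hp3 : p ≤ 3)
    (ℱ : ℤ → MeasurableSpace Ω) (hmono : Monotone ℱ)
    (hle : ∀ n, ℱ n ≤ ‹MeasurableSpace Ω›)
    (d : ℤ → Ω → EuclideanSpace ℝ (Fin D))
    (hadp : ∀ n, StronglyMeasurable[ℱ n] (d n))
    (hint : ∀ n, Integrable (d n) P)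
    (hmds : ∀ n : ℤ, P[d n | ℱ (n - 1)] =ᵐ[P] 0)
    -- stationarity of the sequence
    (hstat : ∀ k : ℤ,
      Measure.map (fun ω => fun n : ℤ => d (n + k) ω) P
        = Measure.map (fun ω => fun n : ℤ => d n ω) P)
    -- moment of order `p`
    (hmom : MemLp (d 0) (ENNReal.ofReal p) P)
    -- condition (C1)
    (hC1 : ∀ i j : Fin D,
      ∑' n : ℕ, ENNReal.ofReal ((n + 1 : ℝ) ^ (-(3 - p / 2))) *
        envNorm P p (fun ω =>
          (P[fun ω' => partialSum d (n + 1) ω' i * partialSum d (n + 1) ω' j | ℱ 0]) ω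
            - ∫ ω', partialSum d (n + 1) ω' i * partialSum d (n + 1) ω' j ∂P) < ⊤)
    -- condition (C2)
    (hC2 : ∀ i j : Fin D,
      ∑' n : ℕ, ENNReal.ofReal ((n + 1 : ℝ) ^ (-(1 + 2 / p))) *
        eLpNorm (fun ω =>
          (P[fun ω' => partialSum d (n + 1) ω' i * partialSum d (n + 1) ω' j | ℱ 0]) ω
            - ∫ ω', partialSum d (n + 1) ω' i * partialSum d (n + 1) ω' j ∂P)
          (ENNReal.ofReal (p / 2)) P < ⊤) :
    ∀ ε > (0 : ℝ),
      ∃ (Ω' : Type) (_ : MeasurableSpace Ω') (P' : Measure Ω'),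
        IsProbabilityMeasure P' ∧
        ∃ (S : Ω' → ℕ → EuclideanSpace ℝ (Fin D)) (N : ℕ → Ω' → EuclideanSpace ℝ (Fin D)),
          -- `S` is a copy of the sequence of partial sums `(M_n)`
          Measure.map S P' = Measure.map (fun ω => fun n : ℕ => partialSum d n ω) P ∧
          -- `(N_i)` are iid centered Gaussian with covariance `E(d₀ d₀ᵗ)`
          iIndepFun N P' ∧
          (∀ i : ℕ, IsCenteredGaussianCov D
            (fun a b => ∫ ω, d 0 ω a * d 0 ω b ∂P) (Measure.map (N i) P')) ∧
          ∀ᵐ ω' ∂P',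
            (fun n : ℕ => S ω' n - ∑ i ∈ Finset.Icc 1 n, N i ω')
              =o[atTop]
            (fun n : ℕ => (n : ℝ) ^ (1 / p) *
              Real.log n ^ (if p = 3 then 1 + ε else (p + 1) / (2 * p) + ε)) := by
  intro ε hε
  have h : IsStationaryMDS p P ℱ d := ⟨hmono, hle, hadp, by simpa using hmds 1, hstat, hmom⟩
  obtain ⟨Ω', m', P', hP', S, N, hS, hN, hG, hO⟩ := h.exists_approx hp hp3
    (Y := fun n i j => condDeviation P (ℱ 0) fun ω => partialSum d n ω i * partialSum d n ω j)
    (fun _ _ _ => rfl) hC1 hC2 (κ := (1 + logExponent p) / 2 + ε / 2) (by linarith)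
  refine ⟨Ω', m', P', hP', S, N, hS, hN, hG, hO.mono fun ω hω => hω.trans_isLittleO ?_⟩
  have e : (if p = 3 then 1 + ε else (p + 1) / (2 * p) + ε)
      = (1 + logExponent p) / 2 + ε / 2 + ε / 2 := by
    rw [logExponent]
    split_ifs
    · ring
    · field_simp; ring
  rw [e]
  refine (isBigO_refl _ _).mul_isLittleO ?_
  have hlog : Tendsto (fun n : ℕ => Real.log n) atTop atTop :=
    Real.tendsto_log_atTop.comp tendsto_natCast_atTop_atTop
  have h1 : (fun n : ℕ => Real.log n ^ (-(ε / 2))) =o[atTop] fun _ => (1 : ℝ) :=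
    (isLittleO_one_iff ℝ).2 ((tendsto_rpow_neg_atTop (half_pos hε)).comp hlog)
  refine (h1.mul_isBigO (isBigO_refl
    (fun n : ℕ => Real.log n ^ ((1 + logExponent p) / 2 + ε / 2 + ε / 2)) atTop)).congr' ?_
    (Eventually.of_forall fun n => one_mul _)
  filter_upwards [hlog.eventually_gt_atTop 0] with n hn
  rw [← rpow_add hn]
  ring_nf

end
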